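/- There exist positive constants A and B such that the following holds for every positive integer n. Let p₁ < p₂ < … < pₙ be the first n rational primes congruent to 1 modulo 4. Then there exist n+1 pairwise distinct rational primes q₁, q₂, …, q_{n+1} such that: (i) for each 1 ≤ i ≤ n, the prime q_i is inert in the real quadratic field ℚ(√p_i) and splits in ℚ(√p_j) for every 1 ≤ j ≤ n with j ≠ i; (ii) q_{n+1} is inert in every field ℚ(√p_1), …, ℚ(√p_n); and (iii) every q_i lies in the interval [2, A·n^{Bn}]. -/

import Mathlib

open NumberField

/-- The real quadratic field `ℚ(√m) ⊂ ℝ`. -/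
noncomputable def sqrtField (m : ℕ) : IntermediateField ℚ ℝ :=
  IntermediateField.adjoin ℚ {Real.sqrt m}

/-- A rational prime `q` is *inert* in the number field `K ⊂ ℝ` if `q O_K` remains a
prime ideal of `O_K`. -/
def IsInertIn (K : IntermediateField ℚ ℝ) (q : ℕ) : Prop :=
  (Ideal.span {(q : 𝓞 ↥K)}).IsPrime

/-- A rational prime `q` *splits* in the number field `K ⊂ ℝ` if `q O_K` is a product of
two distinct prime ideals of `O_K`. -/
def SplitsInReal (K : IntermediateField ℚ ℝ) (q : ℕ) : Prop :=
  ∃ P Q : Ideal (𝓞 ↥K), P ≠ Q ∧ P.IsPrime ∧ Q.IsPrime ∧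
    Ideal.span {(q : 𝓞 ↥K)} = P * Q

set_option linter.unusedSectionVars false

/-- The alternating sum `∑ (-1)^|S| ∏_{ℓ ∈ S} x ℓ` over the subsets `S` of `P` with at most `b`
elements. -/
noncomputable def truncProd (P : Finset ℕ) (x : ℕ → ℝ) (b : ℕ) : ℝ :=
  ∑ S ∈ P.powerset with S.card ≤ b, ∏ l ∈ S, (-x l)

theorem truncProd_zero (P : Finset ℕ) (x : ℕ → ℝ) : truncProd P x 0 = 1 := by
  unfold truncProd
  have : P.powerset.filter (fun S => S.card ≤ 0) = {∅} := by
    ext S; simp +contextual [Finset.card_eq_zero]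
    
  rw [this]; simp

theorem truncProd_empty (x : ℕ → ℝ) (b : ℕ) : truncProd ∅ x b = 1 := by
  unfold truncProd
  have : (∅ : Finset ℕ).powerset.filter (fun S => S.card ≤ b) = {∅} := by
    ext S; simp +contextual
  rw [this]; simp

theorem truncProd_insert {P : Finset ℕ} {a : ℕ} (ha : a ∉ P) (x : ℕ → ℝ) (b : ℕ) :
    truncProd (insert a P) x (b + 1) = truncProd P x (b + 1) - x a * truncProd P x b := by
  unfold truncProd
  rw [Finset.sum_filter, Finset.sum_powerset_insert ha, ← Finset.sum_filter, sub_eq_add_neg,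
    ← neg_mul, Finset.mul_sum, Finset.sum_filter, Finset.sum_filter, ]
  congr 1
  apply Finset.sum_congr rfl
  intro S hS
  have haS : a ∉ S := fun h => ha (Finset.mem_powerset.1 hS h)
  rw [Finset.card_insert_of_notMem haS, Finset.prod_insert haS]
  simp

theorem truncProd_succ (P : Finset ℕ) (x : ℕ → ℝ) (b : ℕ) :
    truncProd P x (b + 1) =
      truncProd P x b + (-1) ^ (b + 1) * ∑ S ∈ P.powersetCard (b + 1), ∏ l ∈ S, x l := by
  unfold truncProd
  have h1 : P.powerset.filter (fun S => S.card ≤ b + 1) =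
      P.powerset.filter (fun S => S.card ≤ b) ∪ P.powersetCard (b + 1) := by
    ext S
    simp only [Finset.mem_filter, Finset.mem_union, Finset.mem_powerset, Finset.mem_powersetCard]
    constructor
    · rintro ⟨h, h'⟩
      rcases Nat.lt_or_ge b S.card with h2 | h2
      · exact Or.inr ⟨h, by omega⟩
      · exact Or.inl ⟨h, h2⟩
    · rintro (⟨h, h'⟩ | ⟨h, h'⟩)
      · exact ⟨h, by omega⟩
      · exact ⟨h, by omega⟩
  rw [h1, Finset.sum_union, Finset.mul_sum]
  · congr 1
    apply Finset.sum_congr rfl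
    intro S hS
    rw [Finset.prod_neg, (Finset.mem_powersetCard.1 hS).2]
  · rw [Finset.disjoint_left]
    intro S h h'
    have := (Finset.mem_filter.1 h).2
    have := (Finset.mem_powersetCard.1 h').2
    omega

theorem bonferroni (P : Finset ℕ) (x : ℕ → ℝ) (h0 : ∀ l ∈ P, 0 ≤ x l) (h1 : ∀ l ∈ P, x l ≤ 1)
    (b : ℕ) : 0 ≤ (-1) ^ b * (truncProd P x b - ∏ l ∈ P, (1 - x l)) := by
  induction P using Finset.induction_on generalizing b with
  | empty => simp [truncProd_empty]
  | insert a P ha ih =>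
    have ih' := ih (fun l hl => h0 l (Finset.mem_insert_of_mem hl))
      (fun l hl => h1 l (Finset.mem_insert_of_mem hl))
    cases b with
    | zero =>
      rw [truncProd_zero]
      have : ∏ l ∈ insert a P, (1 - x l) ≤ 1 :=
        Finset.prod_le_one (fun l hl => by linarith [h1 l hl]) (fun l hl => by linarith [h0 l hl])
      simpa using this
    | succ b =>
      rw [truncProd_insert ha, Finset.prod_insert ha]
      have e : (-1 : ℝ) ^ (b + 1) * (truncProd P x (b + 1) - x a * truncProd P x b
          - (1 - x a) * ∏ l ∈ P, (1 - x l)) =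
        (-1) ^ (b + 1) * (truncProd P x (b + 1) - ∏ l ∈ P, (1 - x l)) +
          x a * ((-1) ^ b * (truncProd P x b - ∏ l ∈ P, (1 - x l))) := by ring
      rw [e]
      have := mul_nonneg (h0 a (Finset.mem_insert_self _ _)) (ih' b)
      linarith [ih' (b + 1)]

theorem prod_le_truncProd {P : Finset ℕ} {x : ℕ → ℝ} (h0 : ∀ l ∈ P, 0 ≤ x l)
    (h1 : ∀ l ∈ P, x l ≤ 1) {b : ℕ} (hb : Even b) : ∏ l ∈ P, (1 - x l) ≤ truncProd P x b := by
  have := bonferroni P x h0 h1 b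
  rw [hb.neg_one_pow] at this
  linarith

theorem truncProd_le {P : Finset ℕ} {x : ℕ → ℝ} (h0 : ∀ l ∈ P, 0 ≤ x l)
    (h1 : ∀ l ∈ P, x l ≤ 1) {b : ℕ} (hb : Even b) : truncProd P x b ≤
      ∏ l ∈ P, (1 - x l) + ∑ S ∈ P.powersetCard (b + 1), ∏ l ∈ S, x l := by
  have := bonferroni P x h0 h1 (b + 1)
  rw [truncProd_succ, (hb.add_one).neg_one_pow] at this
  linarith

/-- Elementary symmetric sums are bounded by powers of the sum. -/
theorem sum_powersetCard_prod_le (P : Finset ℕ) (x : ℕ → ℝ) (h0 : ∀ l ∈ P, 0 ≤ x l) (k : ℕ) :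
    ∑ S ∈ P.powersetCard k, ∏ l ∈ S, x l ≤ (∑ l ∈ P, x l) ^ k / k.factorial := by
  induction k with
  | zero => simp
  | succ k ih =>
    have hs : 0 ≤ ∑ l ∈ P, x l := Finset.sum_nonneg h0
    have key : ((k + 1 : ℕ) : ℝ) * ∑ S ∈ P.powersetCard (k + 1), ∏ l ∈ S, x l ≤
        (∑ l ∈ P, x l) * ∑ S ∈ P.powersetCard k, ∏ l ∈ S, x l := by
      have h2 : ((k + 1 : ℕ) : ℝ) * ∑ S ∈ P.powersetCard (k + 1), ∏ l ∈ S, x l =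
          ∑ S ∈ P.powersetCard (k + 1), ∑ a ∈ S, x a * ∏ l ∈ S.erase a, x l := by
        rw [Finset.mul_sum]
        apply Finset.sum_congr rfl
        intro S hS
        rw [Finset.sum_congr rfl (fun a ha => Finset.mul_prod_erase S x ha), Finset.sum_const,
          (Finset.mem_powersetCard.1 hS).2, nsmul_eq_mul]
      rw [h2, Finset.sum_mul_sum, Finset.sum_sigma', ← Finset.sum_product']
      rw [← Finset.sum_image (s := (P.powersetCard (k + 1)).sigma fun S => S)
        (g := fun p : (_ : Finset ℕ) × ℕ => ((p.2, p.1.erase p.2) : ℕ × Finset ℕ))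
        (f := fun p : ℕ × Finset ℕ => x p.1 * ∏ l ∈ p.2, x l)]
      · apply Finset.sum_le_sum_of_subset_of_nonneg
        · intro p hp
          simp only [Finset.mem_image, Finset.mem_sigma] at hp
          obtain ⟨⟨S, a⟩, ⟨hS, ha⟩, rfl⟩ := hp
          have hS' := Finset.mem_powersetCard.1 hS
          refine Finset.mem_product.2 ⟨hS'.1 ha, Finset.mem_powersetCard.2
            ⟨(Finset.erase_subset _ _).trans hS'.1, ?_⟩⟩
          rw [Finset.card_erase_of_mem ha, hS'.2]; rfl
        · intro p hp _
          have hp' := Finset.mem_product.1 hp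
          exact mul_nonneg (h0 _ hp'.1) (Finset.prod_nonneg fun l hl =>
            h0 l ((Finset.mem_powersetCard.1 hp'.2).1 hl))
      · rintro ⟨S, a⟩ hp ⟨S', a'⟩ hp' h
        simp only [Finset.coe_sigma, Set.mem_sigma_iff, Finset.mem_coe] at hp hp'
        simp only [Prod.mk.injEq] at h
        obtain ⟨rfl, h⟩ := h
        have : S = S' := by rw [← Finset.insert_erase hp.2, h, Finset.insert_erase hp'.2]
        subst this; rfl
    have hk : (0 : ℝ) < ((k + 1 : ℕ) : ℝ) := by positivity
    rw [Nat.factorial_succ, le_div_iff₀ (by positivity)]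
    push_cast at key hk ⊢
    have h3 : (∑ S ∈ P.powersetCard k, ∏ l ∈ S, x l) * k.factorial ≤ (∑ l ∈ P, x l) ^ k := by
      rw [← le_div_iff₀ (by positivity)]; exact ih
    calc _ = (((k : ℝ) + 1) * ∑ S ∈ P.powersetCard (k + 1), ∏ l ∈ S, x l) * k.factorial := by ring
      _ ≤ ((∑ l ∈ P, x l) * ∑ S ∈ P.powersetCard k, ∏ l ∈ S, x l) * k.factorial := by gcongr
      _ = (∑ l ∈ P, x l) * ((∑ S ∈ P.powersetCard k, ∏ l ∈ S, x l) * k.factorial) := by ring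
      _ ≤ (∑ l ∈ P, x l) * (∑ l ∈ P, x l) ^ k := by gcongr
      _ = _ := by ring

/-- Expansion of a product of sums over divisor sets against a sequence. -/
theorem expand_sieve_product {I : ℕ} (A : Finset ℕ) (a : ℕ → ℝ) (X R : ℝ) (g : ℕ → ℝ)
    (D : Fin I → Finset (Finset ℕ)) (c : Fin I → Finset ℕ → ℝ)
    (hc : ∀ i, ∀ S ∈ D i, |c i S| ≤ 1)
    (hR : ∀ x ∈ Fintype.piFinset D,
      |∑ m ∈ A, a m * ∏ i, ∏ l ∈ x i, (if l ∣ m then (1 : ℝ) else 0) -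
        X * ∏ i, ∏ l ∈ x i, g l| ≤ R) :
    |∑ m ∈ A, a m * ∏ i, ∑ S ∈ D i, c i S * ∏ l ∈ S, (if l ∣ m then (1 : ℝ) else 0) -
        X * ∏ i, ∑ S ∈ D i, c i S * ∏ l ∈ S, g l| ≤ R * ∏ i, ((D i).card : ℝ) := by
  simp_rw [Finset.prod_univ_sum, Finset.prod_mul_distrib, Finset.mul_sum]
  rw [Finset.sum_comm, ← Finset.sum_sub_distrib]
  have e : ∀ x ∈ Fintype.piFinset D,
      |∑ m ∈ A, a m * ((∏ i, c i (x i)) * ∏ i, ∏ l ∈ x i, (if l ∣ m then (1 : ℝ) else 0)) -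
        X * ((∏ i, c i (x i)) * ∏ i, ∏ l ∈ x i, g l)| ≤ R := by
    intro x hx
    have : ∑ m ∈ A, a m * ((∏ i, c i (x i)) * ∏ i, ∏ l ∈ x i, (if l ∣ m then (1 : ℝ) else 0)) -
        X * ((∏ i, c i (x i)) * ∏ i, ∏ l ∈ x i, g l) =
        (∏ i, c i (x i)) * (∑ m ∈ A, a m * ∏ i, ∏ l ∈ x i, (if l ∣ m then (1 : ℝ) else 0) -
        X * ∏ i, ∏ l ∈ x i, g l) := by
      rw [mul_sub, Finset.mul_sum]
      congr 1
      · exact Finset.sum_congr rfl fun m _ => by ring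
      · ring
    rw [this, abs_mul, Finset.abs_prod]
    have h1 : ∏ i, |c i (x i)| ≤ 1 := Finset.prod_le_one (fun _ _ => abs_nonneg _)
      (fun i _ => hc i _ (Fintype.mem_piFinset.1 hx i))
    calc _ ≤ 1 * |∑ m ∈ A, a m * ∏ i, ∏ l ∈ x i, (if l ∣ m then (1 : ℝ) else 0) -
        X * ∏ i, ∏ l ∈ x i, g l| := by gcongr
      _ ≤ R := by rw [one_mul]; exact hR x hx
  refine (Finset.abs_sum_le_sum_abs _ _).trans ((Finset.sum_le_sum e).trans ?_)
  rw [Finset.sum_const, Fintype.card_piFinset, nsmul_eq_mul]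
  push_cast
  rw [mul_comm]

/-- The lower-bound inequality for products. -/
theorem prod_sub_sum_le_prod {ι : Type*} [DecidableEq ι] (s : Finset ι) (x y : ι → ℝ)
    (hx : ∀ i ∈ s, 0 ≤ x i) (hxy : ∀ i ∈ s, x i ≤ y i) :
    ∏ i ∈ s, y i - ∑ j ∈ s, (y j - x j) * ∏ i ∈ s.erase j, y i ≤ ∏ i ∈ s, x i := by
  induction s using Finset.induction_on with
  | empty => simp
  | insert a s ha ih =>
    have ih' := ih (fun i hi => hx i (Finset.mem_insert_of_mem hi))
      (fun i hi => hxy i (Finset.mem_insert_of_mem hi))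
    rw [Finset.prod_insert ha, Finset.prod_insert ha, Finset.sum_insert ha,
      Finset.erase_insert ha]
    have e : ∑ j ∈ s, (y j - x j) * ∏ i ∈ (insert a s).erase j, y i =
        y a * ∑ j ∈ s, (y j - x j) * ∏ i ∈ s.erase j, y i := by
      rw [Finset.mul_sum]
      apply Finset.sum_congr rfl
      intro j hj
      have hja : a ≠ j := fun h => ha (h ▸ hj)
      rw [Finset.erase_insert_of_ne hja, Finset.prod_insert (fun h => ha (Finset.mem_of_mem_erase h))]
      ring
    rw [e]
    have hxa := hx a (Finset.mem_insert_self _ _)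
    have hya := hxy a (Finset.mem_insert_self _ _)
    have hP : ∏ i ∈ s, x i ≤ ∏ i ∈ s, y i :=
      Finset.prod_le_prod (fun i hi => hx i (Finset.mem_insert_of_mem hi))
        (fun i hi => hxy i (Finset.mem_insert_of_mem hi))
    have h0 : 0 ≤ ∏ i ∈ s, x i :=
      Finset.prod_nonneg (fun i hi => hx i (Finset.mem_insert_of_mem hi))
    have h3 := mul_le_mul_of_nonneg_left ih' (hxa.trans hya)
    nlinarith [mul_nonneg (sub_nonneg.2 hya) (sub_nonneg.2 hP)]

/-- The primes in `[2 ^ 2 ^ i, 2 ^ 2 ^ (i + 1))`. -/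
def sieveBlock (i : ℕ) : Finset ℕ :=
  (Finset.range (2 ^ 2 ^ (i + 1))).filter fun l => l.Prime ∧ 2 ^ 2 ^ i ≤ l

/-- `m` has no prime factor below `z`. -/
def IsRough (z m : ℕ) : Prop := ∀ l : ℕ, l.Prime → l < z → ¬ l ∣ m

theorem mem_sieveBlock {i l : ℕ} :
    l ∈ sieveBlock i ↔ l < 2 ^ 2 ^ (i + 1) ∧ l.Prime ∧ 2 ^ 2 ^ i ≤ l := by
  simp [sieveBlock]

theorem card_primes_dyadic_le (k : ℕ) :
    k * ((Finset.range (2 ^ (k + 1))).filter fun l => l.Prime ∧ 2 ^ k ≤ l).card ≤ 4 * 2 ^ k := by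
  set P := (Finset.range (2 ^ (k + 1))).filter fun l => l.Prime ∧ 2 ^ k ≤ l with hP
  have h1 : (2 ^ k) ^ P.card ≤ ∏ l ∈ P, l := by
    apply Finset.pow_card_le_prod
    intro l hl
    exact (Finset.mem_filter.1 hl).2.2
  have h2 : ∏ l ∈ P, l ≤ primorial (2 ^ (k + 1)) := by
    unfold primorial
    apply Finset.prod_le_prod_of_subset_of_one_le'
    · intro l hl
      have := Finset.mem_filter.1 hl
      simp only [Finset.mem_range] at this
      simp only [Finset.mem_filter, Finset.mem_range]
      exact ⟨by omega, this.2.1⟩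
    · intro l hl _
      exact (Finset.mem_filter.1 hl).2.one_le
  have h3 := primorial_le_four_pow (2 ^ (k + 1))
  have h4 : 2 ^ (k * P.card) ≤ 2 ^ (2 * 2 ^ (k + 1)) := by
    calc 2 ^ (k * P.card) = (2 ^ k) ^ P.card := by rw [pow_mul]
      _ ≤ 4 ^ (2 ^ (k + 1)) := h1.trans (h2.trans h3)
      _ = _ := by rw [show (4 : ℕ) = 2 ^ 2 by norm_num, ← pow_mul]
  have := (Nat.pow_le_pow_iff_right (by norm_num : 1 < 2)).1 h4
  rw [pow_succ] at this
  omega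

theorem sum_inv_dyadic_le {k : ℕ} (hk : 0 < k) :
    ∑ l ∈ (Finset.range (2 ^ (k + 1))).filter (fun l => l.Prime ∧ 2 ^ k ≤ l), (1 / l : ℝ) ≤ 4 / k := by
  have h := card_primes_dyadic_le k
  set P := (Finset.range (2 ^ (k + 1))).filter fun l => l.Prime ∧ 2 ^ k ≤ l with hP
  calc ∑ l ∈ P, (1 / l : ℝ) ≤ ∑ l ∈ P, (1 / 2 ^ k : ℝ) := by
        apply Finset.sum_le_sum
        intro l hl
        have : 2 ^ k ≤ l := (Finset.mem_filter.1 hl).2.2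
        have h' : (2 : ℝ) ^ k ≤ l := by exact_mod_cast this
        gcongr
    _ = P.card / 2 ^ k := by rw [Finset.sum_const, nsmul_eq_mul]; ring
    _ ≤ 4 / k := by
        rw [div_le_div_iff₀ (by positivity) (by positivity)]
        have : (k : ℝ) * P.card ≤ 4 * 2 ^ k := by exact_mod_cast h
        linarith

theorem sum_inv_sieveBlock_le (i : ℕ) : ∑ l ∈ sieveBlock i, (1 / l : ℝ) ≤ 4 := by
  have hsub : sieveBlock i ⊆ (Finset.Ico (2 ^ i) (2 ^ (i + 1))).biUnion fun k =>
      (Finset.range (2 ^ (k + 1))).filter (fun l => l.Prime ∧ 2 ^ k ≤ l) := by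
    intro l hl
    obtain ⟨h1, h2, h3⟩ := mem_sieveBlock.1 hl
    have hl0 : l ≠ 0 := h2.ne_zero
    simp only [Finset.mem_biUnion, Finset.mem_Ico, Finset.mem_filter, Finset.mem_range]
    refine ⟨Nat.log 2 l, ⟨?_, ?_⟩, Nat.lt_pow_succ_log_self (by norm_num) l, h2,
      Nat.pow_log_le_self 2 hl0⟩
    · exact (Nat.le_log_iff_pow_le (by norm_num) hl0).2 h3
    · exact (Nat.log_lt_iff_lt_pow (by norm_num) hl0).2 h1
  calc ∑ l ∈ sieveBlock i, (1 / l : ℝ) ≤ _ :=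
        Finset.sum_le_sum_of_subset_of_nonneg hsub (fun _ _ _ => by positivity)
    _ ≤ ∑ k ∈ Finset.Ico (2 ^ i) (2 ^ (i + 1)),
        ∑ l ∈ (Finset.range (2 ^ (k + 1))).filter (fun l => l.Prime ∧ 2 ^ k ≤ l), (1 / l : ℝ) := by
        induction Finset.Ico (2 ^ i) (2 ^ (i + 1)) using Finset.induction_on with
        | empty => simp
        | insert a s ha ih =>
          rw [Finset.biUnion_insert, Finset.sum_insert ha]
          refine le_trans ?_ (add_le_add_right ih _)
          rw [← Finset.sum_union_inter]
          exact le_add_of_nonneg_right (Finset.sum_nonneg fun _ _ => by positivity)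
    _ ≤ ∑ k ∈ Finset.Ico (2 ^ i) (2 ^ (i + 1)), (4 / 2 ^ i : ℝ) := by
        apply Finset.sum_le_sum
        intro k hk
        have hk' := (Finset.mem_Ico.1 hk).1
        refine (sum_inv_dyadic_le (lt_of_lt_of_le (by positivity) hk')).trans ?_
        have : (2 : ℝ) ^ i ≤ k := by exact_mod_cast hk'
        gcongr
    _ = 4 := by
        rw [Finset.sum_const, Nat.card_Ico, nsmul_eq_mul]
        have : 2 ^ (i + 1) - 2 ^ i = 2 ^ i := by rw [pow_succ]; omega
        rw [this]; push_cast; field_simp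

theorem isRough_iff (I m : ℕ) :
    IsRough (2 ^ 2 ^ I) m ↔ ∀ i : Fin I, ∀ l ∈ sieveBlock i, ¬ l ∣ m := by
  constructor
  · intro h i l hl
    obtain ⟨h1, h2, h3⟩ := mem_sieveBlock.1 hl
    refine h l h2 (h1.trans_le ?_)
    have := i.2
    gcongr <;> omega
  · intro h l hl hlt
    have h4 : 2 ≤ l := hl.two_le
    have hlog : Nat.log 2 l ≠ 0 := (Nat.log_pos (by norm_num) h4).ne'
    set i := Nat.log 2 (Nat.log 2 l) with hi
    have hi1 : 2 ^ 2 ^ i ≤ l := by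
      rw [← Nat.le_log_iff_pow_le (by norm_num) hl.ne_zero]
      exact Nat.pow_log_le_self 2 hlog
    have hi2 : l < 2 ^ 2 ^ (i + 1) := by
      rw [← Nat.log_lt_iff_lt_pow (by norm_num) hl.ne_zero]
      exact Nat.lt_pow_succ_log_self (by norm_num) _
    have hiI : i < I := by
      have : 2 ^ 2 ^ i < 2 ^ 2 ^ I := hi1.trans_lt hlt
      exact (Nat.pow_lt_pow_iff_right (by norm_num)).1 ((Nat.pow_lt_pow_iff_right (by norm_num)).1 this)
    exact h ⟨i, hiI⟩ l (mem_sieveBlock.2 ⟨hi2, hl, hi1⟩)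

theorem rough_indicator (I m : ℕ) [Decidable (IsRough (2 ^ 2 ^ I) m)] :
    (if IsRough (2 ^ 2 ^ I) m then (1 : ℝ) else 0) =
      ∏ i : Fin I, ∏ l ∈ sieveBlock i, (1 - (if l ∣ m then (1 : ℝ) else 0)) := by
  split_ifs with h
  · rw [isRough_iff] at h
    symm
    refine Finset.prod_eq_one fun i _ => Finset.prod_eq_one fun l hl => ?_
    rw [if_neg (h i l hl)]; norm_num
  · rw [isRough_iff] at h
    push Not at h
    obtain ⟨i, l, hl, hd⟩ := h
    symm
    refine Finset.prod_eq_zero (Finset.mem_univ i) (Finset.prod_eq_zero hl ?_)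
    rw [if_pos hd]; norm_num

theorem sieveBlock_disjoint {i j : ℕ} (h : i ≠ j) : Disjoint (sieveBlock i) (sieveBlock j) := by
  have key : ∀ i j : ℕ, i < j → Disjoint (sieveBlock i) (sieveBlock j) := by
    intro i j hij
    rw [Finset.disjoint_left]
    intro l hl hl'
    have h1 := (mem_sieveBlock.1 hl).1
    have h2 := (mem_sieveBlock.1 hl').2.2
    have : 2 ^ 2 ^ (i + 1) ≤ 2 ^ 2 ^ j := by gcongr <;> omega
    omega
  rcases lt_or_gt_of_ne h with h | h
  · exact key i j h
  · exact (key j i h).symm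

theorem card_powerset_le (P : Finset ℕ) (k : ℕ) :
    (P.powerset.filter fun S => S.card ≤ k).card ≤ (P.card + 1) ^ k := by
  induction k with
  | zero =>
    simp only [pow_zero, Finset.card_le_one]
    intro a ha b hb
    have h1 := (Finset.mem_filter.1 ha).2
    have h2 := (Finset.mem_filter.1 hb).2
    rw [Nat.le_zero, Finset.card_eq_zero] at h1 h2
    rw [h1, h2]
  | succ k ih =>
    have hsub : (P.powerset.filter fun S => S.card ≤ k + 1) ⊆
        ((P.powerset.filter fun S => S.card ≤ k) ×ˢ (Finset.insertNone P)).image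
          (fun p => match p.2 with
            | none => p.1
            | some a => insert a p.1) := by
      intro S hS
      obtain ⟨h1, h2⟩ := Finset.mem_filter.1 hS
      rw [Finset.mem_powerset] at h1
      rw [Finset.mem_image]
      rcases S.eq_empty_or_nonempty with rfl | ⟨a, ha⟩
      · exact ⟨(∅, none), by simp, rfl⟩
      · refine ⟨(S.erase a, some a), ?_, by simp [Finset.insert_erase ha]⟩
        simp only [Finset.mem_product, Finset.mem_filter, Finset.mem_powerset,
          Finset.some_mem_insertNone]
        refine ⟨⟨(Finset.erase_subset _ _).trans h1, ?_⟩, h1 ha⟩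
        rw [Finset.card_erase_of_mem ha]; omega
    refine (Finset.card_le_card hsub).trans (Finset.card_image_le.trans ?_)
    rw [Finset.card_product, Finset.card_insertNone, pow_succ]
    gcongr

theorem card_sieveBlock_lt (i : ℕ) : (sieveBlock i).card + 1 ≤ 2 ^ 2 ^ (i + 1) := by
  have hsub : sieveBlock i ⊆ (Finset.range (2 ^ 2 ^ (i + 1))).erase 0 := by
    intro l hl
    obtain ⟨h1, h2, h3⟩ := mem_sieveBlock.1 hl
    exact Finset.mem_erase.2 ⟨h2.ne_zero, Finset.mem_range.2 h1⟩
  have := Finset.card_le_card hsub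
  rw [Finset.card_erase_of_mem (by simp), Finset.card_range] at this
  have : 0 < 2 ^ 2 ^ (i + 1) := by positivity
  omega

/-- The truncation level used in the `i`-th of `I` blocks. -/
def blockLevel (I b i : ℕ) : ℕ := b + 2 * (I - 1 - i)

theorem sum_blockLevel_le (I b : ℕ) :
    ∑ i : Fin I, 2 ^ (i.1 + 1) * (blockLevel I b i + 1) ≤ 2 ^ I * (2 * b + 6) := by
  have h : ∀ I : ℕ, ∑ i ∈ Finset.range I, 2 ^ (i + 1) * (blockLevel I b i + 1) + (2 * b + 6 + 4 * I)
      ≤ 2 ^ I * (2 * b + 6) := by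
    intro I
    have e : ∑ i ∈ Finset.range I, 2 ^ (i + 1) * (blockLevel I b i + 1) =
        ∑ j ∈ Finset.range I, 2 ^ (I - j) * (b + 1 + 2 * j) := by
      rw [← Finset.sum_range_reflect]
      apply Finset.sum_congr rfl
      intro j hj
      have hj' := Finset.mem_range.1 hj
      unfold blockLevel
      have e1 : I - 1 - j + 1 = I - j := by omega
      have e2 : I - 1 - (I - 1 - j) = j := by omega
      rw [e1, e2]; ring
    rw [e]
    clear e
    induction I with
    | zero => simp
    | succ I ih =>
      rw [Finset.sum_range_succ]
      have e3 : ∑ j ∈ Finset.range I, 2 ^ (I + 1 - j) * (b + 1 + 2 * j) =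
          2 * ∑ j ∈ Finset.range I, 2 ^ (I - j) * (b + 1 + 2 * j) := by
        rw [Finset.mul_sum]
        apply Finset.sum_congr rfl
        intro j hj
        have hj' := Finset.mem_range.1 hj
        rw [show I + 1 - j = (I - j) + 1 by omega, pow_succ]; ring
      rw [e3, show I + 1 - I = 1 by omega, show 2 ^ (I + 1) = 2 * 2 ^ I from pow_succ' 2 I]
      have e4 : 2 * 2 ^ I * (2 * b + 6) = 2 * (2 ^ I * (2 * b + 6)) := by ring
      rw [e4, pow_one]
      omega
  have := h I
  rw [Finset.sum_range] at this
  omega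

/-- The sieve product over primes below `2 ^ 2 ^ I`. -/
noncomputable def sieveProd (g : ℕ → ℝ) (I : ℕ) : ℝ :=
  ∏ i : Fin I, ∏ l ∈ sieveBlock i, (1 - g l)

/-- The relative error in the fundamental lemma. -/
noncomputable def sieveErr (b : ℕ) : ℝ := Real.exp 24 * (8 ^ (b + 1) / (b + 1).factorial)

theorem sieveErr_pos (b : ℕ) : 0 < sieveErr b := by unfold sieveErr; positivity

theorem exp_neg_two_mul_le {x : ℝ} (h0 : 0 ≤ x) (h1 : x ≤ 3 / 4) : Real.exp (-2 * x) ≤ 1 - x := by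
  have hc := convexOn_exp.2 (Set.mem_univ (0 : ℝ)) (Set.mem_univ (-3 / 2 : ℝ))
    (show 0 ≤ 1 - 4 * x / 3 by linarith) (show 0 ≤ 4 * x / 3 by linarith) (by ring)
  simp only [smul_eq_mul, mul_zero, zero_add, Real.exp_zero, mul_one] at hc
  have e : 4 * x / 3 * (-3 / 2) = -2 * x := by ring
  rw [e] at hc
  have h4 : Real.exp (-3 / 2) ≤ 1 / 4 := by
    rw [show (-3 / 2 : ℝ) = -(3 / 2) by norm_num, Real.exp_neg, inv_eq_one_div]
    apply one_div_le_one_div_of_le (by norm_num)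
    have h := Real.exp_one_gt_d9
    have h5 : Real.exp (1 / 2) * Real.exp (1 / 2) = Real.exp 1 := by
      rw [← Real.exp_add]; norm_num
    have h6 : Real.exp (3 / 2) = Real.exp 1 * Real.exp (1 / 2) := by
      rw [← Real.exp_add]; norm_num
    have h7 : (1.6 : ℝ) ≤ Real.exp (1 / 2) := by
      by_contra hlt
      push Not at hlt
      nlinarith [Real.exp_pos (1 / 2 : ℝ)]
    rw [h6]; nlinarith
  nlinarith

theorem sum_sieveErr_le (I b : ℕ) :
    ∑ i : Fin I, Real.exp 16 * (8 ^ (blockLevel I b i + 1) / (blockLevel I b i + 1).factorial)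
      ≤ sieveErr b := by
  rw [Finset.sum_fin_eq_sum_range, Finset.sum_congr rfl (g := fun i =>
    Real.exp 16 * (8 ^ (blockLevel I b i + 1) / (blockLevel I b i + 1).factorial))
    (fun i hi => by simp [Finset.mem_range.1 hi]), ← Finset.sum_range_reflect]
  calc ∑ j ∈ Finset.range I, Real.exp 16 * (8 ^ (blockLevel I b (I - 1 - j) + 1) /
        (blockLevel I b (I - 1 - j) + 1).factorial)
      ≤ ∑ j ∈ Finset.range I, Real.exp 16 * (8 ^ (b + 1) / (b + 1).factorial) *
          (8 ^ (2 * j) / (2 * j).factorial) := by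
        apply Finset.sum_le_sum
        intro j hj
        have hj' := Finset.mem_range.1 hj
        have e : blockLevel I b (I - 1 - j) + 1 = (b + 1) + 2 * j := by
          unfold blockLevel; omega
        rw [e, mul_assoc]
        apply mul_le_mul_of_nonneg_left _ (Real.exp_pos _).le
        rw [pow_add, div_mul_div_comm]
        apply div_le_div_of_nonneg_left (by positivity) (by positivity)
        exact_mod_cast Nat.le_of_dvd (Nat.factorial_pos _)
          (Nat.factorial_mul_factorial_dvd_factorial_add (b + 1) (2 * j))
    _ = Real.exp 16 * (8 ^ (b + 1) / (b + 1).factorial) *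
          ∑ j ∈ Finset.range I, ((8 : ℝ) ^ (2 * j) / (2 * j).factorial) := by rw [Finset.mul_sum]
    _ ≤ Real.exp 16 * (8 ^ (b + 1) / (b + 1).factorial) * Real.exp 8 := by
        apply mul_le_mul_of_nonneg_left _ (by positivity)
        refine le_trans ?_ (Real.sum_le_exp_of_nonneg (by norm_num : (0 : ℝ) ≤ 8) (2 * I))
        rw [← Finset.sum_image (s := Finset.range I) (g := fun j => 2 * j)
          (f := fun j => (8 : ℝ) ^ j / j.factorial)]
        · apply Finset.sum_le_sum_of_subset_of_nonneg
          · intro k hk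
            obtain ⟨j, hj, rfl⟩ := Finset.mem_image.1 hk
            have := Finset.mem_range.1 hj
            exact Finset.mem_range.2 (by omega)
          · intros; positivity
        · intro a _ b _ h
          have : 2 * a = 2 * b := h
          omega
    _ = sieveErr b := by
        unfold sieveErr
        rw [show (24 : ℝ) = 16 + 8 by norm_num, Real.exp_add]; ring

section
variable {g : ℕ → ℝ}

theorem sum_density_le (hg1 : ∀ l : ℕ, l.Prime → g l ≤ 2 / l)
    (i : ℕ) : ∑ l ∈ sieveBlock i, g l ≤ 8 := by
  calc ∑ l ∈ sieveBlock i, g l ≤ ∑ l ∈ sieveBlock i, 2 * (1 / l : ℝ) := by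
        apply Finset.sum_le_sum
        intro l hl
        rw [mul_one_div]
        exact hg1 l (mem_sieveBlock.1 hl).2.1
    _ = 2 * ∑ l ∈ sieveBlock i, (1 / l : ℝ) := by rw [Finset.mul_sum]
    _ ≤ 8 := by linarith [sum_inv_sieveBlock_le i]

theorem block_esymm_le (hg0 : ∀ l : ℕ, l.Prime → 0 ≤ g l)
    (hg1 : ∀ l : ℕ, l.Prime → g l ≤ 2 / l)
    (i k : ℕ) :
    ∑ S ∈ (sieveBlock i).powersetCard k, ∏ l ∈ S, g l ≤ 8 ^ k / k.factorial := by
  refine (sum_powersetCard_prod_le _ g (fun l hl => hg0 l (mem_sieveBlock.1 hl).2.1) k).trans ?_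
  gcongr
  · exact Finset.sum_nonneg fun l hl => hg0 l (mem_sieveBlock.1 hl).2.1
  · exact sum_density_le hg1 i

theorem exp_neg_le_block (hg0 : ∀ l : ℕ, l.Prime → 0 ≤ g l)
    (hg1 : ∀ l : ℕ, l.Prime → g l ≤ 2 / l) (hg2 : ∀ l : ℕ, l.Prime → g l ≤ 3 / 4)
    (i : ℕ) : Real.exp (-16) ≤ ∏ l ∈ sieveBlock i, (1 - g l) := by
  calc Real.exp (-16) ≤ Real.exp (∑ l ∈ sieveBlock i, (-2 * g l)) := by
        apply Real.exp_le_exp.2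
        rw [← Finset.mul_sum]
        linarith [sum_density_le hg1 i]
    _ = ∏ l ∈ sieveBlock i, Real.exp (-2 * g l) := Real.exp_sum _ _
    _ ≤ _ := Finset.prod_le_prod (fun _ _ => (Real.exp_pos _).le) fun l hl =>
        exp_neg_two_mul_le (hg0 l (mem_sieveBlock.1 hl).2.1) (hg2 l (mem_sieveBlock.1 hl).2.1)

theorem block_esymm_le_mul (hg0 : ∀ l : ℕ, l.Prime → 0 ≤ g l)
    (hg1 : ∀ l : ℕ, l.Prime → g l ≤ 2 / l) (hg2 : ∀ l : ℕ, l.Prime → g l ≤ 3 / 4)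
    (i k : ℕ) :
    ∑ S ∈ (sieveBlock i).powersetCard k, ∏ l ∈ S, g l ≤
      (∏ l ∈ sieveBlock i, (1 - g l)) * (Real.exp 16 * (8 ^ k / k.factorial)) := by
  refine (block_esymm_le hg0 hg1 i k).trans ?_
  have h := exp_neg_le_block hg0 hg1 hg2 i
  have h2 : Real.exp (-16) * Real.exp 16 = 1 := by rw [← Real.exp_add]; norm_num
  calc (8 : ℝ) ^ k / k.factorial = Real.exp (-16) * (Real.exp 16 * (8 ^ k / k.factorial)) := by
        rw [← mul_assoc, h2, one_mul]
    _ ≤ _ := by gcongr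

theorem block_pos (hg0 : ∀ l : ℕ, l.Prime → 0 ≤ g l)
    (hg1 : ∀ l : ℕ, l.Prime → g l ≤ 2 / l) (hg2 : ∀ l : ℕ, l.Prime → g l ≤ 3 / 4)
    (i : ℕ) : 0 < ∏ l ∈ sieveBlock i, (1 - g l) :=
  (Real.exp_pos _).trans_le (exp_neg_le_block hg0 hg1 hg2 i)

theorem sieveProd_pos (hg0 : ∀ l : ℕ, l.Prime → 0 ≤ g l)
    (hg1 : ∀ l : ℕ, l.Prime → g l ≤ 2 / l) (hg2 : ∀ l : ℕ, l.Prime → g l ≤ 3 / 4)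
    (I : ℕ) : 0 < sieveProd g I :=
  Finset.prod_pos fun i _ => block_pos hg0 hg1 hg2 i

/-- Main terms of the Brun-Hooley sieve. -/
theorem brun_hooley_main (hg0 : ∀ l : ℕ, l.Prime → 0 ≤ g l)
    (hg1 : ∀ l : ℕ, l.Prime → g l ≤ 2 / l) (hg2 : ∀ l : ℕ, l.Prime → g l ≤ 3 / 4)
    (I b : ℕ) (hb : Even b) (hΔ : sieveErr b ≤ 1) :
    (sieveProd g I ≤ ∏ i : Fin I, truncProd (sieveBlock i) g (blockLevel I b i)) ∧
    (∏ i : Fin I, truncProd (sieveBlock i) g (blockLevel I b i) ≤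
      (1 + 2 * sieveErr b) * sieveProd g I) ∧
    ∑ j : Fin I, (∑ S ∈ (sieveBlock j).powersetCard (blockLevel I b j + 1), ∏ l ∈ S, g l) *
      ∏ i ∈ Finset.univ.erase j, truncProd (sieveBlock i) g (blockLevel I b i) ≤
      3 * sieveErr b * sieveProd g I := by
  have hev : ∀ i : ℕ, Even (blockLevel I b i) := fun i => by
    unfold blockLevel; exact hb.add (even_two_mul _)
  set E : Fin I → ℝ := fun i => truncProd (sieveBlock i) g (blockLevel I b i) with hE
  set v : Fin I → ℝ := fun i => ∏ l ∈ sieveBlock i, (1 - g l) with hv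
  set d : Fin I → ℝ := fun i =>
    Real.exp 16 * (8 ^ (blockLevel I b i + 1) / (blockLevel I b i + 1).factorial) with hd
  have hvpos : ∀ i, 0 < v i := fun i => block_pos hg0 hg1 hg2 i
  have hdpos : ∀ i, 0 < d i := fun i => by simp only [hd]; positivity
  have hg0' : ∀ i : Fin I, ∀ l ∈ sieveBlock i, 0 ≤ g l :=
    fun i l hl => hg0 l (mem_sieveBlock.1 hl).2.1
  have hg1' : ∀ i : Fin I, ∀ l ∈ sieveBlock i, g l ≤ 1 :=
    fun i l hl => (hg2 l (mem_sieveBlock.1 hl).2.1).trans (by norm_num)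
  have hvE : ∀ i, v i ≤ E i := fun i => prod_le_truncProd (hg0' i) (hg1' i) (hev i)
  have hEv : ∀ i, E i ≤ v i * (1 + d i) := fun i => by
    have h1 := truncProd_le (hg0' i) (hg1' i) (hev i)
    have h2 := block_esymm_le_mul hg0 hg1 hg2 i (blockLevel I b i + 1)
    calc E i ≤ _ := h1
      _ ≤ v i + v i * d i := by gcongr
      _ = _ := by ring
  have hsum : ∑ i, d i ≤ sieveErr b := sum_sieveErr_le I b
  have hΔ0 := sieveErr_pos b
  have hexp : Real.exp (sieveErr b) ≤ 1 + 2 * sieveErr b := by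
    have hc := convexOn_exp.2 (Set.mem_univ (0 : ℝ)) (Set.mem_univ (1 : ℝ))
      (show 0 ≤ 1 - sieveErr b by linarith) hΔ0.le (by ring)
    simp only [smul_eq_mul, mul_zero, zero_add, Real.exp_zero, mul_one] at hc
    nlinarith [Real.exp_one_lt_d9]
  have hpart : ∀ s : Finset (Fin I), ∏ i ∈ s, E i ≤ (1 + 2 * sieveErr b) * ∏ i ∈ s, v i := by
    intro s
    calc ∏ i ∈ s, E i ≤ ∏ i ∈ s, (v i * (1 + d i)) :=
          Finset.prod_le_prod (fun i _ => (hvpos i).le.trans (hvE i)) fun i _ => hEv i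
      _ = (∏ i ∈ s, (1 + d i)) * ∏ i ∈ s, v i := by rw [Finset.prod_mul_distrib, mul_comm]
      _ ≤ (1 + 2 * sieveErr b) * ∏ i ∈ s, v i := by
          apply mul_le_mul_of_nonneg_right _ (Finset.prod_nonneg fun i _ => (hvpos i).le)
          calc ∏ i ∈ s, (1 + d i) ≤ ∏ i ∈ s, Real.exp (d i) :=
                Finset.prod_le_prod (fun i _ => by linarith [hdpos i]) fun i _ => by
                  linarith [Real.add_one_le_exp (d i)]
            _ = Real.exp (∑ i ∈ s, d i) := (Real.exp_sum _ _).symm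
            _ ≤ Real.exp (sieveErr b) := by
                apply Real.exp_le_exp.2
                exact (Finset.sum_le_sum_of_subset_of_nonneg (Finset.subset_univ s)
                  fun i _ _ => (hdpos i).le).trans hsum
            _ ≤ _ := hexp
  refine ⟨Finset.prod_le_prod (fun i _ => (hvpos i).le) fun i _ => hvE i, hpart _, ?_⟩
  have hV : ∀ j, v j * ∏ i ∈ Finset.univ.erase j, v i = sieveProd g I := fun j =>
    Finset.mul_prod_erase _ _ (Finset.mem_univ j)
  calc ∑ j : Fin I, (∑ S ∈ (sieveBlock j).powersetCard (blockLevel I b j + 1), ∏ l ∈ S, g l) *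
      ∏ i ∈ Finset.univ.erase j, E i
      ≤ ∑ j : Fin I, (v j * d j) * ((1 + 2 * sieveErr b) * ∏ i ∈ Finset.univ.erase j, v i) := by
        apply Finset.sum_le_sum
        intro j _
        apply mul_le_mul (block_esymm_le_mul hg0 hg1 hg2 j _) (hpart _)
        · exact Finset.prod_nonneg fun i _ => (hvpos i).le.trans (hvE i)
        · exact (mul_pos (hvpos j) (hdpos j)).le
    _ = ∑ j : Fin I, d j * ((1 + 2 * sieveErr b) * sieveProd g I) := by
        apply Finset.sum_congr rfl
        intro j _
        rw [← hV j]; ring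
    _ = (∑ j : Fin I, d j) * ((1 + 2 * sieveErr b) * sieveProd g I) := by rw [Finset.sum_mul]
    _ ≤ sieveErr b * (3 * sieveProd g I) := by
        have := sieveProd_pos hg0 hg1 hg2 I
        apply mul_le_mul hsum _ (by positivity) hΔ0.le
        apply mul_le_mul_of_nonneg_right _ this.le
        linarith
    _ = _ := by ring

open Classical in
/-- The fundamental lemma of the sieve (Brun-Hooley form). -/
theorem fundamental_lemma (hg0 : ∀ l : ℕ, l.Prime → 0 ≤ g l)
    (hg1 : ∀ l : ℕ, l.Prime → g l ≤ 2 / l) (hg2 : ∀ l : ℕ, l.Prime → g l ≤ 3 / 4)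
    (I b : ℕ) (hb : Even b) (hΔ : sieveErr b ≤ 1) (A : Finset ℕ)
    (a : ℕ → ℝ) (ha : ∀ m ∈ A, 0 ≤ a m) (X R : ℝ) (hX : 0 ≤ X)
    (hR : ∀ U : Finset ℕ, (∀ l ∈ U, l.Prime ∧ l < 2 ^ 2 ^ I) →
      ∏ l ∈ U, l ≤ (2 ^ 2 ^ I) ^ (2 * b + 6) →
      |∑ m ∈ A, (if ∀ l ∈ U, l ∣ m then a m else 0) - X * ∏ l ∈ U, g l| ≤ R) :
    |∑ m ∈ A, (if IsRough (2 ^ 2 ^ I) m then a m else 0) - X * sieveProd g I| ≤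
      3 * sieveErr b * (X * sieveProd g I) + R * (2 ^ 2 ^ I) ^ (2 * b + 8) := by
  have hR0 : 0 ≤ R := (abs_nonneg _).trans (hR ∅ (by simp) (by simpa using Nat.one_le_pow _ _ (Nat.one_le_two_pow : 0 < 2 ^ 2 ^ I)))
  obtain ⟨hm1, hm2, hm3⟩ := brun_hooley_main hg0 hg1 hg2 I b hb hΔ
  have hev : ∀ i : ℕ, Even (blockLevel I b i) := fun i => by
    unfold blockLevel; exact hb.add (even_two_mul _)
  set ind : ℕ → ℕ → ℝ := fun m l => if l ∣ m then (1 : ℝ) else 0 with hind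
  have hi0 : ∀ m l, 0 ≤ ind m l := fun m l => by simp only [hind]; split_ifs <;> norm_num
  have hi1 : ∀ m l, ind m l ≤ 1 := fun m l => by simp only [hind]; split_ifs <;> norm_num
  set D : Fin I → Finset (Finset ℕ) := fun i =>
    (sieveBlock i).powerset.filter fun S => S.card ≤ blockLevel I b i + 1 with hD
  have hz : ∏ i : Fin I, (2 ^ 2 ^ (i.1 + 1)) ^ (blockLevel I b i + 1) ≤
      (2 ^ 2 ^ I) ^ (2 * b + 6) := by
    simp_rw [← pow_mul]
    rw [Finset.prod_pow_eq_pow_sum]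
    exact Nat.pow_le_pow_right (by norm_num) (sum_blockLevel_le I b)
  have hcard : ∀ D' : Fin I → Finset (Finset ℕ), (∀ i, D' i ⊆ D i) →
      ∏ i, ((D' i).card : ℝ) ≤ (2 ^ 2 ^ I) ^ (2 * b + 6) := by
    intro D' hD'
    have : ∏ i, (D' i).card ≤ (2 ^ 2 ^ I) ^ (2 * b + 6) := by
      refine le_trans (Finset.prod_le_prod' fun i _ => ?_) hz
      refine (Finset.card_le_card (hD' i)).trans ((card_powerset_le _ _).trans ?_)
      exact Nat.pow_le_pow_left (card_sieveBlock_lt i) _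
    exact_mod_cast this
  have hRD : ∀ D' : Fin I → Finset (Finset ℕ), (∀ i, D' i ⊆ D i) → ∀ x ∈ Fintype.piFinset D',
      |∑ m ∈ A, a m * ∏ i, ∏ l ∈ x i, ind m l - X * ∏ i, ∏ l ∈ x i, g l| ≤ R := by
    intro D' hD' x hx
    have hx' : ∀ i, x i ⊆ sieveBlock i ∧ (x i).card ≤ blockLevel I b i + 1 := fun i => by
      have := hD' i (Fintype.mem_piFinset.1 hx i)
      simp only [hD, Finset.mem_filter, Finset.mem_powerset] at this
      exact this
    set U : Finset ℕ := Finset.univ.biUnion x with hU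
    have hdisj : (Set.univ : Set (Fin I)).PairwiseDisjoint x := by
      intro i _ j _ hij
      have : (i : ℕ) ≠ j := fun h => hij (Fin.ext h)
      exact (sieveBlock_disjoint this).mono (hx' i).1 (hx' j).1
    have hdisj' : ((Finset.univ : Finset (Fin I)) : Set (Fin I)).PairwiseDisjoint x := by
      simpa using hdisj
    have hg' : ∏ i, ∏ l ∈ x i, g l = ∏ l ∈ U, g l := (Finset.prod_biUnion hdisj').symm
    have hi' : ∀ m, a m * ∏ i, ∏ l ∈ x i, ind m l = if ∀ l ∈ U, l ∣ m then a m else 0 := by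
      intro m
      rw [← Finset.prod_biUnion hdisj', ← hU]
      split_ifs with h
      · rw [Finset.prod_eq_one fun l hl => by simp only [hind]; rw [if_pos (h l hl)], mul_one]
      · push Not at h
        obtain ⟨l, hl, hd⟩ := h
        rw [Finset.prod_eq_zero hl (by simp only [hind]; rw [if_neg hd]), mul_zero]
    simp_rw [hi']
    rw [hg']
    apply hR U
    · intro l hl
      obtain ⟨i, _, hl'⟩ := Finset.mem_biUnion.1 hl
      obtain ⟨h1, h2, h3⟩ := mem_sieveBlock.1 ((hx' i).1 hl')
      refine ⟨h2, h1.trans_le ?_⟩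
      have := i.2
      gcongr <;> omega
    · rw [hU, Finset.prod_biUnion hdisj']
      refine le_trans (Finset.prod_le_prod' fun i _ => ?_) hz
      calc ∏ l ∈ x i, l ≤ ∏ l ∈ x i, 2 ^ 2 ^ (i.1 + 1) :=
            Finset.prod_le_prod' fun l hl => (mem_sieveBlock.1 ((hx' i).1 hl)).1.le
        _ = (2 ^ 2 ^ (i.1 + 1)) ^ (x i).card := by rw [Finset.prod_const]
        _ ≤ _ := Nat.pow_le_pow_right (by positivity) (hx' i).2
  have hT : ∀ (i : Fin I) (y : ℕ → ℝ), truncProd (sieveBlock i) y (blockLevel I b i) =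
      ∑ S ∈ (sieveBlock i).powerset.filter (fun S => S.card ≤ blockLevel I b i),
        (-1) ^ S.card * ∏ l ∈ S, y l := by
    intro i y
    unfold truncProd
    exact Finset.sum_congr rfl fun S _ => by rw [Finset.prod_neg]
  have hone : ∀ D' : Fin I → Finset (Finset ℕ), (∀ i, D' i ⊆ D i) →
      R * ∏ i, ((D' i).card : ℝ) ≤ R * (2 ^ 2 ^ I) ^ (2 * b + 6) := fun D' hD' =>
    mul_le_mul_of_nonneg_left (hcard D' hD') hR0
  have hfull : |∑ m ∈ A, a m * ∏ i : Fin I, truncProd (sieveBlock i) (ind m) (blockLevel I b i) -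
      X * ∏ i : Fin I, truncProd (sieveBlock i) g (blockLevel I b i)| ≤
      R * (2 ^ 2 ^ I) ^ (2 * b + 6) := by
    have hsub : ∀ i : Fin I, (sieveBlock i).powerset.filter
        (fun S => S.card ≤ blockLevel I b i) ⊆ D i := fun i S hS => by
      simp only [hD, Finset.mem_filter] at hS ⊢
      exact ⟨hS.1, by omega⟩
    refine le_trans ?_ (hone _ hsub)
    simp_rw [hT]
    exact expand_sieve_product A a X R g _ (fun _ S => (-1) ^ S.card) (fun i S _ => by simp)
      (hRD _ hsub)
  have hj : ∀ j : Fin I, |∑ m ∈ A, a m *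
      ((∑ S ∈ (sieveBlock j).powersetCard (blockLevel I b j + 1), ∏ l ∈ S, ind m l) *
        ∏ i ∈ Finset.univ.erase j, truncProd (sieveBlock i) (ind m) (blockLevel I b i)) -
      X * ((∑ S ∈ (sieveBlock j).powersetCard (blockLevel I b j + 1), ∏ l ∈ S, g l) *
        ∏ i ∈ Finset.univ.erase j, truncProd (sieveBlock i) g (blockLevel I b i))| ≤
      R * (2 ^ 2 ^ I) ^ (2 * b + 6) := by
    intro j
    set D' : Fin I → Finset (Finset ℕ) := fun i => if i = j then
      (sieveBlock j).powersetCard (blockLevel I b j + 1) else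
      (sieveBlock i).powerset.filter (fun S => S.card ≤ blockLevel I b i) with hD'
    set c' : Fin I → Finset ℕ → ℝ := fun i S => if i = j then 1 else (-1) ^ S.card with hc'
    have hsub : ∀ i, D' i ⊆ D i := fun i S hS => by
      simp only [hD', hD, Finset.mem_filter, Finset.mem_powerset] at hS ⊢
      split_ifs at hS with h
      · have := Finset.mem_powersetCard.1 hS
        subst h
        exact ⟨this.1, this.2.le⟩
      · have := Finset.mem_filter.1 hS
        exact ⟨Finset.mem_powerset.1 this.1, by omega⟩
    have hprod : ∀ y : ℕ → ℝ,
        (∑ S ∈ (sieveBlock j).powersetCard (blockLevel I b j + 1), ∏ l ∈ S, y l) *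
        ∏ i ∈ Finset.univ.erase j, truncProd (sieveBlock i) y (blockLevel I b i) =
        ∏ i, ∑ S ∈ D' i, c' i S * ∏ l ∈ S, y l := by
      intro y
      rw [← Finset.mul_prod_erase Finset.univ _ (Finset.mem_univ j)]
      congr 1
      · simp [hD', hc']
      · apply Finset.prod_congr rfl
        intro i hi
        have hij : i ≠ j := Finset.ne_of_mem_erase hi
        rw [hT]
        simp [hD', hc', hij]
    refine le_trans ?_ (hone _ hsub)
    simp_rw [hprod]
    refine expand_sieve_product A a X R g D' c' (fun i S _ => ?_) (hRD _ hsub)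
    simp only [hc']
    split_ifs <;> simp
  have hrough : ∀ m, (if IsRough (2 ^ 2 ^ I) m then a m else 0) =
      a m * ∏ i : Fin I, ∏ l ∈ sieveBlock i, (1 - ind m l) := fun m => by
    rw [← rough_indicator]; simp
  simp_rw [hrough]
  have hpow : (2 : ℝ) ^ 2 ^ I ≥ 1 := one_le_pow₀ (by norm_num)
  have hV := sieveProd_pos hg0 hg1 hg2 I
  have hΔ0 := sieveErr_pos b
  have hII : ((I : ℝ) + 1) * (2 ^ 2 ^ I) ^ (2 * b + 6) ≤ (2 ^ 2 ^ I) ^ (2 * b + 8) := by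
    rw [show 2 * b + 8 = 2 + (2 * b + 6) by ring, pow_add _ 2 (2 * b + 6)]
    apply mul_le_mul_of_nonneg_right _ (by positivity)
    have h1 : I < 2 ^ I := Nat.lt_two_pow_self
    have h2 : 2 ^ I < 2 ^ 2 ^ I := Nat.lt_two_pow_self
    have h3 : (I : ℝ) + 1 ≤ 2 ^ 2 ^ I := by exact_mod_cast (by omega : I + 1 ≤ 2 ^ 2 ^ I)
    nlinarith
  have hR1 : R * (2 ^ 2 ^ I) ^ (2 * b + 6) + ∑ j : Fin I, R * (2 ^ 2 ^ I) ^ (2 * b + 6) ≤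
      R * (2 ^ 2 ^ I) ^ (2 * b + 8) := by
    rw [Finset.sum_const, Finset.card_univ, Fintype.card_fin, nsmul_eq_mul]
    have := mul_le_mul_of_nonneg_left hII hR0
    linarith
  have hRsum : 0 ≤ ∑ j : Fin I, R * (2 ^ 2 ^ I) ^ (2 * b + 6) :=
    Finset.sum_nonneg fun _ _ => by positivity
  rw [abs_le]
  constructor
  · have hlow : ∑ m ∈ A, a m * ∏ i : Fin I, truncProd (sieveBlock i) (ind m) (blockLevel I b i) -
        ∑ j : Fin I, ∑ m ∈ A, a m *
        ((∑ S ∈ (sieveBlock j).powersetCard (blockLevel I b j + 1), ∏ l ∈ S, ind m l) *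
          ∏ i ∈ Finset.univ.erase j, truncProd (sieveBlock i) (ind m) (blockLevel I b i)) ≤
        ∑ m ∈ A, a m * ∏ i : Fin I, ∏ l ∈ sieveBlock i, (1 - ind m l) := by
      rw [Finset.sum_comm, ← Finset.sum_sub_distrib]
      apply Finset.sum_le_sum
      intro m hm
      rw [← Finset.mul_sum, ← mul_sub]
      apply mul_le_mul_of_nonneg_left _ (ha m hm)
      have hxy : ∀ i ∈ (Finset.univ : Finset (Fin I)), ∏ l ∈ sieveBlock i, (1 - ind m l) ≤
          truncProd (sieveBlock i) (ind m) (blockLevel I b i) := fun i _ =>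
        prod_le_truncProd (fun l _ => hi0 m l) (fun l _ => hi1 m l) (hev i)
      have hx0 : ∀ i ∈ (Finset.univ : Finset (Fin I)),
          0 ≤ ∏ l ∈ sieveBlock i, (1 - ind m l) := fun i _ =>
        Finset.prod_nonneg fun l _ => by linarith [hi1 m l]
      refine le_trans ?_ (prod_sub_sum_le_prod Finset.univ _ _ hx0 hxy)
      apply sub_le_sub_left
      apply Finset.sum_le_sum
      intro j _
      apply mul_le_mul_of_nonneg_right
      · have := truncProd_le (P := sieveBlock j) (fun l _ => hi0 m l) (fun l _ => hi1 m l) (hev j)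
        linarith
      · exact Finset.prod_nonneg fun i _ => (hx0 i (Finset.mem_univ i)).trans
          (hxy i (Finset.mem_univ i))
    have h1 := (abs_le.1 hfull).1
    have h2 : ∑ j : Fin I, ∑ m ∈ A, a m *
        ((∑ S ∈ (sieveBlock j).powersetCard (blockLevel I b j + 1), ∏ l ∈ S, ind m l) *
          ∏ i ∈ Finset.univ.erase j, truncProd (sieveBlock i) (ind m) (blockLevel I b i)) ≤
        X * ∑ j : Fin I, ((∑ S ∈ (sieveBlock j).powersetCard (blockLevel I b j + 1),
          ∏ l ∈ S, g l) * ∏ i ∈ Finset.univ.erase j,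
          truncProd (sieveBlock i) g (blockLevel I b i)) +
        ∑ j : Fin I, R * (2 ^ 2 ^ I) ^ (2 * b + 6) := by
      rw [Finset.mul_sum, ← Finset.sum_add_distrib]
      apply Finset.sum_le_sum
      intro j _
      linarith [(abs_le.1 (hj j)).2]
    have h3 := mul_le_mul_of_nonneg_left hm1 hX
    have h4 := mul_le_mul_of_nonneg_left hm3 hX
    linarith
  · have hup : ∑ m ∈ A, a m * ∏ i : Fin I, ∏ l ∈ sieveBlock i, (1 - ind m l) ≤
        ∑ m ∈ A, a m * ∏ i : Fin I, truncProd (sieveBlock i) (ind m) (blockLevel I b i) := by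
      apply Finset.sum_le_sum
      intro m hm
      apply mul_le_mul_of_nonneg_left _ (ha m hm)
      exact Finset.prod_le_prod (fun i _ => Finset.prod_nonneg fun l _ => by linarith [hi1 m l])
        fun i _ => prod_le_truncProd (fun l _ => hi0 m l) (fun l _ => hi1 m l) (hev i)
    have h1 := (abs_le.1 hfull).2
    have h3 := mul_le_mul_of_nonneg_left hm2 hX
    have h5 : 0 ≤ sieveErr b * (X * sieveProd g I) := by positivity
    linarith

end

theorem abel_bound (u w : ℕ → ℝ) (M : ℕ) (B : ℝ)
    (hB : ∀ t, |∑ m ∈ Finset.Ioc M t, u m| ≤ B)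
    (hw : ∀ m, M < m → w (m + 1) ≤ w m) (hw0 : ∀ m, M < m → 0 ≤ w m) (N : ℕ) :
    |∑ m ∈ Finset.Ioc M N, u m * w m| ≤ B * w (M + 1) := by
  have hB0 : 0 ≤ B := (abs_nonneg _).trans (hB 0)
  rcases Nat.lt_or_ge M N with h | h
  · obtain ⟨j, rfl⟩ : ∃ j, N = M + 1 + j := ⟨N - (M + 1), by omega⟩
    have key : ∀ j, |∑ m ∈ Finset.Ioc M (M + 1 + j), u m * w m -
        (∑ m ∈ Finset.Ioc M (M + 1 + j), u m) * w (M + 1 + j)| ≤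
        B * (w (M + 1) - w (M + 1 + j)) := by
      intro j
      induction j with
      | zero => simp
      | succ j ih =>
        have e : M + 1 + (j + 1) = (M + 1 + j) + 1 := by ring
        rw [e, ← Finset.insert_Ioc_right_eq_Ioc_add_one (by omega),
          Finset.sum_insert (by simp), Finset.sum_insert (by simp)]
        have h1 := hB (M + 1 + j)
        have h2 := hw (M + 1 + j) (by omega)
        rw [show ∀ a b c d e : ℝ, a * b + c - (a + d) * b = (c - d * e) + d * (e - b) from
          fun a b c d e => by ring]
        calc _ ≤ _ := abs_add_le _ _
          _ ≤ B * (w (M + 1) - w (M + 1 + j)) + B * (w (M + 1 + j) - w (M + 1 + j + 1)) := by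
            apply add_le_add ih
            rw [abs_mul, abs_of_nonneg (sub_nonneg.2 h2)]
            exact mul_le_mul_of_nonneg_right h1 (sub_nonneg.2 h2)
          _ = _ := by ring
    have h1 := key j
    have h2 := hB (M + 1 + j)
    have h3 := hw0 (M + 1 + j) (by omega)
    calc |∑ m ∈ Finset.Ioc M (M + 1 + j), u m * w m|
        = |(∑ m ∈ Finset.Ioc M (M + 1 + j), u m * w m -
          (∑ m ∈ Finset.Ioc M (M + 1 + j), u m) * w (M + 1 + j)) +
          (∑ m ∈ Finset.Ioc M (M + 1 + j), u m) * w (M + 1 + j)| := by ring_nf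
      _ ≤ B * (w (M + 1) - w (M + 1 + j)) + B * w (M + 1 + j) := by
          refine (abs_add_le _ _).trans (add_le_add h1 ?_)
          rw [abs_mul, abs_of_nonneg h3]
          exact mul_le_mul_of_nonneg_right h2 h3
      _ = _ := by ring
  · rw [Finset.Ioc_eq_empty (by omega)]
    simp only [Finset.sum_empty, abs_zero]
    exact mul_nonneg hB0 (hw0 _ (by omega))

theorem periodic_sum_bound (u : ℕ → ℝ) (Q : ℕ) (hQ : 0 < Q) (hper : ∀ m, u (m + Q) = u m)
    (h0 : ∀ m, 0 ≤ u m) (h1 : ∀ m, u m ≤ 1) (t : ℕ) :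
    |∑ m ∈ Finset.range t, u m - t * ((∑ m ∈ Finset.range Q, u m) / Q)| ≤ Q := by
  have hQ' : (0 : ℝ) < Q := by exact_mod_cast hQ
  induction t using Nat.strong_induction_on with
  | _ t ih =>
    rcases Nat.lt_or_ge t Q with h | h
    · have hb : ∀ k, 0 ≤ ∑ m ∈ Finset.range k, u m ∧ ∑ m ∈ Finset.range k, u m ≤ k := fun k =>
        ⟨Finset.sum_nonneg fun m _ => h0 m, by
          simpa using Finset.sum_le_sum (s := Finset.range k) (fun m _ => h1 m)⟩
      have h3 := hb t
      have h4 := hb Q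
      have h5 : (∑ m ∈ Finset.range Q, u m) / Q ≤ 1 := (div_le_one hQ').2 h4.2
      have h6 : 0 ≤ (∑ m ∈ Finset.range Q, u m) / Q := div_nonneg h4.1 hQ'.le
      have h7 : (t : ℝ) ≤ Q := by exact_mod_cast h.le
      have h8 : (0 : ℝ) ≤ t := by positivity
      rw [abs_le]
      constructor <;> nlinarith
    · obtain ⟨r, rfl⟩ : ∃ r, t = Q + r := ⟨t - Q, by omega⟩
      have := ih r (by omega)
      rw [Finset.sum_range_add]
      have e : ∀ m, u (Q + m) = u m := fun m => by rw [add_comm, hper]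
      simp_rw [e]
      have e2 : ((Q + r : ℕ) : ℝ) * ((∑ m ∈ Finset.range Q, u m) / Q) =
          ∑ m ∈ Finset.range Q, u m + r * ((∑ m ∈ Finset.range Q, u m) / Q) := by
        push_cast; field_simp
      rw [e2, add_sub_add_left_eq_sub]
      exact this

section ClassData
variable {Q : ℕ} {G : Type*} [CommGroup G] (c : (ZMod Q)ˣ →* G)

/-- The integer `m` is a unit modulo `Q` whose class under `c` is `h`. -/
def InClass (h : G) (m : ℕ) : Prop := ∃ u : (ZMod Q)ˣ, (u : ZMod Q) = m ∧ c u = h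

variable {c}

theorem InClass.coprime {h : G} {m : ℕ} (hm : InClass c h m) : m.Coprime Q := by
  obtain ⟨u, hu, _⟩ := hm
  rw [← ZMod.isUnit_iff_coprime, ← hu]
  exact u.isUnit

theorem InClass.unique {h h' : G} {m : ℕ} (hm : InClass c h m) (hm' : InClass c h' m) :
    h = h' := by
  obtain ⟨u, hu, rfl⟩ := hm
  obtain ⟨v, hv, rfl⟩ := hm'
  rw [Units.ext (hu.trans hv.symm)]

theorem exists_inClass {m : ℕ} (hm : m.Coprime Q) : ∃ h, InClass c h m :=
  ⟨_, ZMod.unitOfCoprime m hm, ZMod.coe_unitOfCoprime m hm, rfl⟩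

theorem InClass.mul {h h' : G} {m m' : ℕ} (hm : InClass c h m) (hm' : InClass c h' m') :
    InClass c (h * h') (m * m') := by
  obtain ⟨u, hu, rfl⟩ := hm
  obtain ⟨v, hv, rfl⟩ := hm'
  exact ⟨u * v, by push_cast; rw [hu, hv], map_mul c u v⟩

theorem InClass.mul_iff {h e : G} {d k : ℕ} (hd : InClass c e d) :
    InClass c h (d * k) ↔ InClass c (e⁻¹ * h) k := by
  constructor
  · intro h1
    have hk : k.Coprime Q := Nat.Coprime.coprime_mul_left h1.coprime
    obtain ⟨e', he'⟩ := exists_inClass (c := c) hk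
    have := h1.unique (hd.mul he')
    rw [this]; simpa using he'
  · intro h1
    simpa using hd.mul h1

variable (c)

theorem inClass_add (h : G) (m : ℕ) : InClass c h (m + Q) ↔ InClass c h m := by
  unfold InClass; simp

/-- Density of a class. -/
noncomputable def classDensity : ℝ :=
  (Nat.card c.ker : ℝ) / Q

open Classical in
theorem card_class_period [NeZero Q] (hc : Function.Surjective c) (h : G) :
    ∑ m ∈ Finset.range Q, (if InClass c h m then (1 : ℝ) else 0) = Nat.card c.ker := by
  rw [← Finset.sum_filter, Finset.sum_const, nsmul_eq_mul, mul_one]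
  obtain ⟨u0, rfl⟩ := hc h
  congr 1
  rw [Nat.card_eq_fintype_card, ← Finset.card_univ]
  symm
  apply Finset.card_bij (fun (k : c.ker) _ => ((u0 * k : (ZMod Q)ˣ) : ZMod Q).val)
  · intro k _
    simp only [Finset.mem_filter, Finset.mem_range]
    refine ⟨ZMod.val_lt _, u0 * k, by simp, ?_⟩
    rw [map_mul, k.2, mul_one]
  · intro k _ k' _ hk
    have := Units.ext (ZMod.val_injective Q hk)
    exact Subtype.ext (mul_left_cancel this)
  · intro m hm
    simp only [Finset.mem_filter, Finset.mem_range] at hm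
    obtain ⟨hm1, u, hu, hu2⟩ := hm
    refine ⟨⟨u0⁻¹ * u, ?_⟩, Finset.mem_univ _, ?_⟩
    · rw [MonoidHom.mem_ker, map_mul, map_inv, hu2, inv_mul_cancel]
    · simp only [mul_inv_cancel_left, hu]
      exact ZMod.val_natCast_of_lt hm1

theorem classDensity_pos [NeZero Q] : 0 < classDensity c := by
  unfold classDensity
  have : 0 < Nat.card c.ker := Nat.card_pos
  have h2 : 0 < Q := NeZero.pos Q
  positivity

theorem classDensity_le [NeZero Q] : classDensity c ≤ 1 := by
  unfold classDensity
  have h2 : 0 < Q := NeZero.pos Q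
  rw [div_le_one (by exact_mod_cast h2)]
  have h3 : Nat.card c.ker ≤ Nat.card (ZMod Q)ˣ := Nat.card_le_card_of_injective _ Subtype.val_injective
  rw [Nat.card_eq_fintype_card (α := (ZMod Q)ˣ), ZMod.card_units_eq_totient] at h3
  exact_mod_cast h3.trans (Nat.totient_le Q)

theorem card_group_le [NeZero Q] [Fintype G] (hc : Function.Surjective c) : Fintype.card G ≤ Q := by
  have h3 := Fintype.card_le_of_surjective c hc
  rw [ZMod.card_units_eq_totient] at h3
  exact h3.trans (Nat.totient_le Q)

open Classical in
theorem class_count [NeZero Q] (hc : Function.Surjective c) (h : G) (t : ℕ) :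
    |∑ m ∈ Finset.Ioc 0 t, (if InClass c h m then (1 : ℝ) else 0) - t * classDensity c| ≤
      Q + 2 := by
  have h1 := periodic_sum_bound (fun m => if InClass c h m then (1 : ℝ) else 0) Q (NeZero.pos Q)
    (fun m => by simp only [inClass_add]) (fun m => by split_ifs <;> norm_num)
    (fun m => by split_ifs <;> norm_num) (t + 1)
  rw [card_class_period c hc] at h1
  have e : Finset.range (t + 1) = insert 0 (Finset.Ioc 0 t) := by
    ext m; simp
  rw [e, Finset.sum_insert (by simp)] at h1
  change |_ - ((t + 1 : ℕ) : ℝ) * classDensity c| ≤ _ at h1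
  have h2 := classDensity_pos c
  have h3 := classDensity_le c
  have h4 : (0 : ℝ) ≤ if InClass c h 0 then (1 : ℝ) else 0 := by split_ifs <;> norm_num
  have h5 : (if InClass c h 0 then (1 : ℝ) else 0) ≤ 1 := by split_ifs <;> norm_num
  push_cast at h1
  rw [abs_le] at h1 ⊢
  constructor <;> linarith [h1.1, h1.2]

/-- The sieve density for classes. -/
noncomputable def classSieve (Q l : ℕ) : ℝ := if l ∣ Q then 0 else 1 / l

theorem classSieve_nonneg (l : ℕ) : 0 ≤ classSieve Q l := by
  unfold classSieve; split_ifs <;> positivity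

theorem classSieve_le (l : ℕ) : classSieve Q l ≤ 1 / l := by
  unfold classSieve; split_ifs <;> first | positivity | exact le_rfl

theorem prod_primes_dvd_iff {U : Finset ℕ} (hU : ∀ l ∈ U, l.Prime) (m : ℕ) :
    ∏ l ∈ U, l ∣ m ↔ ∀ l ∈ U, l ∣ m :=
  ⟨fun h l hl => (Finset.dvd_prod_of_mem _ hl).trans h, fun h =>
    Finset.prod_primes_dvd m (fun l hl => (hU l hl).prime) h⟩

open Classical in
theorem class_count_dvd [NeZero Q] (hc : Function.Surjective c) (h : G) {U : Finset ℕ}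
    (hU : ∀ l ∈ U, l.Prime) (t : ℕ) :
    |∑ m ∈ Finset.Ioc 0 t, (if (∀ l ∈ U, l ∣ m) ∧ InClass c h m then (1 : ℝ) else 0) -
      t * (classDensity c * ∏ l ∈ U, classSieve Q l)| ≤ Q + 3 := by
  by_cases hcop : ∀ l ∈ U, ¬ l ∣ Q
  · set d := ∏ l ∈ U, l with hd
    have hd0 : 0 < d := Finset.prod_pos fun l hl => (hU l hl).pos
    have hdQ : d.Coprime Q := by
      apply Nat.Coprime.prod_left
      intro l hl
      exact (Nat.Prime.coprime_iff_not_dvd (hU l hl)).2 (hcop l hl)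
    obtain ⟨e, he⟩ := exists_inClass (c := c) hdQ
    have hg : ∏ l ∈ U, classSieve Q l = 1 / d := by
      rw [hd]; push_cast
      rw [one_div, ← Finset.prod_inv_distrib]
      apply Finset.prod_congr rfl
      intro l hl
      simp [classSieve, hcop l hl]
    have hsum : ∑ m ∈ Finset.Ioc 0 t, (if (∀ l ∈ U, l ∣ m) ∧ InClass c h m then (1 : ℝ) else 0) =
        ∑ k ∈ Finset.Ioc 0 (t / d), (if InClass c (e⁻¹ * h) k then (1 : ℝ) else 0) := by
      simp_rw [← prod_primes_dvd_iff hU, ← hd]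
      rw [← Finset.sum_filter, ← Finset.sum_filter, Finset.sum_const, Finset.sum_const]
      congr 1
      symm
      apply Finset.card_bij (fun k _ => d * k)
      · intro k hk
        simp only [Finset.mem_filter, Finset.mem_Ioc] at hk ⊢
        refine ⟨⟨by have := hk.1.1; positivity, ?_⟩, dvd_mul_right _ _, (InClass.mul_iff he).2 hk.2⟩
        have := (Nat.le_div_iff_mul_le hd0).1 hk.1.2
        linarith
      · intro k _ k' _ hk
        exact Nat.eq_of_mul_eq_mul_left hd0 hk
      · intro m hm
        simp only [Finset.mem_filter, Finset.mem_Ioc] at hm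
        obtain ⟨⟨h1, h2⟩, ⟨k, rfl⟩, h3⟩ := hm
        refine ⟨k, ?_, rfl⟩
        simp only [Finset.mem_filter, Finset.mem_Ioc]
        refine ⟨⟨Nat.pos_of_mul_pos_left h1, ?_⟩, (InClass.mul_iff he).1 h3⟩
        exact (Nat.le_div_iff_mul_le hd0).2 (by linarith)
    rw [hsum, hg]
    have h1 := class_count c hc (e⁻¹ * h) (t / d)
    have h2 := classDensity_pos c
    have h3 := classDensity_le c
    have h4 : ((t / d : ℕ) : ℝ) ≤ t / d := Nat.cast_div_le
    have h5 : (t : ℝ) / d ≤ (t / d : ℕ) + 1 := by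
      have h7 : t ≤ (t / d + 1) * d := by
        have := Nat.div_add_mod t d
        have := Nat.mod_lt t hd0
        nlinarith
      rw [div_le_iff₀ (by exact_mod_cast hd0)]
      exact_mod_cast h7
    have h6 : (t : ℝ) * (classDensity c * (1 / d)) = t / d * classDensity c := by ring
    rw [h6]
    rw [abs_le] at h1 ⊢
    constructor <;> nlinarith [h1.1, h1.2]
  · push Not at hcop
    obtain ⟨l, hl, hlQ⟩ := hcop
    have hg : ∏ l ∈ U, classSieve Q l = 0 := Finset.prod_eq_zero hl (by simp [classSieve, hlQ])
    rw [hg, Finset.sum_eq_zero]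
    · simp; positivity
    · intro m _
      rw [if_neg]
      rintro ⟨h1, h2⟩
      have := Nat.Coprime.eq_one_of_dvd (Nat.Coprime.coprime_dvd_left (h1 l hl) h2.coprime) hlQ
      exact (hU l hl).one_lt.ne' this

end ClassData

section ClassSieve
variable {Q : ℕ} [NeZero Q] {G : Type*} [CommGroup G] (c : (ZMod Q)ˣ →* G)

open Classical in
/-- Weighted sum over rough integers of a class in `(M, N]`. -/
noncomputable def roughClassSum (z : ℕ) (h : G) (w : ℕ → ℝ) (M N : ℕ) : ℝ :=
  ∑ m ∈ Finset.Ioc M N, if IsRough z m ∧ InClass c h m then w m else 0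

open Classical in
/-- Weighted sum over all rough integers in `(M, N]`. -/
noncomputable def roughSum (z : ℕ) (w : ℕ → ℝ) (M N : ℕ) : ℝ :=
  ∑ m ∈ Finset.Ioc M N, if IsRough z m then w m else 0

theorem IsRough.coprime {z m Q : ℕ} (hm : IsRough z m) (hQ : Q < z) (hQ0 : 0 < Q) :
    m.Coprime Q := by
  apply Nat.Coprime.symm
  apply Nat.coprime_of_dvd
  intro l hl h1 h2
  exact hm l hl ((Nat.le_of_dvd hQ0 h1).trans_lt hQ) h2

theorem sum_roughClassSum [Fintype G] {z : ℕ} (hQ : Q < z) (w : ℕ → ℝ) (M N : ℕ) :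
    ∑ h, roughClassSum c z h w M N = roughSum z w M N := by
  classical
  unfold roughClassSum roughSum
  rw [Finset.sum_comm]
  apply Finset.sum_congr rfl
  intro m _
  split_ifs with hm
  · obtain ⟨e, he⟩ := exists_inClass (c := c) (hm.coprime hQ (NeZero.pos Q))
    rw [Finset.sum_eq_single e]
    · rw [if_pos ⟨hm, he⟩]
    · intro h _ hne
      rw [if_neg]
      exact fun h' => hne (h'.2.unique he)
    · simp
  · exact Finset.sum_eq_zero fun h _ => if_neg fun h' => hm h'.1

theorem roughClassSum_sieve (hc : Function.Surjective c) (I b : ℕ) (hb : Even b)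
    (hΔ : sieveErr b ≤ 1) (h : G) (w : ℕ → ℝ) (M N : ℕ)
    (hw : ∀ m, M < m → w (m + 1) ≤ w m) (hw0 : ∀ m, M < m → 0 ≤ w m) :
    |roughClassSum c (2 ^ 2 ^ I) h w M N - (classDensity c * ∑ m ∈ Finset.Ioc M N, w m) *
        sieveProd (classSieve Q) I| ≤
      3 * sieveErr b * ((classDensity c * ∑ m ∈ Finset.Ioc M N, w m) *
        sieveProd (classSieve Q) I) +
      (2 * (Q + 3) * w (M + 1)) * (2 ^ 2 ^ I) ^ (2 * b + 8) := by
  classical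
  have hρ := classDensity_pos c
  have key := fundamental_lemma (g := classSieve Q) (fun l _ => classSieve_nonneg l)
    (fun l _ => (classSieve_le l).trans (by gcongr; norm_num))
    (fun l hl => (classSieve_le l).trans (by
      have : (2 : ℝ) ≤ l := by exact_mod_cast hl.two_le
      rw [div_le_iff₀ (by linarith)]; linarith)) I b hb hΔ (Finset.Ioc M N)
    (fun m => if InClass c h m then w m else 0)
    (fun m hm => by
      have := hw0 m (Finset.mem_Ioc.1 hm).1
      split_ifs
      · exact this
      · exact le_rfl)
    (classDensity c * ∑ m ∈ Finset.Ioc M N, w m) (2 * (Q + 3) * w (M + 1))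
    (mul_nonneg hρ.le (Finset.sum_nonneg fun m hm => hw0 m (Finset.mem_Ioc.1 hm).1))
    (fun U hU _ => by
      set κ := classDensity c * ∏ l ∈ U, classSieve Q l with hκ
      set v : ℕ → ℝ := fun m => if (∀ l ∈ U, l ∣ m) ∧ InClass c h m then (1 : ℝ) else 0 with hv
      have e : ∑ m ∈ Finset.Ioc M N, (if ∀ l ∈ U, l ∣ m then
          (if InClass c h m then w m else 0) else 0) -
          (classDensity c * ∑ m ∈ Finset.Ioc M N, w m) * ∏ l ∈ U, classSieve Q l =
          ∑ m ∈ Finset.Ioc M N, (v m - κ) * w m := by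
        rw [mul_right_comm, ← hκ, Finset.mul_sum, ← Finset.sum_sub_distrib]
        apply Finset.sum_congr rfl
        intro m _
        rw [sub_mul]
        congr 1
        by_cases h1 : ∀ l ∈ U, l ∣ m <;> by_cases h2 : InClass c h m <;> simp [hv, h1, h2]
      rw [e]
      apply abel_bound _ w M _ _ hw hw0
      intro t
      have hcount := class_count_dvd c hc h (U := U) (fun l hl => (hU l hl).1)
      rcases Nat.lt_or_ge t M with ht | ht
      · rw [Finset.Ioc_eq_empty (by omega)]; simp; positivity
      · have e2 : ∀ f : ℕ → ℝ, ∑ m ∈ Finset.Ioc M t, f m =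
            ∑ m ∈ Finset.Ioc 0 t, f m - ∑ m ∈ Finset.Ioc 0 M, f m := fun f => by
          rw [← Finset.Ioc_union_Ioc_eq_Ioc (Nat.zero_le M) ht, Finset.sum_union]
          · ring
          · exact Finset.Ioc_disjoint_Ioc_of_le le_rfl
        have h1 := hcount t
        have h2 := hcount M
        have e3 : ∀ t : ℕ, ∑ m ∈ Finset.Ioc 0 t, (v m - κ) = ∑ m ∈ Finset.Ioc 0 t, v m - t * κ :=
          fun t => by rw [Finset.sum_sub_distrib]; simp
        rw [e2, e3, e3]
        rw [abs_le] at h1 h2 ⊢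
        constructor <;> linarith [h1.1, h1.2, h2.1, h2.2])
  unfold roughClassSum
  convert key using 4
  rename_i m _
  by_cases h1 : IsRough (2 ^ 2 ^ I) m <;> by_cases h2 : InClass c h m <;> simp [h1, h2]

/-- Rough integers are equidistributed among the classes. -/
theorem roughClassSum_compare [Fintype G] (hc : Function.Surjective c) {I b : ℕ} (hb : Even b)
    (hΔ : sieveErr b ≤ 1 / 6) (hQ : Q < 2 ^ 2 ^ I) {w : ℕ → ℝ} {M : ℕ}
    (hw : ∀ m, M < m → w (m + 1) ≤ w m) (hw0 : ∀ m, M < m → 0 ≤ w m) (N : ℕ) :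
    (∀ h, roughClassSum c (2 ^ 2 ^ I) h w M N ≤
      3 * (roughSum (2 ^ 2 ^ I) w M N / Fintype.card G) +
        4 * (w (M + 1) * (2 ^ 2 ^ I) ^ (2 * b + 11))) ∧
    (∀ h h', |roughClassSum c (2 ^ 2 ^ I) h w M N - roughClassSum c (2 ^ 2 ^ I) h' w M N| ≤
      12 * sieveErr b * (roughSum (2 ^ 2 ^ I) w M N / Fintype.card G) +
        4 * (w (M + 1) * (2 ^ 2 ^ I) ^ (2 * b + 11))) := by
  have key := fun h => roughClassSum_sieve c hc I b hb (hΔ.trans (by norm_num)) h w M N hw hw0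
  set X := (classDensity c * ∑ m ∈ Finset.Ioc M N, w m) * sieveProd (classSieve Q) I with hX
  have hX0 : 0 ≤ X := by
    have h1 := classDensity_pos c
    have h2 : 0 ≤ ∑ m ∈ Finset.Ioc M N, w m :=
      Finset.sum_nonneg fun m hm => hw0 m (Finset.mem_Ioc.1 hm).1
    have h3 := sieveProd_pos (g := classSieve Q) (fun l _ => classSieve_nonneg l)
      (fun l _ => (classSieve_le l).trans (by gcongr; norm_num))
      (fun l hl => (classSieve_le l).trans (by
        have : (2 : ℝ) ≤ l := by exact_mod_cast hl.two_le
        rw [div_le_iff₀ (by linarith)]; linarith)) I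
    positivity
  set R := w (M + 1) * (2 ^ 2 ^ I) ^ (2 * b + 11) with hR
  have hR' : (2 * ((Q : ℝ) + 3) * w (M + 1)) * (2 ^ 2 ^ I) ^ (2 * b + 8) ≤ R := by
    have hz : (2 : ℝ) ≤ 2 ^ 2 ^ I := by
      calc (2 : ℝ) = 2 ^ 1 := by norm_num
        _ ≤ 2 ^ 2 ^ I := pow_le_pow_right₀ (by norm_num) Nat.one_le_two_pow
    have hQz : (Q : ℝ) + 1 ≤ 2 ^ 2 ^ I := by exact_mod_cast hQ
    have h3 : 2 * ((Q : ℝ) + 3) ≤ (2 ^ 2 ^ I) ^ 3 := by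
      set z : ℝ := 2 ^ 2 ^ I
      have : z ^ 3 ≥ 4 * z := by nlinarith [mul_self_nonneg (z - 2), mul_self_nonneg z]
      linarith
    have hw1 := hw0 (M + 1) (by omega)
    rw [hR, show 2 * b + 11 = 3 + (2 * b + 8) by ring, pow_add _ 3 (2 * b + 8)]
    have := mul_le_mul_of_nonneg_right h3 (mul_nonneg hw1
      (by positivity : (0 : ℝ) ≤ (2 ^ 2 ^ I) ^ (2 * b + 8)))
    linarith
  have hR0 : 0 ≤ R := mul_nonneg (hw0 (M + 1) (by omega)) (by positivity)
  have hΔ0 := sieveErr_pos b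
  have key' : ∀ h, X - 3 * sieveErr b * X - R ≤ roughClassSum c (2 ^ 2 ^ I) h w M N ∧
      roughClassSum c (2 ^ 2 ^ I) h w M N ≤ X + 3 * sieveErr b * X + R := fun h => by
    have := abs_le.1 (key h)
    constructor <;> linarith [this.1, this.2]
  have hΔX : sieveErr b * X ≤ 1 / 6 * X := mul_le_mul_of_nonneg_right hΔ hX0
  have hG : (0 : ℝ) < Fintype.card G := by exact_mod_cast Fintype.card_pos
  have htot : X ≤ 2 * (roughSum (2 ^ 2 ^ I) w M N / Fintype.card G) + 2 * R := by
    have h1 : (Fintype.card G : ℝ) * (X / 2 - R) ≤ roughSum (2 ^ 2 ^ I) w M N := by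
      rw [← sum_roughClassSum c hQ, ← nsmul_eq_mul, ← Finset.card_univ, ← Finset.sum_const]
      apply Finset.sum_le_sum
      intro h _
      linarith [(key' h).1]
    have h2 : X / 2 - R ≤ roughSum (2 ^ 2 ^ I) w M N / Fintype.card G := by
      rw [le_div_iff₀ hG]; linarith
    linarith
  have h5 : sieveErr b * X ≤ sieveErr b *
      (2 * (roughSum (2 ^ 2 ^ I) w M N / Fintype.card G) + 2 * R) :=
    mul_le_mul_of_nonneg_left htot hΔ0.le
  have h6 : sieveErr b * R ≤ 1 / 6 * R := mul_le_mul_of_nonneg_right hΔ hR0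
  constructor
  · intro h
    linarith [(key' h).2]
  · intro h h'
    rw [abs_le]
    constructor <;> linarith [(key' h).1, (key' h').1, (key' h).2, (key' h').2]

end ClassSieve

theorem rpow_telescope {s : ℝ} (hs : 0 < s) {m : ℝ} (hm : 1 < m) :
    m ^ (-(1 + s)) ≤ (1 / s) * ((m - 1) ^ (-s) - m ^ (-s)) := by
  have hm0 : 0 < m := by linarith
  have hm1 : 0 < m - 1 := by linarith
  have h1 : (m - 1) ^ (-s) ≥ m ^ (-s) * (1 + s / m) := by
    have e : (m - 1) ^ (-s) = m ^ (-s) * ((m - 1) / m) ^ (-s) := by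
      rw [← Real.mul_rpow hm0.le (by positivity)]
      congr 1; field_simp
    rw [e]
    apply mul_le_mul_of_nonneg_left _ (by positivity)
    rw [Real.rpow_def_of_pos (by positivity)]
    have h2 : Real.log ((m - 1) / m) ≤ (m - 1) / m - 1 := Real.log_le_sub_one_of_pos (by positivity)
    have h3 : (m - 1) / m - 1 = -(1 / m) := by field_simp; ring
    have h4 := Real.add_one_le_exp (Real.log ((m - 1) / m) * -s)
    have h5 : s / m ≤ Real.log ((m - 1) / m) * -s := by
      rw [h3] at h2
      have := mul_le_mul_of_nonneg_right h2 hs.le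
      have e : s / m = 1 / m * s := by ring
      rw [e]; linarith
    linarith
  have h6 : m ^ (-(1 + s)) = m ^ (-s) / m := by
    rw [neg_add, add_comm, ← sub_eq_add_neg, Real.rpow_sub_one hm0.ne']
  have h7 : m ^ (-s) * (1 + s / m) = m ^ (-s) + s * (m ^ (-s) / m) := by ring
  rw [h7] at h1
  rw [h6, one_div, inv_mul_eq_div, le_div_iff₀ hs]
  linarith

theorem sum_rpow_le {s : ℝ} (hs : 0 < s) (N : ℕ) :
    ∑ m ∈ Finset.Ioc 0 N, (m : ℝ) ^ (-(1 + s)) ≤ 1 + 1 / s := by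
  have key : ∀ N : ℕ, ∑ m ∈ Finset.Ioc 0 (N + 1), (m : ℝ) ^ (-(1 + s)) ≤
      1 + 1 / s * (1 - ((N + 1 : ℕ) : ℝ) ^ (-s)) := by
    intro N
    induction N with
    | zero => simp
    | succ N ih =>
      rw [← Finset.insert_Ioc_right_eq_Ioc_add_one (by omega), Finset.sum_insert (by simp)]
      have h1 := rpow_telescope hs (m := ((N + 1 + 1 : ℕ) : ℝ)) (by push_cast; linarith [(Nat.cast_nonneg N : (0:ℝ) ≤ N)])
      have e : ((N + 1 + 1 : ℕ) : ℝ) - 1 = ((N + 1 : ℕ) : ℝ) := by push_cast; ring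
      rw [e] at h1
      linarith
  cases N with
  | zero => simp; positivity
  | succ N =>
    refine (key N).trans ?_
    have : 0 ≤ ((N + 1 : ℕ) : ℝ) ^ (-s) := by positivity
    have h2 : 0 < 1 / s := by positivity
    nlinarith

theorem roughSum_mono {z : ℕ} {w w' : ℕ → ℝ} {M N M' N' : ℕ} (hM : M' ≤ M) (hN : N ≤ N')
    (h : ∀ m, M < m → m ≤ N → w m ≤ w' m) (h0 : ∀ m, M' < m → m ≤ N' → 0 ≤ w' m) :
    roughSum z w M N ≤ roughSum z w' M' N' := by
  unfold roughSum
  calc _ ≤ ∑ m ∈ Finset.Ioc M N, (open Classical in if IsRough z m then w' m else 0) := by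
        apply Finset.sum_le_sum
        intro m hm
        have := Finset.mem_Ioc.1 hm
        split_ifs
        · exact h m this.1 this.2
        · exact le_rfl
    _ ≤ _ := by
        apply Finset.sum_le_sum_of_subset_of_nonneg (Finset.Ioc_subset_Ioc hM hN)
        intro m hm _
        have := Finset.mem_Ioc.1 hm
        split_ifs
        · exact h0 m this.1 this.2
        · exact le_rfl

theorem smooth_mul_rough_injective {z j k j' k' : ℕ} (hj : 0 < j) (hjz : j < z) (hj' : 0 < j')
    (hjz' : j' < z) (hk : IsRough z k) (hk' : IsRough z k') (h : j * k = j' * k') :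
    j = j' ∧ k = k' := by
  have cop : ∀ {j k : ℕ}, 0 < j → j < z → IsRough z k → j.Coprime k := by
    intro j k hj hjz hk
    exact (hk.coprime hjz hj).symm
  have h1 : j ∣ j' := (cop hj hjz hk').dvd_of_dvd_mul_right (h ▸ dvd_mul_right j k)
  have h2 : j' ∣ j := (cop hj' hjz' hk).dvd_of_dvd_mul_right (h ▸ dvd_mul_right j' k')
  have h3 := Nat.dvd_antisymm h1 h2
  subst h3
  exact ⟨rfl, Nat.eq_of_mul_eq_mul_left hj h⟩

theorem log_le_sum_inv (z : ℕ) : Real.log z ≤ ∑ m ∈ Finset.Ico 1 z, (1 / m : ℝ) := by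
  rcases Nat.eq_zero_or_pos z with rfl | hz
  · simp
  have := log_add_one_le_harmonic (z - 1)
  rw [harmonic_eq_sum_Icc] at this
  push_cast at this
  have e : ((z - 1 : ℕ) : ℝ) + 1 = z := by exact_mod_cast Nat.sub_add_cancel hz
  rw [e] at this
  refine this.trans (le_of_eq ?_)
  apply Finset.sum_congr
  · ext m; simp; omega
  · intro m _; rw [one_div]

theorem roughSum_rpow_le {z : ℕ} (hz : 2 ≤ z) {s : ℝ} (hs : 0 < s) (hs1 : s ≤ 1)
    (hsz : s * Real.log z ≤ 1) (M N : ℕ) :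
    roughSum z (fun k => (k : ℝ) ^ (-(1 + s))) M N ≤ 6 / (s * Real.log z) := by
  classical
  have hz' : (2 : ℝ) ≤ z := by exact_mod_cast hz
  have hlz : 0 < Real.log z := Real.log_pos (by linarith)
  refine (roughSum_mono (Nat.zero_le M) le_rfl (fun m _ _ => le_rfl)
    (fun m _ _ => by positivity)).trans ?_
  set K := (Finset.Ioc 0 N).filter (IsRough z) with hK
  have e1 : roughSum z (fun k => (k : ℝ) ^ (-(1 + s))) 0 N = ∑ k ∈ K, (k : ℝ) ^ (-(1 + s)) := by
    unfold roughSum; rw [hK, Finset.sum_filter]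
  rw [e1]
  have hH : Real.exp (-1) * Real.log z ≤ ∑ j ∈ Finset.Ico 1 z, (j : ℝ) ^ (-(1 + s)) := by
    refine (mul_le_mul_of_nonneg_left (log_le_sum_inv z) (Real.exp_pos _).le).trans ?_
    rw [Finset.mul_sum]
    apply Finset.sum_le_sum
    intro j hj
    have hj' := Finset.mem_Ico.1 hj
    have hj0 : (0 : ℝ) < j := by exact_mod_cast hj'.1
    have e : (j : ℝ) ^ (-(1 + s)) = (j : ℝ) ^ (-s) * (1 / j) := by
      rw [neg_add, add_comm, ← sub_eq_add_neg, Real.rpow_sub_one hj0.ne']; ring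
    rw [e]
    apply mul_le_mul_of_nonneg_right _ (by positivity)
    rw [Real.rpow_def_of_pos hj0]
    apply Real.exp_le_exp.2
    have : Real.log j ≤ Real.log z := Real.log_le_log hj0 (by exact_mod_cast hj'.2.le)
    nlinarith
  have hprod : (∑ j ∈ Finset.Ico 1 z, (j : ℝ) ^ (-(1 + s))) * ∑ k ∈ K, (k : ℝ) ^ (-(1 + s)) ≤
      1 + 1 / s := by
    rw [Finset.sum_mul_sum, ← Finset.sum_product']
    have hinj : Set.InjOn (fun p : ℕ × ℕ => p.1 * p.2) (Finset.Ico 1 z ×ˢ K : Finset (ℕ × ℕ)) := by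
      rintro ⟨j, k⟩ hp ⟨j', k'⟩ hp' h
      simp only [hK, Finset.coe_product, Set.mem_prod, Finset.mem_coe, Finset.mem_Ico,
        Finset.mem_filter] at hp hp'
      obtain ⟨h1, h2⟩ := smooth_mul_rough_injective hp.1.1 hp.1.2 hp'.1.1 hp'.1.2 hp.2.2 hp'.2.2 h
      rw [h1, h2]
    calc _ = ∑ p ∈ Finset.Ico 1 z ×ˢ K, ((p.1 * p.2 : ℕ) : ℝ) ^ (-(1 + s)) := by
          apply Finset.sum_congr rfl
          intro p _
          rw [Nat.cast_mul, Real.mul_rpow (by positivity) (by positivity)]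
      _ = ∑ m ∈ (Finset.Ico 1 z ×ˢ K).image (fun p : ℕ × ℕ => (p.1 * p.2 : ℕ)), (m : ℝ) ^ (-(1 + s)) :=
          (Finset.sum_image (f := fun m : ℕ => (m : ℝ) ^ (-(1 + s))) hinj).symm
      _ ≤ ∑ m ∈ Finset.Ioc 0 (z * N), (m : ℝ) ^ (-(1 + s)) := by
          apply Finset.sum_le_sum_of_subset_of_nonneg
          · intro m hm
            obtain ⟨⟨j, k⟩, hp, rfl⟩ := Finset.mem_image.1 hm
            simp only [hK, Finset.mem_product, Finset.mem_Ico, Finset.mem_filter,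
              Finset.mem_Ioc] at hp ⊢
            exact ⟨Nat.mul_pos hp.1.1 hp.2.1.1, Nat.mul_le_mul hp.1.2.le hp.2.1.2⟩
          · intros; positivity
      _ ≤ _ := sum_rpow_le hs _
  have hS0 : 0 ≤ ∑ k ∈ K, (k : ℝ) ^ (-(1 + s)) := Finset.sum_nonneg fun _ _ => by positivity
  have h2 : Real.exp (-1) * Real.log z * ∑ k ∈ K, (k : ℝ) ^ (-(1 + s)) ≤ 1 + 1 / s :=
    (mul_le_mul_of_nonneg_right hH hS0).trans hprod
  have he : (1 : ℝ) / 3 ≤ Real.exp (-1) := by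
    rw [Real.exp_neg, one_div]
    exact inv_anti₀ (Real.exp_pos 1) (by linarith [Real.exp_one_lt_d9])
  have h3 : 1 / 3 * Real.log z * ∑ k ∈ K, (k : ℝ) ^ (-(1 + s)) ≤ 1 + 1 / s := by
    refine le_trans ?_ h2
    gcongr
  have h4 : 1 + 1 / s ≤ 2 / s := by
    rw [le_div_iff₀ hs]; field_simp; linarith
  rw [le_div_iff₀ (by positivity)]
  have h5 := mul_le_mul_of_nonneg_right (h3.trans h4) hs.le
  rw [div_mul_cancel₀ _ hs.ne'] at h5
  linarith

theorem roughSum_log_sq_le {z : ℕ} (hz : 2 ≤ z) {s : ℝ} (hs : 0 < s) (hs1 : s ≤ 1)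
    (hsz : s * Real.log z ≤ 1) (M N : ℕ) :
    roughSum z (fun k => Real.log k ^ 2 * (k : ℝ) ^ (-(1 + s))) M N ≤
      192 / (s ^ 3 * Real.log z) := by
  have hz' : (2 : ℝ) ≤ z := by exact_mod_cast hz
  have hlz : 0 < Real.log z := Real.log_pos (by linarith)
  have h1 : roughSum z (fun k => Real.log k ^ 2 * (k : ℝ) ^ (-(1 + s))) M N ≤
      roughSum z (fun k => 16 / s ^ 2 * (k : ℝ) ^ (-(1 + s / 2))) M N := by
    apply roughSum_mono le_rfl le_rfl
    · intro m hm _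
      have hm0 : (1 : ℝ) ≤ m := by exact_mod_cast (by omega : 1 ≤ m)
      have hl0 : 0 ≤ Real.log m := Real.log_nonneg hm0
      have hl : Real.log m ≤ (m : ℝ) ^ (s / 4) / (s / 4) :=
        Real.log_le_rpow_div (by linarith) (by positivity)
      have hl2 : Real.log m ^ 2 ≤ 16 / s ^ 2 * (m : ℝ) ^ (s / 2) := by
        calc Real.log m ^ 2 ≤ ((m : ℝ) ^ (s / 4) / (s / 4)) ^ 2 := by gcongr
          _ = 16 / s ^ 2 * ((m : ℝ) ^ (s / 4)) ^ 2 := by ring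
          _ = _ := by
            have e : ((m : ℝ) ^ (s / 4)) ^ 2 = (m : ℝ) ^ (s / 2) := by
              rw [← Real.rpow_mul_natCast (by positivity)]
              congr 1; push_cast; ring
            rw [e]
      calc _ ≤ 16 / s ^ 2 * (m : ℝ) ^ (s / 2) * (m : ℝ) ^ (-(1 + s)) := by gcongr
        _ = _ := by
          rw [mul_assoc, ← Real.rpow_add (by linarith)]; ring_nf
    · intros; positivity
  refine h1.trans ?_
  have h2 : roughSum z (fun k => 16 / s ^ 2 * (k : ℝ) ^ (-(1 + s / 2))) M N =
      16 / s ^ 2 * roughSum z (fun k => (k : ℝ) ^ (-(1 + s / 2))) M N := by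
    unfold roughSum; rw [Finset.mul_sum]
    apply Finset.sum_congr rfl; intros; split_ifs <;> simp
  rw [h2]
  have h3 := roughSum_rpow_le hz (s := s / 2) (by positivity) (by linarith) (by nlinarith) M N
  calc _ ≤ 16 / s ^ 2 * (6 / (s / 2 * Real.log z)) := by gcongr
    _ = _ := by field_simp; norm_num

theorem roughSum_inv_le {z : ℕ} (hz : 3 ≤ z) {k : ℕ} (hk : 1 ≤ k) (M : ℕ) :
    roughSum z (fun m => 1 / (m : ℝ)) M (z ^ k) ≤ 18 * k := by
  have hz' : (3 : ℝ) ≤ z := by exact_mod_cast hz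
  have hlz : 1 < Real.log z := by
    rw [Real.lt_log_iff_exp_lt (by linarith)]
    linarith [Real.exp_one_lt_d9]
  have hk' : (1 : ℝ) ≤ k := by exact_mod_cast hk
  set s : ℝ := 1 / (k * Real.log z) with hs
  have hs0 : 0 < s := by positivity
  have hs1 : s ≤ 1 := by rw [hs, div_le_one (by positivity)]; nlinarith
  have hsz : s * Real.log z ≤ 1 := by
    rw [hs]; field_simp; exact hk'
  have h1 : roughSum z (fun m => 1 / (m : ℝ)) M (z ^ k) ≤
      roughSum z (fun m => 3 * (m : ℝ) ^ (-(1 + s))) M (z ^ k) := by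
    apply roughSum_mono le_rfl le_rfl
    · intro m hm hm2
      have hm0 : (1 : ℝ) ≤ m := by exact_mod_cast (by omega : 1 ≤ m)
      have e : (m : ℝ) ^ (-(1 + s)) = (m : ℝ) ^ (-s) * (1 / m) := by
        rw [neg_add, add_comm, ← sub_eq_add_neg, Real.rpow_sub_one (by linarith)]; ring
      rw [e, ← mul_assoc]
      have h3 : 1 ≤ 3 * (m : ℝ) ^ (-s) := by
        rw [Real.rpow_def_of_pos (by linarith)]
        have h4 : Real.log m ≤ k * Real.log z := by
          rw [← Real.log_pow]
          exact Real.log_le_log (by linarith) (by exact_mod_cast hm2)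
        have h5 : -1 ≤ Real.log m * -s := by
          rw [mul_neg, neg_le_neg_iff, hs, mul_one_div, div_le_one (by positivity)]
          exact h4
        have h6 := Real.exp_le_exp.2 h5
        have he : (1 : ℝ) / 3 ≤ Real.exp (-1) := by
          rw [Real.exp_neg, one_div]
          exact inv_anti₀ (Real.exp_pos 1) (by linarith [Real.exp_one_lt_d9])
        linarith
      have : (0 : ℝ) ≤ 1 / m := by positivity
      nlinarith
    · intros; positivity
  have h2 : roughSum z (fun m => 3 * (m : ℝ) ^ (-(1 + s))) M (z ^ k) =
      3 * roughSum z (fun m => (m : ℝ) ^ (-(1 + s))) M (z ^ k) := by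
    unfold roughSum; rw [Finset.mul_sum]
    apply Finset.sum_congr rfl; intros; split_ifs <;> simp
  rw [h2] at h1
  have h3 := roughSum_rpow_le (by omega : 2 ≤ z) hs0 hs1 hsz M (z ^ k)
  have h4 : 6 / (s * Real.log z) = 6 * k := by rw [hs]; field_simp
  rw [h4] at h3
  linarith

open ArithmeticFunction in
/-- Selberg's function `Λ log + Λ * Λ`. -/
noncomputable def selbergLambda (m : ℕ) : ℝ :=
  vonMangoldt m * Real.log m + ∑ p ∈ m.divisorsAntidiagonal, vonMangoldt p.1 * vonMangoldt p.2

open ArithmeticFunction in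
theorem pmul_log_mul (f g : ArithmeticFunction ℝ) :
    pmul ArithmeticFunction.log (f * g) = pmul ArithmeticFunction.log f * g + f * pmul ArithmeticFunction.log g := by
  ext m
  simp only [pmul_apply, mul_apply, ArithmeticFunction.add_apply, log_apply]
  rw [Finset.mul_sum, ← Finset.sum_add_distrib]
  apply Finset.sum_congr rfl
  intro p hp
  obtain ⟨rfl, h0⟩ := Nat.mem_divisorsAntidiagonal.1 hp
  have h1 : (p.1 : ℝ) ≠ 0 := by exact_mod_cast left_ne_zero_of_mul h0
  have h2 : (p.2 : ℝ) ≠ 0 := by exact_mod_cast right_ne_zero_of_mul h0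
  push_cast
  rw [Real.log_mul h1 h2]; ring

open ArithmeticFunction in
theorem selbergLambda_eq (m : ℕ) : selbergLambda m =
    ∑ p ∈ m.divisorsAntidiagonal, (moebius p.1 : ℝ) * Real.log p.2 ^ 2 := by
  have h1 : pmul ArithmeticFunction.log ArithmeticFunction.log =
      (pmul ArithmeticFunction.log vonMangoldt + vonMangoldt * vonMangoldt) *
        (zeta : ArithmeticFunction ℝ) := by
    have e : pmul ArithmeticFunction.log ArithmeticFunction.log =
        pmul ArithmeticFunction.log (vonMangoldt * (zeta : ArithmeticFunction ℝ)) := by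
      rw [vonMangoldt_mul_zeta]
    have e2 : pmul ArithmeticFunction.log (zeta : ArithmeticFunction ℝ) =
        ArithmeticFunction.log := by
      ext n; by_cases h : n = 0 <;> simp [h]
    rw [e, pmul_log_mul, e2, add_mul, mul_assoc, vonMangoldt_mul_zeta]
  have h2 : (moebius : ArithmeticFunction ℝ) *
      pmul ArithmeticFunction.log ArithmeticFunction.log =
      pmul ArithmeticFunction.log vonMangoldt + vonMangoldt * vonMangoldt := by
    rw [h1, mul_comm, mul_assoc, coe_zeta_mul_coe_moebius, mul_one]
  have h3 := congrArg (fun f => f m) h2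
  simp only [mul_apply, ArithmeticFunction.add_apply, pmul_apply, log_apply] at h3
  unfold selbergLambda
  rw [mul_comm (vonMangoldt m), ← h3]
  apply Finset.sum_congr rfl
  intro p _
  simp [sq]

theorem log_sq_mul_rpow_antitone {s : ℝ} (hs : 0 < s) {m n : ℕ} (hm : 8 ≤ m) (hmn : m ≤ n) :
    Real.log n ^ 2 * (n : ℝ) ^ (-(1 + s)) ≤ Real.log m ^ 2 * (m : ℝ) ^ (-(1 + s)) := by
  have hm' : (8 : ℝ) ≤ m := by exact_mod_cast hm
  have hmn' : (m : ℝ) ≤ n := by exact_mod_cast hmn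
  have key := Real.log_div_self_rpow_antitoneOn (a := 1 / 2) (by norm_num)
  have he : Real.exp (1 / 2)⁻¹ ≤ 8 := by
    have : Real.exp (1 / 2)⁻¹ = Real.exp 1 * Real.exp 1 := by rw [← Real.exp_add]; norm_num
    rw [this]
    nlinarith [Real.exp_one_lt_d9, Real.exp_pos 1]
  have h1 : Real.log n / (n : ℝ) ^ (1 / 2 : ℝ) ≤ Real.log m / (m : ℝ) ^ (1 / 2 : ℝ) :=
    key (Set.mem_Ici.2 (he.trans hm')) (Set.mem_Ici.2 (he.trans (hm'.trans hmn'))) hmn'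
  have e : ∀ x : ℝ, 8 ≤ x → Real.log x ^ 2 * x ^ (-(1 + s)) =
      (Real.log x / x ^ (1 / 2 : ℝ)) ^ 2 * x ^ (-s) := by
    intro x hx
    have hx0 : 0 < x := by linarith
    rw [div_pow, ← Real.rpow_mul_natCast hx0.le, neg_add, Real.rpow_add hx0, Real.rpow_neg hx0.le 1]
    norm_num
    field_simp
  rw [e n (by linarith), e m hm']
  have h0 : 0 ≤ Real.log n / (n : ℝ) ^ (1 / 2 : ℝ) :=
    div_nonneg (Real.log_natCast_nonneg n) (by positivity)
  apply mul_le_mul (by gcongr) _ (by positivity) (by positivity)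
  exact Real.rpow_le_rpow_of_nonpos (by linarith) hmn' (by linarith)

section Selberg
variable {Q : ℕ} [NeZero Q] {G : Type*} [CommGroup G] (c : (ZMod Q)ˣ →* G)

open Classical in
/-- The class of an integer coprime to `Q`, and `1` otherwise. -/
noncomputable def classOf (m : ℕ) : G :=
  if h : m.Coprime Q then c (ZMod.unitOfCoprime m h) else 1

theorem inClass_classOf {m : ℕ} (h : m.Coprime Q) : InClass c (classOf c m) m := by
  unfold classOf
  rw [dif_pos h]
  exact ⟨_, ZMod.coe_unitOfCoprime m h, rfl⟩

/-- Class sums of Selberg's function over rough integers. -/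
noncomputable def selbergSum (z : ℕ) (h : G) (s : ℝ) (Y N : ℕ) : ℝ :=
  roughClassSum c z h (fun m => selbergLambda m * (m : ℝ) ^ (-(1 + s))) Y N

theorem IsRough.mul_iff {z d k : ℕ} : IsRough z (d * k) ↔ IsRough z d ∧ IsRough z k := by
  constructor
  · intro h
    exact ⟨fun l hl hlz hd => h l hl hlz (hd.mul_right k), fun l hl hlz hd => h l hl hlz (hd.mul_left d)⟩
  · rintro ⟨h1, h2⟩ l hl hlz hd
    rcases (hl.dvd_mul).1 hd with h | h
    · exact h1 l hl hlz h
    · exact h2 l hl hlz h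

open Classical in
/-- Rewriting a rough class sum of a Dirichlet convolution. -/
theorem roughClassSum_convolution {z : ℕ} (hQ : Q < z) (h : G) (u v : ℕ → ℝ) (Y N : ℕ) :
    roughClassSum c z h (fun m => ∑ p ∈ m.divisorsAntidiagonal, u p.1 * v p.2) Y N =
      ∑ d ∈ Finset.Ioc 0 N, if IsRough z d then
        u d * roughClassSum c z ((classOf c d)⁻¹ * h) v (Y / d) (N / d) else 0 := by
  have e1 : roughClassSum c z h (fun m => ∑ p ∈ m.divisorsAntidiagonal, u p.1 * v p.2) Y N =
      ∑ x ∈ (Finset.Ioc Y N).sigma (fun m => m.divisorsAntidiagonal),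
        if IsRough z x.1 ∧ InClass c h x.1 then u x.2.1 * v x.2.2 else 0 := by
    unfold roughClassSum
    rw [Finset.sum_sigma]
    apply Finset.sum_congr rfl
    intro m _
    split_ifs with h1
    · exact Finset.sum_congr rfl fun p _ => rfl
    · simp
  have e2 : (∑ d ∈ Finset.Ioc 0 N, if IsRough z d then
        u d * roughClassSum c z ((classOf c d)⁻¹ * h) v (Y / d) (N / d) else 0) =
      ∑ x ∈ (Finset.Ioc 0 N).sigma (fun d => Finset.Ioc (Y / d) (N / d)),
        if IsRough z (x.1 * x.2) ∧ InClass c h (x.1 * x.2) then u x.1 * v x.2 else 0 := by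
    rw [Finset.sum_sigma]
    apply Finset.sum_congr rfl
    intro d _
    split_ifs with h1
    · unfold roughClassSum
      rw [Finset.mul_sum]
      apply Finset.sum_congr rfl
      intro k _
      have h2 := InClass.mul_iff (h := h) (k := k)
        (inClass_classOf c (h1.coprime hQ (NeZero.pos Q)))
      simp only [IsRough.mul_iff, h1, true_and, h2]
      split_ifs <;> simp
    · symm
      apply Finset.sum_eq_zero
      intro k _
      rw [if_neg]
      rintro ⟨h2, _⟩
      exact h1 (IsRough.mul_iff.1 h2).1
  rw [e1, e2]
  refine Finset.sum_bij' (fun x _ => ⟨x.2.1, x.2.2⟩) (fun x _ => ⟨x.1 * x.2, (x.1, x.2)⟩)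
    ?_ ?_ ?_ ?_ ?_
  · rintro ⟨m, d, k⟩ hx
    simp only [Finset.mem_sigma, Finset.mem_Ioc, Nat.mem_divisorsAntidiagonal] at hx ⊢
    obtain ⟨⟨h1, h2⟩, rfl, h3⟩ := hx
    have hd : 0 < d := Nat.pos_of_ne_zero (left_ne_zero_of_mul h3)
    have hk : 0 < k := Nat.pos_of_ne_zero (right_ne_zero_of_mul h3)
    refine ⟨⟨hd, (Nat.le_mul_of_pos_right d hk).trans h2⟩, ?_, ?_⟩
    · rw [Nat.div_lt_iff_lt_mul hd]; linarith
    · rw [Nat.le_div_iff_mul_le hd]; linarith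
  · rintro ⟨d, k⟩ hx
    simp only [Finset.mem_sigma, Finset.mem_Ioc, Nat.mem_divisorsAntidiagonal] at hx ⊢
    obtain ⟨⟨hd, _⟩, h1, h2⟩ := hx
    have h3 : Y < d * k := by rw [Nat.div_lt_iff_lt_mul hd] at h1; linarith
    refine ⟨⟨h3, ?_⟩, trivial, by omega⟩
    rw [Nat.le_div_iff_mul_le hd] at h2; linarith
  · rintro ⟨m, d, k⟩ hx
    simp only [Finset.mem_sigma, Finset.mem_Ioc, Nat.mem_divisorsAntidiagonal] at hx
    obtain ⟨_, rfl, _⟩ := hx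
    rfl
  · rintro ⟨d, k⟩ _
    rfl
  · rintro ⟨m, d, k⟩ hx
    simp only [Finset.mem_sigma, Finset.mem_Ioc, Nat.mem_divisorsAntidiagonal] at hx
    obtain ⟨_, rfl, _⟩ := hx
    rfl

end Selberg

section SelbergCompare
variable {Q : ℕ} [NeZero Q] {G : Type*} [CommGroup G] (c : (ZMod Q)ˣ →* G)

theorem roughClassSum_split (z : ℕ) (h : G) (w : ℕ → ℝ) (M a b : ℕ) :
    roughClassSum c z h w a b = roughClassSum c z h w (max M a) b +
      roughClassSum c z h (fun k => if k ≤ M then w k else 0) a b := by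
  classical
  unfold roughClassSum
  have e : Finset.Ioc (max M a) b = (Finset.Ioc a b).filter (M < ·) := by
    ext k; simp only [Finset.mem_Ioc, Finset.mem_filter, max_lt_iff]; tauto
  rw [e, Finset.sum_filter, ← Finset.sum_add_distrib]
  apply Finset.sum_congr rfl
  intro k _
  by_cases hk : k ≤ M
  · simp [hk]
  · simp [hk, not_le.1 hk]

theorem roughClassSum_nonneg (z : ℕ) (h : G) {w : ℕ → ℝ} (hw : ∀ k, 0 ≤ w k) (a b : ℕ) :
    0 ≤ roughClassSum c z h w a b := by
  unfold roughClassSum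
  apply Finset.sum_nonneg
  intro k _
  split_ifs
  exacts [hw k, le_rfl]

theorem roughClassSum_convolution_comm {z : ℕ} (hQ : Q < z) (h : G) (u v : ℕ → ℝ) (Y N : ℕ) :
    open Classical in (∑ d ∈ Finset.Ioc 0 N, if IsRough z d then
        u d * roughClassSum c z ((classOf c d)⁻¹ * h) v (Y / d) (N / d) else 0) =
      ∑ d ∈ Finset.Ioc 0 N, if IsRough z d then
        v d * roughClassSum c z ((classOf c d)⁻¹ * h) u (Y / d) (N / d) else 0 := by
  rw [← roughClassSum_convolution c hQ, ← roughClassSum_convolution c hQ]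
  congr 1
  ext m
  conv_lhs => rw [← Nat.map_swap_divisorsAntidiagonal, Finset.sum_map]
  exact Finset.sum_congr rfl fun p _ => mul_comm _ _

open ArithmeticFunction in
theorem selbergSum_eq {z : ℕ} (hQ : Q < z) (h : G) (s : ℝ) (Y N : ℕ) :
    open Classical in selbergSum c z h s Y N = ∑ d ∈ Finset.Ioc 0 N, if IsRough z d then
      ((moebius d : ℝ) * (d : ℝ) ^ (-(1 + s))) * roughClassSum c z ((classOf c d)⁻¹ * h)
        (fun k => Real.log k ^ 2 * (k : ℝ) ^ (-(1 + s))) (Y / d) (N / d) else 0 := by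
  rw [← roughClassSum_convolution c hQ h
    (fun d => (moebius d : ℝ) * (d : ℝ) ^ (-(1 + s)))
    (fun k => Real.log k ^ 2 * (k : ℝ) ^ (-(1 + s)))]
  unfold selbergSum
  congr 1
  ext m
  rw [selbergLambda_eq, Finset.sum_mul]
  apply Finset.sum_congr rfl
  intro p hp
  obtain ⟨rfl, h0⟩ := Nat.mem_divisorsAntidiagonal.1 hp
  push_cast
  rw [Real.mul_rpow (by positivity) (by positivity)]
  ring

variable [Fintype G]

theorem selbergSum_compare (hc : Function.Surjective c) {I b : ℕ} (hI : 1 ≤ I) (hb : Even b)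
    (hΔ : sieveErr b ≤ 1 / 6) (hQ : Q < 2 ^ 2 ^ I) {κ : ℝ} (hκ : 1 ≤ κ) {s : ℝ}
    (hs : s = 1 / (κ * Real.log (2 ^ 2 ^ I : ℕ))) (N : ℕ) (h h' : G) :
    |selbergSum c (2 ^ 2 ^ I) h s ((2 ^ 2 ^ I) ^ (2 * (2 * b + 14))) N -
      selbergSum c (2 ^ 2 ^ I) h' s ((2 ^ 2 ^ I) ^ (2 * (2 * b + 14))) N| ≤
      1 / (s ^ 2 * Fintype.card G) *
        (13824 * sieveErr b * κ ^ 2 + 824 * (2 * b + 14 : ℕ) ^ 3 / κ) := by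
  classical
  have hz4 : 4 ≤ 2 ^ 2 ^ I := by
    calc 4 = 2 ^ 2 ^ 1 := by norm_num
      _ ≤ 2 ^ 2 ^ I := Nat.pow_le_pow_right (by norm_num) (Nat.pow_le_pow_right (by norm_num) hI)
  have hcard := card_group_le (c := c) hc
  have hcmp := fun (w : ℕ → ℝ) (M : ℕ) (hw : ∀ m > M, w (m + 1) ≤ w m) (hw0 : ∀ m > M, 0 ≤ w m)
    (N : ℕ) => roughClassSum_compare c hc hb hΔ hQ hw hw0 N
  have hgpos : (0 : ℝ) < Fintype.card G := by exact_mod_cast Fintype.card_pos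
  have hQ' := hQ
  rw [show ((2 : ℝ) ^ 2 ^ I) = ((2 ^ 2 ^ I : ℕ) : ℝ) by push_cast; rfl] at hcmp
  generalize hz : 2 ^ 2 ^ I = z at *
  set m0 := 2 * b + 14 with hm0
  set lz := Real.log z with hlz
  set g : ℝ := (Fintype.card G : ℝ) with hg
  have hz4' : (4 : ℝ) ≤ z := by exact_mod_cast hz4
  have hz0 : (0 : ℝ) < z := by linarith
  have hlz1 : 1 ≤ lz := by
    rw [hlz, Real.le_log_iff_exp_le hz0]
    linarith [Real.exp_one_lt_d9]
  have hlzz : lz ≤ z := (Real.log_le_sub_one_of_pos hz0).trans (by linarith)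
  have hgz : g ≤ z := by
    have : Fintype.card G ≤ z := by omega
    rw [hg]; exact_mod_cast this
  have hs0 : 0 < s := by rw [hs]; positivity
  have hslz : s * lz = 1 / κ := by rw [hs]; field_simp
  have hκs : κ * s * lz = 1 := by rw [mul_assoc, hslz]; field_simp
  have hslz1 : s * lz ≤ 1 := by rw [hslz, div_le_one (by linarith)]; exact hκ
  have hs1 : s ≤ 1 := by nlinarith
  have hΔ0 := sieveErr_pos b
  set w0 : ℕ → ℝ := fun k => (k : ℝ) ^ (-(1 + s)) with hw0
  set w2 : ℕ → ℝ := fun k => Real.log k ^ 2 * (k : ℝ) ^ (-(1 + s)) with hw2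
  have hw0n : ∀ k, 0 ≤ w0 k := fun k => by positivity
  have hw2n : ∀ k, 0 ≤ w2 k := fun k => by positivity
  have hinv : ∀ k : ℕ, 1 ≤ k → w0 k ≤ 1 / k := by
    intro k hk
    have hk' : (1 : ℝ) ≤ k := by exact_mod_cast hk
    rw [hw0, one_div, ← Real.rpow_neg_one]
    exact Real.rpow_le_rpow_of_exponent_le hk' (by linarith)
  set M := z ^ m0 with hM
  have hM8 : 8 ≤ M := by
    calc 8 ≤ 4 ^ 2 := by norm_num
      _ ≤ z ^ 2 := Nat.pow_le_pow_left hz4 2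
      _ ≤ z ^ m0 := Nat.pow_le_pow_right (by omega) (by omega)
  have hMR : (M : ℝ) = (z : ℝ) ^ (2 * b + 11) * z ^ 3 := by
    rw [hM, hm0, ← pow_add]; push_cast; rfl
  have hlogM : Real.log M = m0 * lz := by rw [hM]; push_cast; rw [Real.log_pow]
  have hzM : (1 : ℝ) / M * z ^ (2 * b + 11) = 1 / z ^ 3 := by rw [hMR]; field_simp
  have hz3 : lz ^ 2 * (1 / (z : ℝ) ^ 3) ≤ 1 / g := by
    rw [mul_one_div, div_le_div_iff₀ (by positivity) hgpos, one_mul]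
    have : lz ^ 2 ≤ (z : ℝ) ^ 2 := by gcongr
    calc lz ^ 2 * g ≤ (z : ℝ) ^ 2 * z := by gcongr
      _ = (z : ℝ) ^ 3 := by ring
  have hz3' : (1 / (z : ℝ) ^ 3) ≤ 1 / g := by
    refine le_trans ?_ hz3
    exact le_mul_of_one_le_left (by positivity) (one_le_pow₀ hlz1)
  have hsum0 : ∀ a N, roughSum z w0 a N ≤ 6 * κ := by
    intro a N
    refine (roughSum_rpow_le (by omega) hs0 hs1 hslz1 a N).trans (le_of_eq ?_)
    rw [← hlz, hslz]; field_simp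
  -- large `k`
  have hA : ∀ a N h h', |roughClassSum c z h w2 (max M a) N - roughClassSum c z h' w2 (max M a) N| ≤
      (2304 * sieveErr b / (s ^ 3 * lz) + 4 * m0 ^ 2) / g := by
    intro a N h h'
    have h1 := (hcmp w2 (max M a)
      (fun m hm => log_sq_mul_rpow_antitone hs0
        (hM8.trans ((le_max_left _ _).trans hm.le)) (Nat.le_succ m))
      (fun m _ => hw2n m) N).2 h h'
    refine h1.trans ?_
    have h2 := roughSum_log_sq_le (z := z) (by omega) hs0 hs1 hslz1 (max M a) N
    have h3 : w2 (max M a + 1) ≤ (m0 * lz) ^ 2 * (1 / M) := by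
      rw [← hlogM]
      refine (log_sq_mul_rpow_antitone hs0 hM8 ((le_max_left M a).trans (Nat.le_succ _))).trans ?_
      exact mul_le_mul_of_nonneg_left (hinv M (by omega)) (by positivity)
    calc 12 * sieveErr b * (roughSum z w2 (max M a) N / g) +
          4 * (w2 (max M a + 1) * z ^ (2 * b + 11))
        ≤ 12 * sieveErr b * (192 / (s ^ 3 * lz) / g) +
          4 * ((m0 * lz) ^ 2 * (1 / M) * z ^ (2 * b + 11)) := by gcongr
      _ = 2304 * sieveErr b / (s ^ 3 * lz) / g +
          4 * m0 ^ 2 * (lz ^ 2 * (1 / M * z ^ (2 * b + 11))) := by ring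
      _ ≤ 2304 * sieveErr b / (s ^ 3 * lz) / g + 4 * m0 ^ 2 * (1 / g) := by
          rw [hzM]; gcongr
      _ = _ := by ring
  -- small `k`
  have hB : ∀ h, ∑ d ∈ Finset.Ioc 0 N, (if IsRough z d then
        w0 d * roughClassSum c z ((classOf c d)⁻¹ * h) (fun k => if k ≤ M then w2 k else 0)
          (z ^ (2 * m0) / d) (N / d) else 0) ≤ 396 * m0 ^ 3 * lz ^ 2 * κ / g := by
    intro h
    rw [roughClassSum_convolution_comm c hQ]
    have h1 : ∀ k ∈ Finset.Ioc 0 N, (if IsRough z k then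
        (if k ≤ M then w2 k else 0) * roughClassSum c z ((classOf c k)⁻¹ * h) w0
          (z ^ (2 * m0) / k) (N / k) else 0) ≤ (if k ≤ M then
          (if IsRough z k then (m0 * lz) ^ 2 * (1 / k) * (22 * κ / g) else 0) else 0) := by
      intro k hk
      rw [Finset.mem_Ioc] at hk
      by_cases hkr : IsRough z k
      swap
      · simp [hkr]
      by_cases hkM : k ≤ M
      swap
      · simp [hkM]
      simp only [hkr, hkM, if_true]
      have hMk : M ≤ z ^ (2 * m0) / k := by
        rw [Nat.le_div_iff_mul_le hk.1]
        calc M * k ≤ M * M := Nat.mul_le_mul_left _ hkM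
          _ = z ^ (2 * m0) := by rw [hM]; ring
      have h2 := (hcmp w0 (z ^ (2 * m0) / k) (fun m hm => by
          apply Real.rpow_le_rpow_of_nonpos (by exact_mod_cast (by omega : 0 < m))
            (by push_cast; linarith) (by linarith)) (fun m _ => hw0n m) (N / k)).1
          ((classOf c k)⁻¹ * h)
      have h3 : w0 (z ^ (2 * m0) / k + 1) ≤ 1 / M := by
        refine (hinv _ (by omega)).trans ?_
        apply one_div_le_one_div_of_le (by exact_mod_cast (by omega : 0 < M))
        exact_mod_cast hMk.trans (Nat.le_succ _)
      have h4 : roughClassSum c z ((classOf c k)⁻¹ * h) w0 (z ^ (2 * m0) / k) (N / k) ≤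
          22 * κ / g := by
        refine h2.trans ?_
        calc 3 * (roughSum z w0 (z ^ (2 * m0) / k) (N / k) / g) +
              4 * (w0 (z ^ (2 * m0) / k + 1) * z ^ (2 * b + 11))
            ≤ 3 * (6 * κ / g) + 4 * (1 / M * z ^ (2 * b + 11)) := by
              gcongr; exact hsum0 _ _
          _ ≤ 3 * (6 * κ / g) + 4 * (κ / g) := by
              rw [hzM]
              have : 1 / g ≤ κ / g := by gcongr
              exact add_le_add le_rfl (mul_le_mul_of_nonneg_left (hz3'.trans this) (by norm_num))
          _ = 22 * κ / g := by ring
      have h5 : w2 k ≤ (m0 * lz) ^ 2 * (1 / k) := by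
        rw [← hlogM]
        have : Real.log k ≤ Real.log M :=
          Real.log_le_log (by exact_mod_cast hk.1) (by exact_mod_cast hkM)
        have h0 := Real.log_natCast_nonneg k
        exact mul_le_mul (by gcongr) (hinv k hk.1) (hw0n k) (by positivity)
      exact mul_le_mul h5 h4 (roughClassSum_nonneg c z _ hw0n _ _) (by positivity)
    refine (Finset.sum_le_sum h1).trans ?_
    have h6 := roughSum_inv_le (z := z) (by omega) (k := m0) (by omega) 0
    have h7 : ∑ k ∈ Finset.Ioc 0 N, (if k ≤ M then
          (if IsRough z k then (m0 * lz) ^ 2 * (1 / (k : ℝ)) * (22 * κ / g) else 0) else 0) ≤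
          (m0 * lz) ^ 2 * (22 * κ / g) * roughSum z (fun m => 1 / (m : ℝ)) 0 M := by
      unfold roughSum
      rw [← Finset.sum_filter, Finset.mul_sum]
      have : ∀ k ∈ Finset.Ioc 0 M, (m0 * lz) ^ 2 * (22 * κ / g) *
          (if IsRough z k then 1 / (k : ℝ) else 0) =
          if IsRough z k then (m0 * lz) ^ 2 * (1 / (k : ℝ)) * (22 * κ / g) else 0 := by
        intro k _; split_ifs <;> ring
      rw [Finset.sum_congr rfl this]
      apply Finset.sum_le_sum_of_subset_of_nonneg
      · intro k hk
        simp only [Finset.mem_filter, Finset.mem_Ioc] at hk ⊢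
        exact ⟨hk.1.1, hk.2⟩
      · intro k _ _
        split_ifs <;> positivity
    refine h7.trans ?_
    calc (m0 * lz) ^ 2 * (22 * κ / g) * roughSum z (fun m => 1 / (m : ℝ)) 0 M
        ≤ (m0 * lz) ^ 2 * (22 * κ / g) * (18 * m0) := by gcongr
      _ = _ := by ring
  have hdiff : |selbergSum c z h s (z ^ (2 * m0)) N - selbergSum c z h' s (z ^ (2 * m0)) N| ≤
      ∑ d ∈ Finset.Ioc 0 N, (if IsRough z d then
        w0 d * ((2304 * sieveErr b / (s ^ 3 * lz) + 4 * m0 ^ 2) / g) else 0) +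
      ∑ d ∈ Finset.Ioc 0 N, (if IsRough z d then
        w0 d * roughClassSum c z ((classOf c d)⁻¹ * h) (fun k => if k ≤ M then w2 k else 0)
          (z ^ (2 * m0) / d) (N / d) else 0) +
      ∑ d ∈ Finset.Ioc 0 N, (if IsRough z d then
        w0 d * roughClassSum c z ((classOf c d)⁻¹ * h') (fun k => if k ≤ M then w2 k else 0)
          (z ^ (2 * m0) / d) (N / d) else 0) := by
    rw [selbergSum_eq c hQ, selbergSum_eq c hQ, ← Finset.sum_sub_distrib,
      ← Finset.sum_add_distrib, ← Finset.sum_add_distrib]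
    refine (Finset.abs_sum_le_sum_abs _ _).trans (Finset.sum_le_sum fun d _ => ?_)
    split_ifs with hd
    swap
    · simp
    rw [← mul_sub, abs_mul, ← mul_add, ← mul_add]
    have hmu : |(ArithmeticFunction.moebius d : ℝ) * (d : ℝ) ^ (-(1 + s))| ≤ w0 d := by
      rw [abs_mul, abs_of_nonneg (hw0n d)]
      apply mul_le_of_le_one_left (hw0n d)
      exact_mod_cast ArithmeticFunction.abs_moebius_le_one
    refine mul_le_mul hmu ?_ (abs_nonneg _) (hw0n d)
    rw [roughClassSum_split c z ((classOf c d)⁻¹ * h) _ M,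
      roughClassSum_split c z ((classOf c d)⁻¹ * h') _ M]
    have h1 := hA (z ^ (2 * m0) / d) (N / d) ((classOf c d)⁻¹ * h) ((classOf c d)⁻¹ * h')
    have hn : ∀ k, 0 ≤ (if k ≤ M then w2 k else 0) := by
      intro k; split_ifs; exacts [hw2n k, le_rfl]
    have h2 := roughClassSum_nonneg c z ((classOf c d)⁻¹ * h) hn (z ^ (2 * m0) / d) (N / d)
    have h3 := roughClassSum_nonneg c z ((classOf c d)⁻¹ * h') hn (z ^ (2 * m0) / d) (N / d)
    rw [abs_le] at h1 ⊢
    constructor <;> linarith [h1.1, h1.2]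
  have hfirst : ∑ d ∈ Finset.Ioc 0 N, (if IsRough z d then
        w0 d * ((2304 * sieveErr b / (s ^ 3 * lz) + 4 * m0 ^ 2) / g) else 0) ≤
      6 * κ * ((2304 * sieveErr b / (s ^ 3 * lz) + 4 * m0 ^ 2) / g) := by
    refine le_trans (le_of_eq ?_) (mul_le_mul_of_nonneg_right (hsum0 0 N) (by positivity))
    unfold roughSum
    rw [Finset.sum_mul]
    apply Finset.sum_congr rfl
    intro d _
    split_ifs <;> ring
  refine hdiff.trans ((add_le_add (add_le_add hfirst (hB h)) (hB h')).trans ?_)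
  have hlz0 : lz ≠ 0 := by positivity
  have hκ0 : κ ≠ 0 := by positivity
  have e1 : 1 / (s ^ 2 * g) * (13824 * sieveErr b * κ ^ 2 + 824 * (m0 : ℝ) ^ 3 / κ) =
      (13824 * sieveErr b * κ ^ 4 * lz ^ 2 + 824 * m0 ^ 3 * κ * lz ^ 2) / g := by
    rw [hs]; field_simp
  have e2 : 2304 * sieveErr b / (s ^ 3 * lz) = 2304 * sieveErr b * κ ^ 3 * lz ^ 2 := by
    rw [hs]; field_simp
  rw [e1, e2]
  rw [show 6 * κ * ((2304 * sieveErr b * κ ^ 3 * lz ^ 2 + 4 * (m0 : ℝ) ^ 2) / g) +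
    396 * (m0 : ℝ) ^ 3 * lz ^ 2 * κ / g + 396 * (m0 : ℝ) ^ 3 * lz ^ 2 * κ / g =
    (13824 * sieveErr b * κ ^ 4 * lz ^ 2 + 24 * κ * m0 ^ 2 + 792 * m0 ^ 3 * lz ^ 2 * κ) / g by ring]
  have hm1 : (1 : ℝ) ≤ m0 := by exact_mod_cast (by omega : 1 ≤ m0)
  have h8 : κ * (m0 : ℝ) ^ 2 ≤ κ * (m0 ^ 3 * lz ^ 2) := by
    apply mul_le_mul_of_nonneg_left _ (by positivity)
    calc (m0 : ℝ) ^ 2 ≤ m0 ^ 3 := pow_le_pow_right₀ hm1 (by norm_num)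
      _ ≤ m0 ^ 3 * lz ^ 2 := le_mul_of_one_le_right (by positivity) (one_le_pow₀ hlz1)
  apply div_le_div_of_nonneg_right _ hgpos.le
  nlinarith

end SelbergCompare

section SignGroup
variable {n : ℕ}

/-- The real character of the sign group attached to a set of coordinates. -/
noncomputable def signChar (T : Finset (Fin n)) (h : Fin n → ℤˣ) : ℝ :=
  ∏ j ∈ T, ((h j : ℤ) : ℝ)

theorem signChar_mul (T : Finset (Fin n)) (h k : Fin n → ℤˣ) :
    signChar T (h * k) = signChar T h * signChar T k := by
  unfold signChar
  rw [← Finset.prod_mul_distrib]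
  exact Finset.prod_congr rfl fun j _ => by push_cast [Pi.mul_apply]; ring

theorem signChar_eq (T : Finset (Fin n)) (h : Fin n → ℤˣ) :
    signChar T h = 1 ∨ signChar T h = -1 := by
  unfold signChar
  induction T using Finset.induction_on with
  | empty => simp
  | insert a s ha ih =>
    rw [Finset.prod_insert ha]
    rcases Int.units_eq_one_or (h a) with h1 | h1 <;> rcases ih with h2 | h2 <;> rw [h1, h2] <;> simp

theorem signVec_mul_self (h : Fin n → ℤˣ) : h * h = 1 := by
  ext j; simp

theorem signVec_inv (h : Fin n → ℤˣ) : h⁻¹ = h := by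
  rw [inv_eq_iff_mul_eq_one, signVec_mul_self]

theorem sum_signChar (h : Fin n → ℤˣ) :
    ∑ T : Finset (Fin n), signChar T h =
      if h = 1 then (Fintype.card (Fin n → ℤˣ) : ℝ) else 0 := by
  have e : ∑ T : Finset (Fin n), signChar T h = ∏ j, (1 + ((h j : ℤ) : ℝ)) := by
    rw [Finset.prod_one_add]
    simp [signChar]
  rw [e]
  split_ifs with h1
  · rw [h1]; norm_num
  · obtain ⟨j, hj⟩ := Function.ne_iff.1 h1
    apply Finset.prod_eq_zero (Finset.mem_univ j)
    rcases Int.units_eq_one_or (h j) with h2 | h2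
    · exact absurd h2 hj
    · rw [h2]; simp

/-- Fourier coefficient, without normalization. -/
noncomputable def signCoeff (f : (Fin n → ℤˣ) → ℝ) (T : Finset (Fin n)) : ℝ :=
  ∑ h, f h * signChar T h

theorem signCoeff_empty (f : (Fin n → ℤˣ) → ℝ) : signCoeff f ∅ = ∑ h, f h := by
  simp [signCoeff, signChar]

theorem sum_signCoeff_sq (f : (Fin n → ℤˣ) → ℝ) :
    ∑ T, signCoeff f T ^ 2 = (Fintype.card (Fin n → ℤˣ) : ℝ) * ∑ h, f h ^ 2 := by
  have e : ∀ T, signCoeff f T ^ 2 = ∑ h, ∑ k, f h * f k * signChar T (h * k) := by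
    intro T
    rw [sq, signCoeff, Finset.sum_mul_sum]
    refine Finset.sum_congr rfl fun h _ => Finset.sum_congr rfl fun k _ => ?_
    rw [signChar_mul]; ring
  simp_rw [e]
  rw [Finset.sum_comm, Finset.mul_sum]
  refine Finset.sum_congr rfl fun h _ => ?_
  rw [Finset.sum_comm, Finset.sum_eq_single h]
  · rw [← Finset.mul_sum, sum_signChar, if_pos (signVec_mul_self h)]; ring
  · intro k _ hk
    rw [← Finset.mul_sum, sum_signChar, if_neg, mul_zero]
    intro h1
    exact hk (by rw [← signVec_inv h, eq_inv_iff_mul_eq_one, mul_comm, h1])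
  · simp

theorem sum_signCoeff_cube (f : (Fin n → ℤˣ) → ℝ) :
    ∑ T, signCoeff f T ^ 3 =
      (Fintype.card (Fin n → ℤˣ) : ℝ) * ∑ h, f h * ∑ k, f k * f (k⁻¹ * h) := by
  have e : ∀ T, signCoeff f T ^ 3 =
      ∑ h, ∑ k, ∑ l, f h * f k * f l * signChar T (h * k * l) := by
    intro T
    rw [pow_succ, sq, signCoeff, Finset.sum_mul_sum, Finset.sum_mul]
    refine Finset.sum_congr rfl fun h _ => ?_
    rw [Finset.sum_mul_sum]
    refine Finset.sum_congr rfl fun k _ => Finset.sum_congr rfl fun l _ => ?_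
    rw [signChar_mul, signChar_mul]; ring
  simp_rw [e]
  rw [Finset.sum_comm, Finset.mul_sum]
  refine Finset.sum_congr rfl fun h _ => ?_
  rw [Finset.sum_comm, Finset.mul_sum, Finset.mul_sum]
  refine Finset.sum_congr rfl fun k _ => ?_
  rw [Finset.sum_comm, Finset.sum_eq_single (k⁻¹ * h)]
  · rw [← Finset.mul_sum, sum_signChar, if_pos]
    · ring
    · rw [signVec_inv, show h * k * (k * h) = (h * h) * (k * k) by
        rw [mul_mul_mul_comm, mul_comm k h, mul_mul_mul_comm], signVec_mul_self, signVec_mul_self, one_mul]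
  · intro l _ hl
    rw [← Finset.mul_sum, sum_signChar, if_neg, mul_zero]
    intro h1
    apply hl
    have : l = (h * k)⁻¹ := by rw [eq_inv_iff_mul_eq_one, mul_comm, h1]
    rw [this, signVec_inv, signVec_inv, mul_comm]
  · simp

set_option maxHeartbeats 1000000 in
open Classical in
/-- A function on the sign group behaving like the normalized prime density, whose
self-convolution is as large as possible at `g`, concentrates on the kernel's complement of some
character trivial at `g`. -/
theorem exists_signChar (f t τ : (Fin n → ℤˣ) → ℝ) (g : Fin n → ℤˣ) {K ε N : ℝ}
    (hN : N = Fintype.card (Fin n → ℤˣ)) (hK : 1 ≤ K) (hε : 0 < ε) (hKε : K * ε ≤ 1 / 100)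
    (f0 : ∀ h, 0 ≤ f h) (τ0 : ∀ h, 0 ≤ τ h)
    (h1 : ∀ h, t h + (∑ k, f k * f (k⁻¹ * h)) / N ≤ 2 + ε)
    (h2 : ∀ h, f h ≤ 2 + ε)
    (h3 : ∑ h, f h ≤ (1 + ε) * N) (h3' : (1 - ε) * N ≤ ∑ h, f h)
    (h3t : (1 - ε) * N ≤ ∑ h, t h)
    (h4 : 2 - ε ≤ (∑ k, f k * f (k⁻¹ * g)) / N)
    (h5 : ∀ h, t h ≤ K * f h + τ h) (h6 : ∑ h, τ h ≤ ε * N) :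
    ∃ T : Finset (Fin n), T.Nonempty ∧ signChar T g = 1 ∧
      ∑ h, (if signChar T h = 1 then f h else 0) ≤ 12 * (K * ε) * N := by
  have hN0 : 0 < N := by rw [hN]; exact_mod_cast Fintype.card_pos
  set x := K * ε with hx
  have hxε : ε ≤ x := by nlinarith
  have hx0 : 0 < x := by linarith
  -- second moment
  have hsq_lower : (2 - ε) * N ≤ ∑ h, f h ^ 2 := by
    rw [le_div_iff₀ hN0] at h4
    have e1 : ∑ k, f (k⁻¹ * g) ^ 2 = ∑ k, f k ^ 2 := by
      apply Fintype.sum_equiv ((Equiv.inv _).trans (Equiv.mulRight g))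
      intro k; rfl
    have e2 : 2 * ∑ k, f k * f (k⁻¹ * g) ≤ ∑ k, f k ^ 2 + ∑ k, f (k⁻¹ * g) ^ 2 := by
      rw [Finset.mul_sum, ← Finset.sum_add_distrib]
      exact Finset.sum_le_sum fun k _ => by nlinarith [sq_nonneg (f k - f (k⁻¹ * g))]
    linarith
  have hsq_upper : ∑ h, f h ^ 2 ≤ (2 + ε) * ((1 + ε) * N) := by
    calc ∑ h, f h ^ 2 ≤ ∑ h, (2 + ε) * f h := Finset.sum_le_sum fun h _ => by
          nlinarith [h2 h, f0 h]
      _ = (2 + ε) * ∑ h, f h := by rw [Finset.mul_sum]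
      _ ≤ _ := by gcongr
  -- correlation of `f` and `t`
  have hft : (2 + ε) * ∑ h, t h - ∑ h, f h * t h ≤
      K * ((2 + ε) * ∑ h, f h - ∑ h, f h ^ 2) + (2 + ε) * ∑ h, τ h := by
    have : ∑ h, ((2 + ε) * t h - f h * t h) ≤
        ∑ h, (K * ((2 + ε) * f h - f h ^ 2) + (2 + ε) * τ h) := by
      apply Finset.sum_le_sum
      intro h _
      have ha : 0 ≤ 2 + ε - f h := by linarith [h2 h]
      have hb := mul_le_mul_of_nonneg_left (h5 h) ha
      have hc := mul_nonneg (f0 h) (τ0 h)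
      nlinarith
    simpa only [Finset.sum_add_distrib, Finset.sum_sub_distrib, ← Finset.mul_sum] using this
  have hfff : ∑ h, f h * ∑ k, f k * f (k⁻¹ * h) ≤
      N * ((2 + ε) * ∑ h, f h - ∑ h, f h * t h) := by
    have : ∑ h, f h * ∑ k, f k * f (k⁻¹ * h) ≤ ∑ h, N * ((2 + ε) * f h - f h * t h) := by
      apply Finset.sum_le_sum
      intro h _
      have ha := h1 h
      have hb : ∑ k, f k * f (k⁻¹ * h) ≤ N * (2 + ε - t h) := by
        have : (∑ k, f k * f (k⁻¹ * h)) / N ≤ 2 + ε - t h := by linarith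
        rw [div_le_iff₀ hN0] at this; linarith
      calc _ ≤ f h * (N * (2 + ε - t h)) := mul_le_mul_of_nonneg_left hb (f0 h)
        _ = _ := by ring
    simpa only [Finset.sum_sub_distrib, ← Finset.mul_sum] using this
  have hε1 : ε ≤ 1 / 100 := by linarith
  have hεx : ε ^ 2 ≤ ε := by nlinarith
  have ht2 : (2 - 10 * x) * N ≤ ∑ h, f h * t h := by
    have a1 : (2 + ε) * ((1 - ε) * N) ≤ (2 + ε) * ∑ h, t h := by gcongr
    have a2 : K * ((2 + ε) * ∑ h, f h - ∑ h, f h ^ 2) ≤ K * (5 * ε * N) := by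
      apply mul_le_mul_of_nonneg_left _ (by linarith)
      have : (2 + ε) * ∑ h, f h ≤ (2 + ε) * ((1 + ε) * N) := by gcongr
      have e : ε ^ 2 * N ≤ ε * N := by gcongr
      nlinarith
    have a3 : (2 + ε) * ∑ h, τ h ≤ 3 * (ε * N) := by
      have : 0 ≤ ∑ h, τ h := Finset.sum_nonneg fun h _ => τ0 h
      nlinarith
    have e : ε ^ 2 * N ≤ ε * N := by gcongr
    have e' : ε * N ≤ x * N := by gcongr
    have e'' : K * (5 * ε * N) = 5 * (x * N) := by rw [hx]; ring
    nlinarith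
  have hcube : ∑ h, f h * ∑ k, f k * f (k⁻¹ * h) ≤ N * (14 * x * N) := by
    refine hfff.trans (mul_le_mul_of_nonneg_left ?_ hN0.le)
    have : (2 + ε) * ∑ h, f h ≤ (2 + ε) * ((1 + ε) * N) := by gcongr
    have e : ε ^ 2 * N ≤ ε * N := by gcongr
    have e' : ε * N ≤ x * N := by gcongr
    nlinarith
  -- Fourier side
  have F2 := sum_signCoeff_sq f
  have F3 := sum_signCoeff_cube f
  rw [← hN] at F2 F3
  rw [← Finset.add_sum_erase _ _ (Finset.mem_univ ∅), signCoeff_empty] at F2 F3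
  set E := ∑ h, f h with hE
  have hE0 : 0 ≤ E := Finset.sum_nonneg fun h _ => f0 h
  have hE2 : ((1 - ε) * N) ^ 2 ≤ E ^ 2 := by
    have : 0 ≤ (1 - ε) * N := mul_nonneg (by linarith) hN0.le
    gcongr
  have hE3 : ((1 - ε) * N) ^ 3 ≤ E ^ 3 := by
    have : 0 ≤ (1 - ε) * N := mul_nonneg (by linarith) hN0.le
    gcongr
  have hex : ∃ T ∈ Finset.univ.erase (∅ : Finset (Fin n)),
      signCoeff f T ≤ -((1 - 23 * x) * N) := by
    by_contra hcon
    push Not at hcon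
    have b1 : -((1 - 23 * x) * N) * ∑ T ∈ Finset.univ.erase ∅, signCoeff f T ^ 2 ≤
        ∑ T ∈ Finset.univ.erase ∅, signCoeff f T ^ 3 := by
      rw [Finset.mul_sum]
      apply Finset.sum_le_sum
      intro T hT
      have := hcon T hT
      nlinarith [sq_nonneg (signCoeff f T)]
    have b2 : ∑ T ∈ Finset.univ.erase ∅, signCoeff f T ^ 2 ≤ N ^ 2 * (1 + 6 * x) := by
      have c1 : N * ∑ h, f h ^ 2 ≤ N * ((2 + ε) * ((1 + ε) * N)) := by gcongr
      have c2 : N ^ 2 * ((2 + ε) * (1 + ε) - (1 - ε) ^ 2) ≤ N ^ 2 * (1 + 6 * x) := by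
        apply mul_le_mul_of_nonneg_left _ (by positivity)
        nlinarith
      linarith
    have b3 : ∑ T ∈ Finset.univ.erase ∅, signCoeff f T ^ 3 ≤ N ^ 3 * (-1 + 17 * x) := by
      have c1 := mul_le_mul_of_nonneg_left hcube hN0.le
      have c2 : N ^ 3 * (14 * x - (1 - ε) ^ 3) ≤ N ^ 3 * (-1 + 17 * x) := by
        apply mul_le_mul_of_nonneg_left _ (by positivity)
        nlinarith [pow_pos hε 3]
      linarith
    have b4 : (1 - 23 * x) * N * ∑ T ∈ Finset.univ.erase ∅, signCoeff f T ^ 2 ≤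
        (1 - 23 * x) * N * (N ^ 2 * (1 + 6 * x)) := by
      apply mul_le_mul_of_nonneg_left b2
      exact mul_nonneg (by linarith) hN0.le
    have b5 : 0 < N ^ 3 * (138 * x ^ 2) := by positivity
    linarith
  obtain ⟨T, hT, hTf⟩ := hex
  have hsum : ∑ h, (if signChar T h = 1 then f h else 0) ≤ 12 * x * N := by
    have : 2 * ∑ h, (if signChar T h = 1 then f h else 0) = E + signCoeff f T := by
      rw [hE, signCoeff, ← Finset.sum_add_distrib, Finset.mul_sum]
      apply Finset.sum_congr rfl
      intro h _
      rcases signChar_eq T h with h' | h' <;> rw [h']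
      · rw [if_pos rfl]; ring
      · rw [if_neg (by norm_num)]; ring
    have e' : ε * N ≤ x * N := by gcongr
    nlinarith
  refine ⟨T, Finset.nonempty_iff_ne_empty.2 (Finset.ne_of_mem_erase hT), ?_, hsum⟩
  by_contra hg
  have hg' : signChar T g = -1 := (signChar_eq T g).resolve_left hg
  set v : (Fin n → ℤˣ) → ℝ := fun h => if signChar T h = 1 then f h else 0 with hv
  have hle : ∑ k, f k * f (k⁻¹ * g) ≤ ∑ k, ((2 + ε) * v k + (2 + ε) * v (k⁻¹ * g)) := by
    apply Finset.sum_le_sum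
    intro k _
    have e : signChar T (k⁻¹ * g) = - signChar T k := by
      rw [signChar_mul, hg', signVec_inv]; ring
    have hv0 : ∀ h, 0 ≤ v h := by
      intro h; rw [hv]; dsimp only; split_ifs; exacts [f0 h, le_rfl]
    have a1 := f0 k
    have a2 := f0 (k⁻¹ * g)
    have a3 := h2 k
    have a4 := h2 (k⁻¹ * g)
    rcases signChar_eq T k with h' | h'
    · have : v k = f k := by rw [hv]; simp [h']
      rw [this]
      nlinarith [hv0 (k⁻¹ * g)]
    · have : v (k⁻¹ * g) = f (k⁻¹ * g) := by rw [hv]; simp [e, h']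
      rw [this]
      nlinarith [hv0 k]
  rw [Finset.sum_add_distrib, ← Finset.mul_sum, ← Finset.mul_sum] at hle
  have e1 : ∑ k, v (k⁻¹ * g) = ∑ k, v k := by
    apply Fintype.sum_equiv ((Equiv.inv _).trans (Equiv.mulRight g))
    intro k; rfl
  rw [e1] at hle
  rw [le_div_iff₀ hN0] at h4
  nlinarith

end SignGroup

section MangoldtAsymptotics

/-- Partial sums of the Dirichlet series of `Λ` at `1 + s`. -/
noncomputable def mangoldtSum (s : ℝ) (N : ℕ) : ℝ :=
  ∑ m ∈ Finset.Ioc 0 N, ArithmeticFunction.vonMangoldt m * (m : ℝ) ^ (-(1 + s))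

/-- Partial sums of the Dirichlet series of `Λ log` at `1 + s`. -/
noncomputable def mangoldtLogSum (s : ℝ) (N : ℕ) : ℝ :=
  ∑ m ∈ Finset.Ioc 0 N,
    ArithmeticFunction.vonMangoldt m * Real.log m * (m : ℝ) ^ (-(1 + s))

theorem mangoldt_hasSum {s : ℝ} (hs : 0 < s) : ∃ v : ℝ,
    HasSum (fun m : ℕ => ArithmeticFunction.vonMangoldt m * (m : ℝ) ^ (-(1 + s))) v ∧
    (v : ℂ) = - (deriv riemannZeta (1 + s : ℂ) / riemannZeta (1 + s : ℂ)) := by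
  have hre : 1 < (1 + s : ℂ).re := by simp [hs]
  have h1 := ArithmeticFunction.LSeriesSummable_vonMangoldt hre
  have h2 := ArithmeticFunction.LSeries_vonMangoldt_eq_deriv_riemannZeta_div hre
  have e : LSeries.term (fun n => (ArithmeticFunction.vonMangoldt n : ℂ)) (1 + s : ℂ) =
      fun m : ℕ => ((ArithmeticFunction.vonMangoldt m * (m : ℝ) ^ (-(1 + s)) : ℝ) : ℂ) := by
    ext m
    rcases Nat.eq_zero_or_pos m with rfl | hm
    · simp
    · rw [LSeries.term_of_ne_zero hm.ne']
      push_cast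
      rw [Complex.ofReal_cpow (Nat.cast_nonneg m)]
      push_cast
      rw [Complex.cpow_neg, div_eq_mul_inv]
  unfold LSeriesSummable at h1
  rw [e] at h1
  have h3 : Summable (fun m : ℕ => ArithmeticFunction.vonMangoldt m * (m : ℝ) ^ (-(1 + s))) := by
    exact_mod_cast h1
  refine ⟨_, h3.hasSum, ?_⟩
  rw [Complex.ofReal_tsum]
  unfold LSeries at h2
  rw [e] at h2
  rw [h2, neg_div]

theorem mangoldt_value_bound : ∃ s0 C : ℝ, 0 < s0 ∧ s0 ≤ 1 ∧ 1 ≤ C ∧ ∀ s v : ℝ, 0 < s → s < s0 →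
    HasSum (fun m : ℕ => ArithmeticFunction.vonMangoldt m * (m : ℝ) ^ (-(1 + s))) v →
    |v - 1 / s| ≤ C := by
  obtain ⟨C, hC⟩ := log_deriv_riemannZeta_add_inv_sub_bounded.bound
  rw [eventually_nhdsWithin_iff, Metric.eventually_nhds_iff] at hC
  obtain ⟨r, hr, hC⟩ := hC
  refine ⟨min r 1, max C 1, by positivity, min_le_right _ _, le_max_right _ _, ?_⟩
  intro s v hs hs0 hv
  obtain ⟨v', hv', he⟩ := mangoldt_hasSum hs
  rw [hv.unique hv']
  have h1 := @hC (1 + s : ℂ) (by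
    rw [dist_eq_norm]; simp [abs_of_pos hs]; exact hs0.trans_le (min_le_left _ _)) (by
    simp; exact hs.ne')
  have h2 : deriv riemannZeta (1 + s : ℂ) / riemannZeta (1 + s : ℂ) + ((1 + s : ℂ) - 1)⁻¹ =
      ((-(v' - 1 / s) : ℝ) : ℂ) := by
    push_cast
    rw [he]; simp; ring
  rw [h2, Complex.norm_real, Real.norm_eq_abs, abs_neg] at h1
  simp only [norm_one, mul_one] at h1
  exact h1.trans (le_max_left _ _)

theorem mangoldt_term_nonneg (s : ℝ) (m : ℕ) :
    0 ≤ ArithmeticFunction.vonMangoldt m * (m : ℝ) ^ (-(1 + s)) :=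
  mul_nonneg ArithmeticFunction.vonMangoldt_nonneg (by positivity)

theorem mangoldtSum_le_of_hasSum {s v : ℝ}
    (hv : HasSum (fun m : ℕ => ArithmeticFunction.vonMangoldt m * (m : ℝ) ^ (-(1 + s))) v)
    (N : ℕ) : mangoldtSum s N ≤ v :=
  sum_le_hasSum _ (fun m _ => mangoldt_term_nonneg s m) hv

theorem tendsto_mangoldtSum {s v : ℝ}
    (hv : HasSum (fun m : ℕ => ArithmeticFunction.vonMangoldt m * (m : ℝ) ^ (-(1 + s))) v) :
    Filter.Tendsto (mangoldtSum s) Filter.atTop (nhds v) := by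
  have h := hv.tendsto_sum_nat.comp (Filter.tendsto_add_atTop_nat 1)
  refine h.congr fun N => ?_
  simp only [Function.comp, mangoldtSum]
  rw [Finset.range_eq_Ico, Finset.sum_eq_sum_Ico_succ_bot (by omega)]
  simp only [ArithmeticFunction.map_zero, zero_mul, zero_add]
  rfl

theorem exists_mangoldt_bound : ∃ C : ℝ, 1 ≤ C ∧ ∀ s v : ℝ, 0 < s → s ≤ 1 →
    HasSum (fun m : ℕ => ArithmeticFunction.vonMangoldt m * (m : ℝ) ^ (-(1 + s))) v →
    |v - 1 / s| ≤ C := by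
  obtain ⟨s0, C, hs0, hs01, hC, h⟩ := mangoldt_value_bound
  refine ⟨C + 2 / s0, by have : 0 < 2 / s0 := by positivity
                         linarith, ?_⟩
  intro s v hs hs1 hv
  rcases lt_or_ge s s0 with hlt | hge
  · refine (h s v hs hlt hv).trans ?_
    have : 0 < 2 / s0 := by positivity
    linarith
  · obtain ⟨v', hv', _⟩ := mangoldt_hasSum (s := s0 / 2) (by positivity)
    have h1 := abs_le.1 (h (s0 / 2) v' (by positivity) (by linarith) hv')
    have h2 : v ≤ v' := by
      refine hasSum_le (fun m => ?_) hv hv'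
      rcases Nat.eq_zero_or_pos m with rfl | hm
      · simp
      · have : (1 : ℝ) ≤ m := by exact_mod_cast hm
        apply mul_le_mul_of_nonneg_left _ ArithmeticFunction.vonMangoldt_nonneg
        exact Real.rpow_le_rpow_of_exponent_le this (by linarith)
    have h3 : 0 ≤ v := hv.nonneg fun m => mangoldt_term_nonneg s m
    have h4 : 1 / s ≤ 1 / s0 := by gcongr
    have h5 : 0 < 1 / s := by positivity
    have e1 : 1 / (s0 / 2) = 2 / s0 := by field_simp
    have e2 : 1 / s0 ≤ 2 / s0 := by gcongr; norm_num
    rw [e1] at h1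
    rw [abs_le]
    constructor <;> linarith [h1.1, h1.2]

/-- Convexity of `s ↦ a ^ (-(1 + s))`. -/
theorem rpow_convex {a s s' : ℝ} (ha : 1 ≤ a) :
    a ^ (-(1 + s)) - a ^ (-(1 + s')) ≤ (s' - s) * (Real.log a * a ^ (-(1 + s))) := by
  have h0 : 0 < a := by linarith
  have e : a ^ (-(1 + s')) = a ^ (-(1 + s)) * Real.exp (-(s' - s) * Real.log a) := by
    rw [Real.rpow_def_of_pos h0, Real.rpow_def_of_pos h0, ← Real.exp_add]
    congr 1; ring
  rw [e]
  have h1 := Real.add_one_le_exp (-(s' - s) * Real.log a)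
  have h2 : 0 ≤ a ^ (-(1 + s)) := by positivity
  nlinarith

theorem mangoldtLogSum_bounds : ∃ C : ℝ, 1 ≤ C ∧
    (∀ s : ℝ, 0 < s → s ≤ 1 → ∀ N, mangoldtSum s N ≤ 1 / s + C) ∧
    (∀ s : ℝ, 0 < s → s ≤ 1 → ∀ᶠ N in Filter.atTop, 1 / s - 2 * C ≤ mangoldtSum s N) ∧
    (∀ s δ : ℝ, 0 < s → s ≤ 1 → 0 < δ → δ < 1 → ∀ N,
      mangoldtLogSum s N ≤ 1 / s ^ 2 * (1 / (1 - δ) + 2 * C * s / δ)) ∧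
    (∀ s δ : ℝ, 0 < s → s ≤ 1 / 2 → 0 < δ → δ < 1 → ∀ᶠ N in Filter.atTop,
      1 / s ^ 2 * (1 / (1 + δ) - 3 * C * s / δ) ≤ mangoldtLogSum s N) := by
  obtain ⟨C, hC, h⟩ := exists_mangoldt_bound
  refine ⟨C, hC, ?_, ?_, ?_, ?_⟩
  · intro s hs hs1 N
    obtain ⟨v, hv, _⟩ := mangoldt_hasSum hs
    linarith [mangoldtSum_le_of_hasSum hv N, (abs_le.1 (h s v hs hs1 hv)).2]
  · intro s hs hs1
    obtain ⟨v, hv, _⟩ := mangoldt_hasSum hs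
    have := (abs_le.1 (h s v hs hs1 hv)).1
    filter_upwards [(tendsto_mangoldtSum hv).eventually (lt_mem_nhds (by linarith : 1 / s - 2 * C < v))]
      with N hN using hN.le
  · intro s δ hs hs1 hδ hδ1 N
    have hs' : 0 < s * (1 - δ) := mul_pos hs (by linarith)
    obtain ⟨v, hv, _⟩ := mangoldt_hasSum hs
    obtain ⟨v', hv', _⟩ := mangoldt_hasSum hs'
    have h1 := abs_le.1 (h s v hs hs1 hv)
    have h2 := abs_le.1 (h _ v' hs' (by nlinarith) hv')
    have hterm : ∀ m : ℕ, s * δ * (ArithmeticFunction.vonMangoldt m * Real.log m * (m : ℝ) ^ (-(1 + s))) ≤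
        ArithmeticFunction.vonMangoldt m * (m : ℝ) ^ (-(1 + s * (1 - δ))) -
        ArithmeticFunction.vonMangoldt m * (m : ℝ) ^ (-(1 + s)) := by
      intro m
      rcases Nat.eq_zero_or_pos m with rfl | hm
      · simp
      · have hm1 : (1 : ℝ) ≤ m := by exact_mod_cast hm
        have := rpow_convex (s := s) (s' := s * (1 - δ)) hm1
        have hL : 0 ≤ ArithmeticFunction.vonMangoldt m := ArithmeticFunction.vonMangoldt_nonneg
        nlinarith
    have h3 : s * δ * mangoldtLogSum s N ≤ v' - v := by
      unfold mangoldtLogSum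
      rw [Finset.mul_sum]
      refine (Finset.sum_le_sum fun m _ => hterm m).trans ?_
      refine sum_le_hasSum _ (fun m _ => ?_) (hv'.sub hv)
      refine le_trans ?_ (hterm m)
      have hL : 0 ≤ ArithmeticFunction.vonMangoldt m := ArithmeticFunction.vonMangoldt_nonneg
      have := Real.log_natCast_nonneg m
      positivity
    have h4 : v' - v ≤ s * δ * (1 / s ^ 2 * (1 / (1 - δ) + 2 * C * s / δ)) := by
      have : s * δ * (1 / s ^ 2 * (1 / (1 - δ) + 2 * C * s / δ)) =
          1 / (s * (1 - δ)) - 1 / s + 2 * C := by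
        have : (1 - δ) ≠ 0 := by linarith
        field_simp; ring
      rw [this]; linarith [h1.1, h2.2]
    exact le_of_mul_le_mul_left (h3.trans h4) (by positivity)
  · intro s δ hs hs1 hδ hδ1
    have hs' : 0 < s * (1 + δ) := mul_pos hs (by linarith)
    obtain ⟨v, hv, _⟩ := mangoldt_hasSum hs
    obtain ⟨v', hv', _⟩ := mangoldt_hasSum hs'
    have h1 := abs_le.1 (h s v hs (by linarith) hv)
    have h2 := abs_le.1 (h _ v' hs' (by nlinarith) hv')
    filter_upwards [(tendsto_mangoldtSum hv).eventually (lt_mem_nhds (by linarith : v - C < v))]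
      with N hN
    have hterm : ∀ m ∈ Finset.Ioc 0 N,
        ArithmeticFunction.vonMangoldt m * (m : ℝ) ^ (-(1 + s)) -
        ArithmeticFunction.vonMangoldt m * (m : ℝ) ^ (-(1 + s * (1 + δ))) ≤
        s * δ * (ArithmeticFunction.vonMangoldt m * Real.log m * (m : ℝ) ^ (-(1 + s))) := by
      intro m hm
      have hm1 : (1 : ℝ) ≤ m := by exact_mod_cast (Finset.mem_Ioc.1 hm).1
      have := rpow_convex (s := s) (s' := s * (1 + δ)) hm1
      have hL : 0 ≤ ArithmeticFunction.vonMangoldt m := ArithmeticFunction.vonMangoldt_nonneg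
      nlinarith
    have h3 : mangoldtSum s N - mangoldtSum (s * (1 + δ)) N ≤ s * δ * mangoldtLogSum s N := by
      unfold mangoldtLogSum mangoldtSum
      rw [Finset.mul_sum, ← Finset.sum_sub_distrib]
      exact Finset.sum_le_sum hterm
    have h4 : s * δ * (1 / s ^ 2 * (1 / (1 + δ) - 3 * C * s / δ)) ≤ v - v' - C := by
      have : s * δ * (1 / s ^ 2 * (1 / (1 + δ) - 3 * C * s / δ)) =
          1 / s - 1 / (s * (1 + δ)) - 3 * C := by
        field_simp; ring
      rw [this]; linarith [h1.1, h2.2]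
    have h5 := mangoldtSum_le_of_hasSum hv' N
    exact le_of_mul_le_mul_left (by linarith) (by positivity : 0 < s * δ)

/-- The contribution of proper prime powers. -/
theorem mangoldt_nonprime_bound : ∃ C : ℝ, 1 ≤ C ∧ ∀ A : Finset ℕ,
    ∑ m ∈ A, (if m.Prime then 0 else ArithmeticFunction.vonMangoldt m) / (m : ℝ) ≤ C := by
  have h := ArithmeticFunction.vonMangoldt.summable_residueClass_non_primes_div (0 : ZMod 1)
  have e : ∀ m, ArithmeticFunction.vonMangoldt.residueClass (0 : ZMod 1) m =
      ArithmeticFunction.vonMangoldt m := by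
    intro m
    unfold ArithmeticFunction.vonMangoldt.residueClass
    rw [Set.indicator_of_mem]
    exact Subsingleton.elim _ _
  simp only [e] at h
  refine ⟨max 1 (∑' m : ℕ, (if m.Prime then 0 else ArithmeticFunction.vonMangoldt m) / (m : ℝ)),
    le_max_left _ _, fun A => ?_⟩
  refine (h.sum_le_tsum A fun m _ => ?_).trans (le_max_right _ _)
  have hL : 0 ≤ ArithmeticFunction.vonMangoldt m := ArithmeticFunction.vonMangoldt_nonneg
  split_ifs <;> positivity

theorem mangoldt_div_sum_le : ∃ C : ℝ, 1 ≤ C ∧ ∀ Y : ℕ, 3 ≤ Y →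
    ∑ m ∈ Finset.Ioc 0 Y, ArithmeticFunction.vonMangoldt m / (m : ℝ) ≤ C * Real.log Y := by
  obtain ⟨C, hC, h, _⟩ := mangoldtLogSum_bounds
  refine ⟨3 * (1 + C), by linarith, fun Y hY => ?_⟩
  have hY' : (3 : ℝ) ≤ Y := by exact_mod_cast hY
  have hl : 1 ≤ Real.log Y := by
    rw [Real.le_log_iff_exp_le (by linarith)]
    linarith [Real.exp_one_lt_d9]
  have h1 := h (1 / Real.log Y) (by positivity) (by rw [div_le_one (by linarith)]; exact hl) Y
  rw [one_div_one_div] at h1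
  have h2 : ∑ m ∈ Finset.Ioc 0 Y, ArithmeticFunction.vonMangoldt m / (m : ℝ) ≤
      3 * mangoldtSum (1 / Real.log Y) Y := by
    unfold mangoldtSum
    rw [Finset.mul_sum]
    apply Finset.sum_le_sum
    intro m hm
    rw [Finset.mem_Ioc] at hm
    have hm0 : (0 : ℝ) < m := by exact_mod_cast hm.1
    have hL : 0 ≤ ArithmeticFunction.vonMangoldt m := ArithmeticFunction.vonMangoldt_nonneg
    have hlm : Real.log m ≤ Real.log Y := Real.log_le_log hm0 (by exact_mod_cast hm.2)
    have h3 : 1 / 3 ≤ (m : ℝ) ^ (-(1 / Real.log Y)) := by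
      rw [Real.rpow_neg hm0.le, one_div]
      apply inv_anti₀ (by positivity)
      rw [Real.rpow_def_of_pos hm0]
      refine (Real.exp_le_exp.2 (?_ : _ ≤ (1 : ℝ))).trans (by linarith [Real.exp_one_lt_d9])
      rw [mul_one_div, div_le_one (by linarith)]; exact hlm
    rw [neg_add, Real.rpow_add hm0, Real.rpow_neg_one, div_eq_mul_inv]
    have h4 : 0 ≤ ArithmeticFunction.vonMangoldt m * (m : ℝ)⁻¹ := by positivity
    nlinarith
  nlinarith

end MangoldtAsymptotics

section ClassDensity
variable {Q : ℕ} [NeZero Q] {G : Type*} [CommGroup G] (c : (ZMod Q)ˣ →* G)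

/-- Class sums of `Λ` over rough integers. -/
noncomputable def mangoldtClass (z Y : ℕ) (h : G) (s : ℝ) (N : ℕ) : ℝ :=
  roughClassSum c z h (fun m => ArithmeticFunction.vonMangoldt m * (m : ℝ) ^ (-(1 + s))) Y N

/-- Class sums of `Λ log` over rough integers. -/
noncomputable def mangoldtLogClass (z Y : ℕ) (h : G) (s : ℝ) (N : ℕ) : ℝ :=
  roughClassSum c z h
    (fun m => ArithmeticFunction.vonMangoldt m * Real.log m * (m : ℝ) ^ (-(1 + s))) Y N

theorem mangoldtLog_term_nonneg (s : ℝ) (m : ℕ) :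
    0 ≤ ArithmeticFunction.vonMangoldt m * Real.log m * (m : ℝ) ^ (-(1 + s)) :=
  mul_nonneg (mul_nonneg ArithmeticFunction.vonMangoldt_nonneg (Real.log_natCast_nonneg m))
    (by positivity)

theorem mangoldtClass_nonneg (z Y : ℕ) (h : G) (s : ℝ) (N : ℕ) :
    0 ≤ mangoldtClass c z Y h s N :=
  roughClassSum_nonneg c z h (mangoldt_term_nonneg s) Y N

theorem mangoldtLogClass_nonneg (z Y : ℕ) (h : G) (s : ℝ) (N : ℕ) :
    0 ≤ mangoldtLogClass c z Y h s N :=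
  roughClassSum_nonneg c z h (mangoldtLog_term_nonneg s) Y N

theorem roughClassSum_mono (z : ℕ) (h : G) {w w' : ℕ → ℝ} {M N M' N' : ℕ} (hM : M' ≤ M)
    (hN : N ≤ N') (hw : ∀ m, M < m → m ≤ N → w m ≤ w' m) (hw0 : ∀ m, M' < m → m ≤ N' → 0 ≤ w' m) :
    roughClassSum c z h w M N ≤ roughClassSum c z h w' M' N' := by
  unfold roughClassSum
  refine (Finset.sum_le_sum (g := fun m => open Classical in
    if IsRough z m ∧ InClass c h m then w' m else 0) fun m hm => ?_).trans
    (Finset.sum_le_sum_of_subset_of_nonneg (Finset.Ioc_subset_Ioc hM hN) fun m hm _ => ?_)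
  · rw [Finset.mem_Ioc] at hm
    split_ifs
    exacts [hw m hm.1 hm.2, le_rfl]
  · rw [Finset.mem_Ioc] at hm
    split_ifs
    exacts [hw0 m hm.1 hm.2, le_rfl]

theorem roughClassSum_mul_left (z : ℕ) (h : G) (w : ℕ → ℝ) (a : ℝ) (M N : ℕ) :
    roughClassSum c z h (fun m => a * w m) M N = a * roughClassSum c z h w M N := by
  unfold roughClassSum
  rw [Finset.mul_sum]
  exact Finset.sum_congr rfl fun m _ => by split_ifs <;> simp

theorem roughClassSum_add (z : ℕ) (h : G) (w w' : ℕ → ℝ) (M N : ℕ) :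
    roughClassSum c z h (fun m => w m + w' m) M N =
      roughClassSum c z h w M N + roughClassSum c z h w' M N := by
  unfold roughClassSum
  rw [← Finset.sum_add_distrib]
  exact Finset.sum_congr rfl fun m _ => by split_ifs <;> simp

open Classical in
theorem sum_roughClassSum_mul [Fintype G] {z : ℕ} (hQ : Q < z) (u : ℕ → ℝ) (Φ : G → ℝ) (M N : ℕ) :
    ∑ k, roughClassSum c z k u M N * Φ k =
      ∑ d ∈ Finset.Ioc M N, if IsRough z d then u d * Φ (classOf c d) else 0 := by
  unfold roughClassSum
  simp_rw [Finset.sum_mul]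
  rw [Finset.sum_comm]
  apply Finset.sum_congr rfl
  intro m _
  split_ifs with hm
  · have he := inClass_classOf c (hm.coprime hQ (NeZero.pos Q))
    rw [Finset.sum_eq_single (classOf c m)]
    · rw [if_pos ⟨hm, he⟩]
    · intro h _ hne
      rw [if_neg, zero_mul]
      exact fun h' => hne (h'.2.unique he)
    · simp
  · exact Finset.sum_eq_zero fun h _ => by rw [if_neg fun h' => hm h'.1, zero_mul]

open Classical in
theorem selbergSum_decomp {z : ℕ} (hQ : Q < z) (h : G) (s : ℝ) (Y N : ℕ) :
    selbergSum c z h s Y N = mangoldtLogClass c z Y h s N +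
      ∑ d ∈ Finset.Ioc 0 N, if IsRough z d then
        (ArithmeticFunction.vonMangoldt d * (d : ℝ) ^ (-(1 + s))) *
          roughClassSum c z ((classOf c d)⁻¹ * h)
            (fun m => ArithmeticFunction.vonMangoldt m * (m : ℝ) ^ (-(1 + s))) (Y / d) (N / d)
        else 0 := by
  rw [← roughClassSum_convolution c hQ h
    (fun m => ArithmeticFunction.vonMangoldt m * (m : ℝ) ^ (-(1 + s)))
    (fun m => ArithmeticFunction.vonMangoldt m * (m : ℝ) ^ (-(1 + s)))]
  unfold selbergSum mangoldtLogClass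
  rw [← roughClassSum_add]
  congr 1
  ext m
  unfold selbergLambda
  rw [add_mul, Finset.sum_mul]
  congr 1
  apply Finset.sum_congr rfl
  intro p hp
  obtain ⟨rfl, h0⟩ := Nat.mem_divisorsAntidiagonal.1 hp
  push_cast
  rw [Real.mul_rpow (by positivity) (by positivity)]
  ring

variable [Fintype G]

theorem selbergSum_ge {z : ℕ} (hQ : Q < z) (h : G) (s : ℝ) {Y N : ℕ} (hN : 1 ≤ N) :
    mangoldtLogClass c z Y h s N +
      ∑ k, mangoldtClass c z Y k s N * mangoldtClass c z Y (k⁻¹ * h) s N ≤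
      selbergSum c z h s Y (N ^ 2) := by
  classical
  have hNN : N ≤ N ^ 2 := Nat.le_self_pow two_ne_zero N
  rw [selbergSum_decomp c hQ]
  apply add_le_add
  · exact roughClassSum_mono c z h le_rfl hNN (fun _ _ _ => le_rfl)
      (fun m _ _ => mangoldtLog_term_nonneg s m)
  · unfold mangoldtClass
    rw [sum_roughClassSum_mul c hQ _ (fun k => roughClassSum c z (k⁻¹ * h)
      (fun m => ArithmeticFunction.vonMangoldt m * (m : ℝ) ^ (-(1 + s))) Y N)]
    refine (Finset.sum_le_sum (g := fun d => if IsRough z d then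
        (ArithmeticFunction.vonMangoldt d * (d : ℝ) ^ (-(1 + s))) *
          roughClassSum c z ((classOf c d)⁻¹ * h)
            (fun m => ArithmeticFunction.vonMangoldt m * (m : ℝ) ^ (-(1 + s))) (Y / d) (N ^ 2 / d)
        else 0) fun d hd => ?_).trans
      (Finset.sum_le_sum_of_subset_of_nonneg (Finset.Ioc_subset_Ioc (Nat.zero_le _) hNN)
        fun d hd _ => ?_)
    · rw [Finset.mem_Ioc] at hd
      split_ifs
      swap
      · exact le_rfl
      apply mul_le_mul_of_nonneg_left _ (mangoldt_term_nonneg s d)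
      refine roughClassSum_mono c z _ (Nat.div_le_self _ _) ?_ (fun _ _ _ => le_rfl)
        (fun m _ _ => mangoldt_term_nonneg s m)
      rw [Nat.le_div_iff_mul_le (by omega), sq]
      exact Nat.mul_le_mul_left _ hd.2
    · split_ifs
      · exact mul_nonneg (mangoldt_term_nonneg s d)
          (roughClassSum_nonneg c z _ (mangoldt_term_nonneg s) _ _)
      · exact le_rfl

theorem sum_mangoldtClass_le {z : ℕ} (hQ : Q < z) (s : ℝ) (Y N : ℕ) :
    ∑ h, mangoldtClass c z Y h s N ≤ mangoldtSum s N := by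
  unfold mangoldtClass mangoldtSum
  rw [sum_roughClassSum c hQ]
  unfold roughSum
  refine (Finset.sum_le_sum_of_subset_of_nonneg (Finset.Ioc_subset_Ioc (Nat.zero_le _) le_rfl)
        fun d hd _ => ?_).trans (Finset.sum_le_sum fun d _ => ?_)
  · split_ifs
    exacts [mangoldt_term_nonneg s d, le_rfl]
  · split_ifs
    exacts [le_rfl, mangoldt_term_nonneg s d]

theorem sum_mangoldtLogClass_le {z : ℕ} (hQ : Q < z) (s : ℝ) (Y N : ℕ) :
    ∑ h, mangoldtLogClass c z Y h s N ≤ mangoldtLogSum s N := by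
  unfold mangoldtLogClass mangoldtLogSum
  rw [sum_roughClassSum c hQ]
  unfold roughSum
  refine (Finset.sum_le_sum_of_subset_of_nonneg (Finset.Ioc_subset_Ioc (Nat.zero_le _) le_rfl)
        fun d hd _ => ?_).trans (Finset.sum_le_sum fun d _ => ?_)
  · split_ifs
    exacts [mangoldtLog_term_nonneg s d, le_rfl]
  · split_ifs
    exacts [le_rfl, mangoldtLog_term_nonneg s d]

theorem sum_selbergSum_le {z : ℕ} (hQ : Q < z) (s : ℝ) (Y N : ℕ) :
    ∑ h, selbergSum c z h s Y N ≤ mangoldtLogSum s N + mangoldtSum s N ^ 2 := by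
  classical
  simp_rw [selbergSum_decomp c hQ]
  rw [Finset.sum_add_distrib, Finset.sum_comm]
  refine add_le_add (sum_mangoldtLogClass_le c hQ s Y N) ?_
  rw [sq]
  conv_rhs => rw [mangoldtSum, Finset.sum_mul]
  apply Finset.sum_le_sum
  intro d hd
  by_cases hdr : IsRough z d
  swap
  · simp only [hdr, if_false, Finset.sum_const_zero]
    exact mul_nonneg (mangoldt_term_nonneg s d)
      (Finset.sum_nonneg fun m _ => mangoldt_term_nonneg s m)
  simp only [hdr, if_true]
  rw [← Finset.mul_sum]
  apply mul_le_mul_of_nonneg_left _ (mangoldt_term_nonneg s d)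
  have e : ∑ h, roughClassSum c z ((classOf c d)⁻¹ * h)
      (fun m => ArithmeticFunction.vonMangoldt m * (m : ℝ) ^ (-(1 + s))) (Y / d) (N / d) =
      ∑ h, roughClassSum c z h
      (fun m => ArithmeticFunction.vonMangoldt m * (m : ℝ) ^ (-(1 + s))) (Y / d) (N / d) :=
    Fintype.sum_equiv (Equiv.mulLeft _) _ _ fun _ => rfl
  rw [e]
  refine (sum_mangoldtClass_le c hQ s (Y / d) (N / d)).trans ?_
  unfold mangoldtSum
  exact Finset.sum_le_sum_of_subset_of_nonneg
    (Finset.Ioc_subset_Ioc le_rfl (Nat.div_le_self _ _)) fun m _ _ => mangoldt_term_nonneg s m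

theorem mangoldtClass_convex (z Y : ℕ) (h : G) (s s' : ℝ) (N : ℕ) :
    mangoldtClass c z Y h s N ≤ mangoldtClass c z Y h s' N +
      (s' - s) * mangoldtLogClass c z Y h s N := by
  unfold mangoldtClass mangoldtLogClass
  rw [← roughClassSum_mul_left, ← roughClassSum_add]
  unfold roughClassSum
  apply Finset.sum_le_sum
  intro m hm
  have hm1 : (1 : ℝ) ≤ m := by exact_mod_cast (Nat.zero_le _).trans_lt (Finset.mem_Ioc.1 hm).1
  split_ifs
  · have := rpow_convex (s := s) (s' := s') hm1
    have hL : 0 ≤ ArithmeticFunction.vonMangoldt m := ArithmeticFunction.vonMangoldt_nonneg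
    nlinarith
  · exact le_rfl

end ClassDensity

section ClassDensity
variable {Q : ℕ} [NeZero Q] {G : Type*} [CommGroup G] (c : (ZMod Q)ˣ →* G)

theorem mangoldt_term_le {s : ℝ} (hs : 0 ≤ s) {m : ℕ} (hm : 1 ≤ m) :
    ArithmeticFunction.vonMangoldt m * (m : ℝ) ^ (-(1 + s)) ≤
      ArithmeticFunction.vonMangoldt m / m := by
  have hm' : (1 : ℝ) ≤ m := by exact_mod_cast hm
  rw [div_eq_mul_inv, ← Real.rpow_neg_one]
  exact mul_le_mul_of_nonneg_left (Real.rpow_le_rpow_of_exponent_le hm' (by linarith))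
    ArithmeticFunction.vonMangoldt_nonneg

variable [Fintype G]

/-- Upper bound for the Selberg sum in a class by products of class sums of `Λ`. -/
theorem selbergSum_le {z : ℕ} (hQ : Q < z) (g : G) {s : ℝ} (hs : 0 ≤ s) {Y N : ℕ} (hY : 1 ≤ Y)
    {B : ℝ} (hB : ∀ h, mangoldtClass c z Y h s N ≤ B) :
    selbergSum c z g s Y N ≤ mangoldtLogClass c z Y g s N +
      ∑ k, mangoldtClass c z Y k s N * mangoldtClass c z Y (k⁻¹ * g) s N +
      2 * (∑ d ∈ Finset.Ioc 0 Y, ArithmeticFunction.vonMangoldt d / d) * B +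
      4 * Real.log Y ^ 2 * roughClassSum c z g (fun m => 1 / (m : ℝ)) Y (Y ^ 2) := by
  classical
  set u : ℕ → ℝ := fun m => ArithmeticFunction.vonMangoldt m * (m : ℝ) ^ (-(1 + s)) with hu
  set u' : ℕ → ℝ := fun k => if k ≤ Y then u k else 0 with hu'
  have hun : ∀ k, 0 ≤ u k := mangoldt_term_nonneg s
  have hun' : ∀ k, 0 ≤ u' k := by
    intro k; simp only [hu']; split_ifs; exacts [hun k, le_rfl]
  have hB0 : 0 ≤ B := (mangoldtClass_nonneg c z Y 1 s N).trans (hB 1)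
  have hF : ∀ k d, roughClassSum c z k u (max Y (Y / d)) (N / d) ≤ mangoldtClass c z Y k s N :=
    fun k d => roughClassSum_mono c z k (le_max_left _ _) (Nat.div_le_self _ _)
      (fun _ _ _ => le_rfl) (fun m _ _ => hun m)
  have hsplit : ∀ v : ℕ → ℝ, (∑ d ∈ Finset.Ioc 0 N, if IsRough z d then
      v d * roughClassSum c z ((classOf c d)⁻¹ * g) u (Y / d) (N / d) else 0) =
      (∑ d ∈ Finset.Ioc 0 N, if IsRough z d then
        v d * roughClassSum c z ((classOf c d)⁻¹ * g) u (max Y (Y / d)) (N / d) else 0) +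
      ∑ d ∈ Finset.Ioc 0 N, if IsRough z d then
        v d * roughClassSum c z ((classOf c d)⁻¹ * g) u' (Y / d) (N / d) else 0 := by
    intro v
    rw [← Finset.sum_add_distrib]
    apply Finset.sum_congr rfl
    intro d _
    split_ifs
    · rw [roughClassSum_split c z _ u Y, mul_add]
    · simp
  have hD : ∑ d ∈ Finset.Ioc 0 Y, u d * B ≤
      (∑ d ∈ Finset.Ioc 0 Y, ArithmeticFunction.vonMangoldt d / d) * B := by
    rw [Finset.sum_mul]
    exact Finset.sum_le_sum fun d hd => mul_le_mul_of_nonneg_right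
      (mangoldt_term_le hs (Finset.mem_Ioc.1 hd).1) hB0
  have h1 : (∑ d ∈ Finset.Ioc 0 N, if IsRough z d then
        u d * roughClassSum c z ((classOf c d)⁻¹ * g) u (max Y (Y / d)) (N / d) else 0) ≤
      ∑ k, mangoldtClass c z Y k s N * mangoldtClass c z Y (k⁻¹ * g) s N +
      ∑ d ∈ Finset.Ioc 0 Y, u d * B := by
    have e : ∑ k, mangoldtClass c z Y k s N * mangoldtClass c z Y (k⁻¹ * g) s N =
        ∑ d ∈ Finset.Ioc Y N, if IsRough z d then u d *
          mangoldtClass c z Y ((classOf c d)⁻¹ * g) s N else 0 :=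
      sum_roughClassSum_mul c hQ u (fun k => mangoldtClass c z Y (k⁻¹ * g) s N) Y N
    rw [e]
    have hsub : Finset.Ioc 0 N ⊆ Finset.Ioc Y N ∪ Finset.Ioc 0 Y := by
      intro d; simp only [Finset.mem_Ioc, Finset.mem_union]; omega
    have hdisj : Disjoint (Finset.Ioc Y N) (Finset.Ioc 0 Y) := by
      rw [Finset.disjoint_left]; intro d; simp only [Finset.mem_Ioc]; omega
    refine (Finset.sum_le_sum_of_subset_of_nonneg hsub fun d _ _ => ?_).trans ?_
    · split_ifs
      exacts [mul_nonneg (hun d) (roughClassSum_nonneg c z _ hun _ _), le_rfl]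
    rw [Finset.sum_union hdisj]
    refine add_le_add (Finset.sum_le_sum fun d _ => ?_) (Finset.sum_le_sum fun d _ => ?_)
    · split_ifs
      exacts [mul_le_mul_of_nonneg_left (hF _ _) (hun d), le_rfl]
    · split_ifs
      exacts [mul_le_mul_of_nonneg_left ((hF _ _).trans (hB _)) (hun d), mul_nonneg (hun d) hB0]
  have h2 : (∑ d ∈ Finset.Ioc 0 N, if IsRough z d then
        u' d * roughClassSum c z ((classOf c d)⁻¹ * g) u (max Y (Y / d)) (N / d) else 0) ≤
      ∑ d ∈ Finset.Ioc 0 Y, u d * B := by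
    have hsub : (Finset.Ioc 0 N).filter (· ≤ Y) ⊆ Finset.Ioc 0 Y := by
      intro d; simp only [Finset.mem_Ioc, Finset.mem_filter]; omega
    refine le_trans ?_ (Finset.sum_le_sum_of_subset_of_nonneg hsub
      fun d _ _ => mul_nonneg (hun d) hB0)
    rw [Finset.sum_filter]
    refine Finset.sum_le_sum fun d _ => ?_
    by_cases hd : d ≤ Y
    · simp only [hu', hd, if_true]
      split_ifs
      exacts [mul_le_mul_of_nonneg_left ((hF _ _).trans (hB _)) (hun d), mul_nonneg (hun d) hB0]
    · simp [hu', hd]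
  have h3 : (∑ d ∈ Finset.Ioc 0 N, if IsRough z d then
        u' d * roughClassSum c z ((classOf c d)⁻¹ * g) u' (Y / d) (N / d) else 0) ≤
      4 * Real.log Y ^ 2 * roughClassSum c z g (fun m => 1 / (m : ℝ)) Y (Y ^ 2) := by
    rw [← roughClassSum_convolution c hQ, ← roughClassSum_mul_left]
    have hpt : ∀ m : ℕ, Y < m → ∑ p ∈ m.divisorsAntidiagonal, u' p.1 * u' p.2 ≤
        if m ≤ Y ^ 2 then 4 * Real.log Y ^ 2 * (1 / (m : ℝ)) else 0 := by
      intro m hm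
      have hm1 : (1 : ℝ) ≤ m := by exact_mod_cast (by omega : 1 ≤ m)
      split_ifs with hmY
      · have hle : ∑ p ∈ m.divisorsAntidiagonal, u' p.1 * u' p.2 ≤
            ∑ p ∈ m.divisorsAntidiagonal, (ArithmeticFunction.vonMangoldt p.1 * Real.log m) *
              (1 / (m : ℝ)) := by
          apply Finset.sum_le_sum
          intro p hp
          obtain ⟨hpm, h0⟩ := Nat.mem_divisorsAntidiagonal.1 hp
          have hle' : ∀ k, u' k ≤ u k := by
            intro k; simp only [hu']; split_ifs; exacts [le_rfl, hun k]
          have hp0 : p.1 * p.2 ≠ 0 := by omega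
          have hp1 : 1 ≤ p.1 := Nat.pos_of_ne_zero (left_ne_zero_of_mul hp0)
          have hp2 : 1 ≤ p.2 := Nat.pos_of_ne_zero (right_ne_zero_of_mul hp0)
          have hlog : ArithmeticFunction.vonMangoldt p.2 ≤ Real.log m :=
            ArithmeticFunction.vonMangoldt_le_log.trans (Real.log_le_log (by exact_mod_cast hp2)
              (by exact_mod_cast (by rw [← hpm]; exact Nat.le_mul_of_pos_left _ hp1)))
          calc u' p.1 * u' p.2 ≤ (ArithmeticFunction.vonMangoldt p.1 / p.1) *
                (ArithmeticFunction.vonMangoldt p.2 / p.2) :=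
                mul_le_mul ((hle' _).trans (mangoldt_term_le hs hp1))
                  ((hle' _).trans (mangoldt_term_le hs hp2)) (hun' _)
                  (div_nonneg ArithmeticFunction.vonMangoldt_nonneg (Nat.cast_nonneg _))
            _ = ArithmeticFunction.vonMangoldt p.1 * ArithmeticFunction.vonMangoldt p.2 *
                (1 / (m : ℝ)) := by
                rw [← hpm]; push_cast; rw [div_mul_div_comm, mul_one_div]
            _ ≤ _ := by
                apply mul_le_mul_of_nonneg_right _ (by positivity)
                exact mul_le_mul_of_nonneg_left hlog ArithmeticFunction.vonMangoldt_nonneg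
        refine hle.trans ?_
        rw [← Finset.sum_mul, ← Finset.sum_mul,
          Nat.sum_divisorsAntidiagonal (fun k _ => ArithmeticFunction.vonMangoldt k),
          ArithmeticFunction.vonMangoldt_sum]
        apply mul_le_mul_of_nonneg_right _ (by positivity)
        have : Real.log m ≤ 2 * Real.log Y := by
          calc Real.log m ≤ Real.log ((Y : ℝ) ^ 2) :=
                Real.log_le_log (by linarith) (by exact_mod_cast hmY)
            _ = 2 * Real.log Y := by rw [Real.log_pow]; norm_num
        nlinarith [Real.log_natCast_nonneg m]
      · apply le_of_eq
        apply Finset.sum_eq_zero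
        intro p hp
        obtain ⟨hpm, h0⟩ := Nat.mem_divisorsAntidiagonal.1 hp
        by_cases h1 : p.1 ≤ Y
        · by_cases h2 : p.2 ≤ Y
          · exfalso
            apply hmY
            rw [← hpm, sq]
            exact Nat.mul_le_mul h1 h2
          · simp [hu', h2]
        · simp [hu', h1]
    unfold roughClassSum
    have hsub : (Finset.Ioc Y N).filter (· ≤ Y ^ 2) ⊆ Finset.Ioc Y (Y ^ 2) := by
      intro d; simp only [Finset.mem_Ioc, Finset.mem_filter]; omega
    refine le_trans ?_ (Finset.sum_le_sum_of_subset_of_nonneg hsub fun d _ _ => ?_)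
    · rw [Finset.sum_filter]
      apply Finset.sum_le_sum
      intro m hm
      have := hpt m (Finset.mem_Ioc.1 hm).1
      by_cases hr : IsRough z m ∧ InClass c g m
      · simpa only [if_pos hr] using this
      · simp only [if_neg hr, ite_self, le_refl]
    · split_ifs <;> positivity
  rw [selbergSum_decomp c hQ, hsplit u, roughClassSum_convolution_comm c hQ g u u', hsplit u']
  linarith

/-- The standing bounds for class sums beyond `z ^ (2 * (2 * b + 14))`. -/
theorem mangoldtClass_le (hc : Function.Surjective c) {I b : ℕ} (hI : 1 ≤ I) (hb : Even b)
    (hΔ : sieveErr b ≤ 1 / 6) (hQ : Q < 2 ^ 2 ^ I) {κ : ℝ} (hκ : 1 ≤ κ) {s : ℝ}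
    (hs : s = 1 / (κ * Real.log (2 ^ 2 ^ I : ℕ))) (N : ℕ) (h : G) :
    mangoldtClass c (2 ^ 2 ^ I) ((2 ^ 2 ^ I) ^ (2 * (2 * b + 14))) h s N ≤
      80 * κ / (s * Fintype.card G) ∧
    roughClassSum c (2 ^ 2 ^ I) h (fun m => 1 / (m : ℝ)) ((2 ^ 2 ^ I) ^ (2 * (2 * b + 14)))
      (((2 ^ 2 ^ I) ^ (2 * (2 * b + 14))) ^ 2) ≤ 220 * (2 * b + 14 : ℕ) / Fintype.card G := by
  classical
  have hz4 : 4 ≤ 2 ^ 2 ^ I := by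
    calc 4 = 2 ^ 2 ^ 1 := by norm_num
      _ ≤ 2 ^ 2 ^ I := Nat.pow_le_pow_right (by norm_num) (Nat.pow_le_pow_right (by norm_num) hI)
  have hcard := card_group_le (c := c) hc
  have hcmp := fun (w : ℕ → ℝ) (M : ℕ) (hw : ∀ m > M, w (m + 1) ≤ w m) (hw0 : ∀ m > M, 0 ≤ w m)
    (N : ℕ) => (roughClassSum_compare c hc hb hΔ hQ hw hw0 N).1 h
  have hgpos : (0 : ℝ) < Fintype.card G := by exact_mod_cast Fintype.card_pos
  have hQ' := hQ
  rw [show ((2 : ℝ) ^ 2 ^ I) = ((2 ^ 2 ^ I : ℕ) : ℝ) by push_cast; rfl] at hcmp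
  generalize hz : 2 ^ 2 ^ I = z at *
  set m0 := 2 * b + 14 with hm0
  set lz := Real.log z with hlz
  set g : ℝ := (Fintype.card G : ℝ) with hg
  have hz4' : (4 : ℝ) ≤ z := by exact_mod_cast hz4
  have hz0 : (0 : ℝ) < z := by linarith
  have hlz1 : 1 ≤ lz := by
    rw [hlz, Real.le_log_iff_exp_le hz0]
    linarith [Real.exp_one_lt_d9]
  have hgz : g ≤ z := by
    have : Fintype.card G ≤ z := by omega
    rw [hg]; exact_mod_cast this
  have hs0 : 0 < s := by rw [hs]; positivity
  have hslz : s * lz = 1 / κ := by rw [hs]; field_simp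
  have hslz1 : s * lz ≤ 1 := by rw [hslz, div_le_one (by linarith)]; exact hκ
  have hs1 : s ≤ 1 := by nlinarith
  set Y := z ^ (2 * m0) with hY
  have hY1 : 1 ≤ Y := Nat.one_le_pow _ _ (by omega)
  have hYz : (z : ℝ) ^ (2 * b + 11) * z ≤ Y := by
    rw [hY, hm0, ← pow_succ]; push_cast
    exact pow_le_pow_right₀ (by linarith) (by omega)
  have hinv : ∀ w : ℕ → ℝ, w (Y + 1) ≤ 1 / ((Y + 1 : ℕ) : ℝ) →
      4 * (w (Y + 1) * z ^ (2 * b + 11)) ≤ 4 / g := by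
    intro w hw
    have : w (Y + 1) ≤ 1 / (z ^ (2 * b + 11) * z) := by
      refine hw.trans (one_div_le_one_div_of_le (by positivity) (hYz.trans ?_))
      push_cast; linarith
    calc 4 * (w (Y + 1) * z ^ (2 * b + 11))
        ≤ 4 * (1 / (z ^ (2 * b + 11) * z) * z ^ (2 * b + 11)) := by gcongr
      _ = 4 / z := by field_simp
      _ ≤ 4 / g := by gcongr
  constructor
  · have h1 : mangoldtClass c z Y h s N ≤
        2 / s * roughClassSum c z h (fun m => (m : ℝ) ^ (-(1 + s / 2))) Y N := by
      rw [← roughClassSum_mul_left]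
      refine roughClassSum_mono c z h le_rfl le_rfl (fun m hm _ => ?_) (fun m _ _ => by positivity)
      have hm0 : (0 : ℝ) < m := by exact_mod_cast (by omega : 0 < m)
      have h2 : Real.log m ≤ 2 / s * (m : ℝ) ^ (s / 2) := by
        refine (Real.log_le_rpow_div hm0.le (half_pos hs0)).trans (le_of_eq ?_)
        field_simp
      calc ArithmeticFunction.vonMangoldt m * (m : ℝ) ^ (-(1 + s))
          ≤ (2 / s * (m : ℝ) ^ (s / 2)) * (m : ℝ) ^ (-(1 + s)) := by
            gcongr
            exact ArithmeticFunction.vonMangoldt_le_log.trans h2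
        _ = _ := by
            rw [mul_assoc, ← Real.rpow_add hm0]
            congr 2; ring
    have h3 := hcmp (fun m => (m : ℝ) ^ (-(1 + s / 2))) Y (fun m hm => by
          apply Real.rpow_le_rpow_of_nonpos (by exact_mod_cast (by omega : 0 < m))
            (by push_cast; linarith) (by linarith)) (fun m _ => by positivity) N
    have h4 := hinv (fun m => (m : ℝ) ^ (-(1 + s / 2))) (by
      rw [one_div, ← Real.rpow_neg_one]
      exact Real.rpow_le_rpow_of_exponent_le (by push_cast; linarith [Nat.cast_nonneg (α := ℝ) Y])
        (by linarith))
    have h5 := roughSum_rpow_le (z := z) (by omega) (half_pos hs0) (by linarith)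
      (by nlinarith : s / 2 * Real.log z ≤ 1) Y N
    have h6 : 6 / (s / 2 * Real.log z) = 12 * κ := by
      rw [div_mul_eq_mul_div, ← hlz, hslz]; field_simp; norm_num
    rw [h6] at h5
    have h7 : 1 / g ≤ κ / g := by gcongr
    calc mangoldtClass c z Y h s N ≤ 2 / s * (3 * (12 * κ / g) + 4 * (κ / g)) := by
          refine h1.trans (mul_le_mul_of_nonneg_left (h3.trans (add_le_add (by gcongr) ?_))
            (by positivity))
          refine h4.trans ?_
          rw [div_eq_mul_one_div]
          exact mul_le_mul_of_nonneg_left h7 (by norm_num)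
      _ = 80 * κ / (s * g) := by field_simp; ring
  · have h3 := hcmp (fun m => 1 / (m : ℝ)) Y (fun m hm =>
      one_div_le_one_div_of_le (by exact_mod_cast (by omega : 0 < m)) (by push_cast; linarith))
      (fun m _ => by positivity) (Y ^ 2)
    have h4 := hinv (fun m => 1 / (m : ℝ)) le_rfl
    have h5 := roughSum_inv_le (z := z) (by omega) (k := 4 * m0) (by omega) Y
    have e : Y ^ 2 = z ^ (4 * m0) := by rw [hY, ← pow_mul]; congr 1; ring
    rw [e] at h3 ⊢
    have hm1 : (1 : ℝ) ≤ m0 := by exact_mod_cast (by omega : 1 ≤ m0)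
    calc _ ≤ 3 * (18 * ((4 * m0 : ℕ) : ℝ) / g) + 4 / g :=
          h3.trans (add_le_add (by gcongr) h4)
      _ = (216 * m0 + 4) / g := by push_cast; ring
      _ ≤ 220 * m0 / g := by gcongr; linarith

end ClassDensity

theorem sum_le_roughSum {u : ℕ → ℝ} (hu : ∀ m, 0 ≤ u m) {z Y : ℕ} (hzY : z ≤ Y) (N : ℕ) :
    ∑ m ∈ Finset.Ioc 0 N, u m ≤ roughSum z u Y N + ∑ m ∈ Finset.Ioc 0 Y, u m +
      ∑ m ∈ Finset.Ioc 0 N, if m.Prime then 0 else u m := by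
  classical
  have hsub : Finset.Ioc 0 N ⊆ Finset.Ioc Y N ∪ Finset.Ioc 0 Y := by
    intro d; simp only [Finset.mem_Ioc, Finset.mem_union]; omega
  have hdisj : Disjoint (Finset.Ioc Y N) (Finset.Ioc 0 Y) := by
    rw [Finset.disjoint_left]; intro d; simp only [Finset.mem_Ioc]; omega
  have h1 := Finset.sum_le_sum_of_subset_of_nonneg hsub fun d _ _ => hu d
  rw [Finset.sum_union hdisj] at h1
  have h2 : ∑ m ∈ Finset.Ioc Y N, u m ≤ roughSum z u Y N +
      ∑ m ∈ Finset.Ioc Y N, if m.Prime then 0 else u m := by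
    unfold roughSum
    rw [← Finset.sum_add_distrib]
    apply Finset.sum_le_sum
    intro m hm
    rw [Finset.mem_Ioc] at hm
    by_cases hp : m.Prime
    · rw [if_pos hp, if_pos]
      · simp
      · intro l hl hlz hlm
        have := (Nat.prime_dvd_prime_iff_eq hl hp).1 hlm
        omega
    · rw [if_neg hp]
      split_ifs
      · linarith [hu m]
      · simp
  have h3 : (∑ m ∈ Finset.Ioc Y N, if m.Prime then 0 else u m) ≤
      ∑ m ∈ Finset.Ioc 0 N, if m.Prime then 0 else u m := by
    apply Finset.sum_le_sum_of_subset_of_nonneg (Finset.Ioc_subset_Ioc (Nat.zero_le _) le_rfl)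
    intro m _ _
    split_ifs
    exacts [le_rfl, hu m]
  linarith

theorem mangoldt_roughSum_ge : ∃ C : ℝ, 1 ≤ C ∧ ∀ (z Y : ℕ), z ≤ Y → 3 ≤ Y → ∀ s : ℝ, 0 < s →
    ∀ N : ℕ, mangoldtSum s N - C * Real.log Y ≤
      roughSum z (fun m => ArithmeticFunction.vonMangoldt m * (m : ℝ) ^ (-(1 + s))) Y N ∧
    mangoldtLogSum s N - C * (Real.log Y ^ 2 + 1 / s) ≤ roughSum z (fun m =>
      ArithmeticFunction.vonMangoldt m * Real.log m * (m : ℝ) ^ (-(1 + s))) Y N := by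
  obtain ⟨C1, hC1, h1⟩ := mangoldt_nonprime_bound
  obtain ⟨C2, hC2, h2⟩ := mangoldt_div_sum_le
  refine ⟨C1 + C2, by linarith, fun z Y hzY hY s hs N => ?_⟩
  have hlY : 1 ≤ Real.log Y := by
    rw [Real.le_log_iff_exp_le (by positivity)]
    have : (3 : ℝ) ≤ Y := by exact_mod_cast hY
    linarith [Real.exp_one_lt_d9]
  have hDY := h2 Y hY
  have hnp := h1 (Finset.Ioc 0 N)
  have hs1 : 0 < 1 / s := by positivity
  constructor
  · have h3 := sum_le_roughSum (mangoldt_term_nonneg s) hzY N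
    have h4 : ∑ m ∈ Finset.Ioc 0 Y, ArithmeticFunction.vonMangoldt m * (m : ℝ) ^ (-(1 + s)) ≤
        C2 * Real.log Y := (Finset.sum_le_sum fun m hm =>
          mangoldt_term_le hs.le (Finset.mem_Ioc.1 hm).1).trans hDY
    have h5 : (∑ m ∈ Finset.Ioc 0 N, if m.Prime then 0 else
        ArithmeticFunction.vonMangoldt m * (m : ℝ) ^ (-(1 + s))) ≤ C1 := by
      refine (Finset.sum_le_sum fun m hm => ?_).trans hnp
      split_ifs
      · simp
      · exact mangoldt_term_le hs.le (Finset.mem_Ioc.1 hm).1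
    unfold mangoldtSum
    nlinarith
  · have h3 := sum_le_roughSum (mangoldtLog_term_nonneg s) hzY N
    have h4 : ∑ m ∈ Finset.Ioc 0 Y,
        ArithmeticFunction.vonMangoldt m * Real.log m * (m : ℝ) ^ (-(1 + s)) ≤
        Real.log Y * (C2 * Real.log Y) := by
      refine (Finset.sum_le_sum fun m hm => ?_).trans
        ((Finset.mul_sum _ _ _).symm.le.trans (mul_le_mul_of_nonneg_left hDY (by linarith)))
      rw [Finset.mem_Ioc] at hm
      have h6 := mangoldt_term_le hs.le hm.1
      have h7 : Real.log m ≤ Real.log Y :=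
        Real.log_le_log (by exact_mod_cast hm.1) (by exact_mod_cast hm.2)
      have h8 := mangoldt_term_nonneg s m
      calc ArithmeticFunction.vonMangoldt m * Real.log m * (m : ℝ) ^ (-(1 + s))
          = Real.log m * (ArithmeticFunction.vonMangoldt m * (m : ℝ) ^ (-(1 + s))) := by ring
        _ ≤ Real.log Y * (ArithmeticFunction.vonMangoldt m / m) :=
            mul_le_mul h7 h6 h8 (by linarith)
    have h5 : (∑ m ∈ Finset.Ioc 0 N, if m.Prime then 0 else
        ArithmeticFunction.vonMangoldt m * Real.log m * (m : ℝ) ^ (-(1 + s))) ≤ 1 / s * C1 := by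
      refine (Finset.sum_le_sum fun m hm => ?_).trans
        ((Finset.mul_sum _ _ _).symm.le.trans (mul_le_mul_of_nonneg_left hnp hs1.le))
      split_ifs
      · simp
      · have hm0 : (0 : ℝ) < m := by exact_mod_cast (Finset.mem_Ioc.1 hm).1
        have h6 : Real.log m ≤ (m : ℝ) ^ s / s := Real.log_le_rpow_div hm0.le hs
        calc ArithmeticFunction.vonMangoldt m * Real.log m * (m : ℝ) ^ (-(1 + s))
            ≤ ArithmeticFunction.vonMangoldt m * ((m : ℝ) ^ s / s) * (m : ℝ) ^ (-(1 + s)) := by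
              gcongr
          _ = 1 / s * (ArithmeticFunction.vonMangoldt m * ((m : ℝ) ^ s * (m : ℝ) ^ (-(1 + s)))) := by
              ring
          _ = _ := by
              rw [← Real.rpow_add hm0, div_eq_mul_inv _ (m : ℝ), ← Real.rpow_neg_one]
              congr 3; ring
    unfold mangoldtLogSum
    nlinarith [sq_nonneg (Real.log Y)]

/-- Level beyond which class sums are taken. -/
def densityCutoff (I b : ℕ) : ℕ := (2 ^ 2 ^ I) ^ (2 * (2 * b + 14))

/-- Parameters for which the sieve comparison applies at scale `s`. -/
structure DensitySetup {Q : ℕ} [NeZero Q] {G : Type} [CommGroup G] [Fintype G]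
    (c : (ZMod Q)ˣ →* G) (I b : ℕ) (κ s : ℝ) : Prop where
  surj : Function.Surjective c
  one_le_I : 1 ≤ I
  even : Even b
  err_le : sieveErr b ≤ 1 / 6
  lt : Q < 2 ^ 2 ^ I
  one_le : 1 ≤ κ
  s_eq : s = 1 / (κ * Real.log (2 ^ 2 ^ I : ℕ))

section Density
variable {Q : ℕ} [NeZero Q] {G : Type} [CommGroup G] [Fintype G] (c : (ZMod Q)ˣ →* G)

/-- Normalised class sum of `Λ`. -/
noncomputable def normMangoldt (I b : ℕ) (s : ℝ) (N : ℕ) (h : G) : ℝ :=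
  s * Fintype.card G * mangoldtClass c (2 ^ 2 ^ I) (densityCutoff I b) h s N

/-- Normalised class sum of `Λ log`. -/
noncomputable def normMangoldtLog (I b : ℕ) (s : ℝ) (N : ℕ) (h : G) : ℝ :=
  s ^ 2 * Fintype.card G * mangoldtLogClass c (2 ^ 2 ^ I) (densityCutoff I b) h s N

/-- Normalised class sum of `Λ log + Λ * Λ`. -/
noncomputable def normSelberg (I b : ℕ) (s : ℝ) (N : ℕ) (h : G) : ℝ :=
  s ^ 2 * Fintype.card G * selbergSum c (2 ^ 2 ^ I) h s (densityCutoff I b) N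

variable {c} {I b : ℕ} {κ s : ℝ}

namespace DensitySetup

theorem card_pos (_ : DensitySetup c I b κ s) : (0 : ℝ) < Fintype.card G := by
  exact_mod_cast Fintype.card_pos

theorem one_le_log (D : DensitySetup c I b κ s) : 1 ≤ Real.log (2 ^ 2 ^ I : ℕ) := by
  have hz4 : 4 ≤ 2 ^ 2 ^ I := by
    calc 4 = 2 ^ 2 ^ 1 := by norm_num
      _ ≤ 2 ^ 2 ^ I := Nat.pow_le_pow_right (by norm_num)
        (Nat.pow_le_pow_right (by norm_num) D.one_le_I)
  have hz4' : (4 : ℝ) ≤ (2 ^ 2 ^ I : ℕ) := by exact_mod_cast hz4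
  rw [Real.le_log_iff_exp_le (by linarith)]
  linarith [Real.exp_one_lt_d9]

theorem s_pos (D : DensitySetup c I b κ s) : 0 < s := by
  rw [D.s_eq]
  have := D.one_le_log
  have := D.one_le
  positivity

theorem s_mul_log (D : DensitySetup c I b κ s) : s * Real.log (2 ^ 2 ^ I : ℕ) = 1 / κ := by
  have h1 := D.one_le_log
  have h2 := D.one_le
  rw [D.s_eq]
  field_simp

theorem s_le (D : DensitySetup c I b κ s) : s ≤ 1 / κ := by
  rw [← D.s_mul_log]
  exact le_mul_of_one_le_right D.s_pos.le D.one_le_log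

theorem s_le_one (D : DensitySetup c I b κ s) : s ≤ 1 :=
  D.s_le.trans ((div_le_one (by linarith [D.one_le])).2 D.one_le)

theorem s_mul_log_cutoff (D : DensitySetup c I b κ s) :
    s * Real.log (densityCutoff I b : ℕ) = 2 * (2 * b + 14 : ℕ) / κ := by
  have h := D.s_mul_log
  unfold densityCutoff
  rw [Nat.cast_pow, Real.log_pow, mul_left_comm, h]
  push_cast; ring

theorem le_cutoff (D : DensitySetup c I b κ s) :
    2 ^ 2 ^ I ≤ densityCutoff I b ∧ 3 ≤ densityCutoff I b := by
  have hz4 : 4 ≤ 2 ^ 2 ^ I := by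
    calc 4 = 2 ^ 2 ^ 1 := by norm_num
      _ ≤ 2 ^ 2 ^ I := Nat.pow_le_pow_right (by norm_num)
        (Nat.pow_le_pow_right (by norm_num) D.one_le_I)
  have : 2 ^ 2 ^ I ≤ densityCutoff I b := Nat.le_self_pow (by omega) _
  exact ⟨this, by omega⟩

theorem normMangoldt_nonneg (D : DensitySetup c I b κ s) (N : ℕ) (h : G) :
    0 ≤ normMangoldt c I b s N h :=
  mul_nonneg (mul_nonneg D.s_pos.le D.card_pos.le) (mangoldtClass_nonneg _ _ _ _ _ _)

theorem normMangoldtLog_nonneg (D : DensitySetup c I b κ s) (N : ℕ) (h : G) :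
    0 ≤ normMangoldtLog c I b s N h :=
  mul_nonneg (mul_nonneg (sq_nonneg _) D.card_pos.le) (mangoldtLogClass_nonneg _ _ _ _ _ _)

theorem add_convolution_le_normSelberg (D : DensitySetup c I b κ s) {N : ℕ} (hN : 1 ≤ N) (h : G) :
    normMangoldtLog c I b s N h +
      (∑ k, normMangoldt c I b s N k * normMangoldt c I b s N (k⁻¹ * h)) / Fintype.card G ≤
      normSelberg c I b s (N ^ 2) h := by
  have h1 := selbergSum_ge c D.lt h s (Y := densityCutoff I b) hN
  have hg := D.card_pos
  have e : (∑ k, normMangoldt c I b s N k * normMangoldt c I b s N (k⁻¹ * h)) / Fintype.card G =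
      s ^ 2 * Fintype.card G * ∑ k, mangoldtClass c (2 ^ 2 ^ I) (densityCutoff I b) k s N *
        mangoldtClass c (2 ^ 2 ^ I) (densityCutoff I b) (k⁻¹ * h) s N := by
    rw [div_eq_iff hg.ne', Finset.mul_sum, Finset.sum_mul]
    exact Finset.sum_congr rfl fun k _ => by unfold normMangoldt; ring
  rw [e]
  unfold normMangoldtLog normSelberg
  rw [← mul_add]
  exact mul_le_mul_of_nonneg_left h1 (by positivity)

theorem abs_normSelberg_sub_le (D : DensitySetup c I b κ s) (N : ℕ) (h h' : G) :
    |normSelberg c I b s N h - normSelberg c I b s N h'| ≤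
      13824 * sieveErr b * κ ^ 2 + 824 * (2 * b + 14 : ℕ) ^ 3 / κ := by
  have h1 := selbergSum_compare c D.surj D.one_le_I D.even D.err_le D.lt D.one_le D.s_eq N h h'
  have hg := D.card_pos
  have hs := D.s_pos
  unfold normSelberg
  rw [← mul_sub, abs_mul, abs_of_nonneg (by positivity)]
  refine (mul_le_mul_of_nonneg_left h1 (by positivity)).trans (le_of_eq ?_)
  field_simp

theorem abs_card_mul_normSelberg_sub_le (D : DensitySetup c I b κ s) (N : ℕ) (h : G) :
    |normSelberg c I b s N h - s ^ 2 * ∑ k, selbergSum c (2 ^ 2 ^ I) k s (densityCutoff I b) N| ≤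
      13824 * sieveErr b * κ ^ 2 + 824 * (2 * b + 14 : ℕ) ^ 3 / κ := by
  have hg := D.card_pos
  have e : normSelberg c I b s N h -
      s ^ 2 * ∑ k, selbergSum c (2 ^ 2 ^ I) k s (densityCutoff I b) N =
      (∑ k, (normSelberg c I b s N h - normSelberg c I b s N k)) / Fintype.card G := by
    rw [Finset.sum_sub_distrib, eq_div_iff hg.ne', Finset.sum_const, Finset.card_univ, nsmul_eq_mul]
    unfold normSelberg
    rw [← Finset.mul_sum]
    ring
  rw [e, abs_div, abs_of_pos hg, div_le_iff₀ hg]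
  refine (Finset.abs_sum_le_sum_abs _ _).trans
    ((Finset.sum_le_sum fun k _ => D.abs_normSelberg_sub_le N h k).trans (le_of_eq ?_))
  rw [Finset.sum_const, Finset.card_univ, nsmul_eq_mul, mul_comm]

theorem normSelberg_le (D : DensitySetup c I b κ s) (N : ℕ) (h : G) :
    normSelberg c I b s N h ≤ s ^ 2 * (mangoldtLogSum s N + mangoldtSum s N ^ 2) +
      (13824 * sieveErr b * κ ^ 2 + 824 * (2 * b + 14 : ℕ) ^ 3 / κ) := by
  have h1 := D.abs_card_mul_normSelberg_sub_le N h
  have h2 := sum_selbergSum_le c D.lt s (densityCutoff I b) N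
  have h3 := mul_le_mul_of_nonneg_left h2 (sq_nonneg s)
  linarith [(abs_le.1 h1).2]

theorem le_normSelberg (D : DensitySetup c I b κ s) {N : ℕ} (hN : 1 ≤ N) (h : G) :
    s ^ 2 * ((∑ k, mangoldtLogClass c (2 ^ 2 ^ I) (densityCutoff I b) k s N) +
        (∑ k, mangoldtClass c (2 ^ 2 ^ I) (densityCutoff I b) k s N) ^ 2) -
      (13824 * sieveErr b * κ ^ 2 + 824 * (2 * b + 14 : ℕ) ^ 3 / κ) ≤
      normSelberg c I b s (N ^ 2) h := by
  have h1 := D.abs_card_mul_normSelberg_sub_le (N ^ 2) h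
  have h2 : (∑ k, mangoldtLogClass c (2 ^ 2 ^ I) (densityCutoff I b) k s N) +
        (∑ k, mangoldtClass c (2 ^ 2 ^ I) (densityCutoff I b) k s N) ^ 2 ≤
        ∑ k, selbergSum c (2 ^ 2 ^ I) k s (densityCutoff I b) (N ^ 2) := by
    refine le_trans (le_of_eq ?_)
      (Finset.sum_le_sum fun k _ => selbergSum_ge c D.lt k s (Y := densityCutoff I b) hN)
    rw [Finset.sum_add_distrib, sq, Finset.sum_mul, Finset.sum_comm]
    congr 1
    apply Finset.sum_congr rfl
    intro k _
    rw [← Finset.mul_sum]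
    congr 1
    exact Fintype.sum_equiv (Equiv.mulLeft k) _ _ fun h => by simp
  have h3 := mul_le_mul_of_nonneg_left h2 (sq_nonneg s)
  linarith [(abs_le.1 h1).1]

theorem sum_normMangoldt (_ : DensitySetup c I b κ s) (N : ℕ) :
    ∑ h, normMangoldt c I b s N h = Fintype.card G *
      (s * ∑ h, mangoldtClass c (2 ^ 2 ^ I) (densityCutoff I b) h s N) := by
  unfold normMangoldt
  rw [← Finset.mul_sum]; ring

theorem sum_normMangoldtLog (_ : DensitySetup c I b κ s) (N : ℕ) :
    ∑ h, normMangoldtLog c I b s N h = Fintype.card G *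
      (s ^ 2 * ∑ h, mangoldtLogClass c (2 ^ 2 ^ I) (densityCutoff I b) h s N) := by
  unfold normMangoldtLog
  rw [← Finset.mul_sum]; ring

theorem normSelberg_le_of_le (D : DensitySetup c I b κ s) {C : ℝ}
    (hC : ∀ Y : ℕ, 3 ≤ Y → ∑ m ∈ Finset.Ioc 0 Y, ArithmeticFunction.vonMangoldt m / m ≤
      C * Real.log Y) {N : ℕ} (hf : ∀ h, normMangoldt c I b s N h ≤ 3) (g : G) :
    normSelberg c I b s N g ≤ normMangoldtLog c I b s N g +
      (∑ k, normMangoldt c I b s N k * normMangoldt c I b s N (k⁻¹ * g)) / Fintype.card G +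
      (12 * C * ((2 * b + 14 : ℕ) / κ) + 3520 * ((2 * b + 14 : ℕ) ^ 3 / κ ^ 2)) := by
  have hg := D.card_pos
  have hs := D.s_pos
  have hY := D.le_cutoff.2
  have hB : ∀ h, mangoldtClass c (2 ^ 2 ^ I) (densityCutoff I b) h s N ≤
      3 / (s * Fintype.card G) := fun h => by
    rw [le_div_iff₀ (by positivity), mul_comm]; exact hf h
  have h1 := selbergSum_le c D.lt g hs.le (by omega : 1 ≤ densityCutoff I b) hB
  have h2 := hC _ hY
  have h3 := (mangoldtClass_le c D.surj D.one_le_I D.even D.err_le D.lt D.one_le D.s_eq N g).2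
  change roughClassSum c (2 ^ 2 ^ I) g (fun m => 1 / (m : ℝ)) (densityCutoff I b)
      (densityCutoff I b ^ 2) ≤ _ at h3
  have h4 := D.s_mul_log_cutoff
  have e : (∑ k, normMangoldt c I b s N k * normMangoldt c I b s N (k⁻¹ * g)) / Fintype.card G =
      s ^ 2 * Fintype.card G * ∑ k, mangoldtClass c (2 ^ 2 ^ I) (densityCutoff I b) k s N *
        mangoldtClass c (2 ^ 2 ^ I) (densityCutoff I b) (k⁻¹ * g) s N := by
    rw [div_eq_iff hg.ne', Finset.mul_sum, Finset.sum_mul]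
    exact Finset.sum_congr rfl fun k _ => by unfold normMangoldt; ring
  rw [e]
  unfold normMangoldtLog normSelberg
  have h5 := mul_le_mul_of_nonneg_left h1 (by positivity : 0 ≤ s ^ 2 * (Fintype.card G : ℝ))
  refine h5.trans ?_
  set m0 : ℝ := ((2 * b + 14 : ℕ) : ℝ)
  have h6 : s ^ 2 * (Fintype.card G : ℝ) * (2 * (∑ d ∈ Finset.Ioc 0 (densityCutoff I b),
      ArithmeticFunction.vonMangoldt d / d) * (3 / (s * Fintype.card G))) ≤
      12 * C * (m0 / κ) := by
    calc s ^ 2 * (Fintype.card G : ℝ) * (2 * (∑ d ∈ Finset.Ioc 0 (densityCutoff I b),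
          ArithmeticFunction.vonMangoldt d / d) * (3 / (s * Fintype.card G)))
        ≤ s ^ 2 * (Fintype.card G : ℝ) * (2 * (C * Real.log (densityCutoff I b)) *
          (3 / (s * Fintype.card G))) := by gcongr
      _ = 6 * C * (s * Real.log (densityCutoff I b)) := by field_simp; ring
      _ = _ := by rw [h4]; ring
  have h7 : s ^ 2 * (Fintype.card G : ℝ) * (4 * Real.log (densityCutoff I b) ^ 2 *
      roughClassSum c (2 ^ 2 ^ I) g (fun m => 1 / (m : ℝ)) (densityCutoff I b)
      (densityCutoff I b ^ 2)) ≤ 3520 * (m0 ^ 3 / κ ^ 2) := by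
    calc s ^ 2 * (Fintype.card G : ℝ) * (4 * Real.log (densityCutoff I b) ^ 2 *
      roughClassSum c (2 ^ 2 ^ I) g (fun m => 1 / (m : ℝ)) (densityCutoff I b)
      (densityCutoff I b ^ 2))
        ≤ s ^ 2 * (Fintype.card G : ℝ) * (4 * Real.log (densityCutoff I b) ^ 2 *
          (220 * m0 / Fintype.card G)) := by gcongr
      _ = 880 * m0 * (s * Real.log (densityCutoff I b)) ^ 2 := by field_simp; ring
      _ = _ := by rw [h4]; ring
  rw [mul_add, mul_add, mul_add]
  linarith

end DensitySetup
end Density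

set_option maxHeartbeats 1000000 in
theorem density_bounds (ε : ℝ) (hε : 0 < ε) : ∃ H : ℝ, 1 ≤ H ∧
    ∀ {Q : ℕ} [NeZero Q] {G : Type} [CommGroup G] [Fintype G] {c : (ZMod Q)ˣ →* G} {I b : ℕ}
      {κ s : ℝ}, DensitySetup c I b κ s → H * (2 * b + 14 : ℕ) ^ 3 ≤ κ →
      sieveErr b * κ ^ 2 ≤ 1 / H →
      (∀ N, 1 ≤ N → ∀ h, normMangoldtLog c I b s N h +
        (∑ k, normMangoldt c I b s N k * normMangoldt c I b s N (k⁻¹ * h)) / Fintype.card G ≤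
        2 + ε) ∧
      (∀ N, ∑ h, normMangoldt c I b s N h ≤ (1 + ε) * Fintype.card G) ∧
      (∀ᶠ N in Filter.atTop, (1 - ε) * Fintype.card G ≤ ∑ h, normMangoldt c I b s N h ∧
        (1 - ε) * Fintype.card G ≤ ∑ h, normMangoldtLog c I b s N h ∧
        ∀ h, 2 - ε ≤ normSelberg c I b s (N ^ 2) h) ∧
      (∀ N, (∀ h, normMangoldt c I b s N h ≤ 3) → ∀ g, normSelberg c I b s N g ≤
        normMangoldtLog c I b s N g + (∑ k, normMangoldt c I b s N k *
          normMangoldt c I b s N (k⁻¹ * g)) / Fintype.card G + ε) := by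
  obtain ⟨C1, hC1, hm1, hm2, hm3, hm4⟩ := mangoldtLogSum_bounds
  obtain ⟨C2, hC2, hdiv⟩ := mangoldt_div_sum_le
  obtain ⟨C3, hC3, hrough⟩ := mangoldt_roughSum_ge
  set δ : ℝ := min ε 1 / 16 with hδ
  have hδ0 : 0 < δ := by positivity
  have hδε : 16 * δ ≤ ε := by rw [hδ]; linarith [min_le_left ε 1]
  have hδ1 : 16 * δ ≤ 1 := by rw [hδ]; linarith [min_le_right ε 1]
  set W : ℝ := 20000 * (C1 + C2 + C3) with hW
  have hW0 : 0 < W := by positivity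
  set r : ℝ := δ ^ 2 / W with hr
  have hr0 : 0 < r := by positivity
  have hWr : W * r = δ ^ 2 := by rw [hr]; field_simp
  have hδ2 : 16 * δ ^ 2 ≤ δ := by nlinarith
  have hC1r : 20000 * (C1 * r) ≤ δ ^ 2 := by
    rw [← hWr, hW]
    linarith [mul_pos (zero_lt_one.trans_le hC1) hr0, mul_pos (zero_lt_one.trans_le hC2) hr0,
      mul_pos (zero_lt_one.trans_le hC3) hr0]
  have hC2r : 20000 * (C2 * r) ≤ δ ^ 2 := by
    rw [← hWr, hW]
    linarith [mul_pos (zero_lt_one.trans_le hC1) hr0, mul_pos (zero_lt_one.trans_le hC2) hr0,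
      mul_pos (zero_lt_one.trans_le hC3) hr0]
  have hC3r : 20000 * (C3 * r) ≤ δ ^ 2 := by
    rw [← hWr, hW]
    linarith [mul_pos (zero_lt_one.trans_le hC1) hr0, mul_pos (zero_lt_one.trans_le hC2) hr0,
      mul_pos (zero_lt_one.trans_le hC3) hr0]
  have hr1 : 20000 * r ≤ δ ^ 2 := by linarith [mul_le_mul_of_nonneg_right hC1 hr0.le]
  refine ⟨1 / r, by rw [le_div_iff₀ hr0]; linarith, ?_⟩
  intro Q _ G _ _ c I b κ s D hκ hΔ
  rw [one_div_one_div] at hΔ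
  have hs0 := D.s_pos
  have hs1 := D.s_le_one
  have hg := D.card_pos
  have hκ1 := D.one_le
  have hY := D.le_cutoff
  have hsY := D.s_mul_log_cutoff
  have hnS := fun N h => D.normSelberg_le N h
  have hSn := fun N (hN : 1 ≤ N) h => D.le_normSelberg hN h
  have hiv := fun N hf g => D.normSelberg_le_of_le hdiv (N := N) hf g
  have hm0 : (1 : ℝ) ≤ (2 * b + 14 : ℕ) := by exact_mod_cast (by omega : 1 ≤ 2 * b + 14)
  set m0 : ℝ := ((2 * b + 14 : ℕ) : ℝ) with hm0'
  have hκ0 : 0 < κ := by linarith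
  have h3 : m0 ^ 3 / κ ≤ r := by
    rw [div_le_iff₀ hκ0]
    rw [div_mul_eq_mul_div, div_le_iff₀ hr0, one_mul] at hκ
    linarith
  have hm03 : m0 ≤ m0 ^ 3 := le_self_pow₀ hm0 (by norm_num)
  have hm13 : 1 ≤ m0 ^ 3 := one_le_pow₀ hm0
  have h1 : m0 / κ ≤ r := le_trans (by gcongr) h3
  have hκκ : κ ≤ κ ^ 2 := le_self_pow₀ hκ1 (by norm_num)
  have h32 : m0 ^ 3 / κ ^ 2 ≤ r := le_trans (by gcongr) h3
  have hsr : s ≤ r := D.s_le.trans (le_trans (by gcongr) h3)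
  have hE : 13824 * sieveErr b * κ ^ 2 + 824 * m0 ^ 3 / κ ≤ δ := by
    have : 824 * m0 ^ 3 / κ = 824 * (m0 ^ 3 / κ) := by ring
    rw [this]; linarith
  have hC1s : C1 * s ≤ C1 * r := by gcongr
  have hC1sδ : C1 * s / δ ≤ δ := by
    rw [div_le_iff₀ hδ0]; linarith
  have hF : ∀ N, s * mangoldtSum s N ≤ 1 + δ := by
    intro N
    have := mul_le_mul_of_nonneg_left (hm1 s hs0 hs1 N) hs0.le
    rw [mul_add, mul_one_div_cancel hs0.ne'] at this
    linarith
  have hFn : ∀ N, 0 ≤ s * mangoldtSum s N := fun N =>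
    mul_nonneg hs0.le (Finset.sum_nonneg fun m _ => mangoldt_term_nonneg s m)
  have hT : ∀ N, s ^ 2 * mangoldtLogSum s N ≤ 1 + 4 * δ := by
    intro N
    have h := mul_le_mul_of_nonneg_left (hm3 s δ hs0 hs1 hδ0 (by linarith) N) (sq_nonneg s)
    have e : s ^ 2 * (1 / s ^ 2 * (1 / (1 - δ) + 2 * C1 * s / δ)) =
      1 / (1 - δ) + 2 * (C1 * s / δ) := by field_simp
    rw [e] at h
    have : 1 / (1 - δ) ≤ 1 + 2 * δ := by
      rw [div_le_iff₀ (by linarith)]; linarith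
    linarith
  have hi : ∀ N h, normSelberg c I b s N h ≤ 2 + ε := by
    intro N h
    have h5 := hnS N h
    have e : s ^ 2 * (mangoldtLogSum s N + mangoldtSum s N ^ 2) =
      s ^ 2 * mangoldtLogSum s N + (s * mangoldtSum s N) ^ 2 := by ring
    rw [e] at h5
    have h6 : (s * mangoldtSum s N) ^ 2 ≤ (1 + δ) ^ 2 := pow_le_pow_left₀ (hFn N) (hF N) 2
    linarith [hT N]
  refine ⟨fun N hN h => (D.add_convolution_le_normSelberg hN h).trans (hi _ h), fun N => ?_, ?_,
    fun N hf g => ?_⟩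
  · rw [D.sum_normMangoldt, mul_comm]
    have := mul_le_mul_of_nonneg_left
      (sum_mangoldtClass_le c D.lt s (densityCutoff I b) N) hs0.le
    apply mul_le_mul_of_nonneg_right _ hg.le
    linarith [hF N]
  · filter_upwards [hm2 s hs0 hs1, hm4 s δ hs0 (by linarith) hδ0 (by linarith),
      Filter.eventually_ge_atTop 1] with N hN1 hN2 hN
    obtain ⟨hR1, hR2⟩ := hrough (2 ^ 2 ^ I) (densityCutoff I b) hY.1 hY.2 s hs0 N
    rw [← sum_roughClassSum c D.lt] at hR1 hR2
    change _ ≤ ∑ h, mangoldtClass c (2 ^ 2 ^ I) (densityCutoff I b) h s N at hR1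
    change _ ≤ ∑ h, mangoldtLogClass c (2 ^ 2 ^ I) (densityCutoff I b) h s N at hR2
    have hA : 1 - δ ≤ s * ∑ h, mangoldtClass c (2 ^ 2 ^ I) (densityCutoff I b) h s N := by
      have h5 := mul_le_mul_of_nonneg_left hR1 hs0.le
      have h6 := mul_le_mul_of_nonneg_left hN1 hs0.le
      have e1 : s * (1 / s - 2 * C1) = 1 - 2 * (C1 * s) := by field_simp
      have e2 : s * (mangoldtSum s N - C3 * Real.log (densityCutoff I b)) =
        s * mangoldtSum s N - C3 * (s * Real.log (densityCutoff I b)) := by ring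
      rw [e2, hsY] at h5
      rw [e1] at h6
      have : C3 * (2 * m0 / κ) ≤ C3 * (2 * r) := by
        rw [mul_div_assoc]; gcongr
      linarith
    have hB : 1 - 5 * δ ≤ s ^ 2 * ∑ h, mangoldtLogClass c (2 ^ 2 ^ I) (densityCutoff I b) h s N := by
      have h5 := mul_le_mul_of_nonneg_left hR2 (sq_nonneg s)
      have h6 := mul_le_mul_of_nonneg_left hN2 (sq_nonneg s)
      have e1 : s ^ 2 * (1 / s ^ 2 * (1 / (1 + δ) - 3 * C1 * s / δ)) =
        1 / (1 + δ) - 3 * (C1 * s / δ) := by field_simp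
      have e2 : s ^ 2 * (mangoldtLogSum s N - C3 * (Real.log (densityCutoff I b) ^ 2 + 1 / s)) =
        s ^ 2 * mangoldtLogSum s N - C3 * ((s * Real.log (densityCutoff I b)) ^ 2 + s) := by
        field_simp
      rw [e2, hsY] at h5
      rw [e1] at h6
      have h7 : 1 - δ ≤ 1 / (1 + δ) := by
        rw [le_div_iff₀ (by linarith)]; linarith [sq_nonneg δ]
      have h8 : (2 * m0 / κ) ^ 2 + s ≤ 5 * r := by
        have : (2 * m0 / κ) ^ 2 = 4 * (m0 / κ) ^ 2 := by ring
        rw [this]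
        have h9 : 0 ≤ m0 / κ := by positivity
        have h10 : r ≤ 1 := by linarith
        have h11 : (m0 / κ) ^ 2 ≤ r ^ 2 := pow_le_pow_left₀ h9 h1 2
        have h12 : r ^ 2 ≤ r := by nlinarith only [h10, hr0]
        linarith
      have : C3 * ((2 * m0 / κ) ^ 2 + s) ≤ C3 * (5 * r) := by gcongr
      linarith
    refine ⟨?_, ?_, fun h => ?_⟩
    · rw [D.sum_normMangoldt, mul_comm]
      exact mul_le_mul_of_nonneg_left (by linarith) hg.le
    · rw [D.sum_normMangoldtLog, mul_comm]
      exact mul_le_mul_of_nonneg_left (by linarith) hg.le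
    · have h5 := hSn N hN h
      rw [mul_add, ← mul_pow] at h5
      have h6 : (1 - δ) ^ 2 ≤
          (s * ∑ h, mangoldtClass c (2 ^ 2 ^ I) (densityCutoff I b) h s N) ^ 2 :=
        pow_le_pow_left₀ (by linarith) hA 2
      linarith [sq_nonneg δ]
  · refine (hiv N hf g).trans ?_
    have : C2 * (m0 / κ) ≤ C2 * r := by gcongr
    linarith

section Density
variable {Q : ℕ} [NeZero Q] {G : Type} [CommGroup G] [Fintype G] {c : (ZMod Q)ˣ →* G}
  {I b : ℕ} {κ s : ℝ}

namespace DensitySetup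

theorem rescale (D : DensitySetup c I b κ s) {κ' : ℝ} (hκ' : 1 ≤ κ') {s' : ℝ}
    (hs : κ' * s' = κ * s) : DensitySetup c I b κ' s' where
  surj := D.surj
  one_le_I := D.one_le_I
  even := D.even
  err_le := D.err_le
  lt := D.lt
  one_le := hκ'
  s_eq := by
    have h1 := D.one_le_log
    have h2 := D.one_le
    have h3 := D.s_eq
    rw [h3] at hs
    field_simp at hs ⊢
    linarith

theorem normMangoldt_le_add (D : DensitySetup c I b κ s) {δ : ℝ} (hδ : 0 < δ) (N : ℕ) (h : G) :
    normMangoldt c I b s N h ≤ normMangoldt c I b ((1 + δ) * s) N h / (1 + δ) +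
      δ * normMangoldtLog c I b s N h := by
  have h1 := mangoldtClass_convex c (2 ^ 2 ^ I) (densityCutoff I b) h s ((1 + δ) * s) N
  have hs := D.s_pos
  have hg := D.card_pos
  unfold normMangoldt normMangoldtLog
  refine (mul_le_mul_of_nonneg_left h1 (by positivity)).trans (le_of_eq ?_)
  field_simp
  ring

theorem normMangoldt_le_mul (D : DensitySetup c I b κ s) (N : ℕ) (h : G) :
    normMangoldt c I b s N h ≤ 80 * κ := by
  have h1 := (mangoldtClass_le c D.surj D.one_le_I D.even D.err_le D.lt D.one_le D.s_eq N h).1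
  have hs := D.s_pos
  have hg := D.card_pos
  unfold normMangoldt
  refine (mul_le_mul_of_nonneg_left h1 (by positivity)).trans (le_of_eq ?_)
  field_simp

theorem normMangoldt_le_iterate {κ₁ κ₂ δ a : ℝ} (hκ₁ : 1 ≤ κ₁) (hδ : 0 < δ) {N : ℕ} {h : G}
    (ha : ∀ κ s, DensitySetup c I b κ s → κ₁ ≤ κ → κ ≤ κ₂ → normMangoldtLog c I b s N h ≤ a)
    (j : ℕ) : ∀ κ s, DensitySetup c I b κ s → κ₁ * (1 + δ) ^ j ≤ κ → κ ≤ κ₂ →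
      normMangoldt c I b s N h ≤ (1 + δ) * a + 80 * κ / (1 + δ) ^ (2 * j) := by
  induction j with
  | zero =>
    intro κ s D h1 h2
    have h3 := D.normMangoldt_le_mul N h
    have h4 := ha κ s D (by simpa using h1) h2
    have h5 := D.normMangoldtLog_nonneg N h
    have : 0 ≤ (1 + δ) * a := mul_nonneg (by linarith) (h5.trans h4)
    simpa using h3.trans (le_add_of_nonneg_left this)
  | succ j ih =>
    intro κ s D h1 h2
    have hp : 0 < (1 + δ) ^ j := by positivity
    have hp1 : 1 ≤ (1 + δ) ^ j := one_le_pow₀ (by linarith)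
    have h6 : κ₁ * (1 + δ) ^ j ≤ κ / (1 + δ) := by
      rw [le_div_iff₀ (by positivity)]
      calc κ₁ * (1 + δ) ^ j * (1 + δ) = κ₁ * (1 + δ) ^ (j + 1) := by ring
        _ ≤ κ := h1
    have h7 : κ₁ ≤ κ / (1 + δ) := le_trans (le_mul_of_one_le_right (by linarith) hp1) h6
    have hκ0 := D.one_le
    have h8 : κ / (1 + δ) ≤ κ := div_le_self (by linarith) (by linarith)
    have D' : DensitySetup c I b (κ / (1 + δ)) ((1 + δ) * s) :=
      D.rescale (by linarith) (by field_simp)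
    have h9 := ih _ _ D' h6 (h8.trans h2)
    have h10 := ha κ s D (h7.trans h8) h2
    have h11 := D.normMangoldt_le_add hδ N h
    calc normMangoldt c I b s N h
        ≤ ((1 + δ) * a + 80 * (κ / (1 + δ)) / (1 + δ) ^ (2 * j)) / (1 + δ) + δ * a := by
          refine h11.trans (add_le_add (by gcongr) (by gcongr))
      _ = _ := by
          rw [show 2 * (j + 1) = 2 * j + 1 + 1 by ring, pow_succ, pow_succ]
          field_simp
          ring

end DensitySetup
end Density

theorem normMangoldt_le (ε : ℝ) (hε : 0 < ε) (hε1 : ε ≤ 1) : ∃ H : ℝ, 1 ≤ H ∧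
    ∀ {Q : ℕ} [NeZero Q] {G : Type} [CommGroup G] [Fintype G] {c : (ZMod Q)ˣ →* G} {I b : ℕ}
      {κ s : ℝ}, DensitySetup c I b κ s → H * (2 * b + 14 : ℕ) ^ 6 ≤ κ →
      sieveErr b * κ ^ 2 ≤ 1 / H → ∀ N, 1 ≤ N → ∀ h, normMangoldt c I b s N h ≤ 2 + ε := by
  obtain ⟨H, hH, hb⟩ := density_bounds (ε / 4) (by linarith)
  have hHH : H ≤ 1280 * H ^ 2 / ε := by
    rw [le_div_iff₀ hε]; nlinarith
  refine ⟨1280 * H ^ 2 / ε, hH.trans hHH, ?_⟩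
  intro Q _ G _ _ c I b κ s D hκ hΔ N hN h
  have hm0 : (1 : ℝ) ≤ (2 * b + 14 : ℕ) := by exact_mod_cast (by omega : 1 ≤ 2 * b + 14)
  set m0 : ℝ := ((2 * b + 14 : ℕ) : ℝ) with hm0'
  have hm3 : 1 ≤ m0 ^ 3 := one_le_pow₀ hm0
  set κ₁ := H * m0 ^ 3 with hκ₁
  have hκ₁1 : 1 ≤ κ₁ := by nlinarith
  have hκκ : 1280 * κ₁ ^ 2 ≤ ε * κ := by
    rw [div_mul_eq_mul_div, div_le_iff₀ hε] at hκ
    calc 1280 * κ₁ ^ 2 = 1280 * H ^ 2 * m0 ^ 6 := by rw [hκ₁]; ring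
      _ ≤ κ * ε := hκ
      _ = ε * κ := mul_comm _ _
  have hκ0 : 0 < κ := by linarith [D.one_le]
  have hκ₁κ : κ₁ ≤ κ := by nlinarith
  have hΔ0 := sieveErr_pos b
  have ha : ∀ κ' s', DensitySetup c I b κ' s' → κ₁ ≤ κ' → κ' ≤ κ →
      normMangoldtLog c I b s' N h ≤ 2 + ε / 4 := by
    intro κ' s' D' h1 h2
    have h3 : sieveErr b * κ' ^ 2 ≤ 1 / H := by
      calc sieveErr b * κ' ^ 2 ≤ sieveErr b * κ ^ 2 := by
            have := D'.one_le
            gcongr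
        _ ≤ 1 / (1280 * H ^ 2 / ε) := hΔ
        _ ≤ 1 / H := one_div_le_one_div_of_le (by linarith) hHH
    have h4 := (hb D' h1 h3).1 N hN h
    have h5 : 0 ≤ (∑ k, normMangoldt c I b s' N k * normMangoldt c I b s' N (k⁻¹ * h)) /
        Fintype.card G := div_nonneg (Finset.sum_nonneg fun k _ =>
          mul_nonneg (D'.normMangoldt_nonneg N k) (D'.normMangoldt_nonneg N _)) D'.card_pos.le
    linarith
  set δ : ℝ := ε / 16 with hδ
  have hδ0 : 0 < δ := by positivity
  obtain ⟨j, hj1, hj2⟩ := exists_nat_pow_near (x := κ / κ₁) (y := 1 + δ)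
    ((one_le_div (by linarith)).2 hκ₁κ) (by linarith)
  have h1 := DensitySetup.normMangoldt_le_iterate hκ₁1 hδ0 ha j κ s D
    (by rw [mul_comm]; exact (le_div_iff₀ (by linarith)).1 hj1) le_rfl
  have h2 : 80 * κ / (1 + δ) ^ (2 * j) ≤ ε / 4 := by
    have hp : 0 < (1 + δ) ^ j := by positivity
    have h3 : κ ≤ 2 * κ₁ * (1 + δ) ^ j := by
      rw [div_lt_iff₀ (by linarith), pow_succ] at hj2
      have h4 : 1 + δ ≤ 2 := by linarith
      calc κ ≤ (1 + δ) ^ j * (1 + δ) * κ₁ := hj2.le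
        _ ≤ (1 + δ) ^ j * 2 * κ₁ := by gcongr
        _ = _ := by ring
    have h5 : κ ^ 2 ≤ 4 * κ₁ ^ 2 * (1 + δ) ^ (2 * j) := by
      calc κ ^ 2 ≤ (2 * κ₁ * (1 + δ) ^ j) ^ 2 := by gcongr
        _ = _ := by rw [pow_mul']; ring
    rw [div_le_iff₀ (by positivity)]
    have hP : 0 < (1 + δ) ^ (2 * j) := by positivity
    have h6 : 320 * κ ^ 2 ≤ ε * κ * (1 + δ) ^ (2 * j) := by
      calc 320 * κ ^ 2 ≤ 1280 * κ₁ ^ 2 * (1 + δ) ^ (2 * j) := by linarith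
        _ ≤ _ := mul_le_mul_of_nonneg_right hκκ hP.le
    have h7 : κ * (320 * κ) ≤ κ * (ε * (1 + δ) ^ (2 * j)) := by linarith
    have := le_of_mul_le_mul_left h7 hκ0
    linarith
  have h3 : (1 + δ) * (2 + ε / 4) ≤ 2 + 3 * ε / 4 := by
    rw [hδ]; nlinarith
  linarith

theorem exists_density_parameters (H : ℝ) (hH : 1 ≤ H) : ∃ b k : ℕ, Even b ∧ sieveErr b ≤ 1 / 6 ∧
    H * (2 * b + 14 : ℕ) ^ 6 ≤ 2 ^ k ∧ sieveErr b * (2 * 2 ^ k) ^ 2 ≤ 1 / H := by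
  set A : ℝ := 16 * H ^ 3 * Real.exp 24 * (Nat.factorial 12) * Real.exp 14 with hA
  have hA0 : 0 < A := by positivity
  have ht : Filter.Tendsto (fun n : ℕ => A * ((8 * Real.exp 2) ^ n / (n.factorial : ℝ)))
      Filter.atTop (nhds 0) := by
    simpa using (FloorSemiring.tendsto_pow_div_factorial_atTop (8 * Real.exp 2)).const_mul A
  obtain ⟨n0, hn0⟩ := Filter.eventually_atTop.1 (ht.eventually_le_const
    (by norm_num : (0 : ℝ) < 1 / 6))
  have hb := hn0 (2 * n0 + 1) (by omega)
  set b := 2 * n0 with hb'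
  have hm0 : (1 : ℝ) ≤ (2 * b + 14 : ℕ) := by exact_mod_cast (by omega : 1 ≤ 2 * b + 14)
  have hcast : ((2 * b + 14 : ℕ) : ℝ) = 2 * b + 14 := by push_cast; ring
  set m0 : ℝ := ((2 * b + 14 : ℕ) : ℝ) with hm0'
  have hm12 : m0 ^ 12 ≤ Nat.factorial 12 * (Real.exp 14 * Real.exp 2 ^ b) := by
    have := Real.pow_div_factorial_le_exp m0 (by linarith) 12
    rw [div_le_iff₀ (by positivity), hcast, Real.exp_add, mul_comm 2 (b : ℝ), Real.exp_nat_mul,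
      mul_comm (b : ℝ) 2, ← hcast] at this
    linarith
  have hkey : sieveErr b * (16 * H ^ 3 * m0 ^ 12) ≤ 1 / 6 := by
    refine le_trans ?_ hb
    have h2 : Real.exp 2 ^ b ≤ Real.exp 2 ^ (b + 1) :=
      pow_le_pow_right₀ (Real.one_le_exp (by norm_num)) (by omega)
    unfold sieveErr
    calc Real.exp 24 * (8 ^ (b + 1) / ((b + 1).factorial : ℝ)) * (16 * H ^ 3 * m0 ^ 12)
        ≤ Real.exp 24 * (8 ^ (b + 1) / ((b + 1).factorial : ℝ)) * (16 * H ^ 3 *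
          (Nat.factorial 12 * (Real.exp 14 * Real.exp 2 ^ (b + 1)))) := by
          gcongr
          exact hm12.trans (by gcongr)
      _ = _ := by rw [hA, mul_pow]; ring
  have hx : 1 ≤ H * m0 ^ 6 := by
    have : 1 ≤ m0 ^ 6 := one_le_pow₀ hm0
    nlinarith
  obtain ⟨k, hk1, hk2⟩ := exists_nat_pow_near hx (one_lt_two : (1 : ℝ) < 2)
  have hΔ := sieveErr_pos b
  have hH3 : 1 ≤ H ^ 3 := one_le_pow₀ hH
  have hm1 : 1 ≤ m0 ^ 12 := one_le_pow₀ hm0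
  refine ⟨b, k + 1, ⟨n0, by omega⟩, ?_, hk2.le, ?_⟩
  · refine le_trans ?_ hkey
    apply le_mul_of_one_le_right hΔ.le
    nlinarith
  · have h1 : ((2 : ℝ) * 2 ^ (k + 1)) ^ 2 ≤ 16 * H ^ 2 * m0 ^ 12 := by
      calc ((2 : ℝ) * 2 ^ (k + 1)) ^ 2 = 16 * (2 ^ k) ^ 2 := by ring
        _ ≤ 16 * (H * m0 ^ 6) ^ 2 := by gcongr
        _ = _ := by ring
    rw [le_div_iff₀ (by linarith)]
    calc sieveErr b * (2 * 2 ^ (k + 1)) ^ 2 * H ≤ sieveErr b * (16 * H ^ 2 * m0 ^ 12) * H := by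
          gcongr
      _ = sieveErr b * (16 * H ^ 3 * m0 ^ 12) := by ring
      _ ≤ 1 := by linarith

section Tail
variable {Q : ℕ} [NeZero Q] {G : Type} [CommGroup G] {c : (ZMod Q)ˣ →* G}

theorem InClass.pow {h : G} {m : ℕ} (hm : InClass c h m) (a : ℕ) : InClass c (h ^ a) (m ^ a) := by
  obtain ⟨u, hu, rfl⟩ := hm
  exact ⟨u ^ a, by push_cast; rw [hu], map_pow c u a⟩

variable [Fintype G] {I b : ℕ} {κ s : ℝ}

theorem rpow_neg_le_exp {s K : ℝ} {m : ℕ} (hm : 1 ≤ m) (hs : 0 < s) (hK : K / s ≤ Real.log m) :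
    (m : ℝ) ^ (-(1 + s)) ≤ Real.exp (-(K / 2)) * (m : ℝ) ^ (-(1 + s / 2)) := by
  have hm0 : (0 : ℝ) < m := by exact_mod_cast hm
  have e : (m : ℝ) ^ (-(1 + s)) = (m : ℝ) ^ (-(s / 2)) * (m : ℝ) ^ (-(1 + s / 2)) := by
    rw [← Real.rpow_add hm0]; congr 1; ring
  rw [e]
  apply mul_le_mul_of_nonneg_right _ (by positivity)
  rw [Real.rpow_def_of_pos hm0, Real.exp_le_exp]
  rw [div_le_iff₀ hs] at hK
  linarith

theorem mangoldtLog_term_le {s K : ℝ} {m : ℕ} (hm : 1 ≤ m) (hs : 0 < s) (hK : K / s ≤ Real.log m) :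
    ArithmeticFunction.vonMangoldt m * Real.log m * (m : ℝ) ^ (-(1 + s)) ≤
      Real.exp (-(K / 2)) *
        (ArithmeticFunction.vonMangoldt m * Real.log m * (m : ℝ) ^ (-(1 + s / 2))) := by
  have h := mul_le_mul_of_nonneg_left (rpow_neg_le_exp hm hs hK)
    (mul_nonneg (ArithmeticFunction.vonMangoldt_nonneg (n := m)) (Real.log_natCast_nonneg m))
  linarith

namespace DensitySetup

theorem normMangoldtLog_le (D : DensitySetup c I b κ s) {K : ℝ} (hK : 0 ≤ K) (N : ℕ) (h : G) :
    normMangoldtLog c I b s N h ≤ K * normMangoldt c I b s N h +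
      4 * Real.exp (-(K / 2)) * normMangoldtLog c I b (s / 2) N h := by
  have hs := D.s_pos
  have hg := D.card_pos
  have h1 : mangoldtLogClass c (2 ^ 2 ^ I) (densityCutoff I b) h s N ≤
      K / s * mangoldtClass c (2 ^ 2 ^ I) (densityCutoff I b) h s N +
      Real.exp (-(K / 2)) *
        mangoldtLogClass c (2 ^ 2 ^ I) (densityCutoff I b) h (s / 2) N := by
    unfold mangoldtLogClass mangoldtClass roughClassSum
    rw [Finset.mul_sum, Finset.mul_sum, ← Finset.sum_add_distrib]
    apply Finset.sum_le_sum
    intro m hm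
    have hm1 : 1 ≤ m := by rw [Finset.mem_Ioc] at hm; omega
    by_cases hr : IsRough (2 ^ 2 ^ I) m ∧ InClass c h m
    swap
    · simp [if_neg hr]
    simp only [if_pos hr]
    have h2 := mangoldtLog_term_nonneg (s / 2) m
    have h3 := mangoldt_term_nonneg s m
    have h4 := Real.exp_pos (-(K / 2))
    rcases le_total (Real.log m) (K / s) with hl | hl
    · have h5 := mul_le_mul_of_nonneg_right hl h3
      nlinarith [mul_nonneg h4.le h2]
    · have h5 := mangoldtLog_term_le hm1 hs hl
      linarith [mul_nonneg (div_nonneg hK hs.le) h3]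
  unfold normMangoldtLog normMangoldt
  refine (mul_le_mul_of_nonneg_left h1 (by positivity)).trans (le_of_eq ?_)
  field_simp
  ring

theorem normMangoldtLog_le_of_forall (D : DensitySetup c I b κ s) {K : ℝ} {h : G}
    (hh : ∀ m, InClass c h m → IsPrimePow m → K / s ≤ Real.log m) (N : ℕ) :
    normMangoldtLog c I b s N h ≤
      4 * Real.exp (-(K / 2)) * normMangoldtLog c I b (s / 2) N h := by
  have hs := D.s_pos
  have hg := D.card_pos
  have h1 : mangoldtLogClass c (2 ^ 2 ^ I) (densityCutoff I b) h s N ≤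
      Real.exp (-(K / 2)) *
        mangoldtLogClass c (2 ^ 2 ^ I) (densityCutoff I b) h (s / 2) N := by
    unfold mangoldtLogClass roughClassSum
    rw [Finset.mul_sum]
    apply Finset.sum_le_sum
    intro m hm
    have hm1 : 1 ≤ m := by rw [Finset.mem_Ioc] at hm; omega
    by_cases hr : IsRough (2 ^ 2 ^ I) m ∧ InClass c h m
    swap
    · simp [if_neg hr]
    simp only [if_pos hr]
    by_cases hpp : IsPrimePow m
    · exact mangoldtLog_term_le hm1 hs (hh m hr.2 hpp)
    · rw [ArithmeticFunction.vonMangoldt_eq_zero_iff.2 hpp]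
      simp
  unfold normMangoldtLog
  refine (mul_le_mul_of_nonneg_left h1 (by positivity)).trans (le_of_eq ?_)
  field_simp
  ring

end DensitySetup

theorem InClass.of_isPrimePow {n : ℕ} {c : (ZMod Q)ˣ →* (Fin n → ℤˣ)} {g : Fin n → ℤˣ}
    (hg : g ≠ 1) {m : ℕ} (hm : InClass c g m) (hpp : IsPrimePow m) :
    ∃ q, q.Prime ∧ q ≤ m ∧ InClass c g q := by
  obtain ⟨q, a, hq, ha, rfl⟩ := hpp
  rw [← Nat.prime_iff] at hq
  have hcop : q.Coprime Q := Nat.Coprime.coprime_dvd_left (dvd_pow_self q ha.ne') hm.coprime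
  obtain ⟨e, he⟩ := exists_inClass (c := c) hcop
  refine ⟨q, hq, Nat.le_self_pow ha.ne' q, ?_⟩
  have h1 := (he.pow a).unique hm
  have h2 : e ^ 2 = 1 := by rw [sq, signVec_mul_self]
  rcases Nat.even_or_odd' a with ⟨j, rfl | rfl⟩
  · rw [pow_mul, h2, one_pow] at h1
    exact absurd h1.symm hg
  · rw [pow_succ, pow_mul, h2, one_pow, one_mul] at h1
    rwa [← h1]

end Tail

set_option maxHeartbeats 1600000 in
/-- If a class contains no small prime, some sign character is exceptional. -/
theorem exists_exceptional_signChar (η : ℝ) (hη : 0 < η) (K₁ : ℕ) :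
    ∃ b k K₀ : ℕ, K₁ ≤ K₀ ∧ Even b ∧ (2 * b + 14) ^ 6 ≤ 2 ^ k ∧
    ∀ {Q n : ℕ} [NeZero Q] {c : (ZMod Q)ˣ →* (Fin n → ℤˣ)} {I : ℕ} {s : ℝ},
      Function.Surjective c → 1 ≤ I → Q < 2 ^ 2 ^ I →
      s = 1 / (2 ^ k * Real.log (2 ^ 2 ^ I : ℕ)) → ∀ g, g ≠ 1 →
      (∀ q : ℕ, q.Prime → InClass c g q → K₀ / s ≤ Real.log q) → ∀ N₁ : ℕ,
      ∃ N ≥ N₁, ∃ T : Finset (Fin n), T.Nonempty ∧ signChar T g = 1 ∧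
        ∑ h, (if signChar T h = 1 then
          mangoldtClass c (2 ^ 2 ^ I) (densityCutoff I b) h s N else 0) ≤ η / s := by
  have ht : Filter.Tendsto (fun x : ℝ => 24 * (x ^ 1 * Real.exp (-x))) Filter.atTop (nhds 0) := by
    simpa using (Real.tendsto_pow_mul_exp_neg_atTop_nhds_zero 1).const_mul 24
  obtain ⟨x, hx1, hx2⟩ := ((ht.eventually_le_const
    (by positivity : 0 < min (1 / 100) (η / 12))).and (Filter.eventually_ge_atTop 1)).exists
  set K : ℝ := 2 * x with hK
  set ε : ℝ := 12 * Real.exp (-(K / 2)) with hε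
  have hKx : K / 2 = x := by rw [hK]; ring
  have hKε : K * ε ≤ min (1 / 100) (η / 12) := by
    refine le_trans (le_of_eq ?_) hx1
    rw [hε, hKx, hK]; ring
  have hK1 : 2 ≤ K := by linarith
  have hε0 : 0 < ε := by positivity
  have hε1 : ε ≤ 1 := by nlinarith [hKε.trans (min_le_left _ _)]
  obtain ⟨H₁, hH₁, hd⟩ := density_bounds (ε / 4) (by linarith)
  obtain ⟨H₂, hH₂, hf⟩ := normMangoldt_le ε hε0 hε1
  set H := max H₁ H₂ with hH
  have hH1 : 1 ≤ H := hH₁.trans (le_max_left _ _)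
  obtain ⟨b, k, hb, hΔ6, hκ, hΔ⟩ := exists_density_parameters H hH1
  have hm0 : (1 : ℝ) ≤ (2 * b + 14 : ℕ) := by exact_mod_cast (by omega : 1 ≤ 2 * b + 14)
  set m0 : ℝ := ((2 * b + 14 : ℕ) : ℝ) with hm0'
  have hm36 : m0 ^ 3 ≤ m0 ^ 6 := pow_le_pow_right₀ hm0 (by norm_num)
  have hm06 : 0 ≤ m0 ^ 6 := by positivity
  have hm03 : 0 ≤ m0 ^ 3 := by positivity
  set κ : ℝ := 2 ^ k with hκ'
  have hκ1 : 1 ≤ κ := one_le_pow₀ (by norm_num)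
  have hΔ0 := sieveErr_pos b
  have hH₁κ : H₁ * m0 ^ 3 ≤ κ := by
    calc H₁ * m0 ^ 3 ≤ H * m0 ^ 6 := by gcongr; exact le_max_left _ _
      _ ≤ κ := hκ
  have hH₂κ : H₂ * m0 ^ 6 ≤ κ := by
    calc H₂ * m0 ^ 6 ≤ H * m0 ^ 6 := by gcongr; exact le_max_right _ _
      _ ≤ κ := hκ
  have hi1 : 1 / H ≤ 1 / H₁ := one_div_le_one_div_of_le (by linarith) (le_max_left _ _)
  have hi2 : 1 / H ≤ 1 / H₂ := one_div_le_one_div_of_le (by linarith) (le_max_right _ _)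
  have hΔκ : sieveErr b * κ ^ 2 ≤ 1 / H := by
    refine le_trans ?_ hΔ
    gcongr; linarith
  set K₀ : ℕ := max K₁ (⌈K⌉₊ + 4) with hK₀
  have hK₀K : K + 4 ≤ K₀ := by
    calc K + 4 ≤ ((⌈K⌉₊ + 4 : ℕ) : ℝ) := by push_cast; linarith [Nat.le_ceil K]
      _ ≤ K₀ := by exact_mod_cast le_max_right _ _
  refine ⟨b, k, K₀, le_max_left _ _, hb, ?_, ?_⟩
  · have : m0 ^ 6 ≤ 2 ^ k := le_trans (by nlinarith) hκ
    rw [hm0'] at this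
    exact_mod_cast this
  intro Q n _ c I s hc hI hQ hs g hg hno N₁
  have D : DensitySetup c I b κ s := ⟨hc, hI, hb, hΔ6, hQ, hκ1, hs⟩
  have D2 : DensitySetup c I b (2 * κ) (s / 2) := D.rescale (by linarith) (by ring)
  have hs0 := D.s_pos
  have hgp := D.card_pos
  obtain ⟨hA, hB, hC, hE⟩ := hd D hH₁κ (hΔκ.trans hi1)
  have hA2 := (hd D2 (hH₁κ.trans (by linarith)) (hΔ.trans hi1)).1
  have hF := hf D hH₂κ (hΔκ.trans hi2)
  have hconv : ∀ N h, 0 ≤ (∑ k, normMangoldt c I b (s / 2) N k *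
      normMangoldt c I b (s / 2) N (k⁻¹ * h)) / Fintype.card (Fin n → ℤˣ) := fun N h =>
    div_nonneg (Finset.sum_nonneg fun k _ =>
      mul_nonneg (D2.normMangoldt_nonneg N k) (D2.normMangoldt_nonneg N _)) hgp.le
  have hT2 : ∀ N, 1 ≤ N → ∀ h, normMangoldtLog c I b (s / 2) N h ≤ 3 := fun N hN h => by
    linarith [hA2 N hN h, hconv N h]
  have htend : Filter.Tendsto (fun N : ℕ => N ^ 2) Filter.atTop Filter.atTop :=
    Filter.tendsto_pow_atTop two_ne_zero
  obtain ⟨N, ⟨⟨-, -, hN1⟩, hN2, hN3, -⟩, hN4⟩ := ((hC.and (htend.eventually hC)).and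
    (Filter.eventually_ge_atTop (max N₁ 1))).exists
  have hNN1 : 1 ≤ N := (le_max_right _ _).trans hN4
  have hNsq : 1 ≤ N ^ 2 := Nat.one_le_pow _ _ hNN1
  have hgt : normMangoldtLog c I b s (N ^ 2) g ≤ ε / 4 := by
    have h1 := D.normMangoldtLog_le_of_forall (K := K₀) (h := g) (fun m hm hpp => by
      obtain ⟨q, hq, hqm, hqg⟩ := hm.of_isPrimePow hg hpp
      exact (hno q hq hqg).trans (Real.log_le_log (by exact_mod_cast hq.pos)
        (by exact_mod_cast hqm))) (N ^ 2)
    have h2 := hT2 _ hNsq g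
    have h3 : Real.exp (-((K₀ : ℝ) / 2)) ≤ Real.exp (-(K / 2)) * (1 / 4) := by
      have h4 : Real.exp (-2) ≤ 1 / 4 := by
        rw [Real.exp_neg, inv_eq_one_div]
        apply one_div_le_one_div_of_le (by norm_num)
        have := Real.add_one_le_exp (1 : ℝ)
        calc (4 : ℝ) ≤ Real.exp 1 * Real.exp 1 := by nlinarith
          _ = Real.exp 2 := by rw [← Real.exp_add]; norm_num
      calc Real.exp (-((K₀ : ℝ) / 2)) ≤ Real.exp (-(K / 2) + -2) := by
            rw [Real.exp_le_exp]; linarith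
        _ = Real.exp (-(K / 2)) * Real.exp (-2) := Real.exp_add _ _
        _ ≤ _ := by gcongr
    refine h1.trans ?_
    calc 4 * Real.exp (-((K₀ : ℝ) / 2)) * normMangoldtLog c I b (s / 2) (N ^ 2) g
        ≤ 4 * (Real.exp (-(K / 2)) * (1 / 4)) * 3 := by
          gcongr
          exact D2.normMangoldtLog_nonneg _ _
      _ = ε / 4 := by rw [hε]; ring
  have h4 : 2 - ε ≤ (∑ k, normMangoldt c I b s (N ^ 2) k *
      normMangoldt c I b s (N ^ 2) (k⁻¹ * g)) / Fintype.card (Fin n → ℤˣ) := by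
    have h5 := hE (N ^ 2) (fun h => (hF _ hNsq h).trans (by linarith)) g
    linarith [hN1 g]
  obtain ⟨T, hT, hTg, hsum⟩ := exists_signChar (normMangoldt c I b s (N ^ 2))
    (normMangoldtLog c I b s (N ^ 2)) (fun _ => ε) g (K := K) (ε := ε) rfl (by linarith) hε0
    (hKε.trans (min_le_left _ _)) (D.normMangoldt_nonneg _) (fun _ => hε0.le)
    (fun h => (hA _ hNsq h).trans (by linarith)) (hF _ hNsq)
    ((hB _).trans (by nlinarith)) (le_trans (by nlinarith) hN2)
    (le_trans (by nlinarith) hN3) h4 (fun h => by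
      refine (D.normMangoldtLog_le (by linarith : 0 ≤ K) _ h).trans
        (add_le_add le_rfl ?_)
      have h2 := hT2 _ hNsq h
      calc 4 * Real.exp (-(K / 2)) * normMangoldtLog c I b (s / 2) (N ^ 2) h
          ≤ 4 * Real.exp (-(K / 2)) * 3 := by gcongr
        _ = ε := by rw [hε]; ring)
    (by rw [Finset.sum_const, Finset.card_univ, nsmul_eq_mul, mul_comm])
  refine ⟨N ^ 2, ((le_max_left _ _).trans hN4).trans (Nat.le_self_pow two_ne_zero N), T, hT, hTg, ?_⟩
  have e : ∑ h, (if signChar T h = 1 then normMangoldt c I b s (N ^ 2) h else 0) =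
      s * Fintype.card (Fin n → ℤˣ) * ∑ h, (if signChar T h = 1 then
        mangoldtClass c (2 ^ 2 ^ I) (densityCutoff I b) h s (N ^ 2) else 0) := by
    rw [Finset.mul_sum]
    apply Finset.sum_congr rfl
    intro h _
    unfold normMangoldt
    split_ifs <;> simp
  rw [e] at hsum
  have h6 : 12 * (K * ε) ≤ η := by linarith [hKε.trans (min_le_right _ _)]
  rw [le_div_iff₀ hs0]
  refine le_of_mul_le_mul_right ?_ hgp
  calc _ = _ := by ring
    _ ≤ _ := hsum
    _ ≤ _ := mul_le_mul_of_nonneg_right h6 hgp.le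

/-- A real, completely multiplicative function with values in `{0, 1, -1}` and partial sums
bounded by `Q`. -/
structure RealCharacter (Q : ℕ) (χ : ℕ → ℝ) : Prop where
  one : χ 1 = 1
  mul : ∀ a b, χ (a * b) = χ a * χ b
  values : ∀ a, χ a = 0 ∨ χ a = 1 ∨ χ a = -1
  sum_le : ∀ t, |∑ a ∈ Finset.Ioc 0 t, χ a| ≤ Q

/-- The convolution `1 * χ`. -/
noncomputable def charConv (χ : ℕ → ℝ) (m : ℕ) : ℝ := ∑ a ∈ m.divisors, χ a

section Character
variable {Q : ℕ} {χ : ℕ → ℝ}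

theorem RealCharacter.abs_le_one (hχ : RealCharacter Q χ)
    (a : ℕ) : |χ a| ≤ 1 := by
  rcases hχ.values a with h | h | h <;> rw [h] <;> norm_num

theorem RealCharacter.pow (hχ : RealCharacter Q χ)
    (a k : ℕ) : χ (a ^ k) = χ a ^ k := by
  induction k with
  | zero => simpa using hχ.one
  | succ k ih => rw [pow_succ, hχ.mul, ih, pow_succ]

theorem RealCharacter.charConv_mul (hχ : RealCharacter Q χ)
    {a b : ℕ} (h : a.Coprime b) :
    charConv χ (a * b) = charConv χ a * charConv χ b := by
  unfold charConv
  rw [Nat.divisors_mul, Finset.mul_def, Finset.sum_image h.mul_injOn_divisors,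
    Finset.sum_mul_sum, Finset.sum_product]
  simp_rw [hχ.mul]

theorem RealCharacter.charConv_prime_pow (hχ : RealCharacter Q χ)
    {p : ℕ} (hp : p.Prime) (k : ℕ) :
    charConv χ (p ^ k) = ∑ i ∈ Finset.range (k + 1), χ p ^ i := by
  unfold charConv
  rw [Nat.sum_divisors_prime_pow hp]
  simp_rw [hχ.pow]

theorem RealCharacter.charConv_nonneg (hχ : RealCharacter Q χ)
    (m : ℕ) : 0 ≤ charConv χ m := by
  induction m using Nat.recOnPosPrimePosCoprime with
  | zero => simp [charConv]
  | one => simp [charConv, hχ.one]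
  | prime_pow p k hp hk =>
    rw [hχ.charConv_prime_pow hp]
    rcases hχ.values p with h | h | h <;> rw [h]
    · apply Finset.sum_nonneg; intros; positivity
    · apply Finset.sum_nonneg; intros; positivity
    · rw [neg_one_geom_sum]; split_ifs <;> norm_num
  | coprime a b ha hb hab iha ihb =>
    rw [hχ.charConv_mul hab]
    exact mul_nonneg iha ihb

theorem RealCharacter.one_le_charConv_sq (hχ : RealCharacter Q χ)
    {m : ℕ} (hm : m ≠ 0) : 1 ≤ charConv χ (m ^ 2) := by
  induction m using Nat.recOnPosPrimePosCoprime with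
  | zero => exact absurd rfl hm
  | one => simp [charConv, hχ.one]
  | prime_pow p k hp hk =>
    rw [← pow_mul, hχ.charConv_prime_pow hp]
    rcases hχ.values p with h | h | h <;> rw [h]
    · rw [Finset.sum_range_succ']
      simp
    · simp
    · rw [neg_one_geom_sum, if_neg]
      rw [Nat.not_even_iff_odd]
      exact ⟨k, by ring⟩
  | coprime a b ha hb hab iha ihb =>
    rw [mul_pow, hχ.charConv_mul (hab.pow 2 2)]
    exact one_le_mul_of_one_le_of_one_le (iha (by omega)) (ihb (by omega))

theorem RealCharacter.charConv_prime_mul (hχ : RealCharacter Q χ)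
    {l : ℕ} (hl : l.Prime) {k : ℕ} (hk : 0 < k) :
    charConv χ (l * k) =
      (1 + χ l) * charConv χ k - χ l * (if l ∣ k then charConv χ (k / l) else 0) := by
  obtain ⟨a, k', hk', rfl⟩ := Nat.exists_eq_pow_mul_and_not_dvd hk.ne' l hl.ne_one
  have hc : ∀ i, (l ^ i).Coprime k' := fun i =>
    Nat.Coprime.pow_left i ((Nat.Prime.coprime_iff_not_dvd hl).2 hk')
  rw [← mul_assoc, ← pow_succ', hχ.charConv_mul (hc _), hχ.charConv_mul (hc _),
    hχ.charConv_prime_pow hl, hχ.charConv_prime_pow hl]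
  rcases a with _ | a
  · simp [hk', Finset.sum_range_succ]
  · have e : l ^ (a + 1) * k' / l = l ^ a * k' := by
      rw [pow_succ', mul_assoc, Nat.mul_div_cancel_left _ hl.pos]
    rw [if_pos (Dvd.dvd.mul_right (dvd_pow_self l (by omega)) k'), e, hχ.charConv_mul (hc _),
      hχ.charConv_prime_pow hl, Finset.sum_range_succ _ (a + 1 + 1), Finset.sum_range_succ _ (a + 1)]
    ring

end Character

theorem sum_pow_two_step (w : ℝ) (a : ℕ) :
    (a + 1 : ℝ) * w ^ a ≤ ∑ i ∈ Finset.range (a + 1), (w ^ 2) ^ i := by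
  induction a using Nat.strong_induction_on with
  | _ a ih =>
    rcases a with _ | _ | a
    · simp
    · simp only [Finset.sum_range_succ, Finset.sum_range_zero]
      push_cast
      nlinarith [sq_nonneg (w - 1)]
    · have h := ih a (by omega)
      rw [Finset.sum_range_succ, Finset.sum_range_succ']
      have e : ∑ k ∈ Finset.range (a + 1), (w ^ 2) ^ (k + 1) =
          w ^ 2 * ∑ k ∈ Finset.range (a + 1), (w ^ 2) ^ k := by
        rw [Finset.mul_sum]
        exact Finset.sum_congr rfl fun k _ => by ring
      rw [e]
      have h2 : w ^ 2 * ((a + 1 : ℝ) * w ^ a) ≤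
          w ^ 2 * ∑ k ∈ Finset.range (a + 1), (w ^ 2) ^ k := by gcongr
      have h3 : (w ^ 2) ^ (a + 1 + 1) = (w ^ (a + 2)) ^ 2 := by ring
      have h4 : w ^ (a + 1 + 1) = w ^ (a + 2) := rfl
      rw [h3]
      push_cast
      have h5 : w ^ 2 * ((a + 1 : ℝ) * w ^ a) = (a + 1) * w ^ (a + 2) := by ring
      rw [h5] at h2
      nlinarith [sq_nonneg (w ^ (a + 2) - 1)]

/-- Smooth weight comparing Lambert terms with harmonic terms. -/
noncomputable def lambertWeight (x : ℝ) (a : ℕ) : ℝ := 1 / (a * (1 - x)) - x ^ a / (1 - x ^ a)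

theorem lambertWeight_eq (x : ℝ) (a : ℕ) :
    lambertWeight x a = (1 / a - x ^ a / ∑ i ∈ Finset.range a, x ^ i) / (1 - x) := by
  have h : 1 - x ^ a = (∑ i ∈ Finset.range a, x ^ i) * (1 - x) := (geom_sum_mul_neg x a).symm
  unfold lambertWeight
  rw [h, sub_div, div_div, div_div]

theorem lambertWeight_succ_le {x : ℝ} (h0 : 0 < x) (h1 : x < 1) {a : ℕ} (ha : 0 < a) :
    lambertWeight x (a + 1) ≤ lambertWeight x a := by
  rw [lambertWeight_eq, lambertWeight_eq]
  apply div_le_div_of_nonneg_right _ (by linarith)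
  set S := ∑ i ∈ Finset.range a, x ^ i with hS
  set S' := ∑ i ∈ Finset.range (a + 1), x ^ i with hS'
  have hSpos : 0 < S := Finset.sum_pos (fun i _ => by positivity) ⟨0, by simpa using ha⟩
  have hS'pos : 0 < S' := Finset.sum_pos (fun i _ => by positivity) ⟨0, by simp⟩
  have e : S' = 1 + x * S := by
    rw [hS', Finset.sum_range_succ', hS, Finset.mul_sum]
    simp only [pow_zero, pow_succ']
    ring
  obtain ⟨w, hw0, rfl⟩ : ∃ w, 0 ≤ w ∧ x = w ^ 2 := ⟨√x, Real.sqrt_nonneg x, (Real.sq_sqrt h0.le).symm⟩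
  have hw1 : w ≤ 1 := by nlinarith
  obtain ⟨k, rfl⟩ : ∃ k, a = k + 1 := ⟨a - 1, by omega⟩
  have hb1 := sum_pow_two_step w k
  have hb2 := sum_pow_two_step w (k + 1)
  have ha' : (0 : ℝ) < ((k + 1 : ℕ) : ℝ) := by positivity
  have hprod : ((k + 1 : ℕ) : ℝ) * ((k + 1 : ℕ) + 1) * (w ^ 2) ^ (k + 1) ≤ S * S' := by
    calc ((k + 1 : ℕ) : ℝ) * ((k + 1 : ℕ) + 1) * (w ^ 2) ^ (k + 1)
        = (((k + 1 : ℕ) : ℝ) * ((k + 1 : ℕ) + 1) * w ^ (2 * k + 1)) * w := by ring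
      _ ≤ (((k + 1 : ℕ) : ℝ) * ((k + 1 : ℕ) + 1) * w ^ (2 * k + 1)) * 1 := by gcongr
      _ = ((k + 1 : ℝ) * w ^ k) * (((k + 1 : ℕ) + 1 : ℝ) * w ^ (k + 1)) := by push_cast; ring
      _ ≤ S * S' := by gcongr
  set A : ℝ := ((k + 1 : ℕ) : ℝ) with hA
  have hA1 : (((k + 1) + 1 : ℕ) : ℝ) = A + 1 := by rw [hA]; push_cast; ring
  rw [hA1]
  have e1 : (w ^ 2) ^ (k + 1) / S - (w ^ 2) ^ (k + 1 + 1) / S' = (w ^ 2) ^ (k + 1) / (S * S') := by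
    rw [div_sub_div _ _ hSpos.ne' hS'pos.ne', e]; congr 1; ring
  have e2 : 1 / A - 1 / (A + 1) = 1 / (A * (A + 1)) := by field_simp; ring
  have h3 : (w ^ 2) ^ (k + 1) / (S * S') ≤ 1 / (A * (A + 1)) := by
    rw [div_le_div_iff₀ (by positivity) (by positivity)]
    linarith
  linarith

theorem lambertWeight_nonneg {x : ℝ} (h0 : 0 < x) (h1 : x < 1) {a : ℕ} (ha : 0 < a) :
    0 ≤ lambertWeight x a := by
  rw [lambertWeight_eq]
  apply div_nonneg _ (by linarith)
  have hSpos : 0 < ∑ i ∈ Finset.range a, x ^ i :=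
    Finset.sum_pos (fun i _ => by positivity) ⟨0, by simpa using ha⟩
  have : (a : ℝ) * x ^ a ≤ ∑ i ∈ Finset.range a, x ^ i := by
    have h : ∑ i ∈ Finset.range a, x ^ a ≤ ∑ i ∈ Finset.range a, x ^ i :=
      Finset.sum_le_sum fun i hi =>
        pow_le_pow_of_le_one h0.le h1.le (Finset.mem_range.1 hi).le
    simpa using h
  rw [sub_nonneg, div_le_div_iff₀ hSpos (by positivity)]
  linarith

theorem lambertWeight_one {x : ℝ} (h1 : x < 1) : lambertWeight x 1 = 1 := by
  unfold lambertWeight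
  have : 1 - x ≠ 0 := by linarith
  field_simp
  simp

/-- Truncated Lambert expansion of a convolution. -/
theorem sum_charConv_mul_eq (χ f : ℕ → ℝ) (N : ℕ) :
    ∑ m ∈ Finset.Ioc 0 N, charConv χ m * f m =
      ∑ a ∈ Finset.Ioc 0 N, ∑ b ∈ Finset.Ioc 0 (N / a), χ a * f (a * b) := by
  unfold charConv
  simp_rw [Finset.sum_mul]
  rw [Finset.sum_sigma', Finset.sum_sigma']
  refine Finset.sum_bij' (fun x _ => ⟨x.2, x.1 / x.2⟩) (fun x _ => ⟨x.1 * x.2, x.1⟩) ?_ ?_ ?_ ?_ ?_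
  · rintro ⟨m, a⟩ h
    simp only [Finset.mem_sigma, Finset.mem_Ioc, Nat.mem_divisors] at h ⊢
    obtain ⟨⟨h1, h2⟩, h3, h4⟩ := h
    have ha := Nat.pos_of_dvd_of_pos h3 h1
    exact ⟨⟨ha, (Nat.le_of_dvd h1 h3).trans h2⟩, Nat.div_pos (Nat.le_of_dvd h1 h3) ha,
      Nat.div_le_div_right h2⟩
  · rintro ⟨a, b⟩ h
    simp only [Finset.mem_sigma, Finset.mem_Ioc, Nat.mem_divisors] at h ⊢
    obtain ⟨⟨h1, h2⟩, h3, h4⟩ := h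
    refine ⟨⟨by positivity, ?_⟩, dvd_mul_right _ _, by positivity⟩
    have := (Nat.le_div_iff_mul_le h1).1 h4
    linarith
  · rintro ⟨m, a⟩ h
    simp only [Finset.mem_sigma, Finset.mem_Ioc, Nat.mem_divisors] at h
    simp [Nat.mul_div_cancel' h.2.1]
  · rintro ⟨a, b⟩ h
    simp only [Finset.mem_sigma, Finset.mem_Ioc] at h
    simp [Nat.mul_div_cancel_left b h.1.1]
  · rintro ⟨m, a⟩ h
    simp only [Finset.mem_sigma, Finset.mem_Ioc, Nat.mem_divisors] at h
    simp [Nat.mul_div_cancel' h.2.1]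

section Character
variable {Q : ℕ} {χ : ℕ → ℝ}

theorem RealCharacter.sum_Ioc_le (hχ : RealCharacter Q χ)
    (M t : ℕ) : |∑ a ∈ Finset.Ioc M t, χ a| ≤ 2 * Q := by
  rcases Nat.le_total t M with h | h
  · rw [Finset.Ioc_eq_empty (by omega)]; simp
  · have e := Finset.sum_Ioc_consecutive χ (Nat.zero_le M) h
    have h1 := hχ.sum_le M
    have h2 := hχ.sum_le t
    rw [abs_le] at *
    constructor <;> linarith [h1.1, h1.2, h2.1, h2.2]

theorem RealCharacter.sum_div_le (hχ : RealCharacter Q χ)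
    (M N : ℕ) :
    |∑ a ∈ Finset.Ioc M N, χ a / a| ≤ 2 * Q / (M + 1 : ℕ) := by
  have := abel_bound χ (fun a => 1 / (a : ℝ)) M (2 * Q) (hχ.sum_Ioc_le M)
    (fun m hm => by
      apply one_div_le_one_div_of_le
      · exact_mod_cast (by omega : 0 < m)
      · push_cast; linarith) (fun m _ => by positivity) N
  simpa [div_eq_mul_inv] using this

theorem RealCharacter.exists_lvalue (hχ : RealCharacter Q χ) : ∃ L : ℝ,
    Filter.Tendsto (fun N => ∑ a ∈ Finset.Ioc 0 N, χ a / a) Filter.atTop (nhds L) ∧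
    ∀ M : ℕ, |∑ a ∈ Finset.Ioc 0 M, χ a / a - L| ≤ 2 * Q / (M + 1 : ℕ) := by
  have hd : ∀ M N, M ≤ N → |∑ a ∈ Finset.Ioc 0 M, χ a / a - ∑ a ∈ Finset.Ioc 0 N, χ a / a| ≤
      2 * Q / (M + 1 : ℕ) := by
    intro M N h
    rw [← Finset.sum_Ioc_consecutive _ (Nat.zero_le M) h]
    rw [sub_add_cancel_left, abs_neg]
    exact hχ.sum_div_le M N
  have ht : Filter.Tendsto (fun M : ℕ => 2 * (Q : ℝ) / (M + 1 : ℕ)) Filter.atTop (nhds 0) := by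
    have := (tendsto_const_div_atTop_nhds_zero_nat (2 * (Q : ℝ)))
    exact this.comp (Filter.tendsto_add_atTop_nat 1)
  have hc : CauchySeq (fun N => ∑ a ∈ Finset.Ioc 0 N, χ a / a) := by
    apply cauchySeq_of_le_tendsto_0' (fun M : ℕ => 2 * (Q : ℝ) / (M + 1 : ℕ)) _ ht
    intro M N h
    rw [Real.dist_eq]; exact hd M N h
  obtain ⟨L, hL⟩ := cauchySeq_tendsto_of_complete hc
  refine ⟨L, hL, fun M => ?_⟩
  refine le_of_tendsto ((hL.const_sub _).abs) ?_
  filter_upwards [Filter.eventually_ge_atTop M] with N hN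
  exact hd M N hN

theorem RealCharacter.lambert_lower (hχ : RealCharacter Q χ)
    {x : ℝ} (h0 : 0 < x) (h1 : x < 1) {N : ℕ} :
    ∑ j ∈ Finset.Ioc 0 (Nat.sqrt N), x ^ (j ^ 2) ≤
      (∑ a ∈ Finset.Ioc 0 N, χ a / a) / (1 - x) + Q + N * x ^ N / (1 - x) := by
  have hx : 0 < 1 - x := by linarith
  have hb := abel_bound χ (lambertWeight x) 0 Q hχ.sum_le
    (fun m hm => lambertWeight_succ_le h0 h1 hm) (fun m hm => lambertWeight_nonneg h0 h1 hm) N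
  rw [zero_add, lambertWeight_one h1, mul_one] at hb
  have e1 : ∑ a ∈ Finset.Ioc 0 N, χ a * lambertWeight x a =
      (∑ a ∈ Finset.Ioc 0 N, χ a / a) / (1 - x) -
        ∑ a ∈ Finset.Ioc 0 N, χ a * (x ^ a / (1 - x ^ a)) := by
    rw [Finset.sum_div, ← Finset.sum_sub_distrib]
    refine Finset.sum_congr rfl fun a _ => ?_
    unfold lambertWeight
    rw [mul_sub, mul_one_div, div_div]
  have e2 : ∑ m ∈ Finset.Ioc 0 N, charConv χ m * x ^ m ≤
      ∑ a ∈ Finset.Ioc 0 N, χ a * (x ^ a / (1 - x ^ a)) + N * x ^ N / (1 - x) := by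
    rw [sum_charConv_mul_eq χ (fun m => x ^ m)]
    have e3 : (N : ℝ) * x ^ N / (1 - x) = ∑ a ∈ Finset.Ioc 0 N, x ^ N / (1 - x) := by
      simp [mul_div_assoc]
    rw [e3, ← Finset.sum_add_distrib]
    apply Finset.sum_le_sum
    intro a ha
    rw [Finset.mem_Ioc] at ha
    have ha1 : x ^ a < 1 := pow_lt_one₀ h0.le h1 (by omega)
    have ha2 : x ^ a ≤ x := pow_le_of_le_one h0.le h1.le (by omega)
    have hs : ∑ b ∈ Finset.Ioc 0 (N / a), χ a * x ^ (a * b) =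
        χ a * (x ^ a / (1 - x ^ a)) - χ a * (x ^ (a * (N / a + 1)) / (1 - x ^ a)) := by
      rw [← Finset.mul_sum, ← mul_sub]
      congr 1
      have h3 : 1 - x ^ a ≠ 0 := by linarith
      rw [← sub_div, eq_div_iff h3]
      generalize N / a = k
      induction k with
      | zero => simp
      | succ k ih =>
        rw [Finset.sum_Ioc_succ_top (by omega), add_mul, ih]
        ring
    rw [hs]
    have h4 : |χ a * (x ^ (a * (N / a + 1)) / (1 - x ^ a))| ≤ x ^ N / (1 - x) := by
      rw [abs_mul, abs_of_nonneg (a := x ^ (a * (N / a + 1)) / (1 - x ^ a))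
        (div_nonneg (by positivity) (by linarith))]
      calc _ ≤ 1 * (x ^ (a * (N / a + 1)) / (1 - x ^ a)) := by
            apply mul_le_mul_of_nonneg_right (hχ.abs_le_one a)
            exact div_nonneg (by positivity) (by linarith)
        _ = x ^ (a * (N / a + 1)) / (1 - x ^ a) := one_mul _
        _ ≤ x ^ N / (1 - x) := by
            apply div_le_div₀ (by positivity) _ hx (by linarith)
            apply pow_le_pow_of_le_one h0.le h1.le
            have := Nat.div_add_mod N a
            have := Nat.mod_lt N ha.1
            rw [mul_add]; omega
    linarith [neg_le_of_abs_le h4]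
  have e4 : ∑ j ∈ Finset.Ioc 0 (Nat.sqrt N), x ^ (j ^ 2) ≤
      ∑ m ∈ Finset.Ioc 0 N, charConv χ m * x ^ m := by
    have hinj : Set.InjOn (fun j : ℕ => j ^ 2) (Finset.Ioc 0 (Nat.sqrt N) : Finset ℕ) :=
      fun a _ b _ h => Nat.pow_left_injective two_ne_zero h
    calc ∑ j ∈ Finset.Ioc 0 (Nat.sqrt N), x ^ (j ^ 2)
        ≤ ∑ j ∈ Finset.Ioc 0 (Nat.sqrt N), charConv χ (j ^ 2) * x ^ (j ^ 2) := by
          refine Finset.sum_le_sum fun j hj => ?_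
          rw [Finset.mem_Ioc] at hj
          exact le_mul_of_one_le_left (by positivity) (hχ.one_le_charConv_sq (by omega))
      _ = ∑ m ∈ (Finset.Ioc 0 (Nat.sqrt N)).image (fun j => j ^ 2), charConv χ m * x ^ m :=
          (Finset.sum_image (f := fun m => charConv χ m * x ^ m) hinj).symm
      _ ≤ _ := by
          apply Finset.sum_le_sum_of_subset_of_nonneg
          · intro m hm
            simp only [Finset.mem_image, Finset.mem_Ioc] at hm ⊢
            obtain ⟨j, ⟨hj1, hj2⟩, rfl⟩ := hm
            exact ⟨by positivity, by nlinarith [Nat.sqrt_le' N, Nat.pow_le_pow_left hj2 2]⟩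
          · intro m _ _
            exact mul_nonneg (hχ.charConv_nonneg m) (by positivity)
  rw [abs_le] at hb
  linarith [hb.1, hb.2]

theorem RealCharacter.lvalue_ge (hχ : RealCharacter Q χ)
    (hQ : 0 < Q) {L : ℝ}
    (hL : Filter.Tendsto (fun N => ∑ a ∈ Finset.Ioc 0 N, χ a / a) Filter.atTop (nhds L)) :
    1 / (32 * Q) ≤ L := by
  have hQ' : (1 : ℝ) ≤ Q := by exact_mod_cast hQ
  set x : ℝ := 1 - 1 / (8 * Q) ^ 2 with hx
  have hd : 1 - x = 1 / (8 * Q) ^ 2 := by rw [hx]; ring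
  have hd1 : 1 / (8 * (Q : ℝ)) ^ 2 < 1 := by
    rw [div_lt_one (by positivity)]; nlinarith
  have hd0 : 0 < 1 / (8 * (Q : ℝ)) ^ 2 := by positivity
  have h0 : 0 < x := by rw [hx]; linarith
  have h1 : x < 1 := by rw [hx]; linarith
  have hlow : ∀ᶠ N : ℕ in Filter.atTop, (3 * Q : ℝ) ≤
      (∑ a ∈ Finset.Ioc 0 N, χ a / a) / (1 - x) + Q + N * x ^ N / (1 - x) := by
    filter_upwards [Filter.eventually_ge_atTop ((4 * Q) ^ 2)] with N hN
    refine le_trans ?_ (hχ.lambert_lower h0 h1)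
    have h4 : 4 * Q ≤ Nat.sqrt N := Nat.le_sqrt'.2 hN
    calc (3 * Q : ℝ) = ∑ j ∈ Finset.Ioc 0 (4 * Q), (3 / 4 : ℝ) := by
          rw [Finset.sum_const]; simp; ring
      _ ≤ ∑ j ∈ Finset.Ioc 0 (4 * Q), x ^ (j ^ 2) := by
          refine Finset.sum_le_sum fun j hj => ?_
          rw [Finset.mem_Ioc] at hj
          have hj' : (j : ℝ) ≤ 4 * Q := by exact_mod_cast hj.2
          have hb := one_add_mul_le_pow (a := -(1 / (8 * (Q : ℝ)) ^ 2)) (by linarith) (j ^ 2)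
          have e : 1 + -(1 / (8 * (Q : ℝ)) ^ 2) = x := by rw [hx]; ring
          rw [e] at hb
          refine le_trans ?_ hb
          have h5 : ((j ^ 2 : ℕ) : ℝ) * (1 / (8 * (Q : ℝ)) ^ 2) ≤ 1 / 4 := by
            rw [mul_one_div, div_le_iff₀ (by positivity)]
            push_cast; nlinarith
          linarith
      _ ≤ _ := Finset.sum_le_sum_of_subset_of_nonneg (Finset.Ioc_subset_Ioc le_rfl h4)
          fun j _ _ => by positivity
  have hz : Filter.Tendsto (fun N : ℕ => (N : ℝ) * x ^ N / (1 - x)) Filter.atTop (nhds 0) := by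
    have := (tendsto_self_mul_const_pow_of_lt_one h0.le h1).div_const (1 - x)
    simpa using this
  have hlim := ge_of_tendsto (((hL.div_const (1 - x)).add_const (Q : ℝ)).add hz) hlow
  rw [hd, add_zero] at hlim
  have h6 : 2 * (Q : ℝ) ≤ L * (8 * Q) ^ 2 := by
    have : L / (1 / (8 * (Q : ℝ)) ^ 2) = L * (8 * Q) ^ 2 := by field_simp
    linarith
  rw [div_le_iff₀ (by positivity)]
  have h7 : (2 * (Q : ℝ)) * 1 ≤ (2 * Q) * (L * (32 * Q)) := by nlinarith
  exact le_of_mul_le_mul_left h7 (by positivity)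

end Character

section Hyperbola

theorem sum_Ioc_div_eq (f : ℕ → ℝ) {a : ℕ} (ha : 0 < a) (Y : ℕ) :
    ∑ b ∈ Finset.Ioc 0 (Y / a), f b = ∑ b ∈ Finset.Ioc 0 Y, if a * b ≤ Y then f b else 0 := by
  rw [← Finset.sum_filter]
  congr 1
  ext b
  simp only [Finset.mem_Ioc, Finset.mem_filter, Nat.le_div_iff_mul_le ha]
  constructor
  · rintro ⟨h1, h2⟩
    exact ⟨⟨h1, by nlinarith⟩, by linarith⟩
  · rintro ⟨⟨h1, _⟩, h3⟩
    exact ⟨h1, by linarith⟩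

theorem sum_Ioc_le_eq (f : ℕ → ℝ) {w Y : ℕ} (h : w ≤ Y) :
    ∑ b ∈ Finset.Ioc 0 w, f b = ∑ b ∈ Finset.Ioc 0 Y, if b ≤ w then f b else 0 := by
  rw [← Finset.sum_filter]
  congr 1
  ext b
  simp only [Finset.mem_Ioc, Finset.mem_filter]
  omega

/-- Dirichlet's hyperbola method. -/
theorem sum_hyperbola (F : ℕ → ℕ → ℝ) (Y : ℕ) :
    ∑ a ∈ Finset.Ioc 0 Y, ∑ b ∈ Finset.Ioc 0 (Y / a), F a b =
      ∑ a ∈ Finset.Ioc 0 (Nat.sqrt Y), ∑ b ∈ Finset.Ioc 0 (Y / a), F a b +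
      ∑ b ∈ Finset.Ioc 0 (Nat.sqrt Y), ∑ a ∈ Finset.Ioc 0 (Y / b), F a b -
      ∑ a ∈ Finset.Ioc 0 (Nat.sqrt Y), ∑ b ∈ Finset.Ioc 0 (Nat.sqrt Y), F a b := by
  have hw : Nat.sqrt Y ≤ Y := Nat.sqrt_le_self Y
  have e1 : ∀ s : Finset ℕ, (∀ a ∈ s, 0 < a) → ∑ a ∈ s, ∑ b ∈ Finset.Ioc 0 (Y / a), F a b =
      ∑ a ∈ s, ∑ b ∈ Finset.Ioc 0 Y, if a * b ≤ Y then F a b else 0 := fun s hs =>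
    Finset.sum_congr rfl fun a ha => sum_Ioc_div_eq _ (hs a ha) Y
  have e2 : ∑ b ∈ Finset.Ioc 0 (Nat.sqrt Y), ∑ a ∈ Finset.Ioc 0 (Y / b), F a b =
      ∑ b ∈ Finset.Ioc 0 (Nat.sqrt Y), ∑ a ∈ Finset.Ioc 0 Y, if b * a ≤ Y then F a b else 0 :=
    Finset.sum_congr rfl fun b hb => sum_Ioc_div_eq (fun a => F a b) (Finset.mem_Ioc.1 hb).1 Y
  rw [e1 _ fun a ha => (Finset.mem_Ioc.1 ha).1, e1 _ fun a ha => (Finset.mem_Ioc.1 ha).1, e2,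
    sum_Ioc_le_eq _ hw, sum_Ioc_le_eq _ hw, sum_Ioc_le_eq _ hw]
  have e3 : (∑ b ∈ Finset.Ioc 0 Y, if b ≤ Nat.sqrt Y then
      ∑ a ∈ Finset.Ioc 0 Y, (if b * a ≤ Y then F a b else 0) else 0) =
      ∑ a ∈ Finset.Ioc 0 Y, ∑ b ∈ Finset.Ioc 0 Y,
        if b ≤ Nat.sqrt Y then (if b * a ≤ Y then F a b else 0) else 0 := by
    rw [Finset.sum_comm]
    refine Finset.sum_congr rfl fun b _ => ?_
    split_ifs
    · rfl
    · simp
  rw [e3, ← Finset.sum_add_distrib, ← Finset.sum_sub_distrib]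
  refine Finset.sum_congr rfl fun a _ => ?_
  rw [sum_Ioc_le_eq (fun b => F a b) hw]
  have e4 : ∀ (p : Prop) [Decidable p] (f : ℕ → ℝ), (if p then ∑ b ∈ Finset.Ioc 0 Y, f b else 0) =
      ∑ b ∈ Finset.Ioc 0 Y, if p then f b else 0 := fun p _ f => by split_ifs <;> simp
  rw [e4, e4, ← Finset.sum_add_distrib, ← Finset.sum_sub_distrib]
  refine Finset.sum_congr rfl fun b _ => ?_
  rw [mul_comm b a]
  by_cases ha : a ≤ Nat.sqrt Y <;> by_cases hb : b ≤ Nat.sqrt Y <;> by_cases hab : a * b ≤ Y <;>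
    simp only [ha, hb, hab, if_true, if_false] <;> try ring1
  · exact absurd ((Nat.mul_le_mul ha hb).trans (Nat.sqrt_le Y)) hab
  · push Not at ha hb
    have h1 : (Nat.sqrt Y + 1) * (Nat.sqrt Y + 1) ≤ a * b := Nat.mul_le_mul ha hb
    have h2 := Nat.lt_succ_sqrt Y
    simp only [Nat.succ_eq_add_one] at h2
    omega

end Hyperbola

section ExceptionalChar
variable {Q n : ℕ} [NeZero Q] (c : (ZMod Q)ˣ →* (Fin n → ℤˣ)) (T : Finset (Fin n))

/-- The sign character as a function on the natural numbers. -/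
noncomputable def exChar (m : ℕ) : ℝ :=
  if m.Coprime Q then signChar T (classOf c m) else 0

variable {c}

theorem InClass.exChar_eq {h : Fin n → ℤˣ} {m : ℕ} (hm : InClass c h m) :
    exChar c T m = signChar T h := by
  unfold exChar
  rw [if_pos hm.coprime, ← hm.unique (inClass_classOf c hm.coprime)]

variable {T}

theorem sum_signChar_eq_zero (hT : T.Nonempty) : ∑ h : Fin n → ℤˣ, signChar T h = 0 := by
  obtain ⟨j, hj⟩ := hT
  set k : Fin n → ℤˣ := Function.update 1 j (-1) with hk
  have hkT : signChar T k = -1 := by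
    unfold signChar
    rw [Finset.prod_eq_single j]
    · simp [hk]
    · intro i _ hij
      simp [hk, Function.update_of_ne hij]
    · exact fun h => absurd hj h
  have h1 : ∑ h : Fin n → ℤˣ, signChar T (k * h) = ∑ h : Fin n → ℤˣ, signChar T h :=
    Equiv.sum_comp (Equiv.mulLeft k) (signChar T)
  simp_rw [signChar_mul, hkT] at h1
  rw [← Finset.mul_sum] at h1
  linarith

theorem exChar_realCharacter (hc : Function.Surjective c) (hT : T.Nonempty) :
    RealCharacter Q (exChar c T) where
  one := by
    have : InClass c 1 1 := ⟨1, by simp, by simp⟩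
    rw [this.exChar_eq]; simp [signChar]
  mul := by
    intro a b
    by_cases ha : a.Coprime Q
    · by_cases hb : b.Coprime Q
      · have h1 := inClass_classOf c ha
        have h2 := inClass_classOf c hb
        rw [(h1.mul h2).exChar_eq, h1.exChar_eq, h2.exChar_eq, signChar_mul]
      · have : ¬ (a * b).Coprime Q := fun h => hb (Nat.Coprime.coprime_mul_left h)
        simp [exChar, hb, this]
    · have : ¬ (a * b).Coprime Q := fun h => ha (Nat.Coprime.coprime_mul_right h)
      simp [exChar, ha, this]
  values := by
    intro a
    unfold exChar
    split_ifs
    · exact Or.inr (signChar_eq T _)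
    · exact Or.inl rfl
  sum_le := by
    classical
    have habs : ∀ m, |exChar c T m| ≤ 1 := by
      intro m
      unfold exChar
      split_ifs
      · rcases signChar_eq T (classOf c m) with h | h <;> rw [h] <;> norm_num
      · norm_num
    have hper : ∀ m, exChar c T (m + Q) = exChar c T m := by
      intro m
      by_cases hm : m.Coprime Q
      · have h1 := inClass_classOf c hm
        rw [h1.exChar_eq, ((inClass_add c _ m).2 h1).exChar_eq]
      · have : ¬ (m + Q).Coprime Q := by simpa using hm
        simp [exChar, hm, this]
    have e0 : ∀ m, exChar c T m = ∑ h, signChar T h * (if InClass c h m then 1 else 0) := by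
      intro m
      by_cases hm : m.Coprime Q
      · have h1 := inClass_classOf c hm
        rw [Finset.sum_eq_single (classOf c m), if_pos h1, h1.exChar_eq, mul_one]
        · intro h _ hne
          rw [if_neg fun h2 => hne (h2.unique h1), mul_zero]
        · exact fun h => absurd (Finset.mem_univ _) h
      · rw [Finset.sum_eq_zero]
        · simp [exChar, hm]
        · intro h _
          rw [if_neg fun h2 => hm h2.coprime, mul_zero]
    have hz : ∑ m ∈ Finset.range Q, exChar c T m = 0 := by
      simp_rw [e0]
      rw [Finset.sum_comm]
      simp_rw [← Finset.mul_sum, card_class_period c hc]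
      rw [← Finset.sum_mul, sum_signChar_eq_zero hT, zero_mul]
    have hz' : ∑ m ∈ Finset.range Q, exChar c T (m + 1) = 0 := by
      have h1 := Finset.sum_range_succ' (exChar c T) Q
      rw [Finset.sum_range_succ, hz] at h1
      have := hper 0
      rw [zero_add] at this
      linarith
    have key : ∀ t, |∑ m ∈ Finset.range t, exChar c T (m + 1)| ≤ Q := by
      intro t
      induction t using Nat.strong_induction_on with
      | _ t ih =>
        rcases Nat.lt_or_ge t Q with h | h
        · refine (Finset.abs_sum_le_sum_abs _ _).trans ?_
          refine (Finset.sum_le_sum fun m _ => habs (m + 1)).trans ?_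
          simpa using h.le
        · obtain ⟨r, rfl⟩ : ∃ r, t = Q + r := ⟨t - Q, by omega⟩
          rw [Finset.sum_range_add, hz', zero_add]
          have e : ∀ m, exChar c T (Q + m + 1) = exChar c T (m + 1) := fun m => by
            rw [show Q + m + 1 = m + 1 + Q by ring, hper]
          simp_rw [e]
          exact ih r (by have := NeZero.pos Q; omega)
    intro t
    have e : ∑ m ∈ Finset.Ioc 0 t, exChar c T m = ∑ m ∈ Finset.range t, exChar c T (m + 1) := by
      induction t with
      | zero => simp
      | succ t ih => rw [Finset.sum_Ioc_succ_top (by omega), Finset.sum_range_succ, ih]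
    rw [e]
    exact key t

open Classical in
theorem sum_exChar_class (hc : Function.Surjective c) (h : Fin n → ℤˣ) (a t : ℕ) :
    |∑ b ∈ Finset.Ioc 0 t, exChar c T a * (if InClass c h (a * b) then (1 : ℝ) else 0) -
      exChar c T a * (t * classDensity c)| ≤ Q + 2 := by
  by_cases ha : a.Coprime Q
  · have h1 := inClass_classOf c ha
    simp_rw [InClass.mul_iff h1]
    rw [← Finset.mul_sum, ← mul_sub, abs_mul]
    have h2 := class_count c hc ((classOf c a)⁻¹ * h) t
    have h3 : |exChar c T a| = 1 := by
      rw [h1.exChar_eq]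
      rcases signChar_eq T (classOf c a) with h | h <;> rw [h] <;> norm_num
    rw [h3, one_mul]
    exact h2
  · simp [exChar, ha]
    positivity

open Classical in
/-- Sum of `1 * χ` over a class, restricted to multiples of the primes in `U`. -/
noncomputable def convClassSum (c : (ZMod Q)ˣ →* (Fin n → ℤˣ)) (T : Finset (Fin n))
    (h : Fin n → ℤˣ) (U : Finset ℕ) (y : ℕ) : ℝ :=
  ∑ m ∈ Finset.Ioc 0 y,
    if ∀ l ∈ U, l ∣ m then (if InClass c h m then charConv (exChar c T) m else 0) else 0

theorem convClassSum_empty (hc : Function.Surjective c) (hT : T.Nonempty) {h : Fin n → ℤˣ}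
    (hh : signChar T h = 1) {L : ℝ}
    (hL : ∀ M : ℕ, |∑ a ∈ Finset.Ioc 0 M, exChar c T a / a - L| ≤ 2 * Q / (M + 1 : ℕ))
    {y : ℝ} (hy : 0 ≤ y) :
    |convClassSum c T h ∅ ⌊y⌋₊ - 2 * classDensity c * L * y| ≤ 16 * Q * √y := by
  classical
  have hχ := exChar_realCharacter hc hT
  have hρ0 := classDensity_pos c
  have hρ1 := classDensity_le c
  have hQ1 : (1 : ℝ) ≤ Q := by exact_mod_cast NeZero.pos Q
  rcases lt_or_ge y 1 with hy1 | hy1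
  · have e : ⌊y⌋₊ = 0 := Nat.floor_eq_zero.2 hy1
    have hL0 := hL 0
    simp only [Finset.Ioc_self, Finset.sum_empty, zero_sub, abs_neg, zero_add, Nat.cast_one,
      div_one] at hL0
    have hys : y ≤ √y := Real.le_sqrt_of_sq_le (by nlinarith)
    simp only [convClassSum, e, Finset.Ioc_self, Finset.sum_empty, zero_sub, abs_neg]
    rw [abs_mul, abs_mul, abs_mul, abs_of_pos hρ0, abs_of_nonneg hy, abs_two]
    have : classDensity c * |L| ≤ 1 * (2 * Q) := by gcongr
    calc 2 * classDensity c * |L| * y = 2 * (classDensity c * |L|) * y := by ring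
      _ ≤ 2 * (1 * (2 * Q)) * √y := by gcongr
      _ ≤ _ := by nlinarith [Real.sqrt_nonneg y]
  · set Y := ⌊y⌋₊ with hY
    set w := Nat.sqrt Y with hw
    set ind : ℕ → ℝ := fun m => if InClass c h m then (1 : ℝ) else 0 with hind
    have e1 : convClassSum c T h ∅ Y =
        ∑ a ∈ Finset.Ioc 0 Y, ∑ b ∈ Finset.Ioc 0 (Y / a), exChar c T a * ind (a * b) := by
      rw [← sum_charConv_mul_eq]
      unfold convClassSum
      refine Finset.sum_congr rfl fun m _ => ?_
      simp [hind]
    have hsym : ∀ a b, exChar c T a * ind (a * b) = exChar c T b * ind (b * a) := by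
      intro a b
      rw [mul_comm b a]
      simp only [hind]
      split_ifs with hab
      · have h1 := hab.exChar_eq T
        rw [hh, hχ.mul] at h1
        rcases hχ.values a with ha | ha | ha <;> rcases hχ.values b with hb | hb | hb <;>
          rw [ha, hb] at h1 <;> rw [ha, hb] <;> norm_num at h1
      · simp
    have e2 : ∑ b ∈ Finset.Ioc 0 w, ∑ a ∈ Finset.Ioc 0 (Y / b), exChar c T a * ind (a * b) =
        ∑ a ∈ Finset.Ioc 0 w, ∑ b ∈ Finset.Ioc 0 (Y / a), exChar c T a * ind (a * b) :=
      Finset.sum_congr rfl fun b _ => Finset.sum_congr rfl fun a _ => hsym a b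
    rw [e1, sum_hyperbola, ← hw, e2]
    have hwy : (w : ℝ) ≤ √y := by
      apply Real.le_sqrt_of_sq_le
      calc (w : ℝ) ^ 2 ≤ Y := by exact_mod_cast Nat.sqrt_le' Y
        _ ≤ y := Nat.floor_le hy
    have hyw : y / (w + 1 : ℕ) ≤ √y := by
      rw [div_le_iff₀ (by positivity)]
      have h1 : √y ≤ (w + 1 : ℕ) := by
        apply Real.sqrt_le_iff.2 ⟨by positivity, ?_⟩
        have h2 : Y + 1 ≤ (w + 1) ^ 2 := Nat.lt_succ_sqrt' Y
        calc y ≤ (Y + 1 : ℕ) := by push_cast; exact (Nat.lt_floor_add_one y).le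
          _ ≤ _ := by exact_mod_cast h2
      calc y = √y * √y := (Real.mul_self_sqrt hy).symm
        _ ≤ _ := by gcongr
    have hA : |∑ a ∈ Finset.Ioc 0 w, ∑ b ∈ Finset.Ioc 0 (Y / a), exChar c T a * ind (a * b) -
        classDensity c * y * ∑ a ∈ Finset.Ioc 0 w, exChar c T a / a| ≤ w * (Q + 3) := by
      rw [Finset.mul_sum, ← Finset.sum_sub_distrib]
      refine (Finset.abs_sum_le_sum_abs _ _).trans ?_
      have : (w : ℝ) * (Q + 3) = ∑ a ∈ Finset.Ioc 0 w, ((Q : ℝ) + 3) := by simp [mul_add]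
      rw [this]
      refine Finset.sum_le_sum fun a ha => ?_
      have ha0 : (0 : ℝ) < a := by exact_mod_cast (Finset.mem_Ioc.1 ha).1
      have h1 := sum_exChar_class (T := T) hc h a (Y / a)
      have h2 : |exChar c T a * (((Y / a : ℕ) : ℝ) * classDensity c) -
          classDensity c * y * (exChar c T a / a)| ≤ 1 := by
        rw [show exChar c T a * (((Y / a : ℕ) : ℝ) * classDensity c) -
          classDensity c * y * (exChar c T a / a) =
          exChar c T a * (classDensity c * (((Y / a : ℕ) : ℝ) - y / a)) by ring, abs_mul, abs_mul,
          abs_of_pos hρ0]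
        have h3 : |((Y / a : ℕ) : ℝ) - y / a| ≤ 1 := by
          rw [hY, ← Nat.floor_div_natCast]
          rw [abs_le]
          have h4 := Nat.floor_le (show 0 ≤ y / a by positivity)
          have h5 := Nat.lt_floor_add_one (y / a)
          constructor <;> linarith
        calc |exChar c T a| * (classDensity c * |((Y / a : ℕ) : ℝ) - y / a|) ≤ 1 * (1 * 1) := by
              gcongr
              exact hχ.abs_le_one a
          _ = 1 := by norm_num
      calc _ ≤ _ := abs_sub_le _ (exChar c T a * (((Y / a : ℕ) : ℝ) * classDensity c)) _
        _ ≤ (Q + 2) + 1 := add_le_add h1 h2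
        _ = _ := by ring
    have hB : |∑ a ∈ Finset.Ioc 0 w, ∑ b ∈ Finset.Ioc 0 w, exChar c T a * ind (a * b)| ≤
        w * (2 * Q + 2) := by
      have h1 : |∑ a ∈ Finset.Ioc 0 w, ∑ b ∈ Finset.Ioc 0 w, exChar c T a * ind (a * b) -
          (∑ a ∈ Finset.Ioc 0 w, exChar c T a) * (w * classDensity c)| ≤ w * (Q + 2) := by
        rw [Finset.sum_mul, ← Finset.sum_sub_distrib]
        refine (Finset.abs_sum_le_sum_abs _ _).trans ?_
        refine (Finset.sum_le_sum fun a _ => sum_exChar_class (T := T) hc h a w).trans ?_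
        simp [mul_add]
      have h2 : |(∑ a ∈ Finset.Ioc 0 w, exChar c T a) * (w * classDensity c)| ≤ Q * (w * 1) := by
        rw [abs_mul, abs_of_nonneg (a := (w : ℝ) * classDensity c) (by positivity)]
        gcongr
        exact hχ.sum_le w
      have h3 := abs_sub_abs_le_abs_sub
        (∑ a ∈ Finset.Ioc 0 w, ∑ b ∈ Finset.Ioc 0 w, exChar c T a * ind (a * b))
        ((∑ a ∈ Finset.Ioc 0 w, exChar c T a) * (w * classDensity c))
      linarith
    have hC : |classDensity c * y * ∑ a ∈ Finset.Ioc 0 w, exChar c T a / a -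
        classDensity c * y * L| ≤ 2 * Q * √y := by
      rw [← mul_sub, abs_mul, abs_of_nonneg (a := classDensity c * y) (by positivity)]
      calc _ ≤ 1 * y * (2 * Q / (w + 1 : ℕ)) := by gcongr; exact hL w
        _ = 2 * Q * (y / (w + 1 : ℕ)) := by ring
        _ ≤ _ := by gcongr
    have hD : (w : ℝ) * (2 * (Q + 3) + (2 * Q + 2)) ≤ √y * (2 * (Q + 3) + (2 * Q + 2)) := by gcongr
    have hE : √y * (2 * (Q + 3) + (2 * Q + 2)) ≤ √y * (12 * Q) := by gcongr; linarith
    generalize ∑ a ∈ Finset.Ioc 0 w, ∑ b ∈ Finset.Ioc 0 (Y / a), exChar c T a * ind (a * b) = S1 at *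
    generalize ∑ a ∈ Finset.Ioc 0 w, ∑ b ∈ Finset.Ioc 0 w, exChar c T a * ind (a * b) = S2 at *
    generalize classDensity c * y * ∑ a ∈ Finset.Ioc 0 w, exChar c T a / a = S3 at *
    rw [abs_le] at *
    constructor <;> linarith [hA.1, hA.2, hB.1, hB.2, hC.1, hC.2]

end ExceptionalChar

section ExceptionalSieve
variable {Q n : ℕ} [NeZero Q] {c : (ZMod Q)ˣ →* (Fin n → ℤˣ)} {T : Finset (Fin n)}

/-- The density of multiples of `l` with respect to `1 * χ`. -/
noncomputable def exDensity (c : (ZMod Q)ˣ →* (Fin n → ℤˣ)) (T : Finset (Fin n)) (l : ℕ) : ℝ :=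
  if exChar c T l = 1 then 2 / l - 1 / l ^ 2 else if exChar c T l = -1 then 1 / l ^ 2 else 0

theorem exDensity_nonneg {l : ℕ} (hl : l.Prime) : 0 ≤ exDensity c T l := by
  have hl2 : (2 : ℝ) ≤ l := by exact_mod_cast hl.two_le
  unfold exDensity
  split_ifs
  · have : 1 / (l : ℝ) ^ 2 ≤ 2 / l := by
      rw [div_le_div_iff₀ (by positivity) (by positivity)]; nlinarith
    linarith
  · positivity
  · exact le_rfl

theorem exDensity_le {l : ℕ} (hl : l.Prime) : exDensity c T l ≤ 2 / l := by
  have hl2 : (2 : ℝ) ≤ l := by exact_mod_cast hl.two_le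
  unfold exDensity
  split_ifs
  · have : 0 ≤ 1 / (l : ℝ) ^ 2 := by positivity
    linarith
  · rw [div_le_div_iff₀ (by positivity) (by positivity)]; nlinarith
  · positivity

theorem exDensity_le' {l : ℕ} (hl : l.Prime) : exDensity c T l ≤ 3 / 4 := by
  have hl2 : (2 : ℝ) ≤ l := by exact_mod_cast hl.two_le
  have hi : 1 / (l : ℝ) ≤ 1 / 2 := one_div_le_one_div_of_le (by norm_num) hl2
  have hi0 : 0 < 1 / (l : ℝ) := by positivity
  have e : 1 / (l : ℝ) ^ 2 = (1 / l) ^ 2 := by rw [one_div_pow]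
  have e2 : 2 / (l : ℝ) = 2 * (1 / l) := by ring
  unfold exDensity
  rw [e, e2]
  split_ifs <;> nlinarith

open Classical in
theorem sum_multiples (f : ℕ → ℝ) {l : ℕ} (hl : 0 < l) (Y : ℕ) :
    ∑ m ∈ Finset.Ioc 0 Y, (if l ∣ m then f m else 0) = ∑ k ∈ Finset.Ioc 0 (Y / l), f (l * k) := by
  rw [← Finset.sum_filter]
  symm
  apply Finset.sum_bij (fun k _ => l * k)
  · intro k hk
    simp only [Finset.mem_filter, Finset.mem_Ioc] at hk ⊢
    have := (Nat.le_div_iff_mul_le hl).1 hk.2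
    exact ⟨⟨by have := hk.1; positivity, by linarith⟩, dvd_mul_right _ _⟩
  · intro k _ k' _ hk
    exact Nat.eq_of_mul_eq_mul_left hl hk
  · intro m hm
    simp only [Finset.mem_filter, Finset.mem_Ioc] at hm
    obtain ⟨⟨h1, h2⟩, ⟨k, rfl⟩⟩ := hm
    refine ⟨k, ?_, rfl⟩
    rw [Finset.mem_Ioc]
    exact ⟨Nat.pos_of_mul_pos_left h1, (Nat.le_div_iff_mul_le hl).2 (by linarith)⟩
  · exact fun _ _ => rfl

theorem exChar_ne_zero_iff {m : ℕ} : exChar c T m ≠ 0 ↔ m.Coprime Q := by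
  unfold exChar
  constructor
  · intro h
    by_contra h2
    exact h (if_neg h2)
  · intro h
    rw [if_pos h]
    rcases signChar_eq T (classOf c m) with h | h <;> rw [h] <;> norm_num

theorem convClassSum_insert (hχ : RealCharacter Q (exChar c T)) {l : ℕ} (hl : l.Prime)
    {e : Fin n → ℤˣ} (he : InClass c e l) {U : Finset ℕ} (hU : ∀ p ∈ U, p.Prime) (hlU : l ∉ U)
    (h : Fin n → ℤˣ) (Y : ℕ) :
    convClassSum c T h (insert l U) Y = (1 + exChar c T l) * convClassSum c T (e⁻¹ * h) U (Y / l) -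
      exChar c T l * convClassSum c T (e⁻¹ * (e⁻¹ * h)) U (Y / l / l) := by
  classical
  have hcop : ∀ p ∈ U, p.Coprime l := fun p hp =>
    (Nat.coprime_primes (hU p hp) hl).2 fun h => hlU (h ▸ hp)
  have hUl : ∀ k, (∀ p ∈ U, p ∣ l * k) ↔ ∀ p ∈ U, p ∣ k := fun k =>
    forall₂_congr fun p hp => (hcop p hp).dvd_mul_left
  have e1 : convClassSum c T h (insert l U) Y = ∑ m ∈ Finset.Ioc 0 Y, if l ∣ m then
      (if ∀ p ∈ U, p ∣ m then (if InClass c h m then charConv (exChar c T) m else 0) else 0)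
      else 0 := by
    unfold convClassSum
    refine Finset.sum_congr rfl fun m _ => ?_
    simp only [Finset.forall_mem_insert, ite_and]
  have e2 : convClassSum c T (e⁻¹ * (e⁻¹ * h)) U (Y / l / l) =
      ∑ k ∈ Finset.Ioc 0 (Y / l), if l ∣ k then (if ∀ p ∈ U, p ∣ k then
        (if InClass c (e⁻¹ * h) k then charConv (exChar c T) (k / l) else 0) else 0) else 0 := by
    rw [sum_multiples _ hl.pos]
    unfold convClassSum
    refine Finset.sum_congr rfl fun k _ => ?_
    simp only [hUl, InClass.mul_iff he, Nat.mul_div_cancel_left k hl.pos]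
  rw [e1, sum_multiples _ hl.pos, e2]
  unfold convClassSum
  rw [Finset.mul_sum, Finset.mul_sum, ← Finset.sum_sub_distrib]
  refine Finset.sum_congr rfl fun k hk => ?_
  simp only [hUl, InClass.mul_iff he]
  rw [hχ.charConv_prime_mul hl (Finset.mem_Ioc.1 hk).1]
  split_ifs <;> ring

theorem convClassSum_bound (hc : Function.Surjective c) (hT : T.Nonempty) {L : ℝ}
    (hL : ∀ M : ℕ, |∑ a ∈ Finset.Ioc 0 M, exChar c T a / a - L| ≤ 2 * Q / (M + 1 : ℕ))
    {U : Finset ℕ} (hU : ∀ p ∈ U, p.Prime) :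
    ∀ h : Fin n → ℤˣ, signChar T h = 1 → ∀ y : ℝ, 0 ≤ y →
    |convClassSum c T h U ⌊y⌋₊ - 2 * classDensity c * L * y * ∏ l ∈ U, exDensity c T l| ≤
      16 * Q * √y * ∏ l ∈ U, (l : ℝ) := by
  classical
  have hχ := exChar_realCharacter hc hT
  induction U using Finset.induction_on with
  | empty =>
    intro h hh y hy
    simpa using convClassSum_empty hc hT hh hL hy
  | insert l U hlU ih =>
    have hl : l.Prime := hU l (by simp)
    have hU' : ∀ p ∈ U, p.Prime := fun p hp => hU p (by simp [hp])
    have ih := ih hU'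
    intro h hh y hy
    have hl2 : (2 : ℝ) ≤ l := by exact_mod_cast hl.two_le
    set P := ∏ l ∈ U, (l : ℝ) with hP
    have hP0 : 0 ≤ P := Finset.prod_nonneg fun _ _ => by positivity
    have hQ0 : (0 : ℝ) ≤ Q := by positivity
    rw [Finset.prod_insert hlU, Finset.prod_insert hlU, ← hP]
    by_cases hcop : l.Coprime Q
    · obtain ⟨e, he⟩ := exists_inClass (c := c) hcop
      rw [convClassSum_insert hχ hl he hU' hlU]
      have hse := he.exChar_eq T
      have e1 : ⌊y⌋₊ / l = ⌊y / l⌋₊ := (Nat.floor_div_natCast y l).symm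
      have e2 : ⌊y⌋₊ / l / l = ⌊y / l / l⌋₊ :=
        (congrArg (· / l) e1).trans (Nat.floor_div_natCast (y / l) l).symm
      have h2 := ih (e⁻¹ * (e⁻¹ * h)) (by
        rw [signVec_inv, signChar_mul, signChar_mul, hh]
        rcases signChar_eq T e with h | h <;> rw [h] <;> norm_num) (y / l / l) (by positivity)
      rw [e2, e1]
      have hs1 : √(y / l) ≤ 3 / 4 * √y := by
        apply Real.sqrt_le_iff.2 ⟨by positivity, ?_⟩
        rw [mul_pow, Real.sq_sqrt hy, div_le_iff₀ (by positivity)]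
        nlinarith
      have hs2 : √(y / l / l) ≤ 1 / 2 * √y := by
        apply Real.sqrt_le_iff.2 ⟨by positivity, ?_⟩
        rw [mul_pow, Real.sq_sqrt hy, div_div, div_le_iff₀ (by positivity)]
        nlinarith [mul_le_mul hl2 hl2 (by norm_num) (by linarith)]
      have hs0 := Real.sqrt_nonneg y
      have hb2 : 16 * Q * √(y / l / l) * P ≤ 16 * Q * (1 / 2 * √y) * P := by gcongr
      have hfin : 16 * Q * (2 * √y) * P ≤ 16 * Q * √y * (l * P) := by
        have : 16 * (Q : ℝ) * √y * (2 * P) ≤ 16 * Q * √y * (l * P) := by gcongr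
        linarith
      have hw0 : 0 ≤ 16 * (Q : ℝ) * √y * P := by positivity
      rcases signChar_eq T e with hs | hs
      · have h1 := ih (e⁻¹ * h) (by rw [signVec_inv, signChar_mul, hh, hs, one_mul]) (y / l)
          (by positivity)
        have hb1 : 16 * Q * √(y / l) * P ≤ 16 * Q * (3 / 4 * √y) * P := by gcongr
        have hg : exDensity c T l = 2 / l - 1 / l ^ 2 := by
          unfold exDensity; rw [if_pos (hse.trans hs)]
        rw [hse, hs, hg]
        set G := ∏ l ∈ U, exDensity c T l
        have e3 : 2 * classDensity c * L * y * ((2 / l - 1 / l ^ 2) * G) =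
            2 * (2 * classDensity c * L * (y / l) * G) -
              2 * classDensity c * L * (y / l / l) * G := by
          field_simp
        rw [e3]
        rw [abs_le] at *
        constructor <;> linarith [h1.1, h1.2, h2.1, h2.2]
      · have hg : exDensity c T l = 1 / l ^ 2 := by
          unfold exDensity; rw [if_neg (by rw [hse, hs]; norm_num), if_pos (hse.trans hs)]
        rw [hse, hs, hg]
        set G := ∏ l ∈ U, exDensity c T l
        have e3 : 2 * classDensity c * L * y * (1 / l ^ 2 * G) =
              2 * classDensity c * L * (y / l / l) * G := by
          field_simp
        rw [e3]
        rw [abs_le] at *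
        constructor <;> linarith [h2.1, h2.2]
    · have hg : exDensity c T l = 0 := by
        have : exChar c T l = 0 := by
          by_contra h; exact hcop (exChar_ne_zero_iff.1 h)
        unfold exDensity; rw [this]; norm_num
      have hS : convClassSum c T h (insert l U) ⌊y⌋₊ = 0 := by
        apply Finset.sum_eq_zero
        intro m _
        split_ifs with h1 h2
        · exact absurd (Nat.Coprime.coprime_dvd_left (h1 l (by simp)) h2.coprime) hcop
        · rfl
        · rfl
      rw [hS, hg]
      simp only [zero_mul, mul_zero, sub_zero, abs_zero]
      positivity

open Classical in
/-- Sum of `1 * χ` over the rough members of a class. -/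
noncomputable def convRoughSum (c : (ZMod Q)ˣ →* (Fin n → ℤˣ)) (T : Finset (Fin n)) (z : ℕ)
    (h : Fin n → ℤˣ) (y : ℕ) : ℝ :=
  ∑ m ∈ Finset.Ioc 0 y,
    if IsRough z m then (if InClass c h m then charConv (exChar c T) m else 0) else 0

theorem convRoughSum_bound (hc : Function.Surjective c) (hT : T.Nonempty) {L : ℝ} (hL0 : 0 ≤ L)
    (hL : ∀ M : ℕ, |∑ a ∈ Finset.Ioc 0 M, exChar c T a / a - L| ≤ 2 * Q / (M + 1 : ℕ))
    {I b : ℕ} (hb : Even b) (hΔ : sieveErr b ≤ 1 / 30)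
    {h : Fin n → ℤˣ} (hh : signChar T h = 1) {y : ℝ} (hy : 0 ≤ y) :
    |convRoughSum c T (2 ^ 2 ^ I) h ⌊y⌋₊ -
        2 * classDensity c * L * y * sieveProd (exDensity c T) I| ≤
      1 / 10 * (2 * classDensity c * L * y * sieveProd (exDensity c T) I) +
        16 * Q * √y * (2 ^ 2 ^ I) ^ (4 * b + 14) := by
  classical
  have hχ := exChar_realCharacter hc hT
  have hρ0 := classDensity_pos c
  have hX : 0 ≤ 2 * classDensity c * L * y := by positivity
  have hV := sieveProd_pos (g := exDensity c T) (fun l hl => exDensity_nonneg hl)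
    (fun l hl => exDensity_le hl) (fun l hl => exDensity_le' hl) I
  have := fundamental_lemma (g := exDensity c T) (fun l hl => exDensity_nonneg hl)
    (fun l hl => exDensity_le hl) (fun l hl => exDensity_le' hl) I b hb (by linarith)
    (Finset.Ioc 0 ⌊y⌋₊) (fun m => if InClass c h m then charConv (exChar c T) m else 0)
    (fun m _ => by
      split_ifs
      · exact hχ.charConv_nonneg m
      · exact le_rfl) (2 * classDensity c * L * y)
    (16 * Q * √y * (2 ^ 2 ^ I) ^ (2 * b + 6)) hX (fun U hU hU2 => by
      refine (convClassSum_bound hc hT hL (fun p hp => (hU p hp).1) h hh y hy).trans ?_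
      have : ∏ l ∈ U, (l : ℝ) ≤ (2 ^ 2 ^ I) ^ (2 * b + 6) := by
        have h2 : ((∏ l ∈ U, l : ℕ) : ℝ) ≤ (((2 ^ 2 ^ I) ^ (2 * b + 6) : ℕ) : ℝ) :=
          Nat.cast_le.2 hU2
        rw [Nat.cast_prod, Nat.cast_pow, Nat.cast_pow, Nat.cast_ofNat] at h2
        exact h2
      gcongr)
  refine this.trans ?_
  apply add_le_add
  · have : 0 ≤ 2 * classDensity c * L * y * sieveProd (exDensity c T) I := by positivity
    nlinarith
  · rw [mul_assoc, ← pow_add]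
    apply le_of_eq
    congr 2
    ring

end ExceptionalSieve

section ExceptionalSieve
variable {Q n : ℕ} [NeZero Q] {c : (ZMod Q)ˣ →* (Fin n → ℤˣ)} {T : Finset (Fin n)}

theorem IsRough.of_mul_right {z l k : ℕ} (h : IsRough z (l * k)) : IsRough z k :=
  fun p hp hpz hd => h p hp hpz (hd.mul_left l)

open Classical in
theorem convRoughSum_multiples_le_of_one (hχ : RealCharacter Q (exChar c T)) {l : ℕ} (hl : l.Prime)
    {e : Fin n → ℤˣ} (he : InClass c e l) (hs : exChar c T l = 1) (z : ℕ) (h : Fin n → ℤˣ)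
    (Y : ℕ) :
    ∑ m ∈ Finset.Ioc 0 Y, (if l ∣ m then (if IsRough z m then
      (if InClass c h m then charConv (exChar c T) m else 0) else 0) else 0) ≤
    2 * convRoughSum c T z (e⁻¹ * h) (Y / l) := by
  rw [sum_multiples _ hl.pos]
  unfold convRoughSum
  rw [Finset.mul_sum]
  refine Finset.sum_le_sum fun k hk => ?_
  simp only [InClass.mul_iff he]
  have h0 := hχ.charConv_nonneg k
  have h1 := hχ.charConv_nonneg (k / l)
  rw [hχ.charConv_prime_mul hl (Finset.mem_Ioc.1 hk).1, hs]
  by_cases hr : IsRough z (l * k)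
  · rw [if_pos hr, if_pos hr.of_mul_right]
    split_ifs <;> linarith
  · rw [if_neg hr]
    split_ifs <;> linarith

open Classical in
theorem convRoughSum_multiples_le_of_neg_one (hχ : RealCharacter Q (exChar c T)) {l : ℕ}
    (hl : l.Prime) {e : Fin n → ℤˣ} (he : InClass c e l) (hs : exChar c T l = -1) (z : ℕ)
    (h : Fin n → ℤˣ) (Y : ℕ) :
    ∑ m ∈ Finset.Ioc 0 Y, (if l ∣ m then (if IsRough z m then
      (if InClass c h m then charConv (exChar c T) m else 0) else 0) else 0) ≤
    convRoughSum c T z (e⁻¹ * (e⁻¹ * h)) (Y / l / l) := by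
  rw [sum_multiples _ hl.pos]
  have e2 : convRoughSum c T z (e⁻¹ * (e⁻¹ * h)) (Y / l / l) =
      ∑ k ∈ Finset.Ioc 0 (Y / l), if l ∣ k then (if IsRough z (k / l) then
        (if InClass c (e⁻¹ * h) k then charConv (exChar c T) (k / l) else 0) else 0) else 0 := by
    rw [sum_multiples _ hl.pos]
    unfold convRoughSum
    refine Finset.sum_congr rfl fun k _ => ?_
    simp only [InClass.mul_iff he, Nat.mul_div_cancel_left k hl.pos]
  rw [e2]
  refine Finset.sum_le_sum fun k hk => ?_
  simp only [InClass.mul_iff he]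
  rw [hχ.charConv_prime_mul hl (Finset.mem_Ioc.1 hk).1, hs]
  by_cases hlk : l ∣ k
  · obtain ⟨j, rfl⟩ := hlk
    have h0 := hχ.charConv_nonneg j
    rw [if_pos (dvd_mul_right l j), if_pos (dvd_mul_right l j), Nat.mul_div_cancel_left j hl.pos]
    by_cases hr : IsRough z (l * (l * j))
    · rw [if_pos hr, if_pos hr.of_mul_right.of_mul_right]
      split_ifs <;> linarith
    · rw [if_neg hr]
      split_ifs <;> linarith
  · rw [if_neg hlk, if_neg hlk]
    simp

theorem sum_one_div_sqrt_le (N : ℕ) : ∑ l ∈ Finset.Ioc 0 N, 1 / √(l : ℝ) ≤ 2 * √(N : ℝ) := by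
  induction N with
  | zero => simp
  | succ N ih =>
    rw [Finset.sum_Ioc_succ_top (Nat.zero_le N)]
    have h1 : (0 : ℝ) < √((N + 1 : ℕ) : ℝ) := Real.sqrt_pos.2 (by positivity)
    have h2 := Real.sq_sqrt (show (0 : ℝ) ≤ N by positivity)
    have h3 := Real.sq_sqrt (show (0 : ℝ) ≤ (N + 1 : ℕ) by positivity)
    have h4 := Real.sqrt_nonneg (N : ℝ)
    have : 1 / √((N + 1 : ℕ) : ℝ) ≤ 2 * √((N + 1 : ℕ) : ℝ) - 2 * √(N : ℝ) := by
      rw [div_le_iff₀ h1]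
      push_cast at h3 h1 ⊢
      nlinarith [sq_nonneg (√((N : ℝ) + 1) - √(N : ℝ))]
    linarith

theorem sum_one_div_sq_le {z : ℕ} (hz : 2 ≤ z) (N : ℕ) :
    ∑ l ∈ (Finset.Ioc 0 N).filter (z ≤ ·), 1 / (l : ℝ) ^ 2 ≤ 2 / (z : ℝ) := by
  have key : ∀ N, z ≤ N + 1 → ∑ l ∈ (Finset.Ioc 0 N).filter (z ≤ ·), 1 / (l : ℝ) ^ 2 ≤
      1 / ((z : ℝ) - 1) - 1 / (N : ℝ) := by
    intro N hN
    induction N, (show z - 1 ≤ N by omega) using Nat.le_induction with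
    | base =>
      rw [Finset.sum_eq_zero]
      · rw [Nat.cast_sub (by omega)]; simp
      · intro l hl
        simp only [Finset.mem_filter, Finset.mem_Ioc] at hl
        omega
    | succ N hN' ih =>
      have h1 := ih (by omega)
      rw [Finset.sum_filter] at h1 ⊢
      rw [Finset.sum_Ioc_succ_top (Nat.zero_le N), if_pos (by omega)]
      have hN0 : (0 : ℝ) < N := by exact_mod_cast (show 0 < N by omega)
      have : 1 / ((N + 1 : ℕ) : ℝ) ^ 2 ≤ 1 / N - 1 / (N + 1 : ℕ) := by
        push_cast
        rw [div_sub_div _ _ hN0.ne' (by positivity), div_le_div_iff₀ (by positivity)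
          (by positivity)]
        nlinarith
      linarith
  have hz' : (2 : ℝ) ≤ z := by exact_mod_cast hz
  calc _ ≤ ∑ l ∈ (Finset.Ioc 0 (N + z)).filter (z ≤ ·), 1 / (l : ℝ) ^ 2 :=
        Finset.sum_le_sum_of_subset_of_nonneg
          (Finset.filter_subset_filter _ (Finset.Ioc_subset_Ioc_right (Nat.le_add_right N z)))
          (fun _ _ _ => by positivity)
    _ ≤ 1 / ((z : ℝ) - 1) - 1 / (N + z : ℕ) := key (N + z) (by omega)
    _ ≤ 1 / ((z : ℝ) - 1) := by
        have : 0 ≤ 1 / ((N + z : ℕ) : ℝ) := by positivity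
        linarith
    _ ≤ 2 / z := by
        rw [div_le_div_iff₀ (by linarith) (by linarith)]
        linarith

end ExceptionalSieve

section ExceptionalSieve
variable {Q n : ℕ} [NeZero Q] {c : (ZMod Q)ˣ →* (Fin n → ℤˣ)} {T : Finset (Fin n)}

open Classical in
theorem convRoughSum_multiples_bound (hc : Function.Surjective c) (hT : T.Nonempty) {L : ℝ}
    (hL0 : 0 ≤ L)
    (hL : ∀ M : ℕ, |∑ a ∈ Finset.Ioc 0 M, exChar c T a / a - L| ≤ 2 * Q / (M + 1 : ℕ))
    {I b : ℕ} (hb : Even b) (hΔ : sieveErr b ≤ 1 / 30)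
    {h : Fin n → ℤˣ} (hh : signChar T h = 1) {y : ℝ} (hy : 0 ≤ y) {l : ℕ} (hl : l.Prime)
    (hlQ : l.Coprime Q) :
    ∑ m ∈ Finset.Ioc 0 ⌊y⌋₊, (if l ∣ m then (if IsRough (2 ^ 2 ^ I) m then
      (if InClass c h m then charConv (exChar c T) m else 0) else 0) else 0) ≤
    11 / 10 * (2 * classDensity c * L * y * sieveProd (exDensity c T) I) *
      ((if exChar c T l = 1 then 2 / (l : ℝ) else 0) + 1 / (l : ℝ) ^ 2) +
      32 * Q * √y * (2 ^ 2 ^ I) ^ (4 * b + 14) * (1 / √(l : ℝ)) := by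
  have hχ := exChar_realCharacter hc hT
  obtain ⟨e, he⟩ := exists_inClass (c := c) hlQ
  have hse := he.exChar_eq T
  have hl1 : (1 : ℝ) ≤ l := by exact_mod_cast hl.one_le
  have hl0 : (0 : ℝ) < l := by linarith
  have hρ0 := classDensity_pos c
  have hV := sieveProd_pos (g := exDensity c T) (fun l hl => exDensity_nonneg hl)
    (fun l hl => exDensity_le hl) (fun l hl => exDensity_le' hl) I
  have key : ∀ h' : Fin n → ℤˣ, signChar T h' = 1 → ∀ y' : ℝ, 0 ≤ y' →
      convRoughSum c T (2 ^ 2 ^ I) h' ⌊y'⌋₊ ≤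
      11 / 10 * (2 * classDensity c * L * y' * sieveProd (exDensity c T) I) +
        16 * Q * √y' * (2 ^ 2 ^ I) ^ (4 * b + 14) := by
    intro h' hh' y' hy'
    have := (abs_le.1 (convRoughSum_bound hc hT hL0 hL hb hΔ hh' hy' (I := I))).2
    linarith
  have e1 : ⌊y⌋₊ / l = ⌊y / l⌋₊ := (Nat.floor_div_natCast y l).symm
  have e2 : ⌊y⌋₊ / l / l = ⌊y / l / l⌋₊ :=
    (congrArg (· / l) e1).trans (Nat.floor_div_natCast (y / l) l).symm
  set D : ℝ := (2 ^ 2 ^ I) ^ (4 * b + 14) with hD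
  have hD0 : 0 < D := by positivity
  set V := sieveProd (exDensity c T) I
  have hsl : 1 ≤ √(l : ℝ) := Real.one_le_sqrt.2 hl1
  rcases signChar_eq T e with hs | hs
  · refine (convRoughSum_multiples_le_of_one hχ hl he (hse.trans hs) _ h _).trans ?_
    rw [e1, if_pos (hse.trans hs)]
    have h1 := key (e⁻¹ * h) (by rw [signVec_inv, signChar_mul, hh, hs, one_mul]) (y / l)
      (by positivity)
    rw [Real.sqrt_div hy] at h1
    have e3 : 11 / 10 * (2 * classDensity c * L * y * V) * (2 / l + 1 / (l : ℝ) ^ 2) +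
        32 * Q * √y * D * (1 / √(l : ℝ)) =
        2 * (11 / 10 * (2 * classDensity c * L * (y / l) * V) + 16 * Q * (√y / √(l : ℝ)) * D) +
        11 / 10 * (2 * classDensity c * L * y * V) * (1 / (l : ℝ) ^ 2) := by ring
    have h3 : 0 ≤ 11 / 10 * (2 * classDensity c * L * y * V) * (1 / (l : ℝ) ^ 2) := by positivity
    linarith
  · refine (convRoughSum_multiples_le_of_neg_one hχ hl he (hse.trans hs) _ h _).trans ?_
    rw [e2, if_neg (by rw [hse, hs]; norm_num)]
    have h2 := key (e⁻¹ * (e⁻¹ * h)) (by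
        rw [signVec_inv, signChar_mul, signChar_mul, hh, hs]; norm_num) (y / l / l) (by positivity)
    have hs2 : √(y / l / l) ≤ √y * (1 / √(l : ℝ)) := by
      rw [mul_one_div, ← Real.sqrt_div hy]
      exact Real.sqrt_le_sqrt (div_le_self (by positivity) hl1)
    have e3 : 11 / 10 * (2 * classDensity c * L * y * V) * (0 + 1 / (l : ℝ) ^ 2) =
        11 / 10 * (2 * classDensity c * L * (y / l / l) * V) := by
      field_simp
      ring
    rw [e3]
    have h3 : 16 * Q * √(y / l / l) * D ≤ 16 * Q * (√y * (1 / √(l : ℝ))) * D := by gcongr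
    have h4 : 0 ≤ 16 * Q * (√y * (1 / √(l : ℝ))) * D := by positivity
    linarith

open Classical in
theorem convRoughSum_le_of_no_prime (hc : Function.Surjective c) (hT : T.Nonempty) {L : ℝ}
    (hL0 : 0 ≤ L)
    (hL : ∀ M : ℕ, |∑ a ∈ Finset.Ioc 0 M, exChar c T a / a - L| ≤ 2 * Q / (M + 1 : ℕ))
    {I b : ℕ} (hb : Even b) (hΔ : sieveErr b ≤ 1 / 30) (hQ : Q < 2 ^ 2 ^ I)
    {g : Fin n → ℤˣ} (hg : g ≠ 1) (hgT : signChar T g = 1) {t : ℕ}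
    (hno : ∀ q, q.Prime → InClass c g q → t ^ 4 < q) :
    convRoughSum c T (2 ^ 2 ^ I) g (t ^ 4) ≤
    11 / 10 * (2 * classDensity c * L * t ^ 4 * sieveProd (exDensity c T) I) *
      (2 * ∑ l ∈ Finset.Ioc 0 (t ^ 2), (if l.Prime ∧ 2 ^ 2 ^ I ≤ l ∧ exChar c T l = 1 then
        1 / (l : ℝ) else 0) + 2 / 2 ^ 2 ^ I) +
      64 * Q * t ^ 3 * (2 ^ 2 ^ I) ^ (4 * b + 14) := by
  have hχ := exChar_realCharacter hc hT
  have hρ0 := classDensity_pos c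
  have hV := sieveProd_pos (g := exDensity c T) (fun l hl => exDensity_nonneg hl)
    (fun l hl => exDensity_le hl) (fun l hl => exDensity_le' hl) I
  set z := 2 ^ 2 ^ I with hz
  have hz2 : 2 ≤ z := by
    calc 2 = 2 ^ 1 := by norm_num
      _ ≤ 2 ^ 2 ^ I := Nat.pow_le_pow_right (by norm_num) Nat.one_le_two_pow
  set F : ℕ → ℝ := fun m => if IsRough z m then
      (if InClass c g m then charConv (exChar c T) m else 0) else 0 with hF
  have hF0 : ∀ m, 0 ≤ F m := by
    intro m
    simp only [hF]
    split_ifs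
    · exact hχ.charConv_nonneg m
    · exact le_rfl
    · exact le_rfl
  set P := (Finset.Ioc 0 (t ^ 2)).filter (fun l => l.Prime ∧ z ≤ l) with hP
  have hFP : ∀ m ∈ Finset.Ioc 0 (t ^ 4), F m ≤ ∑ l ∈ P, if l ∣ m then F m else 0 := by
    intro m hm
    rw [Finset.mem_Ioc] at hm
    have hnn : ∀ l ∈ P, 0 ≤ if l ∣ m then F m else 0 := by
      intro l _; split_ifs
      · exact hF0 m
      · exact le_rfl
    by_cases hr : IsRough z m ∧ InClass c g m
    · obtain ⟨hr, hcl⟩ := hr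
      have hm1 : m ≠ 1 := by
        rintro rfl
        exact hg (hcl.unique ⟨1, by simp, by simp⟩)
      have hmp : ¬ m.Prime := fun h => absurd (hno m h hcl) (by omega)
      have hlp := Nat.minFac_prime hm1
      have hlz : z ≤ m.minFac := by
        by_contra h
        exact hr _ hlp (by omega) (Nat.minFac_dvd m)
      have hlt : m.minFac ≤ t ^ 2 := by
        have h1 := Nat.minFac_sq_le_self hm.1 hmp
        have h2 : m.minFac ^ 2 ≤ (t ^ 2) ^ 2 := h1.trans (hm.2.trans_eq (pow_mul t 2 2))
        exact (Nat.pow_le_pow_iff_left (by norm_num)).1 h2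
      have hmem : m.minFac ∈ P := by
        simp only [hP, Finset.mem_filter, Finset.mem_Ioc]
        exact ⟨⟨hlp.pos, hlt⟩, hlp, hlz⟩
      calc F m = if m.minFac ∣ m then F m else 0 := by rw [if_pos (Nat.minFac_dvd m)]
        _ ≤ _ := Finset.single_le_sum (f := fun l => if l ∣ m then F m else 0) hnn hmem
    · have : F m = 0 := by
        simp only [hF]
        split_ifs with h1 h2
        · exact absurd ⟨h1, h2⟩ hr
        · rfl
        · rfl
      rw [this]
      simp
  have hty : ⌊(t : ℝ) ^ 4⌋₊ = t ^ 4 := by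
    rw [← Nat.cast_pow]; exact Nat.floor_natCast _
  have hsy : √((t : ℝ) ^ 4) = t ^ 2 := by
    rw [show (t : ℝ) ^ 4 = (t ^ 2) ^ 2 by ring, Real.sqrt_sq (by positivity)]
  have hbd : ∀ l ∈ P, ∑ m ∈ Finset.Ioc 0 (t ^ 4), (if l ∣ m then F m else 0) ≤
      11 / 10 * (2 * classDensity c * L * t ^ 4 * sieveProd (exDensity c T) I) *
      ((if exChar c T l = 1 then 2 / (l : ℝ) else 0) + 1 / (l : ℝ) ^ 2) +
      32 * Q * t ^ 2 * (2 ^ 2 ^ I) ^ (4 * b + 14) * (1 / √(l : ℝ)) := by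
    intro l hl
    simp only [hP, Finset.mem_filter, Finset.mem_Ioc] at hl
    have hlQ : l.Coprime Q := (Nat.Prime.coprime_iff_not_dvd hl.2.1).2 fun h =>
      ((Nat.le_of_dvd (NeZero.pos Q) h).trans_lt hQ).not_ge hl.2.2
    have := convRoughSum_multiples_bound hc hT hL0 hL hb hΔ hgT (I := I)
      (show (0 : ℝ) ≤ (t : ℝ) ^ 4 by positivity) hl.2.1 hlQ
    rw [hty, hsy] at this
    exact this
  set M := 11 / 10 * (2 * classDensity c * L * t ^ 4 * sieveProd (exDensity c T) I) with hM
  have hM0 : 0 ≤ M := by positivity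
  have hs1 : ∑ l ∈ P, (if exChar c T l = 1 then 2 / (l : ℝ) else 0) =
      2 * ∑ l ∈ Finset.Ioc 0 (t ^ 2), (if l.Prime ∧ z ≤ l ∧ exChar c T l = 1 then
        1 / (l : ℝ) else 0) := by
    rw [hP, Finset.sum_filter, Finset.mul_sum]
    refine Finset.sum_congr rfl fun l _ => ?_
    by_cases h1 : l.Prime <;> by_cases h2 : z ≤ l <;> by_cases h3 : exChar c T l = 1 <;>
      simp [h1, h2, h3, div_eq_mul_inv]
  have hs2 : ∑ l ∈ P, 1 / (l : ℝ) ^ 2 ≤ 2 / (z : ℝ) := by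
    refine le_trans ?_ (sum_one_div_sq_le hz2 (t ^ 2))
    refine Finset.sum_le_sum_of_subset_of_nonneg ?_ (fun _ _ _ => by positivity)
    intro l hl
    simp only [hP, Finset.mem_filter] at hl ⊢
    exact ⟨hl.1, hl.2.2⟩
  have hs3 : ∑ l ∈ P, 1 / √(l : ℝ) ≤ 2 * t := by
    refine (Finset.sum_le_sum_of_subset_of_nonneg (Finset.filter_subset _ _)
      (fun _ _ _ => by positivity)).trans ((sum_one_div_sqrt_le (t ^ 2)).trans ?_)
    rw [Nat.cast_pow, Real.sqrt_sq (by positivity)]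
  calc convRoughSum c T z g (t ^ 4) = ∑ m ∈ Finset.Ioc 0 (t ^ 4), F m := rfl
    _ ≤ ∑ m ∈ Finset.Ioc 0 (t ^ 4), ∑ l ∈ P, (if l ∣ m then F m else 0) := Finset.sum_le_sum hFP
    _ = ∑ l ∈ P, ∑ m ∈ Finset.Ioc 0 (t ^ 4), (if l ∣ m then F m else 0) := Finset.sum_comm
    _ ≤ _ := Finset.sum_le_sum hbd
    _ = M * (∑ l ∈ P, (if exChar c T l = 1 then 2 / (l : ℝ) else 0) + ∑ l ∈ P, 1 / (l : ℝ) ^ 2) +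
        32 * Q * t ^ 2 * (2 ^ 2 ^ I) ^ (4 * b + 14) * ∑ l ∈ P, 1 / √(l : ℝ) := by
      rw [Finset.sum_add_distrib, ← Finset.mul_sum, ← Finset.mul_sum, Finset.sum_add_distrib]
    _ ≤ M * (2 * ∑ l ∈ Finset.Ioc 0 (t ^ 2), (if l.Prime ∧ z ≤ l ∧ exChar c T l = 1 then
        1 / (l : ℝ) else 0) + 2 / (z : ℝ)) +
        32 * Q * t ^ 2 * (2 ^ 2 ^ I) ^ (4 * b + 14) * (2 * t) := by
      rw [hs1]; gcongr
    _ = _ := by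
      rw [hz, Nat.cast_pow, Nat.cast_ofNat]
      ring

theorem exists_prime_of_exceptional (hc : Function.Surjective c) (hT : T.Nonempty)
    {I b : ℕ} (hb : Even b) (hΔ : sieveErr b ≤ 1 / 30) (hI : 3 ≤ I) (hQ : Q < 2 ^ 2 ^ I)
    {g : Fin n → ℤˣ} (hg : g ≠ 1) (hgT : signChar T g = 1) {t : ℕ}
    (ht : t = (2 ^ 2 ^ I) ^ (4 * b + 45))
    (hsum : ∑ l ∈ Finset.Ioc 0 (t ^ 2), (open Classical in
      if l.Prime ∧ 2 ^ 2 ^ I ≤ l ∧ exChar c T l = 1 then 1 / (l : ℝ) else 0) ≤ 1 / 20) :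
    ∃ q, q.Prime ∧ InClass c g q ∧ q ≤ t ^ 4 := by
  classical
  by_contra hno
  push Not at hno
  obtain ⟨L, hLt, hL⟩ := (exChar_realCharacter hc hT).exists_lvalue
  have hQ0 : 0 < Q := NeZero.pos Q
  have hL32 := (exChar_realCharacter hc hT).lvalue_ge hQ0 hLt
  have hQ1 : (1 : ℝ) ≤ Q := by exact_mod_cast hQ0
  have hL0 : 0 < L := lt_of_lt_of_le (by positivity) hL32
  have h1 := convRoughSum_le_of_no_prime hc hT hL0.le hL hb hΔ hQ hg hgT hno
  have h2 := (abs_le.1 (convRoughSum_bound hc hT hL0.le hL hb hΔ hgT (I := I)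
    (show (0 : ℝ) ≤ (t : ℝ) ^ 4 by positivity))).1
  have hty : ⌊(t : ℝ) ^ 4⌋₊ = t ^ 4 := by
    rw [← Nat.cast_pow]; exact Nat.floor_natCast _
  have hsy : √((t : ℝ) ^ 4) = t ^ 2 := by
    rw [show (t : ℝ) ^ 4 = (t ^ 2) ^ 2 by ring, Real.sqrt_sq (by positivity)]
  rw [hty, hsy] at h2
  have hV : Real.exp (-16) ^ I ≤ sieveProd (exDensity c T) I := by
    unfold sieveProd
    calc Real.exp (-16) ^ I = ∏ _i : Fin I, Real.exp (-16) := by simp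
      _ ≤ _ := Finset.prod_le_prod (fun _ _ => (Real.exp_pos _).le) fun i _ =>
        exp_neg_le_block (g := exDensity c T) (fun l hl => exDensity_nonneg hl)
          (fun l hl => exDensity_le hl) (fun l hl => exDensity_le' hl) i
  have hz256 : (256 : ℝ) ≤ 2 ^ 2 ^ I := by
    calc (256 : ℝ) = 2 ^ 2 ^ 3 := by norm_num
      _ ≤ 2 ^ 2 ^ I := pow_le_pow_right₀ (by norm_num) (Nat.pow_le_pow_right (by norm_num) hI)
  have hVz : 1 / (2 ^ 2 ^ I : ℝ) ^ 24 ≤ Real.exp (-16) ^ I := by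
    have h16 : Real.exp 16 ≤ 2 ^ 24 := by
      have := Real.exp_one_lt_d9
      calc Real.exp 16 = Real.exp 1 ^ 16 := by rw [← Real.exp_nat_mul]; norm_num
        _ ≤ 2.7182818286 ^ 16 := by gcongr
        _ ≤ 2 ^ 24 := by norm_num
    rw [Real.exp_neg, inv_pow, one_div]
    apply inv_anti₀ (by positivity)
    calc Real.exp 16 ^ I ≤ (2 ^ 24) ^ I := by gcongr
      _ = (2 ^ I) ^ 24 := by rw [← pow_mul, ← pow_mul, mul_comm]
      _ ≤ (2 ^ 2 ^ I) ^ 24 := by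
        gcongr
        · norm_num
        · exact Nat.lt_two_pow_self.le
  have hρ : 1 / (Q : ℝ) ≤ classDensity c := by
    unfold classDensity
    gcongr
    exact_mod_cast (Nat.card_pos : 0 < Nat.card c.ker)
  have htr : (t : ℝ) = (2 ^ 2 ^ I) ^ (4 * b + 45) := by rw [ht]; push_cast; rfl
  have hQz : (Q : ℝ) ≤ 2 ^ 2 ^ I := by exact_mod_cast hQ.le
  set z : ℝ := 2 ^ 2 ^ I with hz
  set V := sieveProd (exDensity c T) I
  set S := ∑ l ∈ Finset.Ioc 0 (t ^ 2), (open Classical in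
      if l.Prime ∧ 2 ^ 2 ^ I ≤ l ∧ exChar c T l = 1 then 1 / (l : ℝ) else 0)
  set R := 2 * classDensity c * L * (t : ℝ) ^ 4 * V with hR
  have hz0 : 0 < z := by linarith
  have hρ0 := classDensity_pos c
  have ht1 : (1 : ℝ) ≤ t := by rw [htr]; exact one_le_pow₀ (by linarith)
  have hR1 : 2 * (1 / (Q : ℝ)) * (1 / (32 * Q)) * (t : ℝ) ^ 4 * (1 / z ^ 24) ≤ R := by
    have : 1 / z ^ 24 ≤ V := hVz.trans hV
    rw [hR]; gcongr
  have hz2 : 2 / z ≤ 1 / 100 := by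
    rw [div_le_div_iff₀ hz0 (by norm_num)]; linarith
  have hR0 : 0 ≤ R := le_trans (by positivity) hR1
  have hsm : 11 / 10 * R * (2 * S + 2 / z) ≤ 11 / 10 * R * (2 * (1 / 20) + 1 / 100) := by gcongr
  have hD : (0 : ℝ) < z ^ (4 * b + 14) := by positivity
  have hQt : 16 * (Q : ℝ) * t ^ 2 * z ^ (4 * b + 14) ≤ 16 * Q * t ^ 3 * z ^ (4 * b + 14) := by
    gcongr <;> first | exact ht1 | norm_num
  have hfin : R ≤ 160 * Q * t ^ 3 * z ^ (4 * b + 14) := by linarith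
  have h5 := hR1.trans hfin
  have h6 : (t : ℝ) ^ 4 ≤ 2560 * (Q : ℝ) ^ 3 * t ^ 3 * z ^ (4 * b + 38) := by
    have e1 : 2 * (1 / (Q : ℝ)) * (1 / (32 * Q)) * (t : ℝ) ^ 4 * (1 / z ^ 24) =
        t ^ 4 / (16 * Q ^ 2 * z ^ 24) := by field_simp; norm_num
    rw [e1, div_le_iff₀ (by positivity)] at h5
    calc (t : ℝ) ^ 4 ≤ _ := h5
      _ = _ := by ring
  have h7 : (t : ℝ) ≤ 2560 * (Q : ℝ) ^ 3 * z ^ (4 * b + 38) := by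
    have : (t : ℝ) ^ 3 * t ≤ t ^ 3 * (2560 * (Q : ℝ) ^ 3 * z ^ (4 * b + 38)) := by
      calc _ = (t : ℝ) ^ 4 := by ring
        _ ≤ _ := h6
        _ = _ := by ring
    exact le_of_mul_le_mul_left this (by positivity)
  have h8 : 2560 * (Q : ℝ) ^ 3 * z ^ (4 * b + 38) ≤ 2560 * z ^ 3 * z ^ (4 * b + 38) := by gcongr
  have h9 : z ^ (4 * b + 45) ≤ 2560 * z ^ (4 * b + 41) := by
    rw [← htr]
    calc (t : ℝ) ≤ _ := h7
      _ ≤ _ := h8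
      _ = _ := by ring
  have h10 : z ^ (4 * b + 45) = z ^ (4 * b + 41) * z ^ 4 := by ring
  have h11 : (2560 : ℝ) < z ^ 4 := by
    calc (2560 : ℝ) < 256 ^ 4 := by norm_num
      _ ≤ z ^ 4 := by gcongr
  have h12 : (0 : ℝ) < z ^ (4 * b + 41) := by positivity
  nlinarith

end ExceptionalSieve

section Linnik

theorem exists_even_sieveErr_le : ∃ b : ℕ, Even b ∧ sieveErr b ≤ 1 / 30 := by
  obtain ⟨b, k, hb, -, -, h⟩ := exists_density_parameters 30 (by norm_num)
  refine ⟨b, hb, le_trans ?_ h⟩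
  have h2 : (1 : ℝ) ≤ 2 ^ k := one_le_pow₀ (by norm_num)
  exact le_mul_of_one_le_right (sieveErr_pos b).le (by nlinarith)

variable {Q n : ℕ} [NeZero Q] {c : (ZMod Q)ˣ →* (Fin n → ℤˣ)} {T : Finset (Fin n)}

open Classical in
theorem sum_exceptional_primes_le {I b k e : ℕ} {s η : ℝ} (hQ : Q < 2 ^ 2 ^ I)
    (hk : (2 * b + 14) ^ 6 ≤ 2 ^ k) (hs : s = 1 / (2 ^ k * Real.log (2 ^ 2 ^ I : ℕ)))
    {N Y : ℕ} (hY : Y ≤ (2 ^ 2 ^ (I + k)) ^ e) (hN : Y ≤ N)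
    (h : ∑ h, (if signChar T h = 1 then
      mangoldtClass c (2 ^ 2 ^ I) (densityCutoff I b) h s N else 0) ≤ η / s) :
    ∑ l ∈ Finset.Ioc 0 Y, (if l.Prime ∧ 2 ^ 2 ^ (I + k) ≤ l ∧ exChar c T l = 1 then
        1 / (l : ℝ) else 0) ≤ Real.exp e * η := by
  have hz2 : (2 : ℝ) ≤ (2 ^ 2 ^ I : ℕ) := by
    exact_mod_cast (show 2 ≤ 2 ^ 2 ^ I from
      calc 2 = 2 ^ 1 := by norm_num
        _ ≤ 2 ^ 2 ^ I := Nat.pow_le_pow_right (by norm_num) Nat.one_le_two_pow)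
  have hlog : 0 < Real.log (2 ^ 2 ^ I : ℕ) := Real.log_pos (by linarith)
  have hs0 : 0 < s := by rw [hs]; positivity
  have hpow : 2 ^ 2 ^ (I + k) = (2 ^ 2 ^ I) ^ 2 ^ k := by rw [pow_add, pow_mul]
  have hlogz : Real.log (2 ^ 2 ^ (I + k) : ℕ) = 1 / s := by
    rw [hpow, Nat.cast_pow, Real.log_pow, hs, one_div_one_div]
    push_cast
    rfl
  set z := 2 ^ 2 ^ I with hz
  set z' := 2 ^ 2 ^ (I + k) with hz'
  have hz2' : 2 ≤ z := by exact_mod_cast hz2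
  have hm := sum_roughClassSum_mul (z := z) c hQ
    (fun m => ArithmeticFunction.vonMangoldt m * (m : ℝ) ^ (-(1 + s)))
    (fun h => if signChar T h = 1 then 1 else 0) (densityCutoff I b) N
  have hcut : densityCutoff I b < z' := by
    unfold densityCutoff
    rw [hpow]
    apply Nat.pow_lt_pow_right (by omega)
    calc 2 * (2 * b + 14) < (2 * b + 14) ^ 2 := by nlinarith
      _ ≤ (2 * b + 14) ^ 6 := Nat.pow_le_pow_right (by omega) (by norm_num)
      _ ≤ 2 ^ k := hk
  have hzz : z ≤ z' := Nat.pow_le_pow_right (by norm_num)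
    (Nat.pow_le_pow_right (by norm_num) (by omega))
  have hz'0 : 0 < z' := by omega
  have hnn : ∀ m : ℕ, 0 ≤ (if IsRough z m then ArithmeticFunction.vonMangoldt m *
      (m : ℝ) ^ (-(1 + s)) * (if signChar T (classOf c m) = 1 then 1 else 0) else 0) := by
    intro m
    have := mangoldt_term_nonneg s m
    split_ifs
    · rwa [mul_one]
    · rw [mul_zero]
    · exact le_rfl
  have hmain : (1 / s) * (Real.exp (-e) * ∑ l ∈ Finset.Ioc 0 Y,
      (if l.Prime ∧ z' ≤ l ∧ exChar c T l = 1 then 1 / (l : ℝ) else 0)) ≤ η / s := by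
    refine le_trans ?_ h
    calc _ ≤ ∑ d ∈ Finset.Ioc (densityCutoff I b) N, (if IsRough z d then
          ArithmeticFunction.vonMangoldt d * (d : ℝ) ^ (-(1 + s)) *
          (if signChar T (classOf c d) = 1 then 1 else 0) else 0) := by
          rw [← Finset.sum_filter, Finset.mul_sum, Finset.mul_sum]
          refine le_trans (Finset.sum_le_sum fun l hl => ?_)
            (Finset.sum_le_sum_of_subset_of_nonneg ?_ fun m _ _ => hnn m)
          · simp only [Finset.mem_filter, Finset.mem_Ioc] at hl
            obtain ⟨⟨-, hlY⟩, hlp, hlz, hχ⟩ := hl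
            have hr : IsRough z l := fun p hp hpz hd => by
              rw [(Nat.prime_dvd_prime_iff_eq hp hlp)] at hd
              omega
            have hcop := hr.coprime hQ (NeZero.pos Q)
            have hsc : signChar T (classOf c l) = 1 := by
              rw [← (inClass_classOf c hcop).exChar_eq T, hχ]
            have hl0 : (0 : ℝ) < l := by exact_mod_cast hlp.pos
            have hll : 1 / s ≤ Real.log l := by
              rw [← hlogz]
              exact Real.log_le_log (by exact_mod_cast hz'0) (by exact_mod_cast hlz)
            have hlu : s * Real.log l ≤ e := by
              have h1 : Real.log l ≤ e * (1 / s) := by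
                rw [← hlogz, ← Real.log_pow]
                exact Real.log_le_log hl0 (by exact_mod_cast hlY.trans hY)
              calc s * Real.log l ≤ s * (e * (1 / s)) := by gcongr
                _ = e := by field_simp
            have hpw : Real.exp (-e) * (1 / l) ≤ (l : ℝ) ^ (-(1 + s)) := by
              rw [Real.rpow_def_of_pos hl0, one_div, ← Real.exp_log (inv_pos.2 hl0),
                Real.log_inv, ← Real.exp_add]
              apply Real.exp_le_exp.2
              nlinarith
            rw [if_pos hr, if_pos hsc, ArithmeticFunction.vonMangoldt_apply_prime hlp, mul_one]
            gcongr
          · intro l hl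
            simp only [Finset.mem_filter, Finset.mem_Ioc] at hl ⊢
            omega
      _ = _ := by
          rw [← hm]
          refine Finset.sum_congr rfl fun h _ => ?_
          unfold mangoldtClass
          split_ifs <;> simp
  have h3 : (1 / s) * (Real.exp (-e) * ∑ l ∈ Finset.Ioc 0 Y,
      (if l.Prime ∧ z' ≤ l ∧ exChar c T l = 1 then 1 / (l : ℝ) else 0)) ≤ (1 / s) * η := by
    rw [one_div_mul_eq_div (b := η)] at *
    exact hmain
  have h4 := le_of_mul_le_mul_left h3 (by positivity)
  rw [Real.exp_neg, inv_mul_le_iff₀ (Real.exp_pos _)] at h4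
  exact h4

/-- Linnik's theorem for quotients of exponent two. -/
theorem exists_prime_inClass_le : ∃ C : ℕ, ∀ {Q n : ℕ} [NeZero Q]
    {c : (ZMod Q)ˣ →* (Fin n → ℤˣ)}, 2 ≤ Q → Function.Surjective c → ∀ g, g ≠ 1 →
    ∃ q : ℕ, q.Prime ∧ InClass c g q ∧ q ≤ Q ^ C := by
  obtain ⟨b', hb', hΔ⟩ := exists_even_sieveErr_le
  set e := 4 * (4 * b' + 45) with he
  obtain ⟨b, k, K₀, hK, hb, hk, hex⟩ := exists_exceptional_signChar (Real.exp (-e) / 20)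
    (by positivity) (e + 1)
  refine ⟨2 * (2 ^ k * K₀), fun {Q n} _ c hQ2 hc g hg => ?_⟩
  obtain ⟨I, hI1, hQI, hIQ⟩ : ∃ I : ℕ, 1 ≤ I ∧ Q < 2 ^ 2 ^ I ∧ 2 ^ 2 ^ I ≤ Q ^ 2 := by
    refine ⟨Nat.log 2 (Nat.log 2 Q) + 1, by omega, ?_, ?_⟩
    · have h1 := Nat.lt_pow_succ_log_self one_lt_two (Nat.log 2 Q)
      have h2 := Nat.lt_pow_succ_log_self one_lt_two Q
      exact h2.trans_le (Nat.pow_le_pow_right (by norm_num) h1)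
    · have h0 : 0 < Nat.log 2 Q := Nat.log_pos one_lt_two hQ2
      have h1 := Nat.pow_log_le_self 2 h0.ne'
      have h2 := Nat.pow_log_le_self 2 (show Q ≠ 0 by omega)
      rw [pow_succ, pow_mul]
      exact Nat.pow_le_pow_left ((Nat.pow_le_pow_right (by norm_num) h1).trans h2) 2
  set s : ℝ := 1 / (2 ^ k * Real.log (2 ^ 2 ^ I : ℕ)) with hs
  set t := (2 ^ 2 ^ (I + k)) ^ (4 * b' + 45) with ht
  have hk3 : 3 ≤ k := by
    by_contra h
    have h1 : 2 ^ k ≤ 2 ^ 3 := Nat.pow_le_pow_right (by norm_num) (by omega)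
    have h2 : (14 : ℕ) ^ 6 ≤ (2 * b + 14) ^ 6 := Nat.pow_le_pow_left (by omega) 6
    norm_num at h1 h2
    omega
  have hzz : 2 ^ 2 ^ I ≤ 2 ^ 2 ^ (I + k) := Nat.pow_le_pow_right (by norm_num)
    (Nat.pow_le_pow_right (by norm_num) (by omega))
  have hpow : 2 ^ 2 ^ (I + k) = (2 ^ 2 ^ I) ^ 2 ^ k := by rw [pow_add, pow_mul]
  have ht4 : t ^ 4 = (2 ^ 2 ^ (I + k)) ^ e := by rw [ht, he, ← pow_mul]; ring_nf
  have hzQ : (2 ^ 2 ^ (I + k)) ^ K₀ ≤ Q ^ (2 * (2 ^ k * K₀)) := by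
    rw [hpow, ← pow_mul, pow_mul Q]
    exact Nat.pow_le_pow_left hIQ _
  by_contra hno
  push Not at hno
  have hno1 : ∀ q : ℕ, q.Prime → InClass c g q → (2 ^ 2 ^ (I + k)) ^ K₀ < q := fun q hq hc =>
    hzQ.trans_lt (hno q hq hc)
  have hno2 : ∀ q : ℕ, q.Prime → InClass c g q → t ^ 4 < q := fun q hq hc => by
    rw [ht4]
    exact (Nat.pow_le_pow_right (by positivity) (by omega)).trans_lt (hno1 q hq hc)
  have hz2 : (2 : ℝ) ≤ (2 ^ 2 ^ I : ℕ) := by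
    exact_mod_cast (show 2 ≤ 2 ^ 2 ^ I by
      calc 2 = 2 ^ 1 := by norm_num
        _ ≤ 2 ^ 2 ^ I := Nat.pow_le_pow_right (by norm_num) Nat.one_le_two_pow)
  have hlog : 0 < Real.log (2 ^ 2 ^ I : ℕ) := Real.log_pos (by linarith)
  have hs0 : 0 < s := by rw [hs]; positivity
  have hlogz : Real.log (2 ^ 2 ^ (I + k) : ℕ) = 1 / s := by
    rw [hpow, Nat.cast_pow, Real.log_pow, hs, one_div_one_div]
    push_cast
    rfl
  obtain ⟨N, hN, T, hT, hgT, hsum⟩ := hex hc hI1 hQI hs g hg (fun q hq hqg => by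
    have h1 : K₀ * Real.log (2 ^ 2 ^ (I + k) : ℕ) ≤ Real.log q := by
      rw [← Real.log_pow]
      refine Real.log_le_log (by positivity) ?_
      exact_mod_cast (hno1 q hq hqg).le
    rwa [hlogz, mul_one_div] at h1) (t ^ 2)
  have ht24 : t ^ 2 ≤ (2 ^ 2 ^ (I + k)) ^ e := by
    rw [← ht4]
    exact Nat.pow_le_pow_right (by positivity) (by norm_num)
  have hbound := sum_exceptional_primes_le (e := e) hQI hk hs ht24 hN hsum
  have heq : Real.exp e * (Real.exp (-e) / 20) = 1 / 20 := by
    rw [← mul_div_assoc, ← Real.exp_add, add_neg_cancel, Real.exp_zero]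
  rw [heq] at hbound
  obtain ⟨q, hq, hqg, hqt⟩ := exists_prime_of_exceptional hc hT hb' hΔ (I := I + k) (by omega)
    (hQI.trans_le hzz) hg hgT ht hbound
  exact absurd (hno2 q hq hqg) (by omega)

end Linnik

section PrimesOneModFour

open ArithmeticFunction ArithmeticFunction.vonMangoldt Complex

variable {q : ℕ} [NeZero q] {a : ZMod q}

theorem exists_abs_tsum_residueClass_sub_le (ha : IsUnit a) :
    ∃ C : ℝ, ∀ {x : ℝ} (_ : x ∈ Set.Ioc 1 2),
      |∑' n, residueClass a n / (n : ℝ) ^ x - (q.totient : ℝ)⁻¹ / (x - 1)| ≤ C := by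
  have H {x : ℝ} (hx : 1 < x) :
      ∑' n, residueClass a n / (n : ℝ) ^ x =
        (LFunctionResidueClassAux a x).re + (q.totient : ℝ)⁻¹ / (x - 1) := by
    refine ofReal_injective ?_
    simp only [ofReal_tsum, ofReal_div, ofReal_cpow (Nat.cast_nonneg _), ofReal_natCast,
      ofReal_add, ofReal_inv, ofReal_sub, ofReal_one]
    simp_rw [← LFunctionResidueClassAux_real ha hx,
      eqOn_LFunctionResidueClassAux ha <| Set.mem_ofPred.mpr (ofReal_re x ▸ hx), sub_add_cancel,
      LSeries, LSeries.term]
    refine tsum_congr fun n ↦ ?_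
    split_ifs with hn
    · simp only [hn, residueClass_apply_zero, ofReal_zero, zero_div]
    · rfl
  have hcont : ContinuousOn (fun x : ℝ ↦ (LFunctionResidueClassAux a x).re) (Set.Icc 1 2) :=
    continuous_re.continuousOn.comp (t := Set.univ) (continuousOn_LFunctionResidueClassAux a)
      (fun _ _ ↦ trivial) |>.comp continuous_ofReal.continuousOn fun x hx ↦ by
        simpa only [Set.mem_ofPred_eq, ofReal_re] using hx.1
  obtain ⟨C, hC⟩ := isCompact_Icc.exists_bound_of_continuousOn hcont
  refine ⟨C, fun {x} hx ↦ ?_⟩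
  rw [H hx.1, add_sub_cancel_right]
  exact hC x (Set.Ioc_subset_Icc_self hx)

theorem summable_residueClass_div_rpow (a : ZMod q) {x : ℝ} (hx : 1 < x) :
    Summable fun n : ℕ => residueClass a n / (n : ℝ) ^ x :=
  LSeries.summable_real_of_abscissaOfAbsConv_lt <|
    (abscissaOfAbsConv_residueClass_le_one a).trans_lt <| mod_cast hx

theorem residueClass_prime_term_le {n : ℕ} (hn : n.Prime) (a : ZMod q) {s v : ℝ} (hv : 0 < v)
    (hs : s = 1 / v) :
    residueClass a n / (n : ℝ) ^ (1 + s) ≤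
      Real.exp 1 * (residueClass a n / (n : ℝ) ^ (1 + 20 * s)) +
      Real.exp (-5) * (residueClass a n / (n : ℝ) ^ (1 + s / 2)) +
      (if n ∈ (Finset.range (⌊Real.exp (10 * v)⌋₊ + 1)).filter
          (fun n : ℕ => n.Prime ∧ (n : ZMod q) = a) then
        10 * v * Real.exp (-(v / 20)) else 0) := by
  have hn0 : (0 : ℝ) < n := by exact_mod_cast hn.pos
  have hs0 : 0 < s := by rw [hs]; positivity
  have hr := residueClass_nonneg a n
  have hsv : s * v = 1 := by rw [hs]; field_simp
  have hA : 0 ≤ Real.exp 1 * (residueClass a n / (n : ℝ) ^ (1 + 20 * s)) := by positivity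
  have hB : 0 ≤ Real.exp (-5) * (residueClass a n / (n : ℝ) ^ (1 + s / 2)) := by positivity
  have hD : 0 ≤ (if n ∈ (Finset.range (⌊Real.exp (10 * v)⌋₊ + 1)).filter
          (fun n : ℕ => n.Prime ∧ (n : ZMod q) = a) then
        10 * v * Real.exp (-(v / 20)) else 0) := by split_ifs <;> positivity
  have hexp (y : ℝ) : (n : ℝ) ^ y = Real.exp (Real.log n * y) := Real.rpow_def_of_pos hn0 y
  rcases le_or_gt (Real.log n) (v / 20) with h1 | h1
  · have : residueClass a n / (n : ℝ) ^ (1 + s) ≤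
        Real.exp 1 * (residueClass a n / (n : ℝ) ^ (1 + 20 * s)) := by
      rw [← mul_div_assoc, mul_comm, mul_div_assoc, div_eq_mul_inv]
      refine mul_le_mul_of_nonneg_left ?_ hr
      rw [hexp, hexp, ← Real.exp_neg, ← Real.exp_sub, Real.exp_le_exp]
      nlinarith [mul_le_mul_of_nonneg_right h1 hs0.le]
    linarith
  rcases lt_or_ge (10 * v) (Real.log n) with h2 | h2
  · have : residueClass a n / (n : ℝ) ^ (1 + s) ≤
        Real.exp (-5) * (residueClass a n / (n : ℝ) ^ (1 + s / 2)) := by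
      rw [← mul_div_assoc, mul_comm, mul_div_assoc, div_eq_mul_inv]
      refine mul_le_mul_of_nonneg_left ?_ hr
      rw [hexp, hexp, ← Real.exp_neg, ← Real.exp_sub, Real.exp_le_exp]
      nlinarith [mul_le_mul_of_nonneg_right h2.le hs0.le]
    linarith
  · by_cases hna : (n : ZMod q) = a
    · have hmem : n ∈ (Finset.range (⌊Real.exp (10 * v)⌋₊ + 1)).filter
          (fun n : ℕ => n.Prime ∧ (n : ZMod q) = a) := by
        simp only [Finset.mem_filter, Finset.mem_range, Nat.lt_succ_iff]
        refine ⟨Nat.le_floor ?_, hn, hna⟩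
        rwa [← Real.log_le_iff_le_exp hn0]
      rw [if_pos hmem]
      have hle : residueClass a n ≤ 10 * v :=
        (residueClass_le a n).trans (vonMangoldt_le_log.trans h2)
      have : residueClass a n / (n : ℝ) ^ (1 + s) ≤ 10 * v * Real.exp (-(v / 20)) := by
        rw [div_eq_mul_inv, hexp, ← Real.exp_neg]
        refine mul_le_mul hle ?_ (Real.exp_pos _).le (by positivity)
        rw [Real.exp_le_exp]
        nlinarith [mul_pos (show 0 < Real.log n by linarith [show 0 < v / 20 by positivity]) hs0]
      linarith
    · have : residueClass a n = 0 := by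
        simp [residueClass, hna]
      rw [this, zero_div]
      rw [this] at hA hB
      linarith

theorem exists_count_primes_residueClass_ge (ha : IsUnit a) :
    ∃ v₀ : ℝ, 0 < v₀ ∧ ∀ v : ℝ, v₀ ≤ v →
      Real.exp (v / 20) * (1 / (25 * q.totient)) ≤
        ((Finset.range (⌊Real.exp (10 * v)⌋₊ + 1)).filter
          (fun n : ℕ => n.Prime ∧ (n : ZMod q) = a)).card := by
  obtain ⟨C, hC⟩ := exists_abs_tsum_residueClass_sub_le ha
  have hφ : (0 : ℝ) < q.totient := by exact_mod_cast Nat.totient_pos.mpr (NeZero.pos q)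
  set κ : ℝ := (q.totient : ℝ)⁻¹ with hκ
  have hκ0 : 0 < κ := by positivity
  set N := ∑' n : ℕ, (if n.Prime then 0 else residueClass a n) / (n : ℝ) with hN
  have hN0 : 0 ≤ N := tsum_nonneg fun n => by
    split_ifs
    · simp
    · exact div_nonneg (residueClass_nonneg a n) (Nat.cast_nonneg _)
  have hC0 : 0 ≤ C := (abs_nonneg _).trans (hC (x := 2) (by norm_num))
  refine ⟨20 + 10 / κ * (N + 5 * C), by positivity, fun v hv => ?_⟩
  have hv20 : 20 ≤ v := le_trans (by simp; positivity) hv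
  have hv0 : 0 < v := by linarith
  set s := 1 / v with hs
  have hs0 : 0 < s := by positivity
  have hs1 : 20 * s ≤ 1 := by rw [hs, mul_one_div, div_le_one hv0]; exact hv20
  set F := (Finset.range (⌊Real.exp (10 * v)⌋₊ + 1)).filter
          (fun n : ℕ => n.Prime ∧ (n : ZMod q) = a) with hF
  set w := 10 * v * Real.exp (-(v / 20)) with hw
  have hw0 : 0 ≤ w := by positivity
  have hsum1 := summable_residueClass_div_rpow a (show 1 < 1 + s by linarith)
  have hsum20 := summable_residueClass_div_rpow a (show 1 < 1 + 20 * s by linarith)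
  have hsumh := summable_residueClass_div_rpow a (show 1 < 1 + s / 2 by linarith)
  have hsumN := summable_residueClass_non_primes_div a
  have hsumF : Summable fun n : ℕ => if n ∈ F then w else 0 :=
    summable_of_ne_finset_zero (s := F) fun n hn => if_neg hn
  have hpt (n : ℕ) : residueClass a n / (n : ℝ) ^ (1 + s) ≤
      ((if n.Prime then 0 else residueClass a n) / (n : ℝ)) +
      (Real.exp 1 * (residueClass a n / (n : ℝ) ^ (1 + 20 * s)) +
      Real.exp (-5) * (residueClass a n / (n : ℝ) ^ (1 + s / 2)) +
      (if n ∈ F then w else 0)) := by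
    by_cases hn : n.Prime
    · rw [if_pos hn, zero_div, zero_add]
      exact residueClass_prime_term_le hn a hv0 hs
    · rw [if_neg hn]
      have hr := residueClass_nonneg a n
      have h2 : 0 ≤ (if n ∈ F then w else 0) := by split_ifs <;> positivity
      have h1 : residueClass a n / (n : ℝ) ^ (1 + s) ≤ residueClass a n / (n : ℝ) := by
        rcases n.eq_zero_or_pos with rfl | hn0
        · simp
        · refine div_le_div_of_nonneg_left hr (by exact_mod_cast hn0) ?_
          conv_lhs => rw [← Real.rpow_one n]
          exact Real.rpow_le_rpow_of_exponent_le (by exact_mod_cast hn0) (by linarith)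
      have h3 : 0 ≤ Real.exp 1 * (residueClass a n / (n : ℝ) ^ (1 + 20 * s)) +
        Real.exp (-5) * (residueClass a n / (n : ℝ) ^ (1 + s / 2)) := by positivity
      linarith
  have hle := Summable.tsum_le_tsum hpt hsum1
    (hsumN.add (((hsum20.mul_left _).add (hsumh.mul_left _)).add hsumF))
  rw [hsumN.tsum_add (((hsum20.mul_left _).add (hsumh.mul_left _)).add hsumF),
    ((hsum20.mul_left _).add (hsumh.mul_left _)).tsum_add hsumF,
    (hsum20.mul_left _).tsum_add (hsumh.mul_left _), tsum_mul_left, tsum_mul_left, ← hN,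
    tsum_eq_sum (s := F) (fun n hn => if_neg hn), Finset.sum_congr rfl (fun n hn => if_pos hn),
    Finset.sum_const, nsmul_eq_mul] at hle
  have e1 := abs_le.1 (hC (x := 1 + s) ⟨by linarith, by linarith⟩)
  have e2 := abs_le.1 (hC (x := 1 + 20 * s) ⟨by linarith, by linarith⟩)
  have e3 := abs_le.1 (hC (x := 1 + s / 2) ⟨by linarith, by linarith⟩)
  simp only [add_sub_cancel_left] at e1 e2 e3
  have f1 : κ / s = κ * v := by rw [hs]; field_simp
  have f2 : κ / (20 * s) = κ * v / 20 := by rw [hs]; field_simp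
  have f3 : κ / (s / 2) = 2 * (κ * v) := by rw [hs]; field_simp
  rw [f1] at e1
  rw [f2] at e2
  rw [f3] at e3
  have hE1 : Real.exp 1 ≤ 2.72 := by linarith [Real.exp_one_lt_d9]
  have hE5 : Real.exp (-5) ≤ 0.04 := by
    rw [Real.exp_neg, inv_le_comm₀ (Real.exp_pos _) (by norm_num)]
    have : Real.exp 5 = Real.exp 1 ^ 5 := by rw [← Real.exp_nat_mul]; norm_num
    rw [this]
    have h2 : (2 : ℝ) ≤ Real.exp 1 := by linarith [Real.exp_one_gt_d9]
    calc (0.04 : ℝ)⁻¹ ≤ 2 ^ 5 := by norm_num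
      _ ≤ _ := by gcongr
  set S20 := ∑' n, residueClass a n / (n : ℝ) ^ (1 + 20 * s)
  set Sh := ∑' n, residueClass a n / (n : ℝ) ^ (1 + s / 2)
  have g1 : Real.exp 1 * S20 ≤ 2.72 * (κ * v / 20 + C) :=
    mul_le_mul hE1 (by linarith) (tsum_nonneg fun n => by
      have := residueClass_nonneg a n; positivity) (by norm_num)
  have g2 : Real.exp (-5) * Sh ≤ 0.04 * (2 * (κ * v) + C) :=
    mul_le_mul hE5 (by linarith) (tsum_nonneg fun n => by
      have := residueClass_nonneg a n; positivity) (by norm_num)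
  have hv' : 10 * (N + 5 * C) ≤ κ * v := by
    have h3 := mul_le_mul_of_nonneg_left hv hκ0.le
    have h4 : κ * (20 + 10 / κ * (N + 5 * C)) = κ * 20 + 10 * (N + 5 * C) := by
      field_simp
    rw [h4] at h3
    linarith
  have hfin : 0.4 * (κ * v) ≤ F.card * w := by linarith
  have hE := Real.exp_pos (v / 20)
  rw [hw, Real.exp_neg] at hfin
  have h5 : 0.4 * κ * Real.exp (v / 20) ≤ F.card * 10 := by
    have h6 : F.card * (10 * v * (Real.exp (v / 20))⁻¹) * (Real.exp (v / 20) / v) =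
        F.card * 10 := by field_simp
    have h7 : 0.4 * (κ * v) * (Real.exp (v / 20) / v) = 0.4 * κ * Real.exp (v / 20) := by
      field_simp
    rw [← h6, ← h7]
    exact mul_le_mul_of_nonneg_right hfin (by positivity)
  have h8 : Real.exp (v / 20) * (1 / (25 * q.totient)) = 0.04 * κ * Real.exp (v / 20) := by
    rw [hκ]; field_simp; norm_num
  rw [h8]
  linarith

theorem exists_nth_prime_one_mod_four_le : ∃ D : ℕ, ∀ n j : ℕ, j < n →
    Nat.nth (fun r : ℕ => r.Prime ∧ r % 4 = 1) j ≤ D * n ^ 200 := by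
  obtain ⟨v₀, hv₀, h⟩ := exists_count_primes_residueClass_ge (q := 4) (a := 1) isUnit_one
  refine ⟨⌈Real.exp (10 * v₀) * 50 ^ 200⌉₊, fun n j hj => ?_⟩
  have hn0 : (0 : ℝ) < n := by exact_mod_cast (by omega : 0 < n)
  have hn1 : (1 : ℝ) ≤ n := by exact_mod_cast (by omega : 1 ≤ n)
  have hlog : 0 ≤ Real.log (50 * n) := Real.log_nonneg (by linarith)
  set v := v₀ + 20 * Real.log (50 * n) with hv
  have hcount := h v (by linarith)
  have htot : Nat.totient 4 = 2 := by decide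
  rw [htot] at hcount
  have hexp : (50 * n : ℝ) ≤ Real.exp (v / 20) := by
    rw [← Real.log_le_iff_le_exp (by positivity)]
    linarith
  have hfil : ((Finset.range (⌊Real.exp (10 * v)⌋₊ + 1)).filter
      (fun r : ℕ => r.Prime ∧ (r : ZMod 4) = 1)) =
      (Finset.range (⌊Real.exp (10 * v)⌋₊ + 1)).filter (fun r : ℕ => r.Prime ∧ r % 4 = 1) := by
    refine Finset.filter_congr fun r _ => and_congr_right fun _ => ?_
    have := ZMod.natCast_eq_natCast_iff' r 1 4
    simpa using this
  rw [hfil, ← Nat.count_eq_card_filter_range] at hcount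
  have hcn : n ≤ Nat.count (fun r : ℕ => r.Prime ∧ r % 4 = 1) (⌊Real.exp (10 * v)⌋₊ + 1) := by
    have : (n : ℝ) ≤ Nat.count (fun r : ℕ => r.Prime ∧ r % 4 = 1) (⌊Real.exp (10 * v)⌋₊ + 1) := by
      refine le_trans ?_ hcount
      push_cast
      linarith
    exact_mod_cast this
  have hlt := Nat.nth_lt_of_lt_count (lt_of_lt_of_le hj hcn)
  have hle : Nat.nth (fun r : ℕ => r.Prime ∧ r % 4 = 1) j ≤ ⌊Real.exp (10 * v)⌋₊ := by omega
  have hval : Real.exp (10 * v) = Real.exp (10 * v₀) * 50 ^ 200 * (n : ℝ) ^ 200 := by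
    have h1 : 10 * v = 10 * v₀ + (200 : ℕ) * Real.log (50 * n) := by rw [hv]; push_cast; ring
    rw [h1, Real.exp_add, Real.exp_nat_mul, Real.exp_log (by positivity), mul_pow, mul_assoc]
  have hreal : (Nat.nth (fun r : ℕ => r.Prime ∧ r % 4 = 1) j : ℝ) ≤
      ⌈Real.exp (10 * v₀) * 50 ^ 200⌉₊ * (n : ℝ) ^ 200 := by
    refine (Nat.le_floor_iff (Real.exp_pos _).le |>.1 hle).trans ?_
    rw [hval]
    gcongr
    exact Nat.le_ceil _
  exact_mod_cast hreal

theorem infinite_primes_one_mod_four : {r : ℕ | r.Prime ∧ r % 4 = 1}.Infinite :=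
  Nat.infinite_setOfPred_prime_and_modEq (by norm_num) (Nat.coprime_one_left 4)

end PrimesOneModFour

section QuadraticPrimes

variable {R : Type*} [CommRing R] {δ : R} {d : ℤ}

/-- `R` is an order of index dividing two over `ℤ[√d]`, in the sense that every double of an
element is an integral combination of `1` and `δ = √d`, and these are independent. -/
structure IsHalfQuadratic (δ : R) (d : ℤ) : Prop where
  sq : δ ^ 2 = d
  two_mul : ∀ x : R, ∃ m k : ℤ, 2 * x = m + k * δ
  indep : ∀ m k : ℤ, (m + k * δ : R) = 0 → m = 0 ∧ k = 0

namespace IsHalfQuadratic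

theorem dvd_of_dvd (h : IsHalfQuadratic δ d) {q : ℕ} (hq : Odd q) {m k : ℤ}
    (hd : (q : R) ∣ m + k * δ) : (q : ℤ) ∣ m ∧ (q : ℤ) ∣ k := by
  obtain ⟨x, hx⟩ := hd
  obtain ⟨a, b, hab⟩ := h.two_mul x
  have h0 : (((2 * m - q * a : ℤ) : R) + ((2 * k - q * b : ℤ) : R) * δ) = 0 := by
    push_cast
    linear_combination 2 * hx + (q : R) * hab
  obtain ⟨h1, h2⟩ := h.indep _ _ h0
  have hc : IsCoprime (q : ℤ) 2 := by
    rw [← Nat.cast_ofNat, Nat.isCoprime_iff_coprime, Nat.coprime_two_right]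
    exact hq
  exact ⟨hc.dvd_of_dvd_mul_left ⟨a, by linarith⟩, hc.dvd_of_dvd_mul_left ⟨b, by linarith⟩⟩

theorem dvd_of_dvd_two_mul {q : ℕ} (hq : Odd q) {x : R} (hx : (q : R) ∣ 2 * x) : (q : R) ∣ x := by
  obtain ⟨t, ht⟩ := hq
  obtain ⟨y, hy⟩ := hx
  refine ⟨x - t * y, ?_⟩
  have : (q : R) = 2 * t + 1 := by rw [ht]; push_cast; ring
  linear_combination (-t : R) * hy + (-x : R) * this

theorem isPrime_span (h : IsHalfQuadratic δ d) {q : ℕ} [Fact q.Prime] (hq : Odd q)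
    (hleg : legendreSym q d = -1) : (Ideal.span {(q : R)}).IsPrime := by
  have hqp : q.Prime := Fact.out
  have key (x : R) {m k : ℤ} (hx : 2 * x = m + k * δ) (hn : (q : ℤ) ∣ m ^ 2 - d * k ^ 2) :
      x ∈ Ideal.span {(q : R)} := by
    obtain ⟨⟨a, ha⟩, ⟨b, hb⟩⟩ := legendreSym.prime_dvd_of_eq_neg_one hleg hn
    refine Ideal.mem_span_singleton.2 (dvd_of_dvd_two_mul hq ⟨a + b * δ, ?_⟩)
    rw [hx, ha, hb]
    push_cast
    ring
  refine ⟨fun htop => ?_, fun {x y} hxy => ?_⟩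
  · have h1 : (q : R) ∣ ((1 : ℤ) : R) + ((0 : ℤ) : R) * δ := by
      rw [← Ideal.mem_span_singleton, htop]
      trivial
    have h2 := (h.dvd_of_dvd hq h1).1
    exact hqp.one_lt.ne' (by exact_mod_cast Int.eq_one_of_dvd_one (by positivity) h2)
  · obtain ⟨m, k, hx⟩ := h.two_mul x
    obtain ⟨m', k', hy⟩ := h.two_mul y
    obtain ⟨z, hz⟩ := Ideal.mem_span_singleton.1 hxy
    have h1 : (q : R) ∣ ((m * m' + d * (k * k') : ℤ) : R) + ((m * k' + m' * k : ℤ) : R) * δ := by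
      refine ⟨4 * z, ?_⟩
      push_cast
      linear_combination 4 * hz - (2 * y) * hx - (m + k * δ : R) * hy - (k * k' : R) * h.sq
    obtain ⟨⟨U, hU⟩, ⟨V, hV⟩⟩ := h.dvd_of_dvd hq h1
    have h2 : (q : ℤ) ∣ (m ^ 2 - d * k ^ 2) * (m' ^ 2 - d * k' ^ 2) := by
      refine ⟨U * (m * m' + d * (k * k')) - d * (V * (m * k' + m' * k)), ?_⟩
      linear_combination (m * m' + d * (k * k')) * hU - d * (m * k' + m' * k) * hV
    rcases (Nat.prime_iff_prime_int.1 hqp).dvd_or_dvd h2 with h3 | h3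
    · exact Or.inl (key x hx h3)
    · exact Or.inr (key y hy h3)

theorem span_mul_span (h : IsHalfQuadratic δ d) {q : ℕ} (hqp : q.Prime) (hq : Odd q) {r : ℤ}
    (hr : (q : ℤ) ∣ r ^ 2 - d) (hqr : ¬ (q : ℤ) ∣ r) :
    Ideal.span {(q : R)} = Ideal.span {(q : R), δ - r} * Ideal.span {(q : R), δ + r} := by
  obtain ⟨t, ht⟩ := hr
  have ht' : (r : R) ^ 2 - d = q * t := by exact_mod_cast congrArg (Int.cast : ℤ → R) ht
  apply le_antisymm
  · rw [Ideal.span_singleton_le_iff_mem]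
    have hc : IsCoprime (2 * r) (q : ℤ) := by
      refine IsCoprime.mul_left ?_ ?_
      · rw [← Nat.cast_ofNat, Nat.isCoprime_iff_coprime, Nat.coprime_two_left]
        exact hq
      · exact ((Nat.prime_iff_prime_int.1 hqp).coprime_iff_not_dvd.2 hqr).symm
    obtain ⟨u, v, huv⟩ := hc
    have huv' : (u : R) * (2 * r) + v * q = 1 := by
      exact_mod_cast congrArg (Int.cast : ℤ → R) huv
    have h1 : (q : R) ∈ Ideal.span {(q : R), δ - r} := Ideal.subset_span (by simp)
    have h2 : (q : R) ∈ Ideal.span {(q : R), δ + r} := Ideal.subset_span (by simp)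
    have h3 : δ - r ∈ Ideal.span {(q : R), δ - r} := Ideal.subset_span (by simp)
    have h4 : δ + r ∈ Ideal.span {(q : R), δ + r} := Ideal.subset_span (by simp)
    have h5 := Ideal.add_mem _ (Ideal.mul_mem_left _ (u : R)
      (Ideal.sub_mem _ (Ideal.mul_mem_mul h1 h4) (Ideal.mul_mem_mul h3 h2)))
      (Ideal.mul_mem_left _ (v : R) (Ideal.mul_mem_mul h1 h2))
    convert h5 using 1
    linear_combination (-q : R) * huv'
  · rw [Ideal.span_pair_mul_span_pair, Ideal.span_le]
    rintro x (rfl | rfl | rfl | rfl) <;> rw [SetLike.mem_coe, Ideal.mem_span_singleton]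
    · exact ⟨q, rfl⟩
    · exact ⟨δ + r, rfl⟩
    · exact ⟨δ - r, by ring⟩
    · exact ⟨-t, by linear_combination h.sq - ht'⟩

theorem span_ne_top (h : IsHalfQuadratic δ d) {q : ℕ} (hqp : q.Prime) (hq : Odd q) {r : ℤ}
    (hr : (q : ℤ) ∣ r ^ 2 - d) (hqr : ¬ (q : ℤ) ∣ r) :
    Ideal.span {(q : R), δ - r} ≠ ⊤ := by
  intro htop
  have hmul := h.span_mul_span hqp hq hr hqr
  rw [htop, Ideal.top_mul] at hmul
  have h4 : δ + r ∈ Ideal.span {(q : R), δ + r} := Ideal.subset_span (by simp)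
  rw [← hmul, Ideal.mem_span_singleton] at h4
  have h5 : (q : R) ∣ (r : R) + ((1 : ℤ) : R) * δ := by
    convert h4 using 1
    push_cast
    ring
  exact hqr (h.dvd_of_dvd hq h5).1

theorem isPrime_span_pair (h : IsHalfQuadratic δ d) {q : ℕ} (hqp : q.Prime) (hq : Odd q) {r : ℤ}
    (hr : (q : ℤ) ∣ r ^ 2 - d) (hqr : ¬ (q : ℤ) ∣ r) :
    (Ideal.span {(q : R), δ - r}).IsPrime := by
  have hne := h.span_ne_top hqp hq hr hqr
  set P := Ideal.span {(q : R), δ - r} with hP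
  have h1 : (q : R) ∈ P := Ideal.subset_span (by simp)
  have h3 : δ - r ∈ P := Ideal.subset_span (by simp)
  have hmod (x : R) : ∃ a : ℤ, x - a ∈ P := by
    obtain ⟨m, k, hx⟩ := h.two_mul x
    obtain ⟨t, ht⟩ := hq
    have ht' : (q : R) = 2 * t + 1 := by rw [ht]; push_cast; ring
    refine ⟨(t + 1) * (m + k * r), ?_⟩
    have h5 := Ideal.add_mem _ (Ideal.mul_mem_left _ ((t + 1) * k : R) h3)
      (Ideal.mul_mem_left _ (-x) h1)
    convert h5 using 1
    push_cast
    linear_combination (t + 1 : R) * hx + (x : R) * ht'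
  have h_int (a : ℤ) (ha : (a : R) ∈ P) : (q : ℤ) ∣ a := by
    by_contra hna
    obtain ⟨u, v, huv⟩ := (Nat.prime_iff_prime_int.1 hqp).coprime_iff_not_dvd.2 hna
    have huv' : (u : R) * q + v * a = 1 := by
      exact_mod_cast congrArg (Int.cast : ℤ → R) huv
    apply hne
    rw [Ideal.eq_top_iff_one, ← huv']
    exact Ideal.add_mem _ (Ideal.mul_mem_left _ _ h1) (Ideal.mul_mem_left _ _ ha)
  have hback {x : R} {a : ℤ} (hx : x - a ∈ P) (ha : (q : ℤ) ∣ a) : x ∈ P := by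
    obtain ⟨b, rfl⟩ := ha
    have := Ideal.add_mem _ hx (Ideal.mul_mem_left _ (b : R) h1)
    convert this using 1
    push_cast
    ring
  refine ⟨hne, fun {x y} hxy => ?_⟩
  obtain ⟨a, ha⟩ := hmod x
  obtain ⟨b, hb⟩ := hmod y
  have hab : ((a * b : ℤ) : R) ∈ P := by
    have := Ideal.sub_mem _ (Ideal.sub_mem _ hxy (Ideal.mul_mem_left _ y ha))
      (Ideal.mul_mem_left _ (a : R) hb)
    convert this using 1
    push_cast
    ring
  rcases (Nat.prime_iff_prime_int.1 hqp).dvd_or_dvd (h_int _ hab) with h6 | h6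
  · exact Or.inl (hback ha h6)
  · exact Or.inr (hback hb h6)

theorem exists_split (h : IsHalfQuadratic δ d) {q : ℕ} [Fact q.Prime] (hq : Odd q)
    (hleg : legendreSym q d = 1) :
    ∃ P P' : Ideal R, P ≠ P' ∧ P.IsPrime ∧ P'.IsPrime ∧ Ideal.span {(q : R)} = P * P' := by
  have hqp : q.Prime := Fact.out
  have hd0 : (d : ZMod q) ≠ 0 := by
    intro h0
    rw [(legendreSym.eq_zero_iff q d).2 h0] at hleg
    exact zero_ne_one hleg
  obtain ⟨y, hy⟩ := (legendreSym.eq_one_iff q hd0).1 hleg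
  obtain ⟨r, rfl⟩ := ZMod.intCast_surjective y
  have hr : (q : ℤ) ∣ r ^ 2 - d := by
    rw [← ZMod.intCast_zmod_eq_zero_iff_dvd]
    push_cast
    rw [hy]
    ring
  have hqr : ¬ (q : ℤ) ∣ r := by
    intro h1
    rw [← ZMod.intCast_zmod_eq_zero_iff_dvd] at h1
    rw [h1, mul_zero] at hy
    exact hd0 hy
  have hP := h.isPrime_span_pair hqp hq hr hqr
  have hP' : (Ideal.span {(q : R), δ + r}).IsPrime := by
    have := h.isPrime_span_pair (r := -r) hqp hq (by rwa [neg_sq]) (by rwa [dvd_neg])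
    simpa using this
  refine ⟨_, _, fun heq => ?_, hP, hP', h.span_mul_span hqp hq hr hqr⟩
  have h3 : δ - r ∈ Ideal.span {(q : R), δ - r} := Ideal.subset_span (by simp)
  have h1 : (q : R) ∈ Ideal.span {(q : R), δ - r} := Ideal.subset_span (by simp)
  have h4 : δ + r ∈ Ideal.span {(q : R), δ - r} := by
    rw [heq]
    exact Ideal.subset_span (by simp)
  have hc : IsCoprime (2 * r) (q : ℤ) := by
    refine IsCoprime.mul_left ?_ ?_
    · rw [← Nat.cast_ofNat, Nat.isCoprime_iff_coprime, Nat.coprime_two_left]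
      exact hq
    · exact ((Nat.prime_iff_prime_int.1 hqp).coprime_iff_not_dvd.2 hqr).symm
  obtain ⟨u, v, huv⟩ := hc
  have huv' : (u : R) * (2 * r) + v * q = 1 := by
    exact_mod_cast congrArg (Int.cast : ℤ → R) huv
  apply hP.ne_top
  rw [Ideal.eq_top_iff_one]
  have h5 := Ideal.add_mem _ (Ideal.mul_mem_left _ (u : R) (Ideal.sub_mem _ h4 h3))
    (Ideal.mul_mem_left _ (v : R) h1)
  convert h5 using 1
  linear_combination -huv'

end IsHalfQuadratic

end QuadraticPrimes

section QuadraticField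

variable {p : ℕ}

theorem rat_add_mul_sqrt_eq_zero (hp : p.Prime) {a b : ℚ} (h : (a : ℝ) + b * Real.sqrt p = 0) :
    a = 0 ∧ b = 0 := by
  have hirr := hp.irrational_sqrt
  have hb : b = 0 := by
    by_contra hb
    refine hirr ⟨-a / b, ?_⟩
    have : (b : ℝ) ≠ 0 := by exact_mod_cast hb
    push_cast
    rw [div_eq_iff this]
    linarith
  subst hb
  simpa using h

theorem exists_rat_of_mem_sqrtField (hp : p.Prime) {x : ℝ} (hx : x ∈ sqrtField p) :
    ∃ a b : ℚ, x = a + b * Real.sqrt p := by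
  have hsq : Real.sqrt p * Real.sqrt p = p := Real.mul_self_sqrt (Nat.cast_nonneg _)
  induction hx using IntermediateField.adjoin_induction with
  | mem x hx => exact ⟨0, 1, by rw [Set.mem_singleton_iff.1 hx]; simp⟩
  | algebraMap x => exact ⟨x, 0, by simp⟩
  | add x y _ _ hx hy =>
    obtain ⟨a, b, rfl⟩ := hx
    obtain ⟨c, d, rfl⟩ := hy
    exact ⟨a + c, b + d, by push_cast; ring⟩
  | mul x y _ _ hx hy =>
    obtain ⟨a, b, rfl⟩ := hx
    obtain ⟨c, d, rfl⟩ := hy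
    refine ⟨a * c + p * (b * d), a * d + b * c, ?_⟩
    push_cast
    linear_combination (b * d : ℝ) * hsq
  | inv x _ hx =>
    obtain ⟨a, b, rfl⟩ := hx
    by_cases h0 : (a : ℝ) + b * Real.sqrt p = 0
    · exact ⟨0, 0, by rw [h0]; simp⟩
    by_cases h1 : (a : ℝ) - b * Real.sqrt p = 0
    · obtain ⟨ha, hb⟩ := rat_add_mul_sqrt_eq_zero (a := a) (b := -b) hp
        (by push_cast; linarith)
      exact absurd (by rw [ha, neg_eq_zero.1 hb]; simp) h0
    · refine ⟨a / (a ^ 2 - p * b ^ 2), -b / (a ^ 2 - p * b ^ 2), ?_⟩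
      have h2 : ((a : ℝ) + b * Real.sqrt p) * (a - b * Real.sqrt p) = a ^ 2 - p * b ^ 2 := by
        linear_combination (-(b : ℝ) ^ 2) * hsq
      have h3 : (a : ℝ) ^ 2 - p * b ^ 2 ≠ 0 := h2 ▸ mul_ne_zero h0 h1
      push_cast
      rw [inv_eq_of_mul_eq_one_right]
      rw [← div_self h3, ← h2]
      ring

theorem int_of_prime_mul_sq (hp : p.Prime) {t : ℚ} {z : ℤ} (h : p * t ^ 2 = z) :
    ∃ k : ℤ, t = k := by
  have h1 : IsIntegral ℤ (p * t : ℚ) := by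
    refine IsIntegral.of_pow (n := 2) (by norm_num) ?_
    have : (p * t : ℚ) ^ 2 = ((p * z : ℤ) : ℚ) := by
      push_cast
      rw [← h]
      ring
    rw [this]
    exact isIntegral_algebraMap (R := ℤ) (x := (p * z : ℤ))
  obtain ⟨w, hw⟩ := IsIntegrallyClosed.isIntegral_iff.1 h1
  have hw' : (w : ℚ) = p * t := hw
  have hp0 : (p : ℚ) ≠ 0 := by exact_mod_cast hp.ne_zero
  have h2 : w ^ 2 = p * z := by
    have : (w : ℚ) ^ 2 = p * z := by rw [hw', ← h]; ring
    exact_mod_cast this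
  obtain ⟨k, rfl⟩ := (Nat.prime_iff_prime_int.1 hp).dvd_of_dvd_pow ⟨z, h2⟩
  refine ⟨k, ?_⟩
  push_cast at hw'
  exact (mul_left_cancel₀ hp0 hw').symm

open Polynomial in
theorem two_mul_eq_of_isIntegral (hp : p.Prime) {a b : ℚ}
    (h : IsIntegral ℤ ((a : ℝ) + b * Real.sqrt p)) : ∃ m k : ℤ, 2 * a = m ∧ 2 * b = k := by
  set x := (a : ℝ) + b * Real.sqrt p with hx
  have hsq : Real.sqrt p * Real.sqrt p = p := Real.mul_self_sqrt (Nat.cast_nonneg _)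
  by_cases hb : b = 0
  · subst hb
    have hxa : x = algebraMap ℚ ℝ a := by simp [hx]
    rw [hxa, isIntegral_algebraMap_iff (algebraMap ℚ ℝ).injective] at h
    obtain ⟨m, hm⟩ := IsIntegrallyClosed.isIntegral_iff.1 h
    have hm' : (m : ℚ) = a := hm
    exact ⟨2 * m, 0, by push_cast; rw [hm'], by simp⟩
  have hxQ : IsIntegral ℚ x := h.tower_top
  have hdeg : 2 ≤ (minpoly ℚ x).natDegree := by
    rw [minpoly.two_le_natDegree_iff hxQ]
    rintro ⟨c, hc⟩
    have hc' : (c : ℝ) = x := hc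
    exact hb (rat_add_mul_sqrt_eq_zero (a := a - c) (b := b) hp
      (by push_cast; rw [hc', hx]; ring)).2
  set f : ℚ[X] := X ^ 2 + (C (-(2 * a)) * X + C (a ^ 2 - p * b ^ 2)) with hf
  have hlow : (C (-(2 * a)) * X + C (a ^ 2 - p * b ^ 2) : ℚ[X]).degree < 2 :=
    lt_of_le_of_lt degree_linear_le (by norm_num)
  have hmonic : f.Monic := monic_X_pow_add hlow
  have hdegf : f.natDegree = 2 := by
    have : f.degree = 2 := by
      rw [hf, degree_add_eq_left_of_degree_lt] <;> rw [degree_X_pow]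
      · rfl
      · exact hlow
    exact natDegree_eq_of_degree_eq_some this
  have hroot : aeval x f = 0 := by
    simp only [hf, map_add, map_mul, aeval_X, aeval_C, map_pow, eq_ratCast, hx]
    push_cast
    linear_combination (b : ℝ) ^ 2 * hsq
  have heq : minpoly ℚ x = f := by
    refine (eq_of_monic_of_dvd_of_natDegree_le (minpoly.monic hxQ) hmonic
      (minpoly.dvd ℚ x hroot) ?_).symm
    rw [hdegf]
    exact hdeg
  have hfield := minpoly.isIntegrallyClosed_eq_field_fractions' ℚ h
  rw [heq] at hfield
  have hcoeff (u w : ℚ) : (X ^ 2 + (C u * X + C w)).coeff 1 = u ∧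
      (X ^ 2 + (C u * X + C w)).coeff 0 = w := by simp
  have hc1 : f.coeff 1 = -(2 * a) := (hcoeff _ _).1
  have hc0 : f.coeff 0 = a ^ 2 - p * b ^ 2 := (hcoeff _ _).2
  rw [hfield, coeff_map, eq_intCast] at hc1 hc0
  set u := (minpoly ℤ x).coeff 1
  set w := (minpoly ℤ x).coeff 0
  obtain ⟨k, hk⟩ := int_of_prime_mul_sq (t := 2 * b) (z := u ^ 2 - 4 * w) hp (by
    push_cast
    rw [hc0, hc1]
    ring)
  exact ⟨-u, k, by push_cast; rw [hc1]; ring, hk⟩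

theorem exists_isHalfQuadratic (hp : p.Prime) :
    ∃ δ : 𝓞 (sqrtField p), IsHalfQuadratic δ (p : ℤ) := by
  have hsq : Real.sqrt p * Real.sqrt p = p := Real.mul_self_sqrt (Nat.cast_nonneg _)
  let d : sqrtField p := ⟨Real.sqrt p, IntermediateField.mem_adjoin_simple_self ℚ _⟩
  have hd2 : d ^ 2 = p := by
    apply Subtype.ext
    simp [d]
  have hdint : IsIntegral ℤ d := by
    refine IsIntegral.of_pow (n := 2) (by norm_num) ?_
    rw [hd2]
    exact isIntegral_algebraMap (R := ℤ) (x := (p : ℤ))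
  let φ : 𝓞 (sqrtField p) →+* ℝ :=
    (algebraMap (sqrtField p) ℝ).comp (algebraMap (𝓞 (sqrtField p)) (sqrtField p))
  have hφ : Function.Injective φ :=
    (algebraMap (sqrtField p) ℝ).injective.comp RingOfIntegers.coe_injective
  let δ : 𝓞 (sqrtField p) := ⟨d, hdint⟩
  have hδ : φ δ = Real.sqrt p := rfl
  refine ⟨δ, ?_, fun x => ?_, fun m k h => ?_⟩
  · apply hφ
    rw [map_pow, hδ, map_intCast, sq, hsq]
    simp
  · obtain ⟨a, b, hab⟩ := exists_rat_of_mem_sqrtField hp (x : sqrtField p).2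
    have hx : φ x = a + b * Real.sqrt p := hab
    have h_int : IsIntegral ℤ ((a : ℝ) + b * Real.sqrt p) := by
      rw [← hx]
      exact (RingOfIntegers.isIntegral x).map (φ.toIntAlgHom)
    obtain ⟨m, k, hm, hk⟩ := two_mul_eq_of_isIntegral hp h_int
    refine ⟨m, k, hφ ?_⟩
    have hm' : 2 * (a : ℝ) = m := by exact_mod_cast congrArg (Rat.cast : ℚ → ℝ) hm
    have hk' : 2 * (b : ℝ) = k := by exact_mod_cast congrArg (Rat.cast : ℚ → ℝ) hk
    rw [map_mul, map_add, map_mul, hδ, map_intCast, map_intCast, hx, ← hm', ← hk', map_ofNat]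
    ring
  · have h1 := congrArg φ h
    rw [map_add, map_mul, hδ, map_intCast, map_intCast, map_zero] at h1
    have := rat_add_mul_sqrt_eq_zero (a := m) (b := k) hp (by exact_mod_cast h1)
    exact_mod_cast this

theorem isInertIn_of_legendreSym (hp : p.Prime) {q : ℕ} [Fact q.Prime] (hq : Odd q)
    (h : legendreSym q p = -1) : IsInertIn (sqrtField p) q := by
  obtain ⟨δ, hδ⟩ := exists_isHalfQuadratic hp
  exact hδ.isPrime_span hq h

theorem splitsInReal_of_legendreSym (hp : p.Prime) {q : ℕ} [Fact q.Prime] (hq : Odd q)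
    (h : legendreSym q p = 1) : SplitsInReal (sqrtField p) q := by
  obtain ⟨δ, hδ⟩ := exists_isHalfQuadratic hp
  exact hδ.exists_split hq h

end QuadraticField

section AuxiliaryPrimes

variable {n : ℕ} (p : Fin n → ℕ) [∀ j, Fact (p j).Prime]

theorem dvd_four_mul_prod (j : Fin n) : p j ∣ 4 * ∏ j, p j :=
  (Finset.dvd_prod_of_mem p (Finset.mem_univ j)).mul_left 4

/-- The vector of quadratic residue symbols modulo the primes `p j`, as a character
of the units modulo `4 * ∏ j, p j`. -/
noncomputable def residueSymbols : (ZMod (4 * ∏ j, p j))ˣ →* (Fin n → ℤˣ) :=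
  MonoidHom.pi fun j =>
    (quadraticChar (ZMod (p j))).toUnitHom.comp (ZMod.unitsMap (dvd_four_mul_prod p j))

theorem residueSymbols_surjective (hp : Function.Injective p) (h2 : ∀ j, p j ≠ 2) :
    Function.Surjective (residueSymbols p) := by
  intro g
  have hex (j : Fin n) : ∃ a : ZMod (p j), quadraticChar (ZMod (p j)) a = g j := by
    rcases Int.units_eq_one_or (g j) with h | h
    · exact ⟨1, by rw [h]; simp⟩
    · obtain ⟨a, ha⟩ := quadraticChar_exists_neg_one (F := ZMod (p j))
        (by rw [ZMod.ringChar_zmod_n]; exact h2 j)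
      exact ⟨a, by rw [h, ha]; simp⟩
  choose a ha using hex
  have hpp (j : Fin n) : (p j).Prime := Fact.out
  obtain ⟨k, hk⟩ := Nat.chineseRemainderOfFinset (fun j => (a j).val) p Finset.univ
    (fun j _ => (hpp j).ne_zero)
    (fun i _ j _ hij => (Nat.coprime_primes (hpp i) (hpp j)).2 fun h => hij (hp h))
  have hka (j : Fin n) : (k : ZMod (p j)) = a j := by
    have := (ZMod.natCast_eq_natCast_iff _ _ _).2 (hk j (Finset.mem_univ j))
    rw [this, ZMod.natCast_zmod_val]
  have hcop : Nat.Coprime k (∏ j, p j) := by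
    refine Nat.Coprime.prod_right fun j _ => ?_
    rw [Nat.coprime_comm, (hpp j).coprime_iff_not_dvd, ← ZMod.natCast_eq_zero_iff, hka]
    intro h0
    have h1 := ha j
    rw [h0, MulChar.map_zero] at h1
    exact (g j).ne_zero h1.symm
  have : NeZero (4 * ∏ j, p j) :=
    ⟨mul_ne_zero (by norm_num) (Finset.prod_ne_zero_iff.2 fun j _ => (hpp j).ne_zero)⟩
  obtain ⟨u, hu⟩ := ZMod.unitsMap_surjective (Dvd.intro_left 4 rfl : (∏ j, p j) ∣ 4 * ∏ j, p j)
    (ZMod.unitOfCoprime k hcop)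
  refine ⟨u, funext fun j => Units.ext ?_⟩
  have hj : p j ∣ ∏ j, p j := Finset.dvd_prod_of_mem p (Finset.mem_univ j)
  have h3 : ZMod.unitsMap (dvd_four_mul_prod p j) u =
      ZMod.unitsMap hj (ZMod.unitOfCoprime k hcop) := by
    rw [← hu, ← MonoidHom.comp_apply, ZMod.unitsMap_comp]
  change (((quadraticChar (ZMod (p j))).toUnitHom
    (ZMod.unitsMap (dvd_four_mul_prod p j) u) : ℤˣ) : ℤ) = g j
  rw [h3, MulChar.coe_toUnitHom, ← ha, ZMod.unitsMap_val, ZMod.coe_unitOfCoprime,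
    ZMod.cast_natCast hj, hka]

variable {p}

theorem InClass.legendreSym_eq {g : Fin n → ℤˣ} {m : ℕ} (h : InClass (residueSymbols p) g m)
    (j : Fin n) : legendreSym (p j) m = g j := by
  obtain ⟨u, hu, rfl⟩ := h
  change quadraticChar (ZMod (p j)) ((m : ℤ) : ZMod (p j)) =
    (((quadraticChar (ZMod (p j))).toUnitHom
      (ZMod.unitsMap (dvd_four_mul_prod p j) u) : ℤˣ) : ℤ)
  rw [MulChar.coe_toUnitHom, ZMod.unitsMap_val, hu, ZMod.cast_natCast (dvd_four_mul_prod p j),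
    Int.cast_natCast]

theorem InClass.odd {g : Fin n → ℤˣ} {m : ℕ} (h : InClass (residueSymbols p) g m) : Odd m := by
  have h1 := h.coprime.coprime_dvd_right (Dvd.intro _ rfl : 4 ∣ 4 * ∏ j, p j)
  exact Nat.coprime_two_right.1 (h1.coprime_dvd_right (by norm_num))

theorem InClass.isInertIn {g : Fin n → ℤˣ} {q : ℕ} (h : InClass (residueSymbols p) g q)
    (hq : q.Prime) {j : Fin n} (hj : p j % 4 = 1) (hg : g j = -1) :
    IsInertIn (sqrtField (p j)) q := by
  have := Fact.mk hq
  refine isInertIn_of_legendreSym Fact.out h.odd ?_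
  rw [legendreSym.quadratic_reciprocity_one_mod_four hj, h.legendreSym_eq, hg]
  · rfl
  · rintro rfl
    exact absurd h.odd (by decide)

theorem InClass.splitsInReal {g : Fin n → ℤˣ} {q : ℕ} (h : InClass (residueSymbols p) g q)
    (hq : q.Prime) {j : Fin n} (hj : p j % 4 = 1) (hg : g j = 1) :
    SplitsInReal (sqrtField (p j)) q := by
  have := Fact.mk hq
  refine splitsInReal_of_legendreSym Fact.out h.odd ?_
  rw [legendreSym.quadratic_reciprocity_one_mod_four hj, h.legendreSym_eq, hg]
  · rfl
  · rintro rfl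
    exact absurd h.odd (by decide)

/-- The residue pattern of the `i`-th auxiliary prime: a single sign change at `i`, or
sign changes everywhere when `i` is out of range. -/
def auxiliaryPattern (n i : ℕ) : Fin n → ℤˣ := fun j => if i < n ∧ (j : ℕ) ≠ i then 1 else -1

theorem auxiliaryPattern_ne_one (hn : 0 < n) (i : ℕ) : auxiliaryPattern n i ≠ 1 := by
  intro h
  by_cases hi : i < n
  · have := congrFun h ⟨i, hi⟩
    simp [auxiliaryPattern] at this
  · have := congrFun h ⟨0, hn⟩
    simp [auxiliaryPattern, hi] at this

theorem auxiliaryPattern_injOn (hn : 2 ≤ n) {i j : ℕ} (hi : i ≤ n) (hj : j ≤ n)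
    (h : auxiliaryPattern n i = auxiliaryPattern n j) : i = j := by
  by_contra hij
  wlog hlt : i < j generalizing i j
  · exact this hj hi h.symm (Ne.symm hij) (by omega)
  have hin : i < n := by omega
  rcases lt_or_ge j n with hjn | hjn
  · have := congrFun h ⟨i, hin⟩
    simp [auxiliaryPattern, hjn, hij] at this
  · obtain ⟨k, hk, hki⟩ : ∃ k, k < n ∧ k ≠ i := by
      rcases Nat.eq_zero_or_pos i with rfl | h0
      · exact ⟨1, by omega, by omega⟩
      · exact ⟨0, by omega, by omega⟩
    have := congrFun h ⟨k, hk⟩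
    simp [auxiliaryPattern, hin, hki, hjn.not_gt] at this

theorem four_mul_prod_pow_le {D C n : ℕ} (hn : 2 ≤ n) {p : Fin n → ℕ}
    (hp : ∀ j, p j ≤ D * n ^ 200) :
    (4 * ∏ j, p j) ^ C ≤ n ^ (((4 * D + 200) * C + 1) * n) := by
  have h1 : ∏ j, p j ≤ (D * n ^ 200) ^ n := by
    calc ∏ j, p j ≤ ∏ _j : Fin n, D * n ^ 200 := Finset.prod_le_prod' fun j _ => hp j
      _ = (D * n ^ 200) ^ n := by simp
  have h2 : 4 * D ≤ n ^ (4 * D) :=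
    Nat.lt_two_pow_self.le.trans (Nat.pow_le_pow_left hn _)
  have h3 : 4 * ∏ j, p j ≤ n ^ ((4 * D + 200) * n) := by
    calc 4 * ∏ j, p j ≤ 4 ^ n * (D * n ^ 200) ^ n :=
          Nat.mul_le_mul (Nat.le_self_pow (by omega) 4) h1
      _ = (4 * D * n ^ 200) ^ n := by rw [← mul_pow, mul_assoc]
      _ ≤ (n ^ (4 * D) * n ^ 200) ^ n := by gcongr
      _ = n ^ ((4 * D + 200) * n) := by rw [← pow_add, ← pow_mul]
  calc (4 * ∏ j, p j) ^ C ≤ (n ^ ((4 * D + 200) * n)) ^ C := Nat.pow_le_pow_left h3 C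
    _ = n ^ ((4 * D + 200) * n * C) := by rw [← pow_mul]
    _ ≤ _ := Nat.pow_le_pow_right (by omega) (by nlinarith)

theorem nth_prime_one_mod_four_zero : Nat.nth (fun r : ℕ => r.Prime ∧ r % 4 = 1) 0 = 5 := by
  have h := Nat.nth_count (p := fun r : ℕ => r.Prime ∧ r % 4 = 1) (n := 5) (by norm_num)
  have h0 : Nat.count (fun r : ℕ => r.Prime ∧ r % 4 = 1) 5 = 0 := by
    simp [Nat.count_succ, Nat.not_prime_one]
  rwa [h0] at h

theorem isInertIn_sqrtField_five_three : IsInertIn (sqrtField 5) 3 := by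
  have : Fact (Nat.Prime 3) := ⟨by norm_num⟩
  exact isInertIn_of_legendreSym (by norm_num) (by decide) (by norm_num)

theorem isInertIn_sqrtField_five_seven : IsInertIn (sqrtField 5) 7 := by
  have : Fact (Nat.Prime 7) := ⟨by norm_num⟩
  exact isInertIn_of_legendreSym (by norm_num) (by decide) (by norm_num)

end AuxiliaryPrimes

/-- There are positive constants `A, B` such that for every `n ≥ 1`, writing
`p₀, …, p_{n-1}` for the first `n` primes `≡ 1 (mod 4)`, there are `n+1` pairwise
distinct primes `q₀, …, qₙ` with: `q_i` (for `i < n`) inert in `ℚ(√p_i)` and split in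
`ℚ(√p_j)` for `j ≠ i`; `qₙ` inert in every `ℚ(√p_j)`; and every `q_i ∈ [2, A·n^(Bn)]`. -/
theorem exists_auxiliary_primes :
    ∃ A B : ℝ, 0 < A ∧ 0 < B ∧
      ∀ n : ℕ, 1 ≤ n →
        {r : ℕ | r.Prime ∧ r % 4 = 1}.Infinite ∧
        (fun p : ℕ → ℕ =>
          ∃ q : ℕ → ℕ,
            (∀ i ≤ n, (q i).Prime) ∧
            (∀ i ≤ n, ∀ j ≤ n, i ≠ j → q i ≠ q j) ∧
            (∀ i < n, IsInertIn (sqrtField (p i)) (q i) ∧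
              ∀ j < n, j ≠ i → SplitsInReal (sqrtField (p j)) (q i)) ∧
            (∀ j < n, IsInertIn (sqrtField (p j)) (q n)) ∧
            (∀ i ≤ n, 2 ≤ q i ∧ (q i : ℝ) ≤ A * (n : ℝ) ^ (B * (n : ℝ))))
          (fun j => Nat.nth (fun r : ℕ => r.Prime ∧ r % 4 = 1) j) := by
  obtain ⟨C, hC⟩ := exists_prime_inClass_le
  obtain ⟨D, hD⟩ := exists_nth_prime_one_mod_four_le
  refine ⟨7, (((4 * D + 200) * C + 1 : ℕ) : ℝ), by norm_num, by positivity,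
    fun n hn => ⟨infinite_primes_one_mod_four, ?_⟩⟩
  beta_reduce
  have hP (j : ℕ) : (Nat.nth (fun r : ℕ => r.Prime ∧ r % 4 = 1) j).Prime ∧
      Nat.nth (fun r : ℕ => r.Prime ∧ r % 4 = 1) j % 4 = 1 :=
    Nat.nth_mem_of_infinite infinite_primes_one_mod_four j
  rcases hn.eq_or_lt with rfl | hn2
  · refine ⟨fun i => if i = 0 then 3 else 7, fun i _ => ?_, fun i hi j hj hij => ?_,
      fun i hi => ?_, fun j hj => ?_, fun i _ => ?_⟩
    · beta_reduce
      split_ifs <;> norm_num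
    · beta_reduce
      split_ifs <;> omega
    · obtain rfl : i = 0 := by omega
      refine ⟨?_, fun j hj hj0 => by omega⟩
      rw [nth_prime_one_mod_four_zero]
      exact isInertIn_sqrtField_five_three
    · obtain rfl : j = 0 := by omega
      rw [nth_prime_one_mod_four_zero]
      exact isInertIn_sqrtField_five_seven
    · beta_reduce
      split_ifs <;> norm_num
  · set p : Fin n → ℕ := fun j => Nat.nth (fun r : ℕ => r.Prime ∧ r % 4 = 1) j with hp
    have (j : Fin n) : Fact (p j).Prime := ⟨(hP j).1⟩
    have hpinj : Function.Injective p := fun i j hij =>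
      Fin.ext (Nat.nth_injective infinite_primes_one_mod_four hij)
    have hp2 (j : Fin n) : p j ≠ 2 := fun h => by
      have := (hP j).2
      rw [show Nat.nth (fun r : ℕ => r.Prime ∧ r % 4 = 1) j = 2 from h] at this
      norm_num at this
    have hQ0 : 0 < ∏ j, p j := Finset.prod_pos fun j _ => (hP j).1.pos
    have : NeZero (4 * ∏ j, p j) := ⟨by positivity⟩
    have hex (i : ℕ) := hC (c := residueSymbols p) (by omega)
      (residueSymbols_surjective p hpinj hp2) (auxiliaryPattern n i)
      (auxiliaryPattern_ne_one (by omega) i)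
    choose q hqp hqc hqb using hex
    refine ⟨q, fun i _ => hqp i, fun i hi j hj hij hqq => hij ?_, fun i hi => ⟨?_, ?_⟩,
      fun j hj => ?_, fun i _ => ⟨(hqp i).two_le, ?_⟩⟩
    · have h1 := hqc i
      rw [hqq] at h1
      exact auxiliaryPattern_injOn hn2 hi hj (h1.unique (hqc j))
    · exact (hqc i).isInertIn (j := ⟨i, hi⟩) (hqp i) (hP i).2 (by simp [auxiliaryPattern])
    · intro j hj hji
      exact (hqc i).splitsInReal (j := ⟨j, hj⟩) (hqp i) (hP j).2
        (by simp [auxiliaryPattern, hi, hji])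
    · exact (hqc n).isInertIn (j := ⟨j, hj⟩) (hqp n) (hP j).2 (by simp [auxiliaryPattern])
    · have h1 : q i ≤ n ^ (((4 * D + 200) * C + 1) * n) :=
        (hqb i).trans (four_mul_prod_pow_le hn2 fun j => hD n j j.2)
      have h2 : (q i : ℝ) ≤ (n : ℝ) ^ (((4 * D + 200) * C + 1) * n) := by exact_mod_cast h1
      rw [← Nat.cast_mul, Real.rpow_natCast]
      refine h2.trans (le_mul_of_one_le_left (by positivity) (by norm_num))
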